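/- Let ϱ > 2, n ≥ 3, let ρ be a critical radius function on ℝ^n, and for x ∈ ℝ^n write B_x = B(x, ρ(x)). Let μ ∈ A₁^{ρ,loc} and ν ∈ A_∞^{ρ,loc}. Then there is a constant C such that for every bounded compactly supported measurable f and every λ > 0, λ·(μν)({x ∈ ℝ^n : V_ϱ(e^{tΔ})(f·χ_{B_x}·ν)(x) > λ·ν(x)}) ≤ C ∫_{ℝ^n} |f(x)|·μ(x)·ν(x) dx, where (μν)(E) = ∫_E μν and for each x the operator is applied to the function y ↦ f(y)χ_{B_x}(y)ν(y) and then evaluated at x. -/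

import Mathlib

open MeasureTheory ENNReal Set
noncomputable section

/-- `ℝ^n` with the Euclidean norm. -/
abbrev Rn (n : ℕ) := EuclideanSpace ℝ (Fin n)

/-- The cube of center `c` and side length `r`. -/
def cube {n : ℕ} (c : Rn n) (r : ℝ) : Set (Rn n) := {y | ∀ i, |y i - c i| ≤ r / 2}

/-- `ψ_θ(Q) = (1 + r_Q/ρ(x_Q))^θ` for the cube `Q` of center `c` and side length `r`. -/
def psi {n : ℕ} (ρ : Rn n → ℝ) (θ : ℝ) (c : Rn n) (r : ℝ) : ℝ := (1 + r / ρ c) ^ θ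

/-- `ρ` is a critical radius function with constants `C₀, N₀`. -/
def IsCriticalRadiusWith {n : ℕ} (ρ : Rn n → ℝ) (C₀ N₀ : ℝ) : Prop :=
  0 < C₀ ∧ 0 < N₀ ∧ (∀ x, 0 < ρ x) ∧ ∀ x y : Rn n,
    C₀⁻¹ * ρ x * (1 + ‖x - y‖ / ρ x) ^ (-N₀) ≤ ρ y ∧
    ρ y ≤ C₀ * ρ x * (1 + ‖x - y‖ / ρ x) ^ (N₀ / (N₀ + 1))

/-- `ρ` is a critical radius function. -/
def IsCriticalRadius {n : ℕ} (ρ : Rn n → ℝ) : Prop := ∃ C₀ N₀, IsCriticalRadiusWith ρ C₀ N₀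

/-- A weight: locally integrable and a.e. positive. -/
def IsWeight {n : ℕ} (w : Rn n → ℝ) : Prop :=
  LocallyIntegrable w (volume : Measure (Rn n)) ∧ ∀ᵐ x : Rn n, 0 < w x

/-- `w(S) = ∫_S w`. -/
def wMeas {n : ℕ} (w : Rn n → ℝ) (S : Set (Rn n)) : ℝ≥0∞ :=
  ∫⁻ x in S, ENNReal.ofReal (w x)

/-- Fractional maximal operator `M_α^{ρ,θ}` associated with the critical radius function `ρ`. -/
def fracMax (n : ℕ) (ρ : Rn n → ℝ) (θ α : ℝ) (f : Rn n → ℝ) (x : Rn n) : ℝ≥0∞ :=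
  ⨆ (c : Rn n) (r : ℝ) (_ : 0 < r) (_ : x ∈ cube c r),
    ENNReal.ofReal ((psi ρ θ c r * r ^ n) ^ (α / n - 1)) *
      ∫⁻ y in cube c r, ENNReal.ofReal |f y|

/-- The Lorentz `L^{p,1}(w)` norm. -/
def lorentzP1 {n : ℕ} (p : ℝ) (w : Rn n → ℝ) (f : Rn n → ℝ) : ℝ≥0∞ :=
  ENNReal.ofReal p * ∫⁻ y in Ioi (0 : ℝ), (wMeas w {x | y < |f x|}) ^ (1 / p)

/-- The weak `L^{q,∞}(w)` quasi-norm of an `ℝ≥0∞`-valued function. -/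
def weakNormE {n : ℕ} (q : ℝ) (w : Rn n → ℝ) (F : Rn n → ℝ≥0∞) : ℝ≥0∞ :=
  ⨆ (l : ℝ) (_ : 0 < l), ENNReal.ofReal l * (wMeas w {x | ENNReal.ofReal l < F x}) ^ (1 / q)

/-- The weak `L^{q,∞}(w)` quasi-norm of a real function, with `q = ∞` allowed
(in which case it is the `w`-essential supremum). -/
def weakNormR {n : ℕ} (q : ℝ≥0∞) (w : Rn n → ℝ) (f : Rn n → ℝ) : ℝ≥0∞ :=
  if q = ∞ then
    essSup (fun x => ENNReal.ofReal |f x|)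
      ((volume : Measure (Rn n)).withDensity fun x => ENNReal.ofReal (w x))
  else ⨆ (l : ℝ) (_ : 0 < l), ENNReal.ofReal l * (wMeas w {x | l < |f x|}) ^ (1 / q.toReal)

/-- The conjugate exponent `p' = p/(p-1)` (with `1' = ∞`), as an extended real number. -/
def conjE (p : ℝ) : ℝ≥0∞ := if p = 1 then ∞ else ENNReal.ofReal (p / (p - 1))

/-- The constant `[μ,ν]_{A_{p,q,α}^{ρ,θ,R}}`. -/
def ApqR {n : ℕ} (ρ : Rn n → ℝ) (θ α p q : ℝ) (μ ν : Rn n → ℝ) : ℝ≥0∞ :=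
  ⨆ (c : Rn n) (r : ℝ) (_ : 0 < r),
    (wMeas ν (cube c r)) ^ (1 / q) *
      weakNormR (conjE p) μ ((cube c r).indicator fun x => (μ x)⁻¹) *
      ENNReal.ofReal ((r ^ n * psi ρ θ c r) ^ (α / n - 1))

/-- The constant `‖μ,ν‖_{A_{p,q,α}^{ρ,θ,R}}`. -/
def normApqR {n : ℕ} (ρ : Rn n → ℝ) (θ α p q : ℝ) (μ ν : Rn n → ℝ) : ℝ≥0∞ :=
  ⨆ (c : Rn n) (r : ℝ) (_ : 0 < r),
    (wMeas ν (cube c r)) ^ (1 / q) *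
      ⨆ (P : Set (Rn n)) (_ : MeasurableSet P) (_ : 0 < wMeas μ P) (_ : wMeas μ P ≠ ∞),
        volume (P ∩ cube c r) * ENNReal.ofReal ((r ^ n * psi ρ θ c r) ^ (α / n - 1)) *
          (wMeas μ P) ^ (-(1 / p))

/-- The constant `[w]_{A_p^{ρ,σ}}` (for `1 < p < ∞`). -/
def ApC {n : ℕ} (ρ : Rn n → ℝ) (σ p : ℝ) (w : Rn n → ℝ) : ℝ≥0∞ :=
  ⨆ (c : Rn n) (r : ℝ) (_ : 0 < r),
    (ENNReal.ofReal (psi ρ σ c r))⁻¹ *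
      ((ENNReal.ofReal (r ^ n))⁻¹ * wMeas w (cube c r)) *
      ((ENNReal.ofReal (r ^ n))⁻¹ *
        ∫⁻ y in cube c r, ENNReal.ofReal (w y ^ (1 - p / (p - 1)))) ^ (p - 1)
/-- The heat semigroup `e^{tΔ}` on `ℝ^n`. -/
def heatSg (n : ℕ) (t : ℝ) (g : Rn n → ℝ) (x : Rn n) : ℝ :=
  ∫ y : Rn n, (4 * Real.pi * t) ^ (-(n : ℝ) / 2) * Real.exp (-‖x - y‖ ^ 2 / (4 * t)) * g y

/-- The `ϱ`-variation operator of the classical heat semigroup. -/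
def varHeat (n : ℕ) (ϱ : ℝ) (g : Rn n → ℝ) (x : Rn n) : ℝ≥0∞ :=
  ⨆ (t : ℕ → ℝ) (_ : StrictAnti t) (_ : ∀ j, 0 < t j)
      (_ : Filter.Tendsto t Filter.atTop (nhds 0)),
    (∑' j : ℕ, ENNReal.ofReal (|heatSg n (t j) g x - heatSg n (t (j + 1)) g x| ^ ϱ)) ^ (1 / ϱ)

/-- Muckenhoupt `A₁`. -/
def IsA1 {n : ℕ} (w : Rn n → ℝ) : Prop :=
  ∃ C > (0 : ℝ), ∀ (c : Rn n) (r : ℝ), 0 < r →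
    wMeas w (cube c r) ≤ ENNReal.ofReal C * ENNReal.ofReal (r ^ n) *
      essInf (fun x => ENNReal.ofReal (w x)) (volume.restrict (cube c r))

/-- Muckenhoupt `A_p`, `1 < p < ∞`. -/
def IsAp {n : ℕ} (p : ℝ) (w : Rn n → ℝ) : Prop :=
  ∃ C > (0 : ℝ), ∀ (c : Rn n) (r : ℝ), 0 < r →
    wMeas w (cube c r) *
      (∫⁻ y in cube c r, ENNReal.ofReal (w y ^ (1 - p / (p - 1)))) ^ (p - 1) ≤
      ENNReal.ofReal C * (ENNReal.ofReal (r ^ n)) ^ p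

/-- Muckenhoupt `A_∞ = ∪_{p ≥ 1} A_p`. -/
def IsAinfty {n : ℕ} (w : Rn n → ℝ) : Prop := IsA1 w ∨ ∃ p > (1 : ℝ), IsAp p w

/-- The class `A₁^{ρ,loc}`, with the `A₁` condition over balls `B(x,r)`, `r ≤ ρ(x)`. -/
def IsA1loc {n : ℕ} (ρ : Rn n → ℝ) (w : Rn n → ℝ) : Prop :=
  ∃ C > (0 : ℝ), ∀ (x : Rn n) (r : ℝ), 0 < r → r ≤ ρ x →
    wMeas w (Metric.ball x r) ≤ ENNReal.ofReal C * volume (Metric.ball x r) *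
      essInf (fun y => ENNReal.ofReal (w y)) (volume.restrict (Metric.ball x r))

/-- The class `A_p^{ρ,loc}` for `1 < p < ∞`. -/
def IsAploc {n : ℕ} (ρ : Rn n → ℝ) (p : ℝ) (w : Rn n → ℝ) : Prop :=
  ∃ C > (0 : ℝ), ∀ (x : Rn n) (r : ℝ), 0 < r → r ≤ ρ x →
    wMeas w (Metric.ball x r) *
      (∫⁻ y in Metric.ball x r, ENNReal.ofReal (w y ^ (1 - p / (p - 1)))) ^ (p - 1) ≤
      ENNReal.ofReal C * (volume (Metric.ball x r)) ^ p

/-- `A_∞^{ρ,loc} = ∪_{p ≥ 1} A_p^{ρ,loc}`. -/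
def IsAinfLoc {n : ℕ} (ρ : Rn n → ℝ) (w : Rn n → ℝ) : Prop :=
  IsA1loc ρ w ∨ ∃ p > (1 : ℝ), IsAploc ρ p w

/-- The class `A₁^{ρ,θ}`. -/
def IsA1rho {n : ℕ} (ρ : Rn n → ℝ) (θ : ℝ) (w : Rn n → ℝ) : Prop :=
  ∃ C > (0 : ℝ), ∀ (c : Rn n) (r : ℝ), 0 < r →
    wMeas w (cube c r) ≤ ENNReal.ofReal (C * (psi ρ θ c r * r ^ n)) *
      essInf (fun x => ENNReal.ofReal (w x)) (volume.restrict (cube c r))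

/-- The class `A_∞^ρ(μ)`. -/
def IsAinfRhoMu {n : ℕ} (ρ : Rn n → ℝ) (μ w : Rn n → ℝ) : Prop :=
  ∃ θ ≥ (0 : ℝ), ∃ ε > (0 : ℝ), ∃ C > (0 : ℝ), ∀ (c : Rn n) (r : ℝ), 0 < r →
    ∀ E ⊆ cube c r, MeasurableSet E →
      wMeas (fun x => w x * μ x) E ≤ ENNReal.ofReal (C * psi ρ θ c r) *
        (wMeas μ E / wMeas μ (cube c r)) ^ ε * wMeas (fun x => w x * μ x) (cube c r)

/-- The class `A_∞^ρ`. -/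
def IsAinfRho {n : ℕ} (ρ : Rn n → ℝ) (w : Rn n → ℝ) : Prop :=
  ∃ θ ≥ (0 : ℝ), ∃ δ > (0 : ℝ), ∃ C > (0 : ℝ), ∀ (c : Rn n) (r : ℝ), 0 < r →
    ∀ E ⊆ cube c r, MeasurableSet E →
      wMeas w E ≤ ENNReal.ofReal (C * psi ρ θ c r) *
        (volume E / ENNReal.ofReal (r ^ n)) ^ δ * wMeas w (cube c r)

/-- Membership in `RH_∞^{ρ,θ}` with constant `C`. -/
def IsRHinf {n : ℕ} (ρ : Rn n → ℝ) (θ : ℝ) (w : Rn n → ℝ) (C : ℝ) : Prop :=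
  ∀ (c : Rn n) (r : ℝ), 0 < r →
    essSup (fun x => ENNReal.ofReal (w x)) (volume.restrict (cube c r)) ≤
      ENNReal.ofReal (C * psi ρ θ c r) * ((ENNReal.ofReal (r ^ n))⁻¹ * wMeas w (cube c r))

/-- An `η`-sparse family of cubes, encoded by their (center, side length) data. -/
def IsSparse {n : ℕ} (η : ℝ) (S : Set (Rn n × ℝ)) : Prop :=
  S.Countable ∧ (∀ Q ∈ S, 0 < Q.2) ∧
  ∃ E : Rn n × ℝ → Set (Rn n),
    (∀ Q ∈ S, MeasurableSet (E Q) ∧ E Q ⊆ cube Q.1 Q.2 ∧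
      ENNReal.ofReal η * volume (cube Q.1 Q.2) ≤ volume (E Q)) ∧
    S.PairwiseDisjoint E

/-- The sparse operator `A_S^{ρ,N}`. -/
def sparseOp {n : ℕ} (ρ : Rn n → ℝ) (N : ℝ) (S : Set (Rn n × ℝ)) (f : Rn n → ℝ)
    (x : Rn n) : ℝ≥0∞ :=
  ∑' Q : S, (cube (Q : Rn n × ℝ).1 (Q : Rn n × ℝ).2).indicator
    (fun _ => (ENNReal.ofReal ((3 * (Q : Rn n × ℝ).2) ^ n))⁻¹ *
      (∫⁻ y in cube (Q : Rn n × ℝ).1 (3 * (Q : Rn n × ℝ).2), ENNReal.ofReal |f y|) *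
      (ENNReal.ofReal (psi ρ N (Q : Rn n × ℝ).1 (Q : Rn n × ℝ).2))⁻¹) x

namespace MixedHeat

section

variable {n : ℕ} {L : ℝ}

/-- Side length of the level-`j` dyadic cells. -/
def side (L : ℝ) (j : ℕ) : ℝ := L / 2 ^ j

/-- Integer coordinates of the level-`j` dyadic cell containing a point. -/
def idx (L : ℝ) (j : ℕ) (x : Rn n) : Fin n → ℤ := fun i => ⌊x i / side L j⌋

/-- The level-`j` dyadic cell containing `x`. -/
def cell (L : ℝ) (j : ℕ) (x : Rn n) : Set (Rn n) := {y | idx L j y = idx L j x}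

/-- The union of the level-`j` cells at index distance at most `m` from the cell of `x`. -/
def nb (m : ℕ) (L : ℝ) (j : ℕ) (x : Rn n) : Set (Rn n) :=
  {y | ∀ i, |idx L j y i - idx L j x i| ≤ m}

lemma side_pos (hL : 0 < L) (j : ℕ) : 0 < side L j := by unfold side; positivity

lemma side_zero : side L 0 = L := by simp [side]

lemma side_add (j q : ℕ) : side (side L q) j = side L (q + j) := by
  simp [side, pow_add, div_div]

lemma side_succ (j : ℕ) : side L j = 2 * side L (j + 1) := by
  have h : (2:ℝ) ^ j ≠ 0 := by positivity
  rw [side, side, pow_succ]; field_simp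

lemma side_anti (hL : 0 < L) : Antitone (side L) := by
  refine antitone_nat_of_succ_le fun j => ?_
  have := side_pos hL (j + 1)
  rw [side_succ j]; linarith

lemma idx_add (j q : ℕ) (x : Rn n) : idx (side L q) j x = idx L (q + j) x := by
  unfold idx; rw [side_add]

lemma cell_add (j q : ℕ) (x : Rn n) : cell (side L q) j x = cell L (q + j) x := by
  simp [cell, idx_add]

lemma nb_add (m j q : ℕ) (x : Rn n) : nb m (side L q) j x = nb m L (q + j) x := by
  simp [nb, idx_add]

lemma mem_cell_self (j : ℕ) (x : Rn n) : x ∈ cell L j x := rfl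

lemma mem_cell_comm {j : ℕ} {x y : Rn n} : y ∈ cell L j x ↔ x ∈ cell L j y := eq_comm

lemma cell_eq {j : ℕ} {x y : Rn n} (h : y ∈ cell L j x) : cell L j y = cell L j x := by
  have h' : idx L j y = idx L j x := h
  simp [cell, h']

lemma nb_eq {m j : ℕ} {x y : Rn n} (h : y ∈ cell L j x) : nb m L j y = nb m L j x := by
  have h' : idx L j y = idx L j x := h
  simp [nb, h']

lemma idx_succ (j : ℕ) (x : Rn n) (i : Fin n) :
    idx L j x i = idx L (j + 1) x i / 2 := by
  have := Int.floor_div_natCast (x i / side L (j + 1)) 2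
  simp only [idx]
  rw [side_succ j]
  rw [show x i / (2 * side L (j + 1)) = x i / side L (j + 1) / (2 : ℕ) by
    rw [div_div, mul_comm]; norm_num]
  rw [this]; norm_num

lemma cell_succ_subset (j : ℕ) (x : Rn n) : cell L (j + 1) x ⊆ cell L j x := by
  intro y hy
  have hy' : idx L (j + 1) y = idx L (j + 1) x := hy
  change idx L j y = idx L j x
  funext i
  rw [idx_succ j y, idx_succ j x, hy']

lemma cell_subset {j k : ℕ} (h : j ≤ k) (x : Rn n) : cell L k x ⊆ cell L j x := by
  induction k, h using Nat.le_induction with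
  | base => exact subset_rfl
  | succ k _ ih => exact (cell_succ_subset k x).trans ih

lemma nb_succ_subset (m j : ℕ) (x : Rn n) : nb m L (j + 1) x ⊆ nb m L j x := by
  intro y hy i
  have h := hy i
  rw [idx_succ j y, idx_succ j x]
  rw [abs_le] at h ⊢
  omega

lemma nb_subset {j k : ℕ} (m : ℕ) (h : j ≤ k) (x : Rn n) : nb m L k x ⊆ nb m L j x := by
  induction k, h using Nat.le_induction with
  | base => exact subset_rfl
  | succ k _ ih => exact (nb_succ_subset m k x).trans ih

lemma nb_mono {m m' : ℕ} (h : m ≤ m') (j : ℕ) (x : Rn n) : nb m L j x ⊆ nb m' L j x :=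
  fun _ hy i => (hy i).trans (by exact_mod_cast h)

lemma nb_zero (j : ℕ) (x : Rn n) : nb 0 L j x = cell L j x := by
  ext y
  simp [nb, cell, funext_iff, sub_eq_zero]

lemma cell_subset_nb (m j : ℕ) (x : Rn n) : cell L j x ⊆ nb m L j x := by
  rw [← nb_zero]; exact nb_mono (Nat.zero_le _) j x

lemma mem_nb_comm {m j : ℕ} {x y : Rn n} : y ∈ nb m L j x ↔ x ∈ nb m L j y := by
  simp only [nb, mem_ofPred_eq]
  exact forall_congr' fun i => by rw [abs_sub_comm]

lemma mem_nb_trans {m m' j : ℕ} {x y z : Rn n} (h : y ∈ nb m L j x) (h' : z ∈ nb m' L j y) :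
    z ∈ nb (m + m') L j x := by
  intro i
  have h1 := h i
  have h2 := h' i
  rw [abs_le] at *
  push_cast
  omega

lemma measurable_idx (j : ℕ) : Measurable (idx L j : Rn n → Fin n → ℤ) := by
  refine measurable_pi_lambda _ fun i => ?_
  exact Int.measurable_floor.comp (by fun_prop)

lemma measurableSet_idx (j : ℕ) (P : (Fin n → ℤ) → Prop) :
    MeasurableSet {x : Rn n | P (idx L j x)} :=
  measurable_idx j (MeasurableSet.of_discrete (s := {z | P z}))

lemma measurable_of_idx {β : Type*} [MeasurableSpace β] (j : ℕ) (F : (Fin n → ℤ) → β) :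
    Measurable fun x : Rn n => F (idx L j x) :=
  (measurable_of_countable F).comp (measurable_idx j)

/-- A function constant on level-`j` cells is measurable. -/
lemma measurable_of_const {β : Type*} [MeasurableSpace β] [Nonempty β] (j : ℕ) {F : Rn n → β}
    (h : ∀ x y, y ∈ cell L j x → F y = F x) : Measurable F := by
  classical
  have : F = fun x => (fun z => if h : ∃ y, idx L j y = z then F h.choose else
      Classical.arbitrary β) (idx L j x) := by
    funext x
    have hx : ∃ y : Rn n, idx L j y = idx L j x := ⟨x, rfl⟩
    simp only [hx, dif_pos]
    exact (h x _ hx.choose_spec).symm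
  rw [this]
  exact measurable_of_idx j fun z => if h : ∃ y, idx L j y = z then F h.choose else
      Classical.arbitrary β

lemma measurableSet_of_const (j : ℕ) {T : Set (Rn n)}
    (h : ∀ x y, y ∈ cell L j x → (y ∈ T ↔ x ∈ T)) : MeasurableSet T := by
  have := measurable_of_const (L := L) j (F := fun x => x ∈ T) fun x y hy => propext (h x y hy)
  exact measurableSet_setOfPred.2 this

lemma measurableSet_cell (j : ℕ) (x : Rn n) : MeasurableSet (cell L j x) :=
  measurableSet_idx j fun z => z = idx L j x

lemma measurableSet_nb (m j : ℕ) (x : Rn n) : MeasurableSet (nb m L j x) :=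
  measurableSet_idx j fun z => ∀ i, |z i - idx L j x i| ≤ m

lemma volume_box (a b : Fin n → ℝ) :
    volume {y : Rn n | ∀ i, y i ∈ Ico (a i) (b i)} = ∏ i, ENNReal.ofReal (b i - a i) := by
  have h := (PiLp.volume_preserving_ofLp (Fin n)).measure_preimage
    (s := pi univ fun i => Ico (a i) (b i))
    (MeasurableSet.univ_pi fun i => measurableSet_Ico).nullMeasurableSet
  rw [Real.volume_pi_Ico] at h
  rw [← h]
  congr 1
  ext y
  simp

lemma nb_eq_box (hL : 0 < L) (m j : ℕ) (x : Rn n) :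
    nb m L j x = {y : Rn n | ∀ i, y i ∈ Ico ((idx L j x i - m) * side L j)
      ((idx L j x i + m + 1) * side L j)} := by
  have hs := side_pos hL j
  ext y
  refine forall_congr' fun i => ?_
  have e1 : (((idx L j x i - m : ℤ) : ℝ)) = (idx L j x i : ℝ) - m := by push_cast; ring
  have e2 : (((idx L j x i + m + 1 : ℤ) : ℝ)) = (idx L j x i : ℝ) + m + 1 := by push_cast; ring
  have h1 : (idx L j x i - m : ℤ) ≤ idx L j y i ↔
      ((idx L j x i : ℝ) - m) * side L j ≤ y i := by
    rw [show idx L j y i = ⌊y i / side L j⌋ from rfl, Int.le_floor, le_div_iff₀ hs, e1]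
  have h2 : idx L j y i < (idx L j x i + m + 1 : ℤ) ↔
      y i < ((idx L j x i : ℝ) + m + 1) * side L j := by
    rw [show idx L j y i = ⌊y i / side L j⌋ from rfl, Int.floor_lt, div_lt_iff₀ hs, e2]
  rw [mem_Ico, ← h1, ← h2, abs_le]
  omega

lemma volume_nb (hL : 0 < L) (m j : ℕ) (x : Rn n) :
    volume (nb m L j x) = ENNReal.ofReal (((2 * m + 1) * side L j) ^ n) := by
  have hs := side_pos hL j
  rw [nb_eq_box hL, volume_box, ENNReal.ofReal_pow (by positivity)]
  rw [Finset.prod_congr rfl (g := fun _ => ENNReal.ofReal ((2 * m + 1) * side L j))]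
  · simp
  · intro i _
    congr 1; ring

lemma volume_cell (hL : 0 < L) (j : ℕ) (x : Rn n) :
    volume (cell L j x) = ENNReal.ofReal (side L j ^ n) := by
  rw [← nb_zero, volume_nb hL]; simp

lemma volume_cell_pos (hL : 0 < L) (j : ℕ) (x : Rn n) : 0 < volume (cell L j x) := by
  rw [volume_cell hL]; have := side_pos hL j; simp; positivity

lemma volume_cell_ne_top (hL : 0 < L) (j : ℕ) (x : Rn n) : volume (cell L j x) ≠ ∞ := by
  rw [volume_cell hL]; simp

lemma volume_nb_ne_top (hL : 0 < L) (m j : ℕ) (x : Rn n) : volume (nb m L j x) ≠ ∞ := by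
  rw [volume_nb hL]; simp

lemma volume_nb_cell (hL : 0 < L) (m j : ℕ) (x : Rn n) :
    volume (nb m L j x) = ((2 * m + 1 : ℕ) : ℝ≥0∞) ^ n * volume (cell L j x) := by
  rw [volume_nb hL, volume_cell hL, mul_pow, ENNReal.ofReal_mul (by positivity),
    ENNReal.ofReal_pow (by positivity)]
  congr 2
  rw [← ENNReal.ofReal_natCast]; push_cast; rfl

lemma volume_cell_succ (hL : 0 < L) (j : ℕ) (x : Rn n) :
    volume (cell L j x) = 2 ^ n * volume (cell L (j + 1) x) := by
  rw [volume_cell hL, volume_cell hL, side_succ j, mul_pow, ENNReal.ofReal_mul (by positivity),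
    ENNReal.ofReal_pow (by positivity)]
  simp

lemma abs_coord_le (x : Rn n) (i : Fin n) : |x i| ≤ ‖x‖ := by
  have := PiLp.norm_apply_le x i
  simpa using this

lemma norm_le_of_coord {x : Rn n} {a : ℝ} (h : ∀ i, |x i| ≤ a) : ‖x‖ ≤ n * a := by
  have h1 : ‖x‖ ≤ ∑ i, |x i| := by
    rw [EuclideanSpace.norm_eq]
    refine Real.sqrt_le_iff.2 ⟨by positivity, ?_⟩
    simp only [Real.norm_eq_abs]
    have := Finset.sum_sq_le_sq_sum_of_nonneg (s := Finset.univ) (f := fun i => |x i|)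
      (fun i _ => abs_nonneg _)
    simpa using this
  calc ‖x‖ ≤ ∑ i, |x i| := h1
    _ ≤ ∑ _i : Fin n, a := Finset.sum_le_sum fun i _ => h i
    _ = n * a := by simp

lemma norm_sub_le_of_mem_nb (hL : 0 < L) {m j : ℕ} {x y : Rn n} (h : y ∈ nb m L j x) :
    ‖y - x‖ ≤ n * ((m + 1) * side L j) := by
  have hs := side_pos hL j
  refine norm_le_of_coord fun i => ?_
  rw [nb_eq_box hL] at h
  have h1 := h i
  have h2 := (cell_subset_nb (L := L) 0 j x) (mem_cell_self j x)
  rw [nb_eq_box hL] at h2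
  have h2 := h2 i
  simp only [mem_Ico] at h1 h2
  simp only [PiLp.sub_apply]
  rw [abs_le]
  push_cast at *
  constructor <;> nlinarith

lemma norm_sub_le_of_mem_cell (hL : 0 < L) {j : ℕ} {x y : Rn n} (h : y ∈ cell L j x) :
    ‖y - x‖ ≤ n * side L j := by
  have := norm_sub_le_of_mem_nb hL (m := 0) (by rwa [nb_zero])
  simpa using this

lemma mem_nb_of_norm_le (hL : 0 < L) {m j : ℕ} {x y : Rn n} (h : ‖y - x‖ ≤ m * side L j) :
    y ∈ nb m L j x := by
  have hs := side_pos hL j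
  intro i
  have h1 := (abs_coord_le (y - x) i).trans h
  simp only [PiLp.sub_apply] at h1
  have h2 : |y i / side L j - x i / side L j| ≤ m := by
    rw [← sub_div, abs_div, abs_of_pos hs, div_le_iff₀ hs]; exact h1
  rw [abs_le] at h2 ⊢
  simp only [idx]
  constructor
  · have : ⌊x i / side L j⌋ - (m : ℤ) ≤ ⌊y i / side L j⌋ := by
      rw [Int.le_floor]; push_cast
      have := Int.floor_le (x i / side L j); linarith
    linarith
  · have : ⌊y i / side L j⌋ - (m : ℤ) ≤ ⌊x i / side L j⌋ := by
      rw [Int.le_floor]; push_cast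
      have := Int.floor_le (y i / side L j); linarith
    linarith

/-- The set of points with given integer coordinates. -/
def fib (L : ℝ) (j : ℕ) (z : Fin n → ℤ) : Set (Rn n) := {y | idx L j y = z}

lemma measurableSet_fib (j : ℕ) (z : Fin n → ℤ) : MeasurableSet (fib L j z : Set (Rn n)) :=
  measurableSet_idx j fun w => w = z

lemma fib_idx (j : ℕ) (x : Rn n) : fib L j (idx L j x) = cell L j x := rfl

lemma iUnion_fib (j : ℕ) : ⋃ z, fib L j z = (univ : Set (Rn n)) := by
  ext x; simp [fib]

lemma pairwise_disjoint_fib (j : ℕ) :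
    Pairwise (Function.onFun Disjoint (fun z => (fib L j z : Set (Rn n)))) := by
  intro z w hzw
  refine disjoint_left.2 fun x hx hx' => hzw ?_
  exact hx.symm.trans hx'

lemma lintegral_eq_tsum_fib (j : ℕ) (f : Rn n → ℝ≥0∞) :
    ∫⁻ x, f x = ∑' z, ∫⁻ x in fib L j z, f x := by
  rw [← lintegral_iUnion (fun z => measurableSet_fib j z) (pairwise_disjoint_fib j), iUnion_fib,
    Measure.restrict_univ]

lemma setLIntegral_le_of_cell (j : ℕ) {T : Set (Rn n)} (f h : Rn n → ℝ≥0∞)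
    (hT : ∀ x y, y ∈ cell L j x → (y ∈ T ↔ x ∈ T))
    (H : ∀ x ∈ T, ∫⁻ y in cell L j x, f y ≤ ∫⁻ y in cell L j x, h y) :
    ∫⁻ x in T, f x ≤ ∫⁻ x in T, h x := by
  have hTm := measurableSet_of_const j hT
  rw [← lintegral_indicator hTm, ← lintegral_indicator hTm, lintegral_eq_tsum_fib (L := L) j,
    lintegral_eq_tsum_fib (L := L) j (T.indicator h)]
  refine ENNReal.tsum_le_tsum fun z => ?_
  by_cases hz : ∃ x : Rn n, idx L j x = z
  · obtain ⟨x, rfl⟩ := hz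
    rw [fib_idx]
    by_cases hx : x ∈ T
    · have e : ∀ F : Rn n → ℝ≥0∞, ∫⁻ y in cell L j x, T.indicator F y =
          ∫⁻ y in cell L j x, F y := fun F =>
        setLIntegral_congr_fun (measurableSet_cell j x) fun y hy => by
          simp [(hT x y hy).2 hx]
      rw [e, e]; exact H x hx
    · have e : ∀ F : Rn n → ℝ≥0∞, ∫⁻ y in cell L j x, T.indicator F y = 0 := fun F => by
        rw [setLIntegral_congr_fun (g := fun _ => 0) (measurableSet_cell j x)]
        · simp
        · intro y hy
          have : y ∉ T := fun h => hx ((hT x y hy).1 h)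
          simp [this]
      rw [e, e]
  · have : (fib L j z : Set (Rn n)) = ∅ := by
      ext y; simp only [mem_empty_iff_false, iff_false]
      exact fun hy => hz ⟨y, hy⟩
    simp [this]

lemma lintegral_le_of_cell (j : ℕ) (f h : Rn n → ℝ≥0∞)
    (H : ∀ x, ∫⁻ y in cell L j x, f y ≤ ∫⁻ y in cell L j x, h y) :
    ∫⁻ x, f x ≤ ∫⁻ x, h x := by
  have := setLIntegral_le_of_cell (L := L) j (T := univ) f h (by simp) (fun x _ => H x)
  simpa using this

lemma setMeasure_le_of_cell (j : ℕ) {T A : Set (Rn n)} (c : ℝ≥0∞) (hA : MeasurableSet A)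
    (hT : ∀ x y, y ∈ cell L j x → (y ∈ T ↔ x ∈ T))
    (H : ∀ x ∈ T, volume (A ∩ cell L j x) ≤ c * volume (cell L j x)) :
    volume (A ∩ T) ≤ c * volume T := by
  have hTm := measurableSet_of_const j hT
  have := setLIntegral_le_of_cell (L := L) j (A.indicator fun _ => 1) (fun _ => c) hT
    (fun x hx => by
      rw [lintegral_indicator hA, Measure.restrict_restrict hA]
      simpa using H x hx)
  rw [lintegral_indicator hA, Measure.restrict_restrict hA] at this
  simpa using this

lemma integral_eq_of_cell (j : ℕ) {f h : Rn n → ℝ} (hf : Integrable f) (hh : Integrable h)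
    (H : ∀ x, ∫ y in cell L j x, f y = ∫ y in cell L j x, h y) :
    ∫ x, f x = ∫ x, h x := by
  have e : ∀ F : Rn n → ℝ, Integrable F → ∫ x, F x = ∑' z, ∫ x in fib L j z, F x := by
    intro F hF
    rw [← setIntegral_univ, ← iUnion_fib (L := L) j]
    exact integral_iUnion (fun z => measurableSet_fib j z) (pairwise_disjoint_fib j)
      hF.integrableOn
  rw [e f hf, e h hh]
  congr 1
  funext z
  by_cases hz : ∃ x : Rn n, idx L j x = z
  · obtain ⟨x, rfl⟩ := hz
    exact H x
  · have : (fib L j z : Set (Rn n)) = ∅ := by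
      ext y; simp only [mem_empty_iff_false, iff_false]
      exact fun hy => hz ⟨y, hy⟩
    simp [this]

/-- Fubini bound for integrals over moving neighbourhoods. -/
lemma lintegral_nb_le (hL : 0 < L) (m j : ℕ) {S T : Set (Rn n)} (hS : MeasurableSet S)
    (hT : MeasurableSet T) (hST : ∀ x ∈ S, nb m L j x ⊆ T) {F : Rn n → ℝ≥0∞}
    (hF : Measurable F) :
    ∫⁻ x in S, ∫⁻ y in nb m L j x, F y ≤
      ENNReal.ofReal (((2 * m + 1) * side L j) ^ n) * ∫⁻ y in T, F y := by
  classical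
  have hD : MeasurableSet {p : Rn n × Rn n | p.1 ∈ S ∧ p.2 ∈ nb m L j p.1} := by
    refine (measurable_fst hS).inter ?_
    have h1 : Measurable fun p : Rn n × Rn n => (idx L j p.1, idx L j p.2) :=
      ((measurable_idx j).comp measurable_fst).prodMk ((measurable_idx j).comp measurable_snd)
    exact h1 (MeasurableSet.of_discrete
      (s := {q : (Fin n → ℤ) × (Fin n → ℤ) | ∀ i, |q.2 i - q.1 i| ≤ m}))
  have e1 : ∫⁻ x in S, ∫⁻ y in nb m L j x, F y = ∫⁻ x, ∫⁻ y,
      ({p : Rn n × Rn n | p.1 ∈ S ∧ p.2 ∈ nb m L j p.1}.indicator fun p => F p.2) (x, y) := by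
    rw [← lintegral_indicator hS]
    refine lintegral_congr fun x => ?_
    by_cases hx : x ∈ S
    · rw [indicator_of_mem hx, ← lintegral_indicator (measurableSet_nb m j x)]
      refine lintegral_congr fun y => ?_
      simp [indicator, hx]
    · simp [indicator, hx]
  have hm : Measurable ({p : Rn n × Rn n | p.1 ∈ S ∧ p.2 ∈ nb m L j p.1}.indicator
      fun p => F p.2) := (hF.comp measurable_snd).indicator hD
  rw [e1, lintegral_lintegral_swap (f := fun x y =>
    ({p : Rn n × Rn n | p.1 ∈ S ∧ p.2 ∈ nb m L j p.1}.indicator fun p => F p.2) (x, y))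
    hm.aemeasurable]
  rw [← lintegral_indicator hT, ← lintegral_const_mul _ (hF.indicator hT)]
  refine lintegral_mono fun y => ?_
  by_cases hy : y ∈ T
  · calc ∫⁻ x, ({p : Rn n × Rn n | p.1 ∈ S ∧ p.2 ∈ nb m L j p.1}.indicator
          fun p => F p.2) (x, y) ≤ ∫⁻ x, (nb m L j y).indicator (fun _ => F y) x := by
          refine lintegral_mono fun x => ?_
          simp only [indicator, mem_ofPred_eq]
          split_ifs with h1 h2
          · exact le_rfl
          · exact absurd (mem_nb_comm.1 h1.2) h2
          · exact zero_le
          · exact le_rfl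
      _ = _ := by
          rw [lintegral_indicator (measurableSet_nb m j y)]
          simp [hy, volume_nb hL, mul_comm]
  · have : ∀ x, ({p : Rn n × Rn n | p.1 ∈ S ∧ p.2 ∈ nb m L j p.1}.indicator
          fun p => F p.2) (x, y) = 0 := by
      intro x
      simp only [indicator, mem_ofPred_eq, ite_eq_right_iff]
      exact fun h => absurd (hST x h.1 h.2) hy
    simp [this]

end

section

variable {n : ℕ} {L : ℝ}

/-- The `ϱ`-variation of `h` along decreasing sequences in `S`. -/
def vr (ϱ : ℝ) (S : Set ℝ) (h : ℝ → ℝ) : ℝ≥0∞ :=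
  ⨆ (N : ℕ) (r : ℕ → ℝ) (_ : Antitone r) (_ : ∀ i, r i ∈ S),
    (∑ i ∈ Finset.range N, ‖h (r i) - h (r (i + 1))‖ₑ ^ ϱ) ^ (1 / ϱ)

lemma vr_le {ϱ : ℝ} {S : Set ℝ} {h : ℝ → ℝ} {B : ℝ≥0∞}
    (H : ∀ (N : ℕ) (r : ℕ → ℝ), Antitone r → (∀ i, r i ∈ S) →
      (∑ i ∈ Finset.range N, ‖h (r i) - h (r (i + 1))‖ₑ ^ ϱ) ^ (1 / ϱ) ≤ B) : vr ϱ S h ≤ B :=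
  iSup_le fun N => iSup_le fun r => iSup_le fun hr => iSup_le fun hS => H N r hr hS

lemma le_vr (ϱ : ℝ) {S : Set ℝ} (h : ℝ → ℝ) (N : ℕ) {r : ℕ → ℝ} (hr : Antitone r)
    (hS : ∀ i, r i ∈ S) :
    (∑ i ∈ Finset.range N, ‖h (r i) - h (r (i + 1))‖ₑ ^ ϱ) ^ (1 / ϱ) ≤ vr ϱ S h :=
  le_iSup_of_le N <| le_iSup_of_le r <| le_iSup_of_le hr <| le_iSup_of_le hS le_rfl

lemma sum_rpow_le_vr {ϱ : ℝ} (hϱ : 0 < ϱ) {S : Set ℝ} (h : ℝ → ℝ) (N : ℕ) {r : ℕ → ℝ}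
    (hr : Antitone r) (hS : ∀ i, r i ∈ S) :
    ∑ i ∈ Finset.range N, ‖h (r i) - h (r (i + 1))‖ₑ ^ ϱ ≤ vr ϱ S h ^ ϱ := by
  have := ENNReal.rpow_le_rpow (le_vr ϱ h N hr hS) hϱ.le
  rwa [← ENNReal.rpow_mul, one_div, inv_mul_cancel₀ hϱ.ne', ENNReal.rpow_one] at this

lemma vr_le_of_sum {ϱ : ℝ} (hϱ : 0 < ϱ) {S : Set ℝ} {h : ℝ → ℝ} {B : ℝ≥0∞}
    (H : ∀ (N : ℕ) (r : ℕ → ℝ), Antitone r → (∀ i, r i ∈ S) →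
      ∑ i ∈ Finset.range N, ‖h (r i) - h (r (i + 1))‖ₑ ^ ϱ ≤ B ^ ϱ) : vr ϱ S h ≤ B := by
  refine vr_le fun N r hr hS => ?_
  have := ENNReal.rpow_le_rpow (H N r hr hS) (one_div_nonneg.2 hϱ.le)
  rwa [← ENNReal.rpow_mul, mul_one_div, div_self hϱ.ne', ENNReal.rpow_one] at this

lemma vr_mono (ϱ : ℝ) {S T : Set ℝ} (hST : S ⊆ T) (h : ℝ → ℝ) : vr ϱ S h ≤ vr ϱ T h :=
  vr_le fun N _ hr hS => le_vr ϱ h N hr fun i => hST (hS i)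

lemma vr_congr (ϱ : ℝ) {S : Set ℝ} {h k : ℝ → ℝ} (e : EqOn h k S) : vr ϱ S h = vr ϱ S k := by
  refine le_antisymm ?_ ?_ <;> refine vr_le fun N r hr hS => ?_
  · simp_rw [e (hS _)]; exact le_vr ϱ k N hr hS
  · simp_rw [← e (hS _)]; exact le_vr ϱ h N hr hS

lemma vr_add_le {ϱ : ℝ} (hϱ : 1 ≤ ϱ) (S : Set ℝ) (h k : ℝ → ℝ) :
    vr ϱ S (fun r => h r + k r) ≤ vr ϱ S h + vr ϱ S k := by
  have h0 : 0 < ϱ := by linarith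
  refine vr_le fun N r hr hS => ?_
  refine le_trans ?_ (add_le_add (le_vr ϱ h N hr hS) (le_vr ϱ k N hr hS))
  refine le_trans ?_ (ENNReal.Lp_add_le _ _ _ hϱ)
  refine ENNReal.rpow_le_rpow (Finset.sum_le_sum fun i _ => ENNReal.rpow_le_rpow ?_ h0.le)
    (one_div_nonneg.2 h0.le)
  rw [add_sub_add_comm]
  exact enorm_add_le _ _

lemma vr_finset_sum_le {ϱ : ℝ} (hϱ : 1 ≤ ϱ) (S : Set ℝ) {ι : Type*} (s : Finset ι)
    (h : ι → ℝ → ℝ) :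
    vr ϱ S (fun r => ∑ i ∈ s, h i r) ≤ ∑ i ∈ s, vr ϱ S (h i) := by
  classical
  induction s using Finset.induction_on with
  | empty =>
    simp only [Finset.sum_empty]
    refine vr_le fun N r _ _ => ?_
    have h0 : 0 < ϱ := by linarith
    simp [ENNReal.zero_rpow_of_pos h0, h0]
  | insert a s ha ih =>
    simp only [Finset.sum_insert ha]
    exact (vr_add_le hϱ S _ _).trans (add_le_add_right ih _)

lemma vr_const_mul {ϱ : ℝ} (hϱ : 0 < ϱ) (S : Set ℝ) (c : ℝ) (h : ℝ → ℝ) :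
    vr ϱ S (fun r => c * h r) ≤ ‖c‖ₑ * vr ϱ S h := by
  refine vr_le_of_sum hϱ fun N r hr hS => ?_
  rw [ENNReal.mul_rpow_of_nonneg _ _ hϱ.le]
  refine le_trans ?_ (mul_le_mul_right (sum_rpow_le_vr hϱ h N hr hS) _)
  rw [Finset.mul_sum]
  refine Finset.sum_le_sum fun i _ => ?_
  rw [← mul_sub, enorm_mul, ENNReal.mul_rpow_of_nonneg _ _ hϱ.le]

lemma sum_rpow_le_rpow_sum {ϱ : ℝ} (hϱ : 1 ≤ ϱ) {ι : Type*} (s : Finset ι) (a : ι → ℝ≥0∞) :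
    ∑ i ∈ s, a i ^ ϱ ≤ (∑ i ∈ s, a i) ^ ϱ := by
  classical
  induction s using Finset.induction_on with
  | empty => simp
  | insert b s hb ih =>
    rw [Finset.sum_insert hb, Finset.sum_insert hb]
    exact (add_le_add_right ih _).trans (ENNReal.add_rpow_le_rpow_add _ _ hϱ)

lemma vr_le_vr_one {ϱ : ℝ} (hϱ : 1 ≤ ϱ) (S : Set ℝ) (h : ℝ → ℝ) : vr ϱ S h ≤ vr 1 S h := by
  refine vr_le_of_sum (by linarith) fun N r hr hS => ?_
  refine (sum_rpow_le_rpow_sum hϱ _ _).trans (ENNReal.rpow_le_rpow ?_ (by linarith))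
  simpa using sum_rpow_le_vr one_pos h N hr hS

lemma vr_split {ϱ : ℝ} (hϱ : 1 ≤ ϱ) {S : Set ℝ} {b : ℝ} (hb : b ∈ S) (h : ℝ → ℝ) :
    vr ϱ S h ≤ vr ϱ (S ∩ Iic b) h + vr ϱ (S ∩ Ici b) h := by
  have h0 : 0 < ϱ := by linarith
  have e : h = fun r => h (min r b) + (h (max r b) - h b) := by
    funext r
    rcases le_total r b with hr | hr <;> simp [hr]
  have l1 : vr ϱ S (fun r => h (min r b)) ≤ vr ϱ (S ∩ Iic b) h := by
    refine vr_le fun N r hr hS => ?_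
    refine le_vr ϱ h N (r := fun i => min (r i) b) (fun i j hij => min_le_min_right b (hr hij))
      fun i => ⟨?_, mem_Iic.2 (min_le_right _ _)⟩
    rcases le_total (r i) b with h1 | h1 <;> simp [h1, hb, hS i]
  have l2 : vr ϱ S (fun r => h (max r b) - h b) ≤ vr ϱ (S ∩ Ici b) h := by
    refine vr_le fun N r hr hS => ?_
    simp only [sub_sub_sub_cancel_right]
    refine le_vr ϱ h N (r := fun i => max (r i) b) (fun i j hij => max_le_max_right b (hr hij))
      fun i => ⟨?_, mem_Ici.2 (le_max_right _ _)⟩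
    rcases le_total (r i) b with h1 | h1 <;> simp [h1, hb, hS i]
  calc vr ϱ S h = vr ϱ S (fun r => h (min r b) + (h (max r b) - h b)) := by rw [← e]
    _ ≤ _ := vr_add_le hϱ S _ _
    _ ≤ _ := add_le_add l1 l2

lemma vr_Icc_le {ϱ : ℝ} (hϱ : 1 ≤ ϱ) {a b c : ℝ} (hab : a ≤ b) (hbc : b ≤ c) (h : ℝ → ℝ) :
    vr ϱ (Icc a c) h ≤ vr ϱ (Icc a b) h + vr ϱ (Icc b c) h := by
  refine (vr_split hϱ (b := b) (S := Icc a c) ⟨hab, hbc⟩ h).trans (add_le_add (vr_mono _ ?_ _) (vr_mono _ ?_ _))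
  · exact fun r hr => ⟨hr.1.1, hr.2⟩
  · exact fun r hr => ⟨hr.2, hr.1.2⟩

lemma vr_Ioc_lt (hL : 0 < L) {ϱ : ℝ} (h : ℝ → ℝ) {B : ℝ≥0∞} (H : B < vr ϱ (Ioc 0 L) h) :
    ∃ N, B < vr ϱ (Icc (side L N) L) h := by
  simp only [vr, lt_iSup_iff] at H
  obtain ⟨M, r, hr, hS, H⟩ := H
  obtain ⟨N, hN⟩ : ∃ N, side L N < r M := by
    obtain ⟨N, hN⟩ := exists_pow_lt_of_lt_one (div_pos (hS M).1 hL) (y := (1 / 2 : ℝ))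
      (by norm_num)
    refine ⟨N, ?_⟩
    rw [lt_div_iff₀ hL] at hN
    simpa [side, div_eq_inv_mul] using hN
  refine ⟨N, H.trans_le ?_⟩
  have := le_vr (S := Icc (side L N) L) ϱ h M (r := fun i => r (min i M))
    (fun i j hij => hr (min_le_min_right M hij))
    (fun i => ⟨hN.le.trans (hr (min_le_right _ _)), (hS _).2⟩)
  refine le_trans (le_of_eq ?_) this
  congr 1
  refine Finset.sum_congr rfl fun i hi => ?_
  have hi := Finset.mem_range.1 hi
  simp only [min_eq_left hi.le, min_eq_left (Nat.succ_le_of_lt hi)]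

lemma vr_one_le_of_telescope {S : Set ℝ} {h Φ : ℝ → ℝ} {M : ℝ}
    (H : ∀ r ∈ S, ∀ r' ∈ S, r' ≤ r → |h r - h r'| ≤ Φ r' - Φ r)
    (h0 : ∀ r ∈ S, 0 ≤ Φ r) (hM : ∀ r ∈ S, Φ r ≤ M) : vr 1 S h ≤ ENNReal.ofReal M := by
  refine vr_le fun N r hr hS => ?_
  simp only [ENNReal.rpow_one, div_one]
  have : ∀ i, ‖h (r i) - h (r (i + 1))‖ₑ ≤ ENNReal.ofReal (Φ (r (i + 1)) - Φ (r i)) := fun i => by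
    rw [Real.enorm_eq_ofReal_abs]
    exact ENNReal.ofReal_le_ofReal (H _ (hS i) _ (hS _) (hr (Nat.le_succ i)))
  refine (Finset.sum_le_sum fun i _ => this i).trans ?_
  rw [← ENNReal.ofReal_sum_of_nonneg]
  · refine ENNReal.ofReal_le_ofReal ?_
    rw [Finset.sum_range_sub fun i => Φ (r i)]
    have := h0 _ (hS 0)
    have := hM _ (hS N)
    linarith
  · intro i _
    exact (abs_nonneg _).trans (H _ (hS i) _ (hS _) (hr (Nat.le_succ i)))

lemma vr_one_integral_le {α : Type*} [MeasurableSpace α] {m : Measure α} {S : Set ℝ}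
    {k : ℝ → α → ℝ} {b : α → ℝ} (hk : ∀ r ∈ S, Integrable (fun y => k r y * b y) m)
    {M : α → ℝ≥0∞} (hM : ∀ y, b y ≠ 0 → vr 1 S (fun r => k r y) ≤ M y) :
    vr 1 S (fun r => ∫ y, k r y * b y ∂m) ≤ ∫⁻ y, M y * ‖b y‖ₑ ∂m := by
  refine vr_le fun N r hr hS => ?_
  simp only [ENNReal.rpow_one, div_one]
  calc ∑ i ∈ Finset.range N, ‖∫ y, k (r i) y * b y ∂m - ∫ y, k (r (i + 1)) y * b y ∂m‖ₑ
      ≤ ∑ i ∈ Finset.range N, ∫⁻ y, ‖k (r i) y * b y - k (r (i + 1)) y * b y‖ₑ ∂m := by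
        refine Finset.sum_le_sum fun i _ => ?_
        rw [← integral_sub (hk _ (hS _)) (hk _ (hS _))]
        exact enorm_integral_le_lintegral_enorm _
    _ = ∫⁻ y, ∑ i ∈ Finset.range N, ‖k (r i) y * b y - k (r (i + 1)) y * b y‖ₑ ∂m := by
        rw [lintegral_finsetSum']
        exact fun i _ => ((hk _ (hS _)).sub (hk _ (hS _))).1.enorm
    _ ≤ _ := by
        refine lintegral_mono fun y => ?_
        by_cases hb : b y = 0
        · simp [hb]
        · refine le_trans ?_ (mul_le_mul_left (hM y hb) _)
          simp only [← sub_mul, enorm_mul, ← Finset.sum_mul]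
          refine mul_le_mul_left ?_ _
          simpa using le_vr 1 (fun r => k r y) N hr hS

end

section

variable {n : ℕ} {L : ℝ}

/-- Profile in the radius `r` of the compactly supported kernel, at a point of norm `a`. -/
def kr (n : ℕ) (a r : ℝ) : ℝ := (r ^ n)⁻¹ * (max (1 - (a / r) ^ 2) 0) ^ 2

/-- Numerator of the logarithmic derivative of `kr`, as a function of `c = a / r`. -/
def kp (n : ℕ) (c : ℝ) : ℝ := 4 * c ^ 2 * max (1 - c ^ 2) 0 - n * (max (1 - c ^ 2) 0) ^ 2

lemma hasDerivAt_posPart_sq (u : ℝ) :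
    HasDerivAt (fun v : ℝ => (max v 0) ^ 2) (2 * max u 0) u := by
  rcases lt_trichotomy u 0 with hu | rfl | hu
  · have : (fun v : ℝ => (max v 0) ^ 2) =ᶠ[nhds u] fun _ => 0 := by
      filter_upwards [Iio_mem_nhds hu] with v hv
      rw [max_eq_right (mem_Iio.1 hv).le]; norm_num
    rw [max_eq_right hu.le, mul_zero]
    exact (hasDerivAt_const u (0 : ℝ)).congr_of_eventuallyEq this
  · rw [hasDerivAt_iff_isLittleO_nhds_zero]
    have : (fun h : ℝ => (max (0 + h) 0) ^ 2 - (max (0 : ℝ) 0) ^ 2 - h • (2 * max (0 : ℝ) 0))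
        =O[nhds 0] fun h => h ^ 2 := by
      refine Asymptotics.IsBigO.of_bound 1 (Filter.Eventually.of_forall fun h => ?_)
      simp only [zero_add, max_self, mul_zero, smul_eq_mul, one_mul]
      norm_num
      rcases le_total h 0 with h' | h'
      · simp [h', sq_nonneg]
      · simp [h']
    refine this.trans_isLittleO ?_
    simpa using Asymptotics.isLittleO_pow_id (𝕜 := ℝ) one_lt_two
  · have : (fun v : ℝ => (max v 0) ^ 2) =ᶠ[nhds u] fun v => v ^ 2 := by
      filter_upwards [Ioi_mem_nhds hu] with v hv
      rw [max_eq_left (mem_Ioi.1 hv).le]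
    rw [max_eq_left hu.le]
    refine HasDerivAt.congr_of_eventuallyEq ?_ this
    simpa using hasDerivAt_pow 2 u

lemma hasDerivAt_kr (a : ℝ) {r : ℝ} (hr : 0 < r) :
    HasDerivAt (kr n a) ((r ^ (n + 1))⁻¹ * kp n (a / r)) r := by
  have h1 : HasDerivAt (fun r : ℝ => (r ^ n)⁻¹) (-(n * r ^ (n - 1)) / (r ^ n) ^ 2) r :=
    (hasDerivAt_pow n r).inv (by positivity)
  have h2 : HasDerivAt (fun r : ℝ => 1 - (a / r) ^ 2) (2 * a ^ 2 / r ^ 3) r := by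
    have h3 : HasDerivAt (fun r : ℝ => a / r) (-a / r ^ 2) r := by
      have := (hasDerivAt_const r a).div (hasDerivAt_id r) hr.ne'
      refine this.congr_deriv ?_
      simp
    have h4 := (h3.pow 2).const_sub 1
    refine h4.congr_deriv ?_
    field_simp; push_cast; field_simp
  have h5 := (hasDerivAt_posPart_sq (1 - (a / r) ^ 2)).comp r h2
  have h6 := h1.mul h5
  refine h6.congr_deriv ?_
  have e : (n : ℝ) * r ^ (n - 1) / (r ^ n) ^ 2 = n * (r ^ (n + 1))⁻¹ := by
    rcases Nat.eq_zero_or_pos n with rfl | hn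
    · simp
    · obtain ⟨m, rfl⟩ := Nat.exists_eq_add_of_lt hn
      field_simp
      simp [pow_succ]
      ring
  rw [neg_div, e]
  simp only [kp, Function.comp]
  generalize max (1 - (a / r) ^ 2) 0 = u
  field_simp
  ring

lemma kr_eq_zero {a r : ℝ} (hr : 0 < r) (h : r ≤ a) : kr n a r = 0 := by
  have : 1 - (a / r) ^ 2 ≤ 0 := by
    have : 1 ≤ a / r := (one_le_div hr).2 h
    nlinarith
  simp [kr, this]

lemma kp_eq_zero {c : ℝ} (h : 1 ≤ c) : kp n c = 0 := by
  have : 1 - c ^ 2 ≤ 0 := by nlinarith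
  simp [kp, this]

lemma kp_eq_min (c : ℝ) : kp n c = kp n (min c 1) := by
  rcases le_total c 1 with h1 | h1
  · rw [min_eq_left h1]
  · rw [min_eq_right h1, kp_eq_zero h1, kp_eq_zero le_rfl]

/-- Lipschitz constant of `kp`. -/
def kc (n : ℕ) : ℝ := 4 * n + 24

lemma kc_pos : 0 < kc n := by unfold kc; positivity

lemma abs_kp_sub_le_aux {c d : ℝ} (hc : 0 ≤ c) (hd : 0 ≤ d) (hc1 : c ≤ 1) (hd1 : d ≤ 1) :
    |kp n c - kp n d| ≤ kc n * |c - d| := by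
  have e : kp n c - kp n d =
      (4 * (c + d) * (1 - c ^ 2 - d ^ 2) + n * ((c + d) * (2 - c ^ 2 - d ^ 2))) * (c - d) := by
    have h1 : 0 ≤ 1 - c ^ 2 := by nlinarith
    have h2 : 0 ≤ 1 - d ^ 2 := by nlinarith
    rw [kp, kp, max_eq_left h1, max_eq_left h2]; ring
  rw [e, abs_mul]
  refine mul_le_mul_of_nonneg_right ?_ (abs_nonneg _)
  have h1 : c ^ 2 ≤ 1 := by nlinarith
  have h2 : d ^ 2 ≤ 1 := by nlinarith
  have hs : 0 ≤ c + d := by linarith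
  have h3 : |4 * (c + d) * (1 - c ^ 2 - d ^ 2)| ≤ 24 := by
    rw [abs_le]; constructor <;> nlinarith [sq_nonneg c, sq_nonneg d]
  have h4 : |(c + d) * (2 - c ^ 2 - d ^ 2)| ≤ 4 := by
    rw [abs_le]; constructor <;> nlinarith [sq_nonneg c, sq_nonneg d]
  refine (abs_add_le _ _).trans ?_
  rw [abs_mul (n : ℝ), Nat.abs_cast]
  have : (n : ℝ) * |(c + d) * (2 - c ^ 2 - d ^ 2)| ≤ n * 4 :=
    mul_le_mul_of_nonneg_left h4 (Nat.cast_nonneg n)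
  unfold kc
  linarith

lemma abs_kp_sub_le {c d : ℝ} (hc : 0 ≤ c) (hd : 0 ≤ d) :
    |kp n c - kp n d| ≤ kc n * |c - d| := by
  rw [kp_eq_min c, kp_eq_min d]
  refine (abs_kp_sub_le_aux (le_min hc zero_le_one) (le_min hd zero_le_one) (min_le_right _ _)
    (min_le_right _ _)).trans (mul_le_mul_of_nonneg_left ?_ kc_pos.le)
  have := abs_min_sub_min_le_max c 1 d 1
  simpa using this

lemma abs_kp_le {c : ℝ} (hc : 0 ≤ c) : |kp n c| ≤ kc n := by
  rw [kp_eq_min c]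
  have h := abs_kp_sub_le_aux (n := n) (c := min c 1) (d := 1) (le_min hc zero_le_one) zero_le_one
    (min_le_right _ _) le_rfl
  rw [kp_eq_zero le_rfl, sub_zero] at h
  refine h.trans ?_
  have : |min c 1 - 1| ≤ 1 := by
    rw [abs_le]
    constructor
    · have := le_min hc zero_le_one; linarith
    · have := min_le_right c 1; linarith
  have := kc_pos (n := n)
  nlinarith

lemma abs_sub_le_of_deriv {φ φ' : ℝ → ℝ} {m : ℕ} {B : ℝ} (hm : 0 < m) (hB : 0 ≤ B)
    (h : ∀ r, 0 < r → HasDerivAt φ (φ' r) r)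
    (hb : ∀ r, 0 < r → |φ' r| ≤ B * (r ^ (m + 1))⁻¹) {r r' : ℝ} (hr' : 0 < r') (hrr : r' ≤ r) :
    |φ r - φ r'| ≤ B * (r' ^ m)⁻¹ - B * (r ^ m)⁻¹ := by
  have hΨ : ∀ r : ℝ, 0 < r → HasDerivAt (fun r : ℝ => B * (r ^ m)⁻¹)
      (-(B * (m * (r ^ (m + 1))⁻¹))) r := by
    intro r hr
    have := ((hasDerivAt_pow m r).inv (by positivity)).const_mul B
    refine this.congr_deriv ?_
    obtain ⟨k, rfl⟩ := Nat.exists_eq_add_of_lt hm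
    field_simp
    simp [pow_succ]
    ring
  have hle : ∀ r : ℝ, 0 < r → B * (r ^ (m + 1))⁻¹ ≤ B * (m * (r ^ (m + 1))⁻¹) := by
    intro r hr
    refine mul_le_mul_of_nonneg_left ?_ hB
    have : (1 : ℝ) ≤ m := by exact_mod_cast hm
    have h2 : 0 < (r ^ (m + 1))⁻¹ := by positivity
    nlinarith
  have key : ∀ s : ℝ, |s| ≤ 1 →
      AntitoneOn (fun r => s * φ r + B * (r ^ m)⁻¹) (Ioi 0) := by
    intro s hs
    have hd : ∀ r, 0 < r → HasDerivAt (fun r => s * φ r + B * (r ^ m)⁻¹)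
        (s * φ' r + -(B * (m * (r ^ (m + 1))⁻¹))) r := fun r hr =>
      ((h r hr).const_mul s).add (hΨ r hr)
    refine antitoneOn_of_deriv_nonpos (convex_Ioi 0)
      (fun r hr => (hd r hr).continuousAt.continuousWithinAt)
      (fun r hr => (hd r (by simpa using hr)).differentiableAt.differentiableWithinAt) ?_
    intro r hr
    rw [interior_Ioi] at hr
    rw [(hd r hr).deriv]
    have h1 := hb r hr
    have h2 := hle r hr
    have h3 : s * φ' r ≤ |φ' r| := (le_abs_self _).trans (by
      rw [abs_mul]; exact mul_le_of_le_one_left (abs_nonneg _) hs)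
    linarith
  have h1 := key 1 (by simp) (mem_Ioi.2 hr') (mem_Ioi.2 (hr'.trans_le hrr)) hrr
  have h2 := key (-1) (by simp) (mem_Ioi.2 hr') (mem_Ioi.2 (hr'.trans_le hrr)) hrr
  simp only at h1 h2
  rw [abs_le]; constructor <;> linarith

lemma vr_one_le_of_deriv {φ φ' : ℝ → ℝ} {m : ℕ} {B s s0 : ℝ} (hm : 0 < m) (hB : 0 ≤ B)
    (h : ∀ r, 0 < r → HasDerivAt φ (φ' r) r)
    (hb : ∀ r, 0 < r → |φ' r| ≤ B * (r ^ (m + 1))⁻¹) (hs : 0 < s)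
    (h0 : ∀ r, 0 < r → r ≤ s0 → φ r = 0) :
    vr 1 (Ici s) φ ≤ ENNReal.ofReal (B * ((max s s0) ^ m)⁻¹) := by
  have e : ∀ r, 0 < r → φ r = φ (max r s0) := by
    intro r hr
    rcases le_total r s0 with h1 | h1
    · rw [max_eq_right h1, h0 r hr h1, h0 s0 (hr.trans_le h1) le_rfl]
    · rw [max_eq_left h1]
  refine vr_one_le_of_telescope (Φ := fun r => B * ((max r s0) ^ m)⁻¹) ?_ ?_ ?_
  · intro r hr r' hr' hrr
    have hr := hs.trans_le (mem_Ici.1 hr)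
    have hr' := hs.trans_le (mem_Ici.1 hr')
    rw [e r hr, e r' hr']
    exact abs_sub_le_of_deriv hm hB h hb (lt_max_of_lt_left hr') (max_le_max_right _ hrr)
  · intro r hr
    have hr := hs.trans_le (mem_Ici.1 hr)
    have : 0 < max r s0 := lt_max_of_lt_left hr
    positivity
  · intro r hr
    have hr := mem_Ici.1 hr
    refine mul_le_mul_of_nonneg_left ?_ hB
    have : 0 < max s s0 := lt_max_of_lt_left hs
    gcongr

lemma vr_one_kr_sub_le {a a' s : ℝ} (ha : 0 ≤ a) (ha' : 0 ≤ a') (hs : 0 < s) :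
    vr 1 (Ici s) (fun r => kr n a r - kr n a' r) ≤
      ENNReal.ofReal (kc n * |a - a'| * ((max s (min a a')) ^ (n + 1))⁻¹) := by
  refine vr_one_le_of_deriv (φ' := fun r => (r ^ (n + 1))⁻¹ * kp n (a / r) -
    (r ^ (n + 1))⁻¹ * kp n (a' / r)) (Nat.succ_pos n)
    (mul_nonneg kc_pos.le (abs_nonneg _)) (fun r hr => (hasDerivAt_kr a hr).sub
      (hasDerivAt_kr a' hr)) ?_ hs ?_
  · intro r hr
    rw [← mul_sub, abs_mul, abs_of_pos (by positivity : 0 < (r ^ (n + 1))⁻¹)]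
    have h1 := abs_kp_sub_le (n := n) (div_nonneg ha hr.le) (div_nonneg ha' hr.le)
    rw [← sub_div, abs_div, abs_of_pos hr] at h1
    calc (r ^ (n + 1))⁻¹ * |kp n (a / r) - kp n (a' / r)|
        ≤ (r ^ (n + 1))⁻¹ * (kc n * (|a - a'| / r)) := by gcongr
      _ = _ := by rw [pow_succ r (n + 1)]; field_simp
  · intro r hr h1
    simp [kr_eq_zero hr (h1.trans (min_le_left _ _)), kr_eq_zero hr (h1.trans (min_le_right _ _))]

lemma vr_one_kr_le (hn : 0 < n) {a s : ℝ} (ha : 0 ≤ a) (hs : 0 < s) :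
    vr 1 (Ici s) (fun r => kr n a r) ≤
      ENNReal.ofReal (kc n * ((max s a) ^ n)⁻¹) := by
  refine vr_one_le_of_deriv (φ' := fun r => (r ^ (n + 1))⁻¹ * kp n (a / r)) hn
    kc_pos.le (fun r hr => hasDerivAt_kr a hr) ?_ hs fun r hr h1 => kr_eq_zero hr h1
  intro r hr
  rw [abs_mul, abs_of_pos (by positivity : 0 < (r ^ (n + 1))⁻¹), mul_comm]
  have h1 := abs_kp_le (n := n) (div_nonneg ha hr.le)
  gcongr

lemma kr_nonneg (a : ℝ) {r : ℝ} (hr : 0 < r) : 0 ≤ kr n a r := by unfold kr; positivity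

lemma kr_le (a : ℝ) {r : ℝ} (hr : 0 < r) : kr n a r ≤ (r ^ n)⁻¹ := by
  unfold kr
  have : (max (1 - (a / r) ^ 2) 0) ^ 2 ≤ 1 := by
    have h1 : max (1 - (a / r) ^ 2) 0 ≤ 1 := max_le (by nlinarith [sq_nonneg (a / r)]) zero_le_one
    have h2 : 0 ≤ max (1 - (a / r) ^ 2) 0 := le_max_right _ _
    nlinarith
  exact mul_le_of_le_one_right (by positivity) this

lemma continuous_kr (r : ℝ) : Continuous fun a => kr n a r := by
  unfold kr; fun_prop

/-- The averaging operator with kernel `kr`. -/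
def av (g : Rn n → ℝ) (x : Rn n) (r : ℝ) : ℝ := ∫ y, kr n ‖x - y‖ r * g y

lemma abs_kr_le (a : ℝ) {r : ℝ} (hr : 0 < r) : |kr n a r| ≤ (r ^ n)⁻¹ := by
  rw [abs_of_nonneg (kr_nonneg a hr)]; exact kr_le a hr

lemma integrable_kr_mul {g : Rn n → ℝ} (hg : Integrable g) (x : Rn n) {r : ℝ} (hr : 0 < r) :
    Integrable fun y => kr n ‖x - y‖ r * g y := by
  refine hg.bdd_mul (c := (r ^ n)⁻¹) ?_ ?_
  · exact ((continuous_kr r).comp (by fun_prop)).aestronglyMeasurable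
  · exact Filter.Eventually.of_forall fun y => by rw [Real.norm_eq_abs]; exact abs_kr_le _ hr

lemma av_congr {g h : Rn n → ℝ} {x : Rn n} {r : ℝ} (hr : 0 < r)
    (e : ∀ y, ‖y - x‖ < r → g y = h y) : av g x r = av h x r := by
  refine integral_congr_ae (Filter.Eventually.of_forall fun y => ?_)
  simp only
  by_cases hy : ‖y - x‖ < r
  · rw [e y hy]
  · rw [kr_eq_zero hr (by rw [norm_sub_rev]; exact not_lt.1 hy)]; simp

lemma av_add {g h : Rn n → ℝ} (hg : Integrable g) (hh : Integrable h) (x : Rn n) {r : ℝ}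
    (hr : 0 < r) : av (fun y => g y + h y) x r = av g x r + av h x r := by
  simp only [av, mul_add]
  exact integral_add (integrable_kr_mul hg x hr) (integrable_kr_mul hh x hr)

lemma av_finset_sum {ι : Type*} (s : Finset ι) {g : ι → Rn n → ℝ} (hg : ∀ i ∈ s, Integrable (g i))
    (x : Rn n) {r : ℝ} (hr : 0 < r) :
    av (fun y => ∑ i ∈ s, g i y) x r = ∑ i ∈ s, av (g i) x r := by
  simp only [av, Finset.mul_sum]
  exact integral_finsetSum s fun i hi => integrable_kr_mul (hg i hi) x hr

lemma vr_av_le (hn : 0 < n) {g : Rn n → ℝ} (hg : Integrable g) (x : Rn n) {s : ℝ} (hs : 0 < s) :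
    vr 1 (Ici s) (av g x) ≤
      ∫⁻ y, ENNReal.ofReal (kc n * ((max s ‖x - y‖) ^ n)⁻¹) * ‖g y‖ₑ :=
  vr_one_integral_le (fun _ hr => integrable_kr_mul hg x (hs.trans_le (mem_Ici.1 hr)))
    fun _ _ => vr_one_kr_le hn (norm_nonneg _) hs

lemma vr_av_sub_le {g : Rn n → ℝ} (hg : Integrable g) (x x' : Rn n) {s : ℝ} (hs : 0 < s) :
    vr 1 (Ici s) (fun r => av g x r - av g x' r) ≤
      ∫⁻ y, ENNReal.ofReal (kc n * ‖x - x'‖ *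
        ((max s (min ‖x - y‖ ‖x' - y‖)) ^ (n + 1))⁻¹) * ‖g y‖ₑ := by
  have e : EqOn (fun r => av g x r - av g x' r)
      (fun r => ∫ y, (kr n ‖x - y‖ r - kr n ‖x' - y‖ r) * g y) (Ici s) := by
    intro r hr
    have hr := hs.trans_le (mem_Ici.1 hr)
    simp only [av]
    rw [← integral_sub (integrable_kr_mul hg x hr) (integrable_kr_mul hg x' hr)]
    simp only [sub_mul]
  rw [vr_congr 1 e]
  refine (vr_one_integral_le (M := fun y => ENNReal.ofReal (kc n * ‖x - x'‖ *
        ((max s (min ‖x - y‖ ‖x' - y‖)) ^ (n + 1))⁻¹)) ?_ ?_)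
  · intro r hr
    have hr := hs.trans_le (mem_Ici.1 hr)
    simp only [sub_mul]
    exact (integrable_kr_mul hg x hr).sub (integrable_kr_mul hg x' hr)
  · intro y _
    refine (vr_one_kr_sub_le (norm_nonneg _) (norm_nonneg _) hs).trans
      (ENNReal.ofReal_le_ofReal ?_)
    have h1 : |‖x - y‖ - ‖x' - y‖| ≤ ‖x - x'‖ := by
      have := abs_norm_sub_norm_le (x - y) (x' - y)
      simpa using this
    have h2 : 0 < max s (min ‖x - y‖ ‖x' - y‖) := lt_max_of_lt_left hs
    have := kc_pos (n := n)
    gcongr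

/-- The corner of the level-`j` cell of `x`. -/
def corner (L : ℝ) (j : ℕ) (x : Rn n) : Rn n :=
  WithLp.toLp 2 fun i => (idx L j x i : ℝ) * side L j

lemma corner_mem_cell (hL : 0 < L) (j : ℕ) (x : Rn n) : corner L j x ∈ cell L j x := by
  have := side_pos hL j
  change idx L j _ = idx L j x
  funext i
  simp [idx, corner, mul_div_assoc, div_self this.ne']

lemma corner_eq {j : ℕ} {x y : Rn n} (h : y ∈ cell L j x) : corner L j y = corner L j x := by
  have h' : idx L j y = idx L j x := h
  simp [corner, h']

lemma measurable_corner (j : ℕ) : Measurable (corner L j : Rn n → Rn n) :=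
  measurable_of_const (L := L) j fun _ _ h => corner_eq h

/-- `h` has mean zero on all level-`i` cells. -/
def MeanZero (L : ℝ) (i : ℕ) (h : Rn n → ℝ) : Prop := ∀ x, ∫ y in cell L i x, h y = 0

/-- `h` is constant on all level-`i` cells. -/
def ConstOn (L : ℝ) (i : ℕ) {β : Type*} (h : Rn n → β) : Prop :=
  ∀ x y, y ∈ cell L i x → h y = h x

lemma ConstOn.mono {i j : ℕ} (hij : i ≤ j) {β : Type*} {h : Rn n → β} (hh : ConstOn L i h) :
    ConstOn L j h := fun x y hy => hh x y (cell_subset hij x hy)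

lemma MeanZero.integral_mul {i : ℕ} {h m : Rn n → ℝ} (hh : MeanZero L i h)
    (hm : ConstOn L i m) (hi : Integrable fun y => m y * h y) : ∫ y, m y * h y = 0 := by
  rw [integral_eq_of_cell (L := L) i (h := fun _ => 0) hi (integrable_zero _ _ _) fun x => ?_]
  · simp
  · rw [setIntegral_congr_fun (g := fun y => m x * h y) (measurableSet_cell i x)]
    · rw [integral_const_mul, hh x]; simp
    · intro y hy; simp only [hm x y hy]

lemma vr_av_meanZero_le (hL : 0 < L) {i : ℕ} {h : Rn n → ℝ} (hi : Integrable h)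
    (hh : MeanZero L i h) (x : Rn n) {s : ℝ} (hs : 0 < s) :
    vr 1 (Ici s) (av h x) ≤
      ∫⁻ y, ENNReal.ofReal (kc n * (n * side L i) *
        ((max s (‖x - y‖ - n * side L i)) ^ (n + 1))⁻¹) * ‖h y‖ₑ := by
  have h_int : ∀ r, 0 < r → Integrable fun y => kr n ‖x - corner L i y‖ r * h y := by
    intro r hr
    refine hi.bdd_mul (c := (r ^ n)⁻¹) ?_ ?_
    · refine ((continuous_kr r).measurable.comp ?_).aestronglyMeasurable
      exact (measurable_const.sub (measurable_corner i)).norm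
    · exact Filter.Eventually.of_forall fun y => by rw [Real.norm_eq_abs]; exact abs_kr_le _ hr
  have e : EqOn (av h x)
      (fun r => ∫ y, (kr n ‖x - y‖ r - kr n ‖x - corner L i y‖ r) * h y) (Ici s) := by
    intro r hr
    have hr := hs.trans_le (mem_Ici.1 hr)
    simp only [av, sub_mul]
    rw [integral_sub (integrable_kr_mul hi x hr) (h_int r hr),
      hh.integral_mul (m := fun y => kr n ‖x - corner L i y‖ r)
      (fun z y hy => by simp only [corner_eq hy]) (h_int r hr), sub_zero]
  rw [vr_congr 1 e]
  refine (vr_one_integral_le (M := fun y => ENNReal.ofReal (kc n * (n * side L i) *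
        ((max s (‖x - y‖ - n * side L i)) ^ (n + 1))⁻¹)) ?_ ?_)
  · intro r hr
    have hr := hs.trans_le (mem_Ici.1 hr)
    simp only [sub_mul]
    exact (integrable_kr_mul hi x hr).sub (h_int r hr)
  · intro y _
    refine (vr_one_kr_sub_le (norm_nonneg _) (norm_nonneg _) hs).trans
      (ENNReal.ofReal_le_ofReal ?_)
    have h0 : ‖corner L i y - y‖ ≤ n * side L i :=
      norm_sub_le_of_mem_cell hL (corner_mem_cell hL i y)
    have h1 : |‖x - y‖ - ‖x - corner L i y‖| ≤ n * side L i := by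
      have := abs_norm_sub_norm_le (x - y) (x - corner L i y)
      refine this.trans ?_
      simpa using h0
    have h3 : ‖x - y‖ - n * side L i ≤ min ‖x - y‖ ‖x - corner L i y‖ := by
      have := (norm_nonneg _).trans h0
      rw [abs_le] at h1
      exact le_min (by linarith) (by linarith)
    have h2 : 0 < max s (‖x - y‖ - n * side L i) := lt_max_of_lt_left hs
    have := kc_pos (n := n)
    have := side_pos hL i
    gcongr

end

section

variable {n : ℕ} {L : ℝ}

lemma exp_eq_integral_posPart {u : ℝ} (hu : 0 ≤ u) :
    ∫ s in Ioi (0 : ℝ), s ^ 2 / 2 * Real.exp (-s) * (max (1 - u / s) 0) ^ 2 = Real.exp (-u) := by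
  have h1 : ∀ s, (Ioi (0 : ℝ)).indicator
      (fun s => s ^ 2 / 2 * Real.exp (-s) * (max (1 - u / s) 0) ^ 2) s =
      (fun v => (Ioi (0 : ℝ)).indicator (fun s => Real.exp (-u) / 2 * (Real.exp (-s) * s ^ 2)) v)
        (s - u) := by
    intro s
    by_cases h2 : u < s
    · have hs : 0 < s := hu.trans_lt h2
      have h3 : 0 ≤ 1 - u / s := by rw [sub_nonneg, div_le_one hs]; exact h2.le
      simp only [indicator, mem_Ioi, hs, sub_pos, h2, if_true]
      rw [max_eq_left h3, show -(s - u) = -s + u by ring, Real.exp_add]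
      rw [Real.exp_neg u]
      field_simp
    · have h3 : ¬ (0 < s - u) := by linarith
      simp only [indicator, mem_Ioi, h3, if_false]
      split_ifs with hs
      · have : 1 - u / s ≤ 0 := by
          rw [sub_nonpos, one_le_div hs]; linarith
        rw [max_eq_right this]; ring
      · rfl
  rw [← integral_indicator measurableSet_Ioi]
  simp_rw [h1]
  rw [integral_sub_right_eq_self (fun v => (Ioi (0 : ℝ)).indicator
    (fun s => Real.exp (-u) / 2 * (Real.exp (-s) * s ^ 2)) v) u,
    integral_indicator measurableSet_Ioi, integral_const_mul]
  have h4 := Real.Gamma_eq_integral (s := 3) (by norm_num)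
  have h5 : Real.Gamma 3 = 2 := by
    simp
  have h6 : ∫ s in Ioi (0 : ℝ), Real.exp (-s) * s ^ 2 = 2 := by
    rw [← h5, h4]
    refine setIntegral_congr_fun measurableSet_Ioi fun s _ => ?_
    norm_num
  rw [h6]; ring

/-- Weight in the superposition of averages giving the heat semigroup. -/
def hw (n : ℕ) (s : ℝ) : ℝ :=
  Real.pi ^ (-(n : ℝ) / 2) / 2 * (Real.exp (-s) * s ^ ((n : ℝ) / 2 + 3 - 1))

lemma integrableOn_hw : IntegrableOn (hw n) (Ioi 0) :=
  (Real.GammaIntegral_convergent (by positivity)).const_mul _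

lemma hw_nonneg {s : ℝ} (hs : 0 < s) : 0 ≤ hw n s := by unfold hw; positivity

lemma measurable_hw : Measurable (hw n) := by unfold hw; fun_prop

lemma hw_mul_kr {t s a : ℝ} (ht : 0 < t) (hs : 0 < s) :
    hw n s * kr n a (2 * Real.sqrt (t * s)) = (4 * Real.pi * t) ^ (-(n : ℝ) / 2) *
      (s ^ 2 / 2 * Real.exp (-s) * (max (1 - a ^ 2 / (4 * t) / s) 0) ^ 2) := by
  have hts : 0 < t * s := mul_pos ht hs
  have e1 : (a / (2 * Real.sqrt (t * s))) ^ 2 = a ^ 2 / (4 * t) / s := by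
    rw [div_pow, mul_pow, Real.sq_sqrt hts.le, div_div]; ring_nf
  have e2 : (2 * Real.sqrt (t * s)) ^ n = (4 * t) ^ ((n : ℝ) / 2) * s ^ ((n : ℝ) / 2) := by
    have h0 : 0 ≤ 2 * Real.sqrt (t * s) := by positivity
    have h1 : (2 * Real.sqrt (t * s)) ^ n = ((2 * Real.sqrt (t * s)) ^ 2) ^ ((n : ℝ) / 2) := by
      rw [← Real.rpow_natCast, ← Real.rpow_natCast, ← Real.rpow_mul h0]
      congr 1; push_cast; ring
    rw [h1, mul_pow, Real.sq_sqrt hts.le, ← Real.mul_rpow (by positivity) hs.le]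
    congr 1; ring
  have e3 : (4 * Real.pi * t) ^ (-(n : ℝ) / 2) =
      Real.pi ^ (-(n : ℝ) / 2) * ((4 * t) ^ ((n : ℝ) / 2))⁻¹ := by
    rw [show 4 * Real.pi * t = Real.pi * (4 * t) by ring,
      Real.mul_rpow Real.pi_pos.le (by positivity), neg_div, Real.rpow_neg (x := 4 * t)
      (by positivity)]
  have e4 : s ^ ((n : ℝ) / 2 + 3 - 1) = s ^ ((n : ℝ) / 2) * s ^ 2 := by
    rw [show (n : ℝ) / 2 + 3 - 1 = (n : ℝ) / 2 + (2 : ℕ) by push_cast; ring,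
      Real.rpow_add hs, Real.rpow_natCast]
  rw [kr, hw, e1, e2, e3, e4]
  have p1 : 0 < s ^ ((n : ℝ) / 2) := by positivity
  have p2 : 0 < (4 * t) ^ ((n : ℝ) / 2) := by positivity
  field_simp

lemma heat_kernel_eq {t : ℝ} (ht : 0 < t) (a : ℝ) :
    (4 * Real.pi * t) ^ (-(n : ℝ) / 2) * Real.exp (-a ^ 2 / (4 * t)) =
      ∫ s in Ioi (0 : ℝ), hw n s * kr n a (2 * Real.sqrt (t * s)) := by
  rw [setIntegral_congr_fun measurableSet_Ioi fun s hs => hw_mul_kr (n := n) ht (mem_Ioi.1 hs),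
    integral_const_mul, exp_eq_integral_posPart (by positivity), neg_div (4 * t)]

lemma measurable_kr_uncurry {α : Type*} [MeasurableSpace α] {a r : α → ℝ} (ha : Measurable a)
    (hr : Measurable r) : Measurable fun p => kr n (a p) (r p) := by
  unfold kr
  fun_prop

lemma heatSg_eq {g : Rn n → ℝ} (hg : Integrable g) (x : Rn n) {t : ℝ} (ht : 0 < t) :
    heatSg n t g x = ∫ s in Ioi (0 : ℝ), hw n s * av g x (2 * Real.sqrt (t * s)) := by
  have e1 : heatSg n t g x =
      ∫ y, ∫ s in Ioi (0 : ℝ), hw n s * kr n ‖x - y‖ (2 * Real.sqrt (t * s)) * g y := by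
    unfold heatSg
    congr 1
    funext y
    rw [heat_kernel_eq ht, integral_mul_const]
  rw [e1, integral_integral_swap]
  · congr 1
    funext s
    simp only [av, mul_assoc]
    rw [integral_const_mul]
  · have hd : Integrable (fun p : Rn n × ℝ => ‖g p.1‖ * ((4 * Real.pi * t) ^ (-(n : ℝ) / 2) *
        (1 / 2 * (Real.exp (-p.2) * p.2 ^ ((3 : ℝ) - 1))))) (volume.prod (volume.restrict (Ioi 0))) := by
      refine hg.norm.mul_prod (f := fun y => ‖g y‖) (g := fun s : ℝ =>
        ((4 * Real.pi * t) ^ (-(n : ℝ) / 2) * (1 / 2 * (Real.exp (-s) * s ^ ((3 : ℝ) - 1))))) ?_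
      exact ((Real.GammaIntegral_convergent (s := 3) (by norm_num)).const_mul _).const_mul _
    refine hd.mono' ?_ ?_
    · refine AEStronglyMeasurable.mul ?_ (hg.1.comp_fst (f := g))
      refine Measurable.aestronglyMeasurable ?_
      refine (measurable_hw.comp measurable_snd).mul (measurable_kr_uncurry ?_ ?_) <;> fun_prop
    · have : ∀ᵐ p : Rn n × ℝ ∂(volume.prod (volume.restrict (Ioi 0))), p.2 ∈ Ioi (0 : ℝ) :=
        Measure.quasiMeasurePreserving_snd.ae (ae_restrict_mem measurableSet_Ioi)
      filter_upwards [this] with p hp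
      have hp : 0 < p.2 := hp
      simp only [Function.uncurry]
      rw [hw_mul_kr ht hp, norm_mul, mul_comm]
      refine mul_le_mul_of_nonneg_left ?_ (norm_nonneg _)
      rw [norm_mul, Real.norm_of_nonneg (by positivity)]
      refine mul_le_mul_of_nonneg_left ?_ (by positivity)
      rw [Real.norm_of_nonneg (by positivity)]
      have h1 : (max (1 - ‖x - p.1‖ ^ 2 / (4 * t) / p.2) 0) ^ 2 ≤ 1 := by
        have h1 : max (1 - ‖x - p.1‖ ^ 2 / (4 * t) / p.2) 0 ≤ 1 :=
          max_le (sub_le_self _ (by positivity)) zero_le_one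
        exact pow_le_one₀ (le_max_right _ _) h1
      have h2 : p.2 ^ ((3 : ℝ) - 1) = p.2 ^ 2 := by norm_num
      rw [h2]
      calc _ ≤ p.2 ^ 2 / 2 * Real.exp (-p.2) * 1 := by gcongr
        _ = _ := by ring

lemma measurable_av {g : Rn n → ℝ} (hg : Integrable g) (x : Rn n) : Measurable (av g x) := by
  have : StronglyMeasurable fun r => ∫ y, kr n ‖x - y‖ r * hg.1.mk g y := by
    refine StronglyMeasurable.integral_prod_right' (f := fun p : ℝ × Rn n =>
      kr n ‖x - p.2‖ p.1 * hg.1.mk g p.2) ?_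
    refine Measurable.stronglyMeasurable ?_
    refine (measurable_kr_uncurry ?_ ?_).mul (hg.1.stronglyMeasurable_mk.measurable.comp
      measurable_snd) <;> fun_prop
  convert! this.measurable using 1
  funext r
  refine integral_congr_ae ?_
  filter_upwards [hg.1.ae_eq_mk] with y hy
  rw [hy]

/-- Total mass of `hw`. -/
def hmass (n : ℕ) : ℝ≥0∞ := ∫⁻ s in Ioi (0 : ℝ), ENNReal.ofReal (hw n s)

lemma hmass_ne_top : hmass n ≠ ∞ := by
  have := (integrableOn_hw (n := n)).2
  rw [hasFiniteIntegral_iff_enorm] at this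
  refine ne_top_of_le_ne_top this.ne (lintegral_mono fun s => ?_)
  exact Real.ofReal_le_enorm _

lemma varHeat_le {ϱ : ℝ} (hϱ : 1 < ϱ) {g : Rn n → ℝ} (hg : Integrable g) (x : Rn n) :
    varHeat n ϱ g x ≤ hmass n * vr ϱ (Ioi 0) (av g x) := by
  have h0 : 0 < ϱ := by linarith
  refine iSup_le fun t => iSup_le fun ht => iSup_le fun hpos => iSup_le fun _ => ?_
  set P : Measure ℝ := (volume.restrict (Ioi 0)).withDensity fun s => ENNReal.ofReal (hw n s)
    with hP
  have hPu : P univ = hmass n := by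
    rw [hP, withDensity_apply _ MeasurableSet.univ, Measure.restrict_univ]; rfl
  set a : ℕ → ℝ → ℝ := fun j s => av g x (2 * Real.sqrt (t j * s)) with ha
  have ham : ∀ j, Measurable (a j) := fun j => (measurable_av hg x).comp (by fun_prop)
  have hm := measurable_hw (n := n)
  have key : ∀ j, ENNReal.ofReal (|heatSg n (t j) g x - heatSg n (t (j + 1)) g x| ^ ϱ) ≤
      hmass n ^ (ϱ - 1) * ∫⁻ s, ‖a j s - a (j + 1) s‖ₑ ^ ϱ ∂P := by
    intro j
    rw [← ENNReal.ofReal_rpow_of_nonneg (abs_nonneg _) h0.le, ← Real.enorm_eq_ofReal_abs]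
    have h1 : ‖heatSg n (t j) g x - heatSg n (t (j + 1)) g x‖ₑ ≤
        ∫⁻ s, ‖a j s - a (j + 1) s‖ₑ ∂P := by
      have hi : ∀ j, Integrable (fun s => hw n s * a j s) (volume.restrict (Ioi 0)) := by
        intro j
        have hd : IntegrableOn (fun s : ℝ => (∫ y, ‖g y‖) * ((4 * Real.pi * t j) ^ (-(n : ℝ) / 2) *
            (1 / 2 * (Real.exp (-s) * s ^ ((3 : ℝ) - 1))))) (Ioi 0) :=
          (((Real.GammaIntegral_convergent (s := 3) (by norm_num)).const_mul _).const_mul _).const_mul _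
        refine hd.mono' (hm.mul (ham j)).aestronglyMeasurable ?_
        filter_upwards [ae_restrict_mem measurableSet_Ioi] with s hs
        have hs : 0 < s := hs
        have htj := hpos j
        simp only [ha, av]
        rw [← integral_const_mul, mul_comm, ← integral_mul_const _ (fun y => ‖g y‖), mul_comm]
        refine norm_integral_le_of_norm_le ?_ (Filter.Eventually.of_forall fun y => ?_)
        · exact hg.norm.mul_const _
        · rw [← mul_assoc, hw_mul_kr (hpos j) hs, norm_mul, mul_comm]
          refine mul_le_mul_of_nonneg_left ?_ (norm_nonneg _)
          have h2 : s ^ ((3 : ℝ) - 1) = s ^ 2 := by norm_num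
          have h1 : (max (1 - ‖x - y‖ ^ 2 / (4 * t j) / s) 0) ^ 2 ≤ 1 :=
            pow_le_one₀ (le_max_right _ _)
              (max_le (sub_le_self _ (by positivity)) zero_le_one)
          rw [Real.norm_of_nonneg (by positivity), h2]
          refine mul_le_mul_of_nonneg_left ?_ (by positivity)
          calc _ ≤ s ^ 2 / 2 * Real.exp (-s) * 1 := by gcongr
            _ = _ := by ring
      rw [heatSg_eq hg x (hpos j), heatSg_eq hg x (hpos (j + 1)), ← integral_sub (hi j) (hi (j + 1))]
      refine (enorm_integral_le_lintegral_enorm _).trans ?_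
      rw [hP, lintegral_withDensity_eq_lintegral_mul _ hm.ennreal_ofReal
        (g := fun s => ‖a j s - a (j + 1) s‖ₑ) ((ham j).sub (ham (j + 1))).enorm]
      refine setLIntegral_mono' measurableSet_Ioi fun s hs => ?_
      simp only [Pi.mul_apply]
      rw [← mul_sub, enorm_mul, Real.enorm_eq_ofReal (hw_nonneg hs)]
    have hc : ϱ.HolderConjugate (ϱ / (ϱ - 1)) := Real.HolderConjugate.conjExponent hϱ
    have h2 := ENNReal.lintegral_mul_le_Lp_mul_Lq P hc
      (f := fun s => ‖a j s - a (j + 1) s‖ₑ) (g := fun _ => 1)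
      ((ham j).sub (ham (j + 1))).enorm.aemeasurable aemeasurable_const
    simp only [Pi.mul_apply, mul_one, ENNReal.one_rpow, lintegral_one, hPu] at h2
    have h3 := ENNReal.rpow_le_rpow (h1.trans h2) h0.le
    refine h3.trans (le_of_eq ?_)
    rw [ENNReal.mul_rpow_of_nonneg _ _ h0.le, ← ENNReal.rpow_mul, ← ENNReal.rpow_mul,
      one_div_mul_cancel h0.ne', ENNReal.rpow_one, mul_comm]
    congr 2
    have : ϱ - 1 ≠ 0 := by linarith
    field_simp
  have hsum : ∑' j, ENNReal.ofReal (|heatSg n (t j) g x - heatSg n (t (j + 1)) g x| ^ ϱ) ≤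
      (hmass n * vr ϱ (Ioi 0) (av g x)) ^ ϱ := by
    refine ENNReal.tsum_le_of_sum_range_le fun N => ?_
    refine (Finset.sum_le_sum fun j _ => key j).trans ?_
    rw [← Finset.mul_sum, ← lintegral_finsetSum']
    · rw [ENNReal.mul_rpow_of_nonneg _ _ h0.le, show ϱ = (ϱ - 1) + 1 by ring,
        ENNReal.rpow_add_of_nonneg _ _ (by linarith) zero_le_one, ENNReal.rpow_one, mul_assoc]
      simp only [sub_add_cancel]
      refine mul_le_mul_right ?_ _
      have h5 : ∀ᵐ s ∂P, ∑ j ∈ Finset.range N, ‖a j s - a (j + 1) s‖ₑ ^ ϱ ≤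
          vr ϱ (Ioi 0) (av g x) ^ ϱ := by
        have : ∀ᵐ s ∂P, s ∈ Ioi (0 : ℝ) :=
          (withDensity_absolutelyContinuous _ _).ae_le (ae_restrict_mem measurableSet_Ioi)
        filter_upwards [this] with s hs
        have hs : 0 < s := hs
        refine sum_rpow_le_vr h0 (av g x) N (r := fun j => 2 * Real.sqrt (t j * s)) ?_ ?_
        · intro i j hij
          have := ht.antitone hij
          simp only
          gcongr
        · intro i
          have := hpos i
          rw [mem_Ioi]; positivity
      refine (lintegral_mono_ae h5).trans ?_
      rw [lintegral_const, hPu, mul_comm]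
    · exact fun j _ => (((ham j).sub (ham (j + 1))).enorm.pow_const _).aemeasurable
  have := ENNReal.rpow_le_rpow hsum (one_div_nonneg.2 h0.le)
  rwa [← ENNReal.rpow_mul, mul_one_div, div_self h0.ne', ENNReal.rpow_one] at this

end

section

variable {n : ℕ} {L : ℝ}

/-- Conditional expectation on level-`j` cells. -/
def ev (L : ℝ) (j : ℕ) (G : Rn n → ℝ) (x : Rn n) : ℝ := (side L j ^ n)⁻¹ * ∫ y in cell L j x, G y

lemma ev_constOn (j : ℕ) (G : Rn n → ℝ) : ConstOn L j (ev L j G) := fun x y h => by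
  simp only [ev, cell_eq h]

lemma measurable_ev (j : ℕ) (G : Rn n → ℝ) : Measurable (ev L j G) :=
  measurable_of_const (L := L) j (ev_constOn j G)

lemma setIntegral_cell_of_const (hL : 0 < L) {j : ℕ} {h : Rn n → ℝ} (hh : ConstOn L j h)
    (x : Rn n) : ∫ y in cell L j x, h y = side L j ^ n * h x := by
  rw [setIntegral_congr_fun (g := fun _ => h x) (measurableSet_cell j x) fun y hy => hh x y hy]
  have := side_pos hL j
  simp only [integral_const, MeasurableSet.univ, measureReal_restrict_apply, univ_inter, smul_eq_mul]
  rw [Measure.real, volume_cell hL, ENNReal.toReal_ofReal (by positivity)]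

lemma setLIntegral_cell_of_const (hL : 0 < L) {j : ℕ} {h : Rn n → ℝ≥0∞} (hh : ConstOn L j h)
    (x : Rn n) : ∫⁻ y in cell L j x, h y = ENNReal.ofReal (side L j ^ n) * h x := by
  rw [setLIntegral_congr_fun (g := fun _ => h x) (measurableSet_cell j x) fun y hy => hh x y hy]
  simp [volume_cell hL, mul_comm]

lemma ev_of_const (hL : 0 < L) {j : ℕ} {h : Rn n → ℝ} (hh : ConstOn L j h) : ev L j h = h := by
  funext x
  have := side_pos hL j
  rw [ev, setIntegral_cell_of_const hL hh]
  field_simp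

lemma setIntegral_cell_ev (hL : 0 < L) (j : ℕ) (G : Rn n → ℝ) (x : Rn n) :
    ∫ y in cell L j x, ev L j G y = ∫ y in cell L j x, G y := by
  have := side_pos hL j
  rw [setIntegral_cell_of_const hL (ev_constOn j G), ev]
  field_simp

lemma enorm_ev_le (hL : 0 < L) (j : ℕ) (G : Rn n → ℝ) (x : Rn n) :
    ‖ev L j G x‖ₑ ≤ ENNReal.ofReal (side L j ^ n)⁻¹ * ∫⁻ y in cell L j x, ‖G y‖ₑ := by
  have := side_pos hL j
  rw [ev, enorm_mul, Real.enorm_eq_ofReal (by positivity)]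
  gcongr
  exact enorm_integral_le_lintegral_enorm _

lemma ofReal_pow_inv_mul {s : ℝ} (hs : 0 < s) (a : ℝ≥0∞) :
    ENNReal.ofReal (s ^ n) * (ENNReal.ofReal (s ^ n)⁻¹ * a) = a := by
  rw [← mul_assoc, ← ENNReal.ofReal_mul (by positivity), mul_inv_cancel₀ (by positivity)]
  simp

lemma setLIntegral_cell_enorm_ev_le (hL : 0 < L) (j : ℕ) (G : Rn n → ℝ) (x : Rn n) :
    ∫⁻ y in cell L j x, ‖ev L j G y‖ₑ ≤ ∫⁻ y in cell L j x, ‖G y‖ₑ := by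
  rw [setLIntegral_cell_of_const hL (h := fun y => ‖ev L j G y‖ₑ)
    fun x y h => by simp only [ev_constOn j G x y h]]
  calc _ ≤ ENNReal.ofReal (side L j ^ n) *
        (ENNReal.ofReal (side L j ^ n)⁻¹ * ∫⁻ y in cell L j x, ‖G y‖ₑ) := by
        gcongr; exact enorm_ev_le hL j G x
    _ = _ := ofReal_pow_inv_mul (side_pos hL j) _

lemma lintegral_enorm_ev_le (hL : 0 < L) (j : ℕ) (G : Rn n → ℝ) :
    ∫⁻ y, ‖ev L j G y‖ₑ ≤ ∫⁻ y, ‖G y‖ₑ :=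
  lintegral_le_of_cell (L := L) j _ _ fun x => setLIntegral_cell_enorm_ev_le hL j G x

lemma integrable_ev (hL : 0 < L) (j : ℕ) {G : Rn n → ℝ} (hG : Integrable G) :
    Integrable (ev L j G) :=
  ⟨(measurable_ev j G).aestronglyMeasurable, (lintegral_enorm_ev_le hL j G).trans_lt hG.2⟩

lemma abs_ev_le (hL : 0 < L) (j : ℕ) {G : Rn n → ℝ} {b : ℝ} (hb : ∀ x, |G x| ≤ b) (x : Rn n) :
    |ev L j G x| ≤ b := by
  have := side_pos hL j
  have h1 : ‖∫ y in cell L j x, G y‖ ≤ b * volume.real (cell L j x) :=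
    norm_setIntegral_le_of_norm_le_const (volume_cell_ne_top hL j x).lt_top fun y _ => hb y
  rw [Measure.real, volume_cell hL, ENNReal.toReal_ofReal (by positivity), Real.norm_eq_abs] at h1
  rw [ev, abs_mul, abs_of_pos (by positivity : 0 < (side L j ^ n)⁻¹)]
  calc _ ≤ (side L j ^ n)⁻¹ * (b * side L j ^ n) := by gcongr
    _ = b := by field_simp

/-- Tower property. -/
lemma setIntegral_ev_of_le (hL : 0 < L) {i j : ℕ} (hij : i ≤ j) {G : Rn n → ℝ}
    (hG : Integrable G) (x : Rn n) :
    ∫ y in cell L i x, ev L j G y = ∫ y in cell L i x, G y := by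
  rw [← integral_indicator (measurableSet_cell i x), ← integral_indicator (measurableSet_cell i x)]
  refine integral_eq_of_cell (L := L) j ((integrable_ev hL j hG).indicator (measurableSet_cell i x))
    (hG.indicator (measurableSet_cell i x)) fun z => ?_
  by_cases hz : z ∈ cell L i x
  · have e : ∀ F : Rn n → ℝ, ∫ y in cell L j z, (cell L i x).indicator F y =
        ∫ y in cell L j z, F y := fun F =>
      setIntegral_congr_fun (measurableSet_cell j z) fun y hy => by
        have : y ∈ cell L i x := by
          rw [← cell_eq hz]; exact cell_subset hij z hy
        simp [this]
    rw [e, e, setIntegral_cell_ev hL]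
  · have e : ∀ F : Rn n → ℝ, ∫ y in cell L j z, (cell L i x).indicator F y = 0 := fun F => by
      rw [setIntegral_congr_fun (g := fun _ => 0) (measurableSet_cell j z)]
      · simp
      · intro y hy
        have : y ∉ cell L i x := fun h => hz (by
          rw [← cell_eq h]; exact mem_cell_comm.1 (cell_subset hij z hy))
        simp [this]
    rw [e, e]

lemma meanZero_ev_sub (hL : 0 < L) {i j : ℕ} (hij : i ≤ j) {G : Rn n → ℝ} (hG : Integrable G) :
    MeanZero L i (fun x => ev L j G x - ev L i G x) := by
  intro x
  rw [integral_sub (integrable_ev hL j hG).integrableOn (integrable_ev hL i hG).integrableOn,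
    setIntegral_ev_of_le hL hij hG, setIntegral_ev_of_le hL le_rfl hG, sub_self]

lemma ev_meanZero {j : ℕ} {h : Rn n → ℝ} (hh : MeanZero L j h) (x : Rn n) : ev L j h x = 0 := by
  rw [ev, hh x, mul_zero]

lemma MeanZero.mono (hL : 0 < L) {i j : ℕ} (hij : j ≤ i) {h : Rn n → ℝ} (hi : Integrable h)
    (hh : MeanZero L i h) : MeanZero L j h := by
  intro x
  rw [← setIntegral_ev_of_le hL hij hi]
  have : ev L i h = fun _ => 0 := by funext y; exact ev_meanZero hh y
  simp [this]

/-- Martingale pieces of `G`. -/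
def mp (L : ℝ) (G : Rn n → ℝ) : ℕ → Rn n → ℝ
  | 0 => ev L 0 G
  | i + 1 => fun x => ev L (i + 1) G x - ev L i G x

lemma sum_mp (G : Rn n → ℝ) (N : ℕ) (x : Rn n) :
    ∑ i ∈ Finset.range (N + 1), mp L G i x = ev L N G x := by
  induction N with
  | zero => simp [mp]
  | succ N ih => rw [Finset.sum_range_succ, ih]; simp [mp]

lemma integrable_mp (hL : 0 < L) {G : Rn n → ℝ} (hG : Integrable G) (i : ℕ) :
    Integrable (mp L G i) := by
  cases i with
  | zero => exact integrable_ev hL 0 hG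
  | succ i => exact (integrable_ev hL _ hG).sub (integrable_ev hL _ hG)

lemma constOn_mp (G : Rn n → ℝ) (i : ℕ) : ConstOn L i (mp L G i) := by
  cases i with
  | zero => exact ev_constOn 0 G
  | succ i =>
    intro x y h
    simp only [mp]
    rw [ev_constOn _ G x y h, (ev_constOn (L := L) i G).mono (Nat.le_succ i) x y h]

lemma integrable_mul_of_bdd {f g : Rn n → ℝ} {b : ℝ} (hf : Integrable f) (hg : Measurable g)
    (hb : ∀ x, |g x| ≤ b) : Integrable fun x => g x * f x :=
  hf.bdd_mul hg.aestronglyMeasurable (Filter.Eventually.of_forall hb)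

lemma integral_mp_sq (hL : 0 < L) {G : Rn n → ℝ} {b : ℝ} (hG : Integrable G)
    (hb : ∀ x, |G x| ≤ b) (N : ℕ) :
    ∑ i ∈ Finset.range (N + 1), ∫ x, mp L G i x ^ 2 = ∫ x, ev L N G x ^ 2 := by
  induction N with
  | zero => simp [mp]
  | succ N ih =>
    rw [Finset.sum_range_succ, ih]
    have i1 : Integrable fun x => ev L N G x * (ev L (N + 1) G x - ev L N G x) :=
      integrable_mul_of_bdd ((integrable_ev hL _ hG).sub (integrable_ev hL _ hG))
        (measurable_ev N G) (abs_ev_le hL N hb)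
    have h0 := (meanZero_ev_sub hL (Nat.le_succ N) hG).integral_mul (ev_constOn N G) i1
    have i2 : ∀ k, Integrable fun x => ev L k G x ^ 2 := fun k => by
      simp only [sq]
      exact integrable_mul_of_bdd (integrable_ev hL _ hG) (measurable_ev k G) (abs_ev_le hL k hb)
    have e : ∀ x, mp L G (N + 1) x ^ 2 = ev L (N + 1) G x ^ 2 - ev L N G x ^ 2
        - 2 * (ev L N G x * (ev L (N + 1) G x - ev L N G x)) := by
      intro x; simp only [mp]; ring
    simp_rw [e]
    rw [integral_sub (f := fun x => ev L (N + 1) G x ^ 2 - ev L N G x ^ 2)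
      ((i2 _).sub (i2 _)) (i1.const_mul 2), integral_sub (i2 _) (i2 _), integral_const_mul]
    have h1 : ∫ x, ev L N G x * (ev L (N + 1) G x - ev L N G x) = 0 := h0
    rw [h1]; ring

lemma lintegral_enorm_sq_eq {h : Rn n → ℝ} (hi : Integrable fun x => h x ^ 2) :
    ∫⁻ x, ‖h x‖ₑ ^ 2 = ENNReal.ofReal (∫ x, h x ^ 2) := by
  rw [ofReal_integral_eq_lintegral_ofReal hi (Filter.Eventually.of_forall fun x => sq_nonneg _)]
  refine lintegral_congr fun x => ?_
  rw [Real.enorm_eq_ofReal_abs, ← ENNReal.ofReal_pow (abs_nonneg _), sq_abs]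

lemma lintegral_mp_sq (hL : 0 < L) {G : Rn n → ℝ} {b : ℝ} (hG : Integrable G)
    (hb : ∀ x, |G x| ≤ b) (N : ℕ) :
    ∑ i ∈ Finset.range (N + 1), ∫⁻ x, ‖mp L G i x‖ₑ ^ 2 = ∫⁻ x, ‖ev L N G x‖ₑ ^ 2 := by
  have i2 : ∀ k, Integrable fun x => ev L k G x ^ 2 := fun k => by
    simp only [sq]
    exact integrable_mul_of_bdd (integrable_ev hL _ hG) (measurable_ev k G) (abs_ev_le hL k hb)
  have i3 : ∀ i, Integrable fun x => mp L G i x ^ 2 := by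
    intro i
    cases i with
    | zero => exact i2 0
    | succ i =>
      simp only [sq]
      refine integrable_mul_of_bdd (b := b + b) (integrable_mp hL hG (i + 1))
        (measurable_of_const (L := L) _ (constOn_mp G (i + 1))) fun x => ?_
      exact (abs_sub _ _).trans (add_le_add (abs_ev_le hL _ hb x) (abs_ev_le hL _ hb x))
  rw [lintegral_enorm_sq_eq (i2 N), ← integral_mp_sq hL hG hb,
    ENNReal.ofReal_sum_of_nonneg fun i _ => integral_nonneg fun x => sq_nonneg _]
  exact Finset.sum_congr rfl fun i _ => lintegral_enorm_sq_eq (i3 i)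

lemma lintegral_ev_sq_le (hL : 0 < L) {G : Rn n → ℝ} {b : ℝ} (hb : ∀ x, |G x| ≤ b) (N : ℕ) :
    ∫⁻ x, ‖ev L N G x‖ₑ ^ 2 ≤ ENNReal.ofReal b * ∫⁻ x, ‖G x‖ₑ := by
  calc ∫⁻ x, ‖ev L N G x‖ₑ ^ 2 ≤ ∫⁻ x, ENNReal.ofReal b * ‖ev L N G x‖ₑ := by
        refine lintegral_mono fun x => ?_
        simp only [sq]
        gcongr
        rw [Real.enorm_eq_ofReal_abs]
        exact ENNReal.ofReal_le_ofReal (abs_ev_le hL N hb x)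
    _ = ENNReal.ofReal b * ∫⁻ x, ‖ev L N G x‖ₑ :=
        lintegral_const_mul _ (measurable_ev N G).enorm
    _ ≤ _ := mul_le_mul_right (lintegral_enorm_ev_le hL N G) _

/-- Local mean of `|h|` over the neighbourhood of a cell. -/
def mn (L : ℝ) (j : ℕ) (h : Rn n → ℝ) (x : Rn n) : ℝ≥0∞ :=
  ENNReal.ofReal (side L j ^ n)⁻¹ * ∫⁻ y in nb 1 L j x, ‖h y‖ₑ

lemma constOn_mn (j : ℕ) (h : Rn n → ℝ) : ConstOn L j (mn L j h) := fun x y hy => by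
  simp only [mn, nb_eq hy]

lemma measurable_mn (j : ℕ) (h : Rn n → ℝ) : Measurable (mn L j h) :=
  measurable_of_const (L := L) j (constOn_mn j h)

lemma sq_setLIntegral_le {s : Set (Rn n)} {h : Rn n → ℝ≥0∞} (hh : Measurable h) :
    (∫⁻ y in s, h y) ^ 2 ≤ volume s * ∫⁻ y in s, h y ^ 2 := by
  have h1 := ENNReal.lintegral_mul_le_Lp_mul_Lq (volume.restrict s) Real.HolderConjugate.two_two
    (f := fun _ => 1) (g := h) aemeasurable_const hh.aemeasurable
  simp only [Pi.mul_apply, one_mul, ENNReal.one_rpow, lintegral_one,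
    Measure.restrict_apply_univ] at h1
  have h2 := pow_le_pow_left' h1 2
  refine h2.trans (le_of_eq ?_)
  rw [mul_pow]
  have e : ∀ a : ℝ≥0∞, (a ^ (1 / 2 : ℝ)) ^ 2 = a := fun a => by
    rw [← ENNReal.rpow_natCast, ← ENNReal.rpow_mul]; norm_num
  rw [e, e]
  congr 1
  refine lintegral_congr fun y => ?_
  rw [← ENNReal.rpow_natCast]; norm_num

lemma lintegral_mn_sq_le (hL : 0 < L) (j : ℕ) {S T : Set (Rn n)} (hS : MeasurableSet S)
    (hT : MeasurableSet T) (hST : ∀ x ∈ S, nb 1 L j x ⊆ T) {h : Rn n → ℝ} (hh : Measurable h) :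
    ∫⁻ x in S, mn L j h x ^ 2 ≤ 9 ^ n * ∫⁻ y in T, ‖h y‖ₑ ^ 2 := by
  have hs := side_pos hL j
  have h3 : ENNReal.ofReal (((2 * (1 : ℕ) + 1) * side L j) ^ n) =
      3 ^ n * ENNReal.ofReal (side L j ^ n) := by
    rw [mul_pow, ENNReal.ofReal_mul (by positivity), ENNReal.ofReal_pow (by positivity)]
    norm_num
  calc ∫⁻ x in S, mn L j h x ^ 2
      ≤ ∫⁻ x in S, 3 ^ n * ENNReal.ofReal (side L j ^ n)⁻¹ * ∫⁻ y in nb 1 L j x, ‖h y‖ₑ ^ 2 := by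
        refine lintegral_mono fun x => ?_
        simp only [mn, mul_pow]
        refine (mul_le_mul_right (sq_setLIntegral_le hh.enorm) _).trans (le_of_eq ?_)
        rw [volume_nb hL, h3, sq, ← mul_assoc, ← mul_assoc]
        congr 1
        calc _ = ENNReal.ofReal (side L j ^ n)⁻¹ * (3 ^ n) * (ENNReal.ofReal (side L j ^ n) *
              (ENNReal.ofReal (side L j ^ n)⁻¹ * 1)) := by ring
          _ = _ := by rw [ofReal_pow_inv_mul hs]; ring
    _ = 3 ^ n * ENNReal.ofReal (side L j ^ n)⁻¹ * ∫⁻ x in S, ∫⁻ y in nb 1 L j x, ‖h y‖ₑ ^ 2 := by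
        refine lintegral_const_mul _ ?_
        exact measurable_of_const (L := L) j fun x y hy => by simp only [nb_eq hy]
    _ ≤ 3 ^ n * ENNReal.ofReal (side L j ^ n)⁻¹ *
        (3 ^ n * ENNReal.ofReal (side L j ^ n) * ∫⁻ y in T, ‖h y‖ₑ ^ 2) := by
        gcongr
        rw [← h3]
        exact lintegral_nb_le hL 1 j hS hT hST (hh.enorm.pow_const 2)
    _ = 3 ^ n * 3 ^ n * (ENNReal.ofReal (side L j ^ n) * (ENNReal.ofReal (side L j ^ n)⁻¹ *
          ∫⁻ y in T, ‖h y‖ₑ ^ 2)) := by ring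
    _ = _ := by
        rw [ofReal_pow_inv_mul hs, ← mul_pow]; norm_num

/-- Points whose level-`j` neighbourhood leaves their level-`i` cell. -/
def bdry (m : ℕ) (L : ℝ) (i j : ℕ) : Set (Rn n) := {x | ¬ nb m L j x ⊆ cell L i x}

lemma constOn_bdry (m : ℕ) {i j : ℕ} (hij : i ≤ j) (x y : Rn n) (h : y ∈ cell L j x) :
    y ∈ bdry m L i j ↔ x ∈ bdry m L i j := by
  change ¬ _ ↔ ¬ _
  rw [nb_eq h, cell_eq (cell_subset hij x h)]

lemma measurableSet_bdry (m : ℕ) {i j : ℕ} (hij : i ≤ j) :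
    MeasurableSet (bdry m L i j : Set (Rn n)) :=
  measurableSet_of_const (L := L) j (constOn_bdry m hij)

lemma idx_add_div (i m : ℕ) (x : Rn n) (a : Fin n) :
    idx L i x a = idx L (i + m) x a / 2 ^ m := by
  induction m with
  | zero => simp
  | succ m ih =>
    rw [ih, idx_succ (i + m), Int.ediv_ediv_of_nonneg (by norm_num), pow_succ', add_assoc]

lemma bdry_subset (i m : ℕ) (z : Rn n) :
    bdry 2 L i (i + m) ∩ cell L i z ⊆ ⋃ a : Fin n, ⋃ e : Fin 2,
      {y | y ∈ cell L i z ∧ idx L i z a * 2 ^ m + e * (2 ^ m - 2) ≤ idx L (i + m) y a ∧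
        idx L (i + m) y a < idx L i z a * 2 ^ m + e * (2 ^ m - 2) + 2} := by
  rintro y ⟨hy, hyz⟩
  by_contra hc
  refine hy fun w hw => ?_
  have hyz' : idx L i y = idx L i z := hyz
  change idx L i w = idx L i y
  funext a
  have h1 := hw a
  rw [abs_le] at h1
  have hp : (0 : ℤ) < 2 ^ m := by positivity
  have hy1 := idx_add_div (L := L) i m y a
  rw [hyz'] at hy1
  have hb1 := Int.mul_ediv_self_le (x := idx L (i + m) y a) hp.ne'
  have hb2 := Int.lt_mul_ediv_self_add (x := idx L (i + m) y a) hp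
  rw [← hy1] at hb1 hb2
  rw [hyz', idx_add_div i m w]
  simp only [mem_iUnion, not_exists, mem_ofPred_eq, not_and, not_lt] at hc
  have c0 := hc a 0 hyz
  have c1 := hc a 1 hyz
  simp only [Fin.val_zero, Fin.val_one, Nat.cast_zero, Nat.cast_one, zero_mul, one_mul] at c0 c1
  push_cast at h1
  set P : ℤ := 2 ^ m
  have c0' := c0 (by linarith)
  have c1' : idx L (i + m) y a < idx L i z a * P + (P - 2) := by
    by_contra hcc
    have := c1 (not_lt.1 hcc)
    linarith
  refine le_antisymm ?_ ?_
  · rw [← Int.lt_add_one_iff, Int.ediv_lt_iff_lt_mul hp]; linarith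
  · rw [Int.le_ediv_iff_mul_le hp]; linarith

lemma volume_bdry_le (hL : 0 < L) (i m : ℕ) (z : Rn n) :
    volume (bdry 2 L i (i + m) ∩ cell L i z) ≤
      ENNReal.ofReal (4 * n * (1 / 2) ^ m) * volume (cell L i z) := by
  have hs := side_pos hL (i + m)
  have hsi := side_pos hL i
  have hside : side L i = 2 ^ m * side L (i + m) := by
    simp only [side, pow_add]; field_simp
  have hslab : ∀ (a : Fin n) (K : ℤ),
      volume {y : Rn n | y ∈ cell L i z ∧ K ≤ idx L (i + m) y a ∧ idx L (i + m) y a < K + 2} ≤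
        ENNReal.ofReal (2 * (1 / 2) ^ m) * volume (cell L i z) := by
    intro a K
    have hsub : {y : Rn n | y ∈ cell L i z ∧ K ≤ idx L (i + m) y a ∧
        idx L (i + m) y a < K + 2} ⊆ {y : Rn n | ∀ b, y b ∈
        Ico (if b = a then K * side L (i + m) else idx L i z b * side L i)
          (if b = a then (K + 2) * side L (i + m) else (idx L i z b + 1) * side L i)} := by
      rintro y ⟨hy, h1, h2⟩ b
      by_cases hb : b = a
      · subst hb
        simp only [if_true]
        simp only [idx] at h1 h2
        rw [Int.le_floor, le_div_iff₀ hs] at h1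
        rw [Int.floor_lt, div_lt_iff₀ hs] at h2
        push_cast at h2
        exact ⟨h1, h2⟩
      · simp only [hb, if_false]
        have := nb_eq_box hL 0 i z
        rw [nb_zero] at this
        rw [this] at hy
        have := hy b
        push_cast at this
        simpa using this
    refine (measure_mono hsub).trans ?_
    rw [volume_box, volume_cell hL]
    have : ∀ b : Fin n, ENNReal.ofReal
        ((if b = a then ((K : ℝ) + 2) * side L (i + m) else (idx L i z b + 1) * side L i) -
        (if b = a then K * side L (i + m) else idx L i z b * side L i)) =
        ENNReal.ofReal (side L i) *
          (if b = a then ENNReal.ofReal (2 * (1 / 2) ^ m) else 1) := by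
      intro b
      split_ifs
      · rw [← ENNReal.ofReal_mul hsi.le, hside]
        congr 1
        rw [one_div, inv_pow]; field_simp; ring
      · rw [mul_one]; congr 1; ring
    rw [Finset.prod_congr rfl fun b _ => this b, Finset.prod_mul_distrib,
      Finset.prod_ite_eq' Finset.univ a]
    simp [mul_comm, ENNReal.ofReal_pow hsi.le]
  refine (measure_mono (bdry_subset i m z)).trans ?_
  refine (measure_iUnion_fintype_le _ _).trans ?_
  calc _ ≤ ∑ _a : Fin n, ∑ _e : Fin 2, ENNReal.ofReal (2 * (1 / 2) ^ m) * volume (cell L i z) := by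
        refine Finset.sum_le_sum fun a _ => (measure_iUnion_fintype_le _ _).trans ?_
        exact Finset.sum_le_sum fun e _ => hslab a _
    _ = _ := by
        simp only [Finset.sum_const, Finset.card_univ, Fintype.card_fin, nsmul_eq_mul, ← mul_assoc]
        congr 1
        rw [← ENNReal.ofReal_natCast, ← ENNReal.ofReal_natCast, ← ENNReal.ofReal_mul (by positivity),
          ← ENNReal.ofReal_mul (by positivity)]
        congr 1; push_cast; ring

lemma lintegral_bdry_mn_sq_le (hL : 0 < L) (i m : ℕ) {h : Rn n → ℝ} (hc : ConstOn L i h) :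
    ∫⁻ x in bdry 1 L i (i + m), mn L (i + m) h x ^ 2 ≤
      9 ^ n * (ENNReal.ofReal (4 * n * (1 / 2) ^ m) * ∫⁻ y, ‖h y‖ₑ ^ 2) := by
  have hij : i ≤ i + m := Nat.le_add_right _ _
  have hh : Measurable h := measurable_of_const (L := L) i hc
  refine (lintegral_mn_sq_le hL (i + m) (measurableSet_bdry (L := L) 1 hij) (measurableSet_bdry (L := L) 2 hij)
    ?_ hh).trans ?_
  · intro x hx y hy hsub
    refine hx ?_
    have h1 : x ∈ cell L i y := hsub (nb_mono one_le_two _ _ (mem_nb_comm.1 hy))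
    rw [cell_eq h1]
    exact fun w hw => hsub (mem_nb_trans (mem_nb_comm.1 hy) hw)
  · gcongr
    rw [← lintegral_indicator (measurableSet_bdry (L := L) 2 hij), ← lintegral_const_mul _
      (hh.enorm.pow_const 2)]
    refine lintegral_le_of_cell (L := L) i _ _ fun z => ?_
    rw [lintegral_const_mul _ (hh.enorm.pow_const 2), lintegral_indicator (measurableSet_bdry (L := L) 2 hij),
      Measure.restrict_restrict (measurableSet_bdry (L := L) 2 hij)]
    have e1 : ∀ s ⊆ cell L i z, MeasurableSet s →
        ∫⁻ y in s, ‖h y‖ₑ ^ 2 = ‖h z‖ₑ ^ 2 * volume s := by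
      intro s hs hm
      rw [setLIntegral_congr_fun (g := fun _ => ‖h z‖ₑ ^ 2) hm fun y hy => by
        simp only [hc z y (hs hy)]]
      simp
    rw [e1 _ inter_subset_right ((measurableSet_bdry (L := L) 2 hij).inter (measurableSet_cell i z)),
      e1 _ subset_rfl (measurableSet_cell i z)]
    calc _ ≤ ‖h z‖ₑ ^ 2 * (ENNReal.ofReal (4 * n * (1 / 2) ^ m) * volume (cell L i z)) := by
          gcongr; exact volume_bdry_le hL i m z
      _ = _ := by ring

end

section

variable {n : ℕ} {L : ℝ}

/-- Total mass of the kernel `kr`. -/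
def kap (n : ℕ) : ℝ := ∫ z : Rn n, kr n ‖z‖ 1

lemma integral_kr (x : Rn n) {r : ℝ} (hr : 0 < r) : ∫ y : Rn n, kr n ‖x - y‖ r = kap n := by
  have h1 : ∫ y : Rn n, kr n ‖x - y‖ r = ∫ y : Rn n, kr n ‖y‖ r :=
    integral_sub_left_eq_self (fun y : Rn n => kr n ‖y‖ r) volume x
  have h2 : ∀ y : Rn n, kr n ‖y‖ r = (r ^ n)⁻¹ * kr n ‖r⁻¹ • y‖ 1 := by
    intro y
    rw [norm_smul, Real.norm_of_nonneg (by positivity)]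
    simp only [kr, one_pow, inv_one, one_mul, div_one]
    rw [div_eq_inv_mul]
  rw [h1]
  simp_rw [h2]
  rw [integral_const_mul, Measure.integral_comp_inv_smul volume (fun y : Rn n => kr n ‖y‖ 1) r]
  simp only [finrank_euclideanSpace, Fintype.card_fin, smul_eq_mul, kap]
  rw [abs_of_pos (by positivity), ← mul_assoc, inv_mul_cancel₀ (by positivity), one_mul]

lemma enorm_av_le {h : Rn n → ℝ} (x : Rn n) {r : ℝ} (hr : 0 < r) :
    ‖av h x r‖ₑ ≤ ENNReal.ofReal (r ^ n)⁻¹ * ∫⁻ y, ‖h y‖ₑ := by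
  rw [← lintegral_const_mul' _ _ ENNReal.ofReal_ne_top]
  refine (enorm_integral_le_lintegral_enorm _).trans (lintegral_mono fun y => ?_)
  rw [enorm_mul, Real.enorm_eq_ofReal_abs (kr _ _ _)]
  gcongr
  exact abs_kr_le _ hr

lemma enorm_sub_le_vr_one {S : Set ℝ} (h : ℝ → ℝ) {a b : ℝ} (ha : a ∈ S) (hb : b ∈ S)
    (hab : a ≤ b) : ‖h b - h a‖ₑ ≤ vr 1 S h := by
  have := le_vr 1 (S := S) h 1 (r := fun i => if i = 0 then b else a)
    (antitone_nat_of_succ_le fun i => by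
      by_cases h0 : i = 0 <;> simp [h0, hab]) (fun i => by by_cases h0 : i = 0 <;> simp [h0, ha, hb])
  simpa using this

lemma enorm_av_le_vr (hn : 0 < n) {h : Rn n → ℝ} (hh : Integrable h) (x : Rn n) {r : ℝ}
    (hr : 0 < r) : ‖av h x r‖ₑ ≤ vr 1 (Ici r) (av h x) := by
  have h1 : ∀ᶠ R in Filter.atTop, ‖av h x r‖ₑ ≤
      (ENNReal.ofReal (R ^ n)⁻¹ * ∫⁻ y, ‖h y‖ₑ) + vr 1 (Ici r) (av h x) := by
    filter_upwards [Filter.eventually_ge_atTop r] with R hR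
    calc ‖av h x r‖ₑ = ‖av h x R - (av h x R - av h x r)‖ₑ := by congr 1; ring
      _ ≤ ‖av h x R‖ₑ + ‖av h x R - av h x r‖ₑ := enorm_sub_le
      _ ≤ _ := add_le_add (enorm_av_le x (hr.trans_le hR))
        (enorm_sub_le_vr_one _ (mem_Ici.2 le_rfl) (mem_Ici.2 hR) hR)
  have h2 : Filter.Tendsto (fun R : ℝ => (ENNReal.ofReal (R ^ n)⁻¹ * ∫⁻ y, ‖h y‖ₑ) +
      vr 1 (Ici r) (av h x)) Filter.atTop
      (nhds ((ENNReal.ofReal 0 * ∫⁻ y, ‖h y‖ₑ) + vr 1 (Ici r) (av h x))) := by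
    refine Filter.Tendsto.add ?_ tendsto_const_nhds
    refine ENNReal.Tendsto.mul_const (ENNReal.tendsto_ofReal ?_) (Or.inr hh.2.ne)
    exact (Filter.tendsto_pow_atTop hn.ne').inv_tendsto_atTop
  simpa using ge_of_tendsto h2 h1

lemma mem_nb_one (hL : 0 < L) {j : ℕ} {x y : Rn n} {r : ℝ} (hr : r ≤ side L j)
    (h : ‖y - x‖ < r) : y ∈ nb 1 L j x := mem_nb_of_norm_le hL (by simp; linarith)

lemma av_eq_nb (hL : 0 < L) {j : ℕ} (h : Rn n → ℝ) (x : Rn n) {r : ℝ} (hr : 0 < r)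
    (hr' : r ≤ side L j) : av h x r = av ((nb 1 L j x).indicator h) x r :=
  av_congr hr fun y hy => by rw [indicator_of_mem (mem_nb_one hL hr' hy)]

/-- Variation of the averages of the part of `h` near the level-`j` cell of `x`. -/
def vn (L : ℝ) (j : ℕ) (h : Rn n → ℝ) (x : Rn n) : ℝ≥0∞ :=
  vr 1 (Ici (side L (j + 1))) (av ((nb 1 L j x).indicator h) x)

lemma side_succ_le (hL : 0 < L) (j : ℕ) : side L (j + 1) ≤ side L j := side_anti hL (Nat.le_succ j)

lemma vr_le_vn (hL : 0 < L) (j : ℕ) (h : Rn n → ℝ) (x : Rn n) :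
    vr 1 (Icc (side L (j + 1)) (side L j)) (av h x) ≤ vn L j h x := by
  rw [vr_congr 1 (k := av ((nb 1 L j x).indicator h) x) fun r hr =>
    av_eq_nb hL h x ((side_pos hL _).trans_le hr.1) hr.2]
  exact vr_mono 1 Icc_subset_Ici_self _

lemma enorm_av_le_vn (hL : 0 < L) (hn : 0 < n) (j : ℕ) {h : Rn n → ℝ} (hh : Integrable h)
    (x : Rn n) : ‖av h x (side L j)‖ₑ ≤ vn L j h x := by
  rw [av_eq_nb hL h x (side_pos hL j) le_rfl]
  refine (enorm_av_le_vr hn (hh.indicator (measurableSet_nb 1 j x)) x (side_pos hL j)).trans ?_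
  exact vr_mono 1 (Ici_subset_Ici.2 (side_succ_le hL j)) _

lemma lintegral_indicator_enorm (j : ℕ) (h : Rn n → ℝ) (x : Rn n) :
    ∫⁻ y, ‖(nb 1 L j x).indicator h y‖ₑ = ∫⁻ y in nb 1 L j x, ‖h y‖ₑ := by
  simp_rw [enorm_indicator_eq_indicator_enorm]
  exact lintegral_indicator (measurableSet_nb 1 j x) _

lemma ofReal_mul_mn (hL : 0 < L) (j : ℕ) (h : Rn n → ℝ) (x : Rn n) {c : ℝ} (hc : 0 ≤ c) :
    ENNReal.ofReal c * mn L j h x =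
      ∫⁻ y, ENNReal.ofReal (c * (side L j ^ n)⁻¹) * ‖(nb 1 L j x).indicator h y‖ₑ := by
  have := side_pos hL j
  rw [mn, lintegral_const_mul' _ _ ENNReal.ofReal_ne_top, lintegral_indicator_enorm,
    ENNReal.ofReal_mul hc, mul_assoc]

lemma vn_le (hL : 0 < L) (hn : 0 < n) (j : ℕ) {h : Rn n → ℝ} (hh : Integrable h) (x : Rn n) :
    vn L j h x ≤ ENNReal.ofReal (kc n * 2 ^ n) * mn L j h x := by
  have hs := side_pos hL (j + 1)
  have hs' := side_pos hL j
  have hk := kc_pos (n := n)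
  refine (vr_av_le hn (hh.indicator (measurableSet_nb 1 j x)) x hs).trans ?_
  rw [ofReal_mul_mn hL j h x (by positivity)]
  refine lintegral_mono fun y => ?_
  refine mul_le_mul_left (ENNReal.ofReal_le_ofReal ?_) _
  rw [mul_assoc, side_succ (L := L) j, mul_pow, mul_inv, ← mul_assoc (2 ^ n),
    mul_inv_cancel₀ (by positivity), one_mul]
  gcongr
  exact le_max_left _ _

lemma MeanZero.indicator {i : ℕ} {h : Rn n → ℝ} (hh : MeanZero L i h) {S : Set (Rn n)}
    (hS : ∀ x y, y ∈ cell L i x → (y ∈ S ↔ x ∈ S)) : MeanZero L i (S.indicator h) := by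
  intro x
  by_cases hx : x ∈ S
  · rw [setIntegral_congr_fun (g := h) (measurableSet_cell i x) fun y hy =>
      indicator_of_mem ((hS x y hy).2 hx) h]
    exact hh x
  · rw [setIntegral_congr_fun (g := fun _ => 0) (measurableSet_cell i x) fun y hy =>
      indicator_of_notMem (fun h' => hx ((hS x y hy).1 h')) h]
    simp

lemma nb_constOn {m i j : ℕ} (hij : j ≤ i) (x z y : Rn n) (h : y ∈ cell L i z) :
    y ∈ nb m L j x ↔ z ∈ nb m L j x := by
  have h1 := cell_subset hij z h
  rw [mem_nb_comm, mem_nb_comm (y := z), nb_eq h1]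

lemma vn_meanZero_le (hL : 0 < L) (j m : ℕ) {h : Rn n → ℝ} (hh : Integrable h)
    (hz : MeanZero L (j + m) h) (x : Rn n) :
    vn L j h x ≤ ENNReal.ofReal (kc n * n * 2 ^ (n + 1) * (1 / 2) ^ m) * mn L j h x := by
  have hs := side_pos hL (j + 1)
  have hs' := side_pos hL j
  have hs'' := side_pos hL (j + m)
  have hk := kc_pos (n := n)
  refine (vr_av_meanZero_le hL (hh.indicator (measurableSet_nb 1 j x))
    (hz.indicator fun z y hy => nb_constOn (Nat.le_add_right _ _) x z y hy) x hs).trans ?_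
  rw [ofReal_mul_mn hL j h x (by positivity)]
  refine lintegral_mono fun y => ?_
  refine mul_le_mul_left (ENNReal.ofReal_le_ofReal ?_) _
  calc kc n * (n * side L (j + m)) *
        ((max (side L (j + 1)) (‖x - y‖ - n * side L (j + m))) ^ (n + 1))⁻¹
      ≤ kc n * (n * side L (j + m)) * ((side L (j + 1)) ^ (n + 1))⁻¹ := by
        gcongr
        exact le_max_left _ _
    _ = _ := by
        have e : side L (j + m) = (1 / 2) ^ m * (2 * side L (j + 1)) := by
          simp only [side, pow_add, one_div, inv_pow]; field_simp
        rw [e, side_succ (L := L) j]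
        field_simp
        ring

/-- The deviation of the averages from the level-`j` conditional expectation is at most `B`. -/
def Dev (L : ℝ) (j : ℕ) (h : Rn n → ℝ) (x : Rn n) (B : ℝ≥0∞) : Prop :=
  vr 1 (Icc (side L (j + 1)) (side L j)) (av h x) ≤ B ∧
    ‖av h x (side L j) - kap n * ev L j h x‖ₑ ≤ B

lemma dev_meanZero (hL : 0 < L) (hn : 0 < n) (j m : ℕ) {h : Rn n → ℝ} (hh : Integrable h)
    (hz : MeanZero L (j + m) h) (x : Rn n) :
    Dev L j h x (ENNReal.ofReal (kc n * n * 2 ^ (n + 1) * (1 / 2) ^ m) * mn L j h x) := by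
  have := vn_meanZero_le hL j m hh hz x
  refine ⟨(vr_le_vn hL j h x).trans this, ?_⟩
  rw [ev_meanZero (hz.mono hL (Nat.le_add_right _ _) hh), mul_zero, sub_zero]
  exact (enorm_av_le_vn hL hn j hh x).trans this

lemma vr_const (S : Set ℝ) (c : ℝ) : vr 1 S (fun _ => c) = 0 := by
  refine le_antisymm (vr_le fun N r _ _ => ?_) (zero_le)
  simp

lemma dev_constOn (hL : 0 < L) (hn : 0 < n) {i j : ℕ} (hij : i ≤ j) {h : Rn n → ℝ}
    (hh : Integrable h) (hc : ConstOn L i h) (x : Rn n) :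
    Dev L j h x ((ENNReal.ofReal (kc n * 2 ^ n) + ‖kap n‖ₑ) *
      (bdry 1 L i j).indicator (mn L j h) x) := by
  have he : ev L j h x = h x := by rw [ev_of_const hL (hc.mono hij)]
  by_cases hx : x ∈ bdry 1 L i j
  · rw [indicator_of_mem hx, add_mul]
    have h1 := vn_le hL hn j hh x
    refine ⟨(vr_le_vn hL j h x).trans (h1.trans (le_self_add)), enorm_sub_le.trans ?_⟩
    refine add_le_add ((enorm_av_le_vn hL hn j hh x).trans h1) ?_
    rw [enorm_mul]
    gcongr
    refine (enorm_ev_le hL j h x).trans ?_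
    rw [mn]
    gcongr
    exact cell_subset_nb 1 j x
  · rw [indicator_of_notMem hx, mul_zero]
    have hsub : nb 1 L j x ⊆ cell L i x := not_not.1 hx
    have hav : ∀ r, 0 < r → r ≤ side L j → av h x r = kap n * h x := by
      intro r hr hr'
      rw [av_congr hr (h := fun _ => h x) fun y hy => hc x y (hsub (mem_nb_one hL hr' hy))]
      rw [av, integral_mul_const, integral_kr x hr]
    refine ⟨?_, ?_⟩
    · rw [vr_congr 1 (k := fun _ => kap n * h x) fun r hr =>
        hav r ((side_pos hL _).trans_le hr.1) hr.2, vr_const]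
    · rw [hav _ (side_pos hL j) le_rfl, he]; simp

lemma Dev.finset_sum (hL : 0 < L) {j : ℕ} {ι : Type*} (s : Finset ι) {h : ι → Rn n → ℝ}
    {x : Rn n} {B : ι → ℝ≥0∞} (hi : ∀ i ∈ s, Integrable (h i))
    (H : ∀ i ∈ s, Dev L j (h i) x (B i)) :
    Dev L j (fun y => ∑ i ∈ s, h i y) x (∑ i ∈ s, B i) := by
  refine ⟨?_, ?_⟩
  · rw [vr_congr 1 (k := fun r => ∑ i ∈ s, av (h i) x r) fun r hr =>
      av_finset_sum s hi x ((side_pos hL _).trans_le hr.1)]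
    exact (vr_finset_sum_le le_rfl _ s _).trans (Finset.sum_le_sum fun i h' => (H i h').1)
  · have e : ev L j (fun y => ∑ i ∈ s, h i y) x = ∑ i ∈ s, ev L j (h i) x := by
      simp only [ev]
      rw [integral_finsetSum s fun i h' => (hi i h').integrableOn, Finset.mul_sum]
    rw [e, av_finset_sum s hi x (side_pos hL _), Finset.mul_sum, ← Finset.sum_sub_distrib]
    exact (enorm_sum_le _ _).trans (Finset.sum_le_sum fun i h' => (H i h').2)

end

section

variable {n : ℕ} {L : ℝ}

lemma sum_pow_dist_le (q : ℝ≥0∞) (j N : ℕ) :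
    ∑ i ∈ Finset.range N, q ^ ((i - j) + (j - i)) ≤ 2 * (1 - q)⁻¹ := by
  have key : ∀ s : Finset ℕ, InjOn (fun i => (i - j) + (j - i)) s →
      ∑ i ∈ s, q ^ ((i - j) + (j - i)) ≤ (1 - q)⁻¹ := by
    intro s hs
    rw [← ENNReal.tsum_geometric, ← Finset.sum_image (f := fun d => q ^ d) hs]
    exact ENNReal.sum_le_tsum _
  rw [← Finset.sum_filter_add_sum_filter_not _ (fun i => i < j), two_mul]
  refine add_le_add (key _ ?_) (key _ ?_)
  · intro a ha b hb h
    simp only [Finset.coe_filter, Finset.mem_range, mem_ofPred_eq] at ha hb h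
    omega
  · intro a ha b hb h
    simp only [Finset.coe_filter, Finset.mem_range, mem_ofPred_eq] at ha hb h
    omega

lemma sq_sum_mul_le {ι : Type*} (s : Finset ι) (f g : ι → ℝ≥0∞) :
    (∑ i ∈ s, f i * g i) ^ 2 ≤ (∑ i ∈ s, f i ^ 2) * ∑ i ∈ s, g i ^ 2 := by
  have h := ENNReal.inner_le_Lp_mul_Lq s f g (p := 2) (q := 2) Real.HolderConjugate.two_two
  calc (∑ i ∈ s, f i * g i) ^ 2 ≤
      ((∑ i ∈ s, f i ^ (2 : ℝ)) ^ (1 / 2 : ℝ) * (∑ i ∈ s, g i ^ (2 : ℝ)) ^ (1 / 2 : ℝ)) ^ 2 := by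
        gcongr
    _ = _ := by
        rw [mul_pow, ← ENNReal.rpow_natCast, ← ENNReal.rpow_natCast, ← ENNReal.rpow_mul,
          ← ENNReal.rpow_mul]
        norm_num

/-- Constant in the pointwise deviation bounds. -/
def cu (n : ℕ) : ℝ≥0∞ := ENNReal.ofReal (kc n * (n + 1) * 2 ^ (n + 1)) + ‖kap n‖ₑ

lemma cu_ne_top : cu n ≠ ∞ := by simp [cu]

/-- Deviation bound at level `j` for the `i`-th martingale difference. -/
def ud (L : ℝ) (G : Rn n → ℝ) (i j : ℕ) (x : Rn n) : ℝ≥0∞ :=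
  if i ≤ j then cu n * (bdry 1 L i j).indicator (mn L j (mp L G i)) x
  else cu n * (ENNReal.ofReal ((1 / 2) ^ (i - 1 - j)) * mn L j (mp L G i) x)

lemma measurable_ud (G : Rn n → ℝ) (i j : ℕ) : Measurable (ud L G i j) := by
  unfold ud
  split_ifs with h
  · exact ((measurable_mn j _).indicator (measurableSet_bdry (L := L) 1 h)).const_mul _
  · exact ((measurable_mn j _).const_mul _).const_mul _

lemma dev_ud (hL : 0 < L) (hn : 0 < n) {G : Rn n → ℝ} (hG : Integrable G) (i j : ℕ) (x : Rn n) :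
    Dev L j (mp L G i) x (ud L G i j x) := by
  have hk := kc_pos (n := n)
  have hi := integrable_mp hL hG i
  unfold ud
  split_ifs with h
  · have H := dev_constOn hL hn h hi (constOn_mp G i) x
    have : ENNReal.ofReal (kc n * 2 ^ n) + ‖kap n‖ₑ ≤ cu n := by
      unfold cu
      gcongr ?_ + _
      refine ENNReal.ofReal_le_ofReal ?_
      rw [mul_assoc]
      gcongr
      have h1 : (2 : ℝ) ^ n ≤ 2 ^ (n + 1) := pow_le_pow_right₀ (by norm_num) (Nat.le_succ n)
      have h2 : (0 : ℝ) ≤ n * 2 ^ (n + 1) := by positivity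
      linarith
    exact ⟨H.1.trans (mul_le_mul_left this _), H.2.trans (mul_le_mul_left this _)⟩
  · push Not at h
    obtain ⟨m, rfl⟩ : ∃ m, i = j + m + 1 := ⟨i - 1 - j, by omega⟩
    have e : j + m + 1 - 1 - j = m := by omega
    rw [e]
    have H := dev_meanZero hL hn j m hi (meanZero_ev_sub hL (Nat.le_succ _) hG) x
    have : ENNReal.ofReal (kc n * n * 2 ^ (n + 1) * (1 / 2) ^ m) * mn L j (mp L G (j + m + 1)) x ≤
        cu n * (ENNReal.ofReal ((1 / 2) ^ m) * mn L j (mp L G (j + m + 1)) x) := by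
      rw [← mul_assoc, ENNReal.ofReal_mul (by positivity)]
      gcongr
      refine le_add_right (ENNReal.ofReal_le_ofReal ?_)
      gcongr
      linarith
    exact ⟨H.1.trans this, H.2.trans this⟩

lemma lintegral_ud_sq_le (hL : 0 < L) (G : Rn n → ℝ) (i j : ℕ) :
    ∫⁻ x, ud L G i j x ^ 2 ≤
      cu n ^ 2 * 9 ^ n * (4 * n + 4) * (2⁻¹ ^ ((i - j) + (j - i)) * ∫⁻ x, ‖mp L G i x‖ₑ ^ 2) := by
  set I := ∫⁻ x, ‖mp L G i x‖ₑ ^ 2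
  have e2 : ∀ m : ℕ, ENNReal.ofReal ((1 / 2 : ℝ) ^ m) = 2⁻¹ ^ m := fun m => by
    rw [ENNReal.ofReal_pow (by norm_num), one_div, ENNReal.ofReal_inv_of_pos (by norm_num)]; simp
  rcases le_or_gt i j with h | h
  · obtain ⟨m, rfl⟩ := Nat.exists_eq_add_of_le h
    have hm := measurableSet_bdry (n := n) (L := L) 1 h
    simp only [ud, if_pos h]
    calc ∫⁻ x, (cu n * (bdry 1 L i (i + m)).indicator (mn L (i + m) (mp L G i)) x) ^ 2
        = cu n ^ 2 * ∫⁻ x in bdry 1 L i (i + m), mn L (i + m) (mp L G i) x ^ 2 := by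
          rw [← lintegral_indicator hm, ← lintegral_const_mul _
            (((measurable_mn _ _).pow_const 2).indicator hm)]
          refine lintegral_congr fun x => ?_
          rw [mul_pow]
          by_cases hx : x ∈ bdry 1 L i (i + m) <;> simp [hx]
      _ ≤ cu n ^ 2 * (9 ^ n * (ENNReal.ofReal (4 * n * (1 / 2) ^ m) * I)) :=
          mul_le_mul_right (lintegral_bdry_mn_sq_le hL i m (constOn_mp G i)) _
      _ ≤ _ := by
          have e1 : (i - (i + m)) + (i + m - i) = m := by omega
          rw [e1, ENNReal.ofReal_mul (by positivity), e2, ENNReal.ofReal_mul (by norm_num),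
            ENNReal.ofReal_natCast, ENNReal.ofReal_ofNat]
          calc cu n ^ 2 * (9 ^ n * (4 * n * 2⁻¹ ^ m * I))
              = cu n ^ 2 * 9 ^ n * (4 * n) * (2⁻¹ ^ m * I) := by ring
            _ ≤ _ := mul_le_mul_left (mul_le_mul_right le_self_add _) _
  · obtain ⟨m, rfl⟩ : ∃ m, i = j + m + 1 := ⟨i - 1 - j, by omega⟩
    have e : j + m + 1 - 1 - j = m := by omega
    have e1 : (j + m + 1 - j) + (j - (j + m + 1)) = m + 1 := by omega
    have hh : Measurable (mp L G (j + m + 1)) :=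
      measurable_of_const (L := L) _ (constOn_mp G (j + m + 1))
    simp only [ud, if_neg h.not_ge, e, e1, e2]
    calc ∫⁻ x, (cu n * (2⁻¹ ^ m * mn L j (mp L G (j + m + 1)) x)) ^ 2
        = (cu n * 2⁻¹ ^ m) ^ 2 * ∫⁻ x, mn L j (mp L G (j + m + 1)) x ^ 2 := by
          rw [← lintegral_const_mul _ ((measurable_mn _ _).pow_const 2)]
          refine lintegral_congr fun x => ?_
          ring
      _ ≤ (cu n * 2⁻¹ ^ m) ^ 2 * (9 ^ n * I) := by
          gcongr
          simpa using lintegral_mn_sq_le hL j MeasurableSet.univ MeasurableSet.univ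
            (fun _ _ => subset_univ _) hh
      _ = cu n ^ 2 * 9 ^ n * ((2⁻¹ ^ m * 2⁻¹ ^ m) * I) := by ring
      _ ≤ cu n ^ 2 * 9 ^ n * ((4 * (2⁻¹ ^ (m + 1))) * I) := by
          refine mul_le_mul_right (mul_le_mul_left ?_ _) _
          calc (2⁻¹ : ℝ≥0∞) ^ m * 2⁻¹ ^ m ≤ 2⁻¹ ^ m * 1 := by
                gcongr
                exact pow_le_one₀ (zero_le) (by simp)
            _ ≤ 4 * 2⁻¹ ^ (m + 1) := by
                rw [pow_succ, mul_comm (2⁻¹ ^ m) 2⁻¹, ← mul_assoc, mul_comm]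
                gcongr
                rw [show (4 : ℝ≥0∞) = 2 * 2 by norm_num, mul_assoc,
                  ENNReal.mul_inv_cancel (by simp) (by simp)]
                norm_num
      _ ≤ _ := by
          simp only [← mul_assoc]
          gcongr
          exact le_add_self

/-- Total deviation bound at level `j`. -/
def od (L : ℝ) (G : Rn n → ℝ) (N j : ℕ) (x : Rn n) : ℝ≥0∞ :=
  ∑ i ∈ Finset.range (N + 1), ud L G i j x

lemma measurable_od (G : Rn n → ℝ) (N j : ℕ) : Measurable (od L G N j) :=
  Finset.measurable_sum _ fun i _ => measurable_ud G i j

lemma dev_od (hL : 0 < L) (hn : 0 < n) {G : Rn n → ℝ} (hG : Integrable G) {N : ℕ}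
    (hc : ConstOn L N G) (j : ℕ) (x : Rn n) : Dev L j G x (od L G N j x) := by
  have := Dev.finset_sum (j := j) (x := x) hL (Finset.range (N + 1)) (h := fun i => mp L G i)
    (fun i _ => integrable_mp hL hG i) fun i _ => dev_ud hL hn hG i j x
  simp only [sum_mp] at this
  rwa [show (fun y => ev L N G y) = G from ev_of_const hL hc] at this

/-- Constant in the square function bound. -/
def cq (n : ℕ) : ℝ≥0∞ := 5 * (cu n ^ 2 * 9 ^ n * (4 * n + 4)) * 18

lemma cq_ne_top : cq n ≠ ∞ := by
  refine ENNReal.mul_ne_top (ENNReal.mul_ne_top (by simp) (ENNReal.mul_ne_top (ENNReal.mul_ne_top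
    (ENNReal.pow_ne_top cu_ne_top) (by simp)) ?_)) (by simp)
  exact ENNReal.add_ne_top.2 ⟨ENNReal.mul_ne_top (by simp) (by simp), by simp⟩

lemma od_sq_le (G : Rn n → ℝ) (N j : ℕ) (x : Rn n) :
    od L G N j x ^ 2 ≤
      5 * ∑ i ∈ Finset.range (N + 1), (16 / 9) ^ ((i - j) + (j - i)) * ud L G i j x ^ 2 := by
  have h916 : (9 / 16 : ℝ≥0∞) = (3 / 4) ^ 2 := by
    rw [ENNReal.div_eq_inv_mul, ENNReal.div_eq_inv_mul, mul_pow, ← ENNReal.inv_pow]; norm_num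
  have hinv : ∀ d : ℕ, (3 / 4 : ℝ≥0∞) ^ d * (4 / 3) ^ d = 1 := fun d => by
    rw [← mul_pow, ENNReal.div_eq_inv_mul, ENNReal.div_eq_inv_mul]
    rw [show (4 : ℝ≥0∞)⁻¹ * 3 * (3⁻¹ * 4) = (4⁻¹ * 4) * (3 * 3⁻¹) by ring,
      ENNReal.inv_mul_cancel (by simp) (by simp), ENNReal.mul_inv_cancel (by simp) (by simp)]
    simp
  have h169 : (16 / 9 : ℝ≥0∞) = (4 / 3) ^ 2 := by
    rw [ENNReal.div_eq_inv_mul, ENNReal.div_eq_inv_mul, mul_pow, ← ENNReal.inv_pow]; norm_num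
  calc od L G N j x ^ 2 = (∑ i ∈ Finset.range (N + 1), (3 / 4) ^ ((i - j) + (j - i)) *
        ((4 / 3) ^ ((i - j) + (j - i)) * ud L G i j x)) ^ 2 := by
        simp only [od, ← mul_assoc, hinv, one_mul]
    _ ≤ _ := sq_sum_mul_le _ _ _
    _ ≤ _ := by
        refine mul_le_mul' ?_ (le_of_eq ?_)
        · simp_rw [← pow_mul, mul_comm _ 2, pow_mul, ← h916]
          refine (sum_pow_dist_le (9 / 16) j (N + 1)).trans ?_
          have : (1 - 9 / 16 : ℝ≥0∞) = 7 / 16 := by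
            refine ENNReal.sub_eq_of_eq_add (by finiteness) ?_
            rw [← ENNReal.add_div, show (7 + 9 : ℝ≥0∞) = 16 by norm_num, ENNReal.div_self] <;> simp
          rw [this, ENNReal.inv_div (by simp) (by simp), ← mul_div_assoc]
          refine ENNReal.div_le_of_le_mul ?_
          norm_num
        · refine Finset.sum_congr rfl fun i _ => ?_
          rw [mul_pow, ← pow_mul, mul_comm _ 2, pow_mul, h169]

lemma sum_lintegral_od_sq_le (hL : 0 < L) {G : Rn n → ℝ} {b : ℝ} (hG : Integrable G)
    (hb : ∀ x, |G x| ≤ b) (N : ℕ) :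
    ∑ j ∈ Finset.range (N + 1), ∫⁻ x, od L G N j x ^ 2 ≤ cq n * ∫⁻ x, ‖ev L N G x‖ₑ ^ 2 := by
  set c := cu n ^ 2 * 9 ^ n * (4 * n + 4) with hc
  have h89 : (16 / 9 : ℝ≥0∞) * 2⁻¹ = 8 / 9 := by
    rw [show (16 / 9 : ℝ≥0∞) = 8 / 9 * 2 by rw [← ENNReal.mul_div_right_comm]; norm_num, mul_assoc,
      ENNReal.mul_inv_cancel (by simp) (by simp), mul_one]
  calc ∑ j ∈ Finset.range (N + 1), ∫⁻ x, od L G N j x ^ 2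
      ≤ ∑ j ∈ Finset.range (N + 1), ∑ i ∈ Finset.range (N + 1),
          5 * (c * ((8 / 9) ^ ((i - j) + (j - i)) * ∫⁻ x, ‖mp L G i x‖ₑ ^ 2)) := by
        refine Finset.sum_le_sum fun j _ => ?_
        refine (lintegral_mono fun x => od_sq_le G N j x).trans ?_
        rw [lintegral_const_mul _ (Finset.measurable_sum _ fun i _ =>
          ((measurable_ud G i j).pow_const 2).const_mul _), lintegral_finsetSum _ fun i _ =>
          ((measurable_ud G i j).pow_const 2).const_mul _, Finset.mul_sum]
        refine Finset.sum_le_sum fun i _ => ?_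
        rw [lintegral_const_mul _ ((measurable_ud G i j).pow_const 2)]
        refine mul_le_mul_right ((mul_le_mul_right (lintegral_ud_sq_le hL G i j) _).trans
          (le_of_eq ?_)) _
        rw [← h89, mul_pow]
        ring
    _ = ∑ i ∈ Finset.range (N + 1), (5 * c * ∫⁻ x, ‖mp L G i x‖ₑ ^ 2) *
          ∑ j ∈ Finset.range (N + 1), (8 / 9) ^ ((j - i) + (i - j)) := by
        rw [Finset.sum_comm]
        refine Finset.sum_congr rfl fun i _ => ?_
        rw [Finset.mul_sum]
        refine Finset.sum_congr rfl fun j _ => ?_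
        rw [add_comm (j - i)]
        ring
    _ ≤ ∑ i ∈ Finset.range (N + 1), (5 * c * ∫⁻ x, ‖mp L G i x‖ₑ ^ 2) * 18 := by
        gcongr with i _
        refine (sum_pow_dist_le (8 / 9) i (N + 1)).trans ?_
        have : (1 - 8 / 9 : ℝ≥0∞) = 1 / 9 := by
          refine ENNReal.sub_eq_of_eq_add (by finiteness) ?_
          rw [← ENNReal.add_div, show (1 + 8 : ℝ≥0∞) = 9 by norm_num, ENNReal.div_self] <;> simp
        rw [this, ENNReal.inv_div (by simp) (by simp)]
        norm_num
    _ = _ := by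
        rw [← lintegral_mp_sq hL hG hb, Finset.mul_sum]
        refine Finset.sum_congr rfl fun i _ => ?_
        rw [cq, ← hc]; ring

end

section

variable {n : ℕ} {L : ℝ}

/-- The level of a scale `r`. -/
def lev (L r : ℝ) : ℕ := sInf {j | side L (j + 1) ≤ r}

lemma lev_le {N : ℕ} {r : ℝ} (h : side L (N + 1) ≤ r) : lev L r ≤ N := Nat.sInf_le h

lemma side_lev_le {N : ℕ} {r : ℝ} (h : side L (N + 1) ≤ r) : side L (lev L r + 1) ≤ r :=
  Nat.sInf_mem (s := {j | side L (j + 1) ≤ r}) ⟨N, h⟩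

lemma le_side_lev {r : ℝ} (h : r ≤ side L 0) : r ≤ side L (lev L r) := by
  rcases Nat.eq_zero_or_pos (lev L r) with h0 | h0
  · rwa [h0]
  · have := Nat.notMem_of_lt_sInf (s := {j | side L (j + 1) ≤ r}) (m := lev L r - 1)
      (Nat.sub_one_lt_of_lt h0)
    rw [mem_ofPred_eq, Nat.sub_add_cancel h0] at this
    exact (not_le.1 this).le

lemma lev_anti {N : ℕ} {r r' : ℝ} (h : side L (N + 1) ≤ r') (hr : r' ≤ r) : lev L r ≤ lev L r' :=
  Nat.sInf_le ((side_lev_le h).trans hr)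

lemma sum_same_level_le {ϱ : ℝ} (hϱ : 1 ≤ ϱ) {a b : ℝ} (hab : a ≤ b) (h : ℝ → ℝ) (M : ℕ)
    {r : ℕ → ℝ} (hr : Antitone r) (s : Finset ℕ) (hs : s ⊆ Finset.range M)
    (hm : ∀ i ∈ s, r i ∈ Icc a b ∧ r (i + 1) ∈ Icc a b) :
    ∑ i ∈ s, ‖h (r i) - h (r (i + 1))‖ₑ ^ ϱ ≤ vr 1 (Icc a b) h ^ ϱ := by
  have e : ∀ i ∈ s, max a (min b (r i)) = r i ∧ max a (min b (r (i + 1))) = r (i + 1) := by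
    intro i hi
    obtain ⟨h1, h2⟩ := hm i hi
    exact ⟨by rw [min_eq_right h1.2, max_eq_right h1.1], by rw [min_eq_right h2.2, max_eq_right h2.1]⟩
  have h1 := le_vr 1 (S := Icc a b) h M (r := fun i => max a (min b (r i)))
    (fun i j hij => max_le_max le_rfl (min_le_min le_rfl (hr hij)))
    (fun i => ⟨le_max_left _ _, max_le hab (min_le_left _ _)⟩)
  simp only [ENNReal.rpow_one, div_one] at h1
  refine (sum_rpow_le_rpow_sum hϱ s _).trans (ENNReal.rpow_le_rpow ?_ (by linarith))
  refine le_trans ?_ h1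
  refine le_trans (le_of_eq ?_) (Finset.sum_le_sum_of_subset hs)
  exact Finset.sum_congr rfl fun i hi => by rw [(e i hi).1, (e i hi).2]

lemma add3_rpow_le {ϱ : ℝ} (hϱ : 0 ≤ ϱ) (a b c : ℝ≥0∞) :
    (a + b + c) ^ ϱ ≤ 3 ^ ϱ * (a ^ ϱ + b ^ ϱ + c ^ ϱ) := by
  have h : a + b + c ≤ 3 * max (max a b) c := by
    have h1 : a ≤ max (max a b) c := (le_max_left _ _).trans (le_max_left _ _)
    have h2 : b ≤ max (max a b) c := (le_max_right _ _).trans (le_max_left _ _)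
    have h3 : c ≤ max (max a b) c := le_max_right _ _
    calc a + b + c ≤ max (max a b) c + max (max a b) c + max (max a b) c := by gcongr
      _ = _ := by ring
  refine (ENNReal.rpow_le_rpow h hϱ).trans ?_
  rw [ENNReal.mul_rpow_of_nonneg _ _ hϱ]
  gcongr
  have hm := ENNReal.monotone_rpow_of_nonneg hϱ
  rw [hm.map_max, hm.map_max]
  refine max_le (max_le ?_ ?_) ?_
  · exact le_self_add.trans le_self_add
  · exact le_add_self.trans le_self_add
  · exact le_add_self

/-- Variation of a function of the scale in terms of block variations and of the variation of a
sequence approximating the values at the dyadic scales. -/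
lemma vr_assemble (hL : 0 < L) {ϱ : ℝ} (hϱ : 1 ≤ ϱ) {N : ℕ} {h : ℝ → ℝ} {E : ℕ → ℝ}
    {O : ℕ → ℝ≥0∞} {D : ℝ≥0∞}
    (hO : ∀ j, vr 1 (Icc (side L (j + 1)) (side L j)) h ≤ O j)
    (hE : ∀ j, ‖h (side L j) - E j‖ₑ ≤ O j)
    (hD : ∀ (M : ℕ) (j : ℕ → ℕ), Monotone j → (∀ i, j i ≤ N) →
      ∑ i ∈ Finset.range M, ‖E (j i) - E (j (i + 1))‖ₑ ^ ϱ ≤ D) :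
    vr ϱ (Icc (side L (N + 1)) (side L 0)) h ^ ϱ ≤
      (1 + 2 * 6 ^ ϱ) * ∑ j ∈ Finset.range (N + 1), O j ^ ϱ + 3 ^ ϱ * D := by
  have hϱ0 : 0 < ϱ := by linarith
  set B := (1 + 2 * 6 ^ ϱ) * ∑ j ∈ Finset.range (N + 1), O j ^ ϱ + 3 ^ ϱ * D with hB
  suffices vr ϱ (Icc (side L (N + 1)) (side L 0)) h ≤ B ^ (1 / ϱ) by
    refine (ENNReal.rpow_le_rpow this hϱ0.le).trans (le_of_eq ?_)
    rw [← ENNReal.rpow_mul, one_div_mul_cancel hϱ0.ne', ENNReal.rpow_one]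
  refine vr_le_of_sum hϱ0 fun M r hr hrI => ?_
  rw [← ENNReal.rpow_mul, one_div_mul_cancel hϱ0.ne', ENNReal.rpow_one]
  set J : ℕ → ℕ := fun i => lev L (r i) with hJ
  have hJm : Monotone J := fun i k hik => lev_anti (hrI k).1 (hr hik)
  have hJN : ∀ i, J i ≤ N := fun i => lev_le (hrI i).1
  have hmem : ∀ i, r i ∈ Icc (side L (J i + 1)) (side L (J i)) := fun i =>
    ⟨side_lev_le (hrI i).1, le_side_lev (hrI i).2⟩
  have hdev : ∀ i, ‖h (r i) - E (J i)‖ₑ ≤ 2 * O (J i) := by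
    intro i
    calc ‖h (r i) - E (J i)‖ₑ = ‖(h (side L (J i)) - E (J i)) - (h (side L (J i)) - h (r i))‖ₑ := by
          congr 1; ring
      _ ≤ ‖h (side L (J i)) - E (J i)‖ₑ + ‖h (side L (J i)) - h (r i)‖ₑ := enorm_sub_le
      _ ≤ O (J i) + O (J i) := add_le_add (hE _) ((enorm_sub_le_vr_one h (hmem i)
          ⟨side_succ_le hL _, le_rfl⟩ (hmem i).2).trans (hO _))
      _ = _ := by ring
  rw [← Finset.sum_filter_add_sum_filter_not (Finset.range M) (fun i => J i = J (i + 1))]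
  have hsame : ∑ i ∈ (Finset.range M).filter (fun i => J i = J (i + 1)),
      ‖h (r i) - h (r (i + 1))‖ₑ ^ ϱ ≤ ∑ j ∈ Finset.range (N + 1), O j ^ ϱ := by
    rw [← Finset.sum_fiberwise_of_maps_to (t := Finset.range (N + 1)) (g := J)
      fun i _ => Finset.mem_range.2 (Nat.lt_succ_of_le (hJN i))]
    refine Finset.sum_le_sum fun j _ => ?_
    refine (sum_same_level_le hϱ (side_succ_le hL j) h M hr _
      ((Finset.filter_subset _ _).trans (Finset.filter_subset _ _)) fun i hi => ?_).trans
      (ENNReal.rpow_le_rpow (hO j) hϱ0.le)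
    simp only [Finset.mem_filter] at hi
    have h1 := hmem i
    have h2 := hmem (i + 1)
    rw [← hi.1.2, hi.2] at h2
    rw [hi.2] at h1
    exact ⟨h1, h2⟩
  set s := (Finset.range M).filter (fun i => ¬ J i = J (i + 1)) with hs
  have hlt : ∀ i ∈ s, J i < J (i + 1) := fun i hi =>
    lt_of_le_of_ne (hJm (Nat.le_succ i)) (Finset.mem_filter.1 hi).2
  have hinj1 : InjOn J s := by
    intro a ha b hb hab
    by_contra hne
    rcases lt_or_gt_of_ne hne with h1 | h1
    · exact absurd ((hlt a ha).trans_le (hJm h1)) (by omega)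
    · exact absurd ((hlt b hb).trans_le (hJm h1)) (by omega)
  have hinj2 : InjOn (fun i => J (i + 1)) s := by
    intro a ha b hb hab
    simp only at hab
    by_contra hne
    rcases lt_or_gt_of_ne hne with h1 | h1
    · exact absurd ((hJm (show a + 1 ≤ b from h1)).trans_lt (hlt b hb)) (by omega)
    · exact absurd ((hJm (show b + 1 ≤ a from h1)).trans_lt (hlt a ha)) (by omega)
  have hsum : ∀ φ : ℕ → ℕ, InjOn φ s → (∀ i, φ i ≤ N) →
      ∑ i ∈ s, O (φ i) ^ ϱ ≤ ∑ j ∈ Finset.range (N + 1), O j ^ ϱ := by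
    intro φ hφ hN
    rw [← Finset.sum_image (f := fun j => O j ^ ϱ) hφ]
    refine Finset.sum_le_sum_of_subset fun j hj => ?_
    obtain ⟨i, _, rfl⟩ := Finset.mem_image.1 hj
    exact Finset.mem_range.2 (Nat.lt_succ_of_le (hN i))
  have hcross : ∑ i ∈ s, ‖h (r i) - h (r (i + 1))‖ₑ ^ ϱ ≤
      2 * 6 ^ ϱ * ∑ j ∈ Finset.range (N + 1), O j ^ ϱ + 3 ^ ϱ * D := by
    calc ∑ i ∈ s, ‖h (r i) - h (r (i + 1))‖ₑ ^ ϱ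
        ≤ ∑ i ∈ s, 3 ^ ϱ * ((2 * O (J i)) ^ ϱ + (2 * O (J (i + 1))) ^ ϱ +
            ‖E (J i) - E (J (i + 1))‖ₑ ^ ϱ) := by
          refine Finset.sum_le_sum fun i _ => ?_
          refine le_trans (ENNReal.rpow_le_rpow ?_ hϱ0.le) (add3_rpow_le hϱ0.le _ _ _)
          calc ‖h (r i) - h (r (i + 1))‖ₑ
              = ‖((h (r i) - E (J i)) - (h (r (i + 1)) - E (J (i + 1)))) +
                (E (J i) - E (J (i + 1)))‖ₑ := by congr 1; ring
            _ ≤ _ := (enorm_add_le _ _).trans (add_le_add (enorm_sub_le.trans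
                (add_le_add (hdev i) (hdev (i + 1)))) le_rfl)
      _ = 6 ^ ϱ * (∑ i ∈ s, O (J i) ^ ϱ) + 6 ^ ϱ * (∑ i ∈ s, O (J (i + 1)) ^ ϱ) +
            3 ^ ϱ * ∑ i ∈ s, ‖E (J i) - E (J (i + 1))‖ₑ ^ ϱ := by
          have e6 : (6 : ℝ≥0∞) ^ ϱ = 3 ^ ϱ * 2 ^ ϱ := by
            rw [← ENNReal.mul_rpow_of_nonneg _ _ hϱ0.le]; norm_num
          rw [e6]
          simp only [Finset.mul_sum, ← Finset.sum_add_distrib]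
          refine Finset.sum_congr rfl fun i _ => ?_
          rw [ENNReal.mul_rpow_of_nonneg _ _ hϱ0.le, ENNReal.mul_rpow_of_nonneg _ _ hϱ0.le]
          ring
      _ ≤ 6 ^ ϱ * (∑ j ∈ Finset.range (N + 1), O j ^ ϱ) +
            6 ^ ϱ * (∑ j ∈ Finset.range (N + 1), O j ^ ϱ) + 3 ^ ϱ * D := by
          gcongr
          · exact hsum J hinj1 hJN
          · exact hsum _ hinj2 fun i => hJN (i + 1)
          · exact (Finset.sum_le_sum_of_subset (Finset.filter_subset _ _)).trans (hD M J hJm hJN)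
      _ = _ := by ring
  refine (add_le_add hsame hcross).trans (le_of_eq ?_)
  rw [hB]; ring

end

section

variable {n : ℕ} {L : ℝ}

/-- Greedy anchors: the last value recorded, a new value being recorded when it differs from the
previous one by at least `δ`. -/
def anc (δ : ℝ) (E : ℕ → ℝ) : ℕ → ℝ
  | 0 => E 0
  | j + 1 => if δ ≤ |E (j + 1) - anc δ E j| then E (j + 1) else anc δ E j

/-- Number of recorded jumps. -/
def jn (δ : ℝ) (E : ℕ → ℝ) : ℕ → ℕ
  | 0 => 0
  | j + 1 => if δ ≤ |E (j + 1) - anc δ E j| then jn δ E j + 1 else jn δ E j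

lemma jn_mono (δ : ℝ) (E : ℕ → ℝ) : Monotone (jn δ E) :=
  monotone_nat_of_le_succ fun j => by simp only [jn]; split_ifs <;> omega

lemma abs_sub_anc_lt {δ : ℝ} (hδ : 0 < δ) (E : ℕ → ℝ) (j : ℕ) : |E j - anc δ E j| < δ := by
  cases j with
  | zero => simpa [anc] using hδ
  | succ j =>
    simp only [anc]
    split_ifs with h
    · simpa using hδ
    · exact not_le.1 h

lemma anc_eq_of_jn_eq (δ : ℝ) (E : ℕ → ℝ) {a b : ℕ} (hab : a ≤ b) (h : jn δ E b = jn δ E a) :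
    anc δ E b = anc δ E a := by
  induction b, hab using Nat.le_induction with
  | base => rfl
  | succ k hk ih =>
    have h1 := jn_mono δ E hk
    have h2 := jn_mono δ E (Nat.le_succ k)
    by_cases hc : δ ≤ |E (k + 1) - anc δ E k|
    · simp only [jn, if_pos hc] at h; omega
    · simp only [jn, if_neg hc] at h
      simp only [anc, if_neg hc]
      exact ih h

lemma jn_lt {δ : ℝ} (hδ : 0 < δ) (E : ℕ → ℝ) {a b : ℕ} (hab : a ≤ b)
    (h : 2 * δ ≤ |E a - E b|) : jn δ E a < jn δ E b := by
  refine lt_of_le_of_ne (jn_mono δ E hab) fun he => ?_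
  have h1 := abs_sub_anc_lt hδ E a
  have h2 := abs_sub_anc_lt hδ E b
  rw [anc_eq_of_jn_eq δ E hab he.symm] at h2
  have h3 : |E a - E b| ≤ |E a - anc δ E a| + |E b - anc δ E a| := by
    have := abs_sub (E a - anc δ E a) (E b - anc δ E a)
    simpa using this
  linarith

lemma card_jumps_le {δ : ℝ} (hδ : 0 < δ) (E : ℕ → ℝ) {j : ℕ → ℕ} (hj : Monotone j) (M : ℕ) :
    ((Finset.range M).filter fun i => 2 * δ ≤ |E (j i) - E (j (i + 1))|).card ≤ jn δ E (j M) := by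
  induction M with
  | zero => simp
  | succ M ih =>
    rw [Finset.range_add_one, Finset.filter_insert]
    have hm := jn_mono δ E (hj (Nat.le_succ M))
    split_ifs with h
    · rw [Finset.card_insert_of_notMem (by simp)]
      have := jn_lt hδ E (hj (Nat.le_succ M)) h
      simp only [Nat.succ_eq_add_one] at this
      omega
    · exact ih.trans hm

lemma jn_le_sum {δ : ℝ} (hδ : 0 ≤ δ) (E : ℕ → ℝ) (N : ℕ) :
    δ ^ 2 * jn δ E N + (E N - anc δ E N) ^ 2 ≤
      ∑ j ∈ Finset.range N, ((E (j + 1) - E j) ^ 2 +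
        2 * ((E j - anc δ E j) * (E (j + 1) - E j))) := by
  induction N with
  | zero => simp [jn, anc]
  | succ N ih =>
    rw [Finset.sum_range_succ]
    have e : (E (N + 1) - E N) ^ 2 + 2 * ((E N - anc δ E N) * (E (N + 1) - E N)) =
      (E (N + 1) - anc δ E N) ^ 2 - (E N - anc δ E N) ^ 2 := by ring
    rw [e]
    by_cases hc : δ ≤ |E (N + 1) - anc δ E N|
    · simp only [jn, anc, if_pos hc]
      have : δ ^ 2 ≤ (E (N + 1) - anc δ E N) ^ 2 := by
        rw [← sq_abs (E (N + 1) - anc δ E N)]; gcongr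
      push_cast
      linarith
    · simp only [jn, anc, if_neg hc]
      linarith

/-- Number of `δ`-jumps of the martingale of conditional expectations. -/
def jmp (L δ : ℝ) (G : Rn n → ℝ) (N : ℕ) (x : Rn n) : ℕ := jn δ (fun j => ev L j G x) N

lemma constOn_anc (δ : ℝ) (G : Rn n → ℝ) (j : ℕ) :
    ConstOn L j fun x => anc δ (fun j => ev L j G x) j := by
  induction j with
  | zero => exact ev_constOn 0 G
  | succ j ih =>
    intro x y hy
    have h1 : ev L (j + 1) G y = ev L (j + 1) G x := ev_constOn _ G x y hy
    have h2 := ih x y (cell_succ_subset j x hy)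
    have e : ∀ z, anc δ (fun j => ev L j G z) (j + 1) =
      if δ ≤ |ev L (j + 1) G z - anc δ (fun j => ev L j G z) j| then ev L (j + 1) G z
      else anc δ (fun j => ev L j G z) j := fun z => rfl
    beta_reduce at h2 ⊢
    rw [e x, e y, h1, h2]

lemma constOn_jmp (δ : ℝ) (G : Rn n → ℝ) (j : ℕ) : ConstOn L j (jmp L δ G j) := by
  induction j with
  | zero => intro x y _; simp only [jmp, jn]
  | succ j ih =>
    intro x y hy
    have h1 : ev L (j + 1) G y = ev L (j + 1) G x := ev_constOn _ G x y hy
    have h2 := ih x y (cell_succ_subset j x hy)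
    have h3 := constOn_anc δ G j x y (cell_succ_subset j x hy)
    have e : ∀ z, jmp L δ G (j + 1) z =
      if δ ≤ |ev L (j + 1) G z - anc δ (fun j => ev L j G z) j| then jmp L δ G j z + 1
      else jmp L δ G j z := fun z => rfl
    beta_reduce at h3
    rw [e x, e y, h1, h2, h3]

lemma measurable_jmp (δ : ℝ) (G : Rn n → ℝ) (j : ℕ) : Measurable (jmp L δ G j) :=
  measurable_of_const (L := L) j (constOn_jmp δ G j)

lemma lintegral_jmp_le (hL : 0 < L) {G : Rn n → ℝ} {b : ℝ} (hG : Integrable G)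
    (hb : ∀ x, |G x| ≤ b) {δ : ℝ} (hδ : 0 < δ) (N : ℕ) :
    ENNReal.ofReal (δ ^ 2) * ∫⁻ x, (jmp L δ G N x : ℝ≥0∞) ≤ ∫⁻ x, ‖ev L N G x‖ₑ ^ 2 := by
  have i2 : ∀ k, Integrable fun x => ev L k G x ^ 2 := fun k => by
    simp only [sq]
    exact integrable_mul_of_bdd (integrable_ev hL _ hG) (measurable_ev k G) (abs_ev_le hL k hb)
  have i3 : ∀ i, Integrable fun x => mp L G i x ^ 2 := by
    intro i
    cases i with
    | zero => exact i2 0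
    | succ i =>
      simp only [sq]
      refine integrable_mul_of_bdd (b := b + b) (integrable_mp hL hG (i + 1))
        (measurable_of_const (L := L) _ (constOn_mp G (i + 1))) fun x => ?_
      exact (abs_sub _ _).trans (add_le_add (abs_ev_le hL _ hb x) (abs_ev_le hL _ hb x))
  set A : ℕ → Rn n → ℝ := fun j x => ev L j G x - anc δ (fun j => ev L j G x) j with hA
  have cA : ∀ j, ConstOn L j (A j) := fun j x y hy => by
    have h1 := ev_constOn j G x y hy
    have h2 := constOn_anc δ G j x y hy
    simp only at h2
    simp only [hA, h1, h2]
  have i4 : ∀ j, Integrable fun x => A j x * mp L G (j + 1) x := fun j =>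
    integrable_mul_of_bdd (b := δ) (integrable_mp hL hG (j + 1))
      (measurable_of_const (L := L) j (cA j)) fun x => (abs_sub_anc_lt hδ (fun j => ev L j G x) j).le
  have i5 : ∀ j, ∫ x, A j x * mp L G (j + 1) x = 0 := fun j =>
    (meanZero_ev_sub hL (Nat.le_succ j) hG).integral_mul (cA j) (i4 j)
  have i6 : ∀ j, Integrable fun x => mp L G (j + 1) x ^ 2 + 2 * (A j x * mp L G (j + 1) x) :=
    fun j => (i3 (j + 1)).add ((i4 j).const_mul 2)
  set Ψ : Rn n → ℝ := fun x => ∑ j ∈ Finset.range N,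
    (mp L G (j + 1) x ^ 2 + 2 * (A j x * mp L G (j + 1) x)) with hΨ
  have iΨ : Integrable Ψ := integrable_finsetSum _ fun j _ => i6 j
  have hle : ∀ x, δ ^ 2 * jmp L δ G N x ≤ Ψ x := fun x =>
    (le_add_of_nonneg_right (sq_nonneg _)).trans (jn_le_sum hδ.le (fun j => ev L j G x) N)
  have hΨ0 : ∀ x, 0 ≤ Ψ x := fun x => le_trans (by positivity) (hle x)
  have h_int : ∫ x, Ψ x ≤ ∫ x, ev L N G x ^ 2 := by
    rw [← integral_mp_sq hL hG hb N, Finset.sum_range_succ', hΨ,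
      integral_finsetSum _ fun j _ => i6 j]
    refine le_trans (Finset.sum_le_sum fun j _ => ?_)
      (le_add_of_nonneg_right (integral_nonneg fun x => sq_nonneg _))
    rw [integral_add (i3 (j + 1)) ((i4 j).const_mul 2), integral_const_mul, i5, mul_zero, add_zero]
  rw [← lintegral_const_mul' _ _ ENNReal.ofReal_ne_top, lintegral_enorm_sq_eq (i2 N)]
  calc ∫⁻ x, ENNReal.ofReal (δ ^ 2) * (jmp L δ G N x : ℝ≥0∞)
      ≤ ∫⁻ x, ENNReal.ofReal (Ψ x) := by
        refine lintegral_mono fun x => ?_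
        rw [← ENNReal.ofReal_natCast, ← ENNReal.ofReal_mul (by positivity)]
        exact ENNReal.ofReal_le_ofReal (hle x)
    _ = ENNReal.ofReal (∫ x, Ψ x) :=
        (ofReal_integral_eq_lintegral_ofReal iΨ (Filter.Eventually.of_forall hΨ0)).symm
    _ ≤ _ := ENNReal.ofReal_le_ofReal h_int

/-- Dyadic decomposition of a power. -/
lemma ofReal_rpow_le_tsum {ϱ b a : ℝ} (hϱ : 0 < ϱ) (hb : 0 < b) (ha : a ≤ 2 * b) :
    ENNReal.ofReal a ^ ϱ ≤ ∑' m : ℕ, ENNReal.ofReal (2 * b * (1 / 2) ^ m) ^ ϱ *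
      (if 2 * (b * (1 / 2) ^ (m + 1)) ≤ a then 1 else 0) := by
  rcases le_or_gt a 0 with h0 | h0
  · rw [ENNReal.ofReal_of_nonpos h0, ENNReal.zero_rpow_of_pos hϱ]; exact zero_le
  obtain ⟨m, hm1, hm2⟩ : ∃ m : ℕ, b * (1 / 2) ^ m ≤ a ∧ a ≤ 2 * b * (1 / 2) ^ m := by
    obtain ⟨k, hk1, hk2⟩ := exists_nat_pow_near_of_lt_one (x := a / (2 * b)) (y := 1 / 2)
      (by positivity) ((div_le_one (by positivity)).2 ha) (by norm_num) (by norm_num)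
    refine ⟨k, ?_, ?_⟩
    · rw [lt_div_iff₀ (by positivity), pow_succ] at hk1
      linarith
    · rw [div_le_iff₀ (by positivity)] at hk2
      linarith
  refine le_trans ?_ (ENNReal.le_tsum m)
  have : 2 * (b * (1 / 2) ^ (m + 1)) ≤ a := by rw [pow_succ]; linarith
  rw [if_pos this, mul_one]
  exact ENNReal.rpow_le_rpow (ENNReal.ofReal_le_ofReal hm2) hϱ.le

/-- Pointwise bound for the variation of the martingale of conditional expectations. -/
def mv (L ϱ b : ℝ) (G : Rn n → ℝ) (N : ℕ) (x : Rn n) : ℝ≥0∞ :=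
  ∑' m : ℕ, ENNReal.ofReal (2 * b * (1 / 2) ^ m) ^ ϱ * jmp L (b * (1 / 2) ^ (m + 1)) G N x

lemma measurable_mv (ϱ b : ℝ) (G : Rn n → ℝ) (N : ℕ) : Measurable (mv L ϱ b G N) :=
  Measurable.tsum fun _ => ((measurable_from_nat (f := fun k : ℕ => (k : ℝ≥0∞))).comp
    (measurable_jmp _ G N)).const_mul _

lemma sum_ev_le_mv (hL : 0 < L) {ϱ b : ℝ} (hϱ : 0 < ϱ) (hb0 : 0 < b) {G : Rn n → ℝ}
    (hb : ∀ x, |G x| ≤ b) (N M : ℕ) {j : ℕ → ℕ} (hj : Monotone j) (hN : ∀ i, j i ≤ N) (x : Rn n) :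
    ∑ i ∈ Finset.range M, ‖ev L (j i) G x - ev L (j (i + 1)) G x‖ₑ ^ ϱ ≤ mv L ϱ b G N x := by
  have h2 : ∀ i, |ev L (j i) G x - ev L (j (i + 1)) G x| ≤ 2 * b := fun i =>
    (abs_sub _ _).trans (by linarith [abs_ev_le hL (j i) hb x, abs_ev_le hL (j (i + 1)) hb x])
  calc ∑ i ∈ Finset.range M, ‖ev L (j i) G x - ev L (j (i + 1)) G x‖ₑ ^ ϱ
      ≤ ∑ i ∈ Finset.range M, ∑' m : ℕ, ENNReal.ofReal (2 * b * (1 / 2) ^ m) ^ ϱ *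
        (if 2 * (b * (1 / 2) ^ (m + 1)) ≤ |ev L (j i) G x - ev L (j (i + 1)) G x| then 1 else 0) :=
        Finset.sum_le_sum fun i _ => by
          rw [Real.enorm_eq_ofReal_abs]
          exact ofReal_rpow_le_tsum hϱ hb0 (h2 i)
    _ = ∑' m : ℕ, ∑ i ∈ Finset.range M, ENNReal.ofReal (2 * b * (1 / 2) ^ m) ^ ϱ *
        (if 2 * (b * (1 / 2) ^ (m + 1)) ≤ |ev L (j i) G x - ev L (j (i + 1)) G x| then 1 else 0) :=
        (Summable.tsum_finsetSum fun i _ => ENNReal.summable).symm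
    _ ≤ _ := by
        refine ENNReal.tsum_le_tsum fun m => ?_
        rw [← Finset.mul_sum]
        refine mul_le_mul_right ?_ _
        rw [Finset.sum_boole]
        have hδ : 0 < b * (1 / 2) ^ (m + 1) := by positivity
        exact_mod_cast (card_jumps_le hδ (fun j => ev L j G x) hj M).trans
          (jn_mono _ _ (hN M))

/-- Constant in the martingale variation bound. -/
def cm (ϱ : ℝ) : ℝ≥0∞ := ENNReal.ofReal (4 * 2 ^ ϱ) * (1 - ENNReal.ofReal ((1 / 2) ^ (ϱ - 2)))⁻¹

lemma cm_ne_top {ϱ : ℝ} (hϱ : 2 < ϱ) : cm ϱ ≠ ∞ := by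
  refine ENNReal.mul_ne_top ENNReal.ofReal_ne_top (ENNReal.inv_ne_top.2 ?_)
  rw [← pos_iff_ne_zero, tsub_pos_iff_lt, ENNReal.ofReal_lt_one]
  exact Real.rpow_lt_one (by norm_num) (by norm_num) (by linarith)

lemma lintegral_mv_le (hL : 0 < L) {ϱ b : ℝ} (hϱ : 0 < ϱ) (hb0 : 0 < b) {G : Rn n → ℝ}
    (hG : Integrable G) (hb : ∀ x, |G x| ≤ b) (N : ℕ) :
    ∫⁻ x, mv L ϱ b G N x ≤
      cm ϱ * (ENNReal.ofReal (b ^ (ϱ - 2)) * ∫⁻ x, ‖ev L N G x‖ₑ ^ 2) := by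
  have hm : ∀ m : ℕ, Measurable fun x : Rn n => ((jmp L (b * (1 / 2) ^ (m + 1)) G N x : ℕ) : ℝ≥0∞) :=
    fun m => (measurable_from_nat (f := fun k : ℕ => (k : ℝ≥0∞))).comp (measurable_jmp _ G N)
  set I := ∫⁻ x, ‖ev L N G x‖ₑ ^ 2 with hI
  unfold mv
  rw [lintegral_tsum fun m => ((hm m).const_mul _).aemeasurable, cm, ← ENNReal.tsum_geometric,
    ← ENNReal.tsum_mul_left, ← ENNReal.tsum_mul_right]
  refine ENNReal.tsum_le_tsum fun m => ?_
  rw [lintegral_const_mul _ (hm m)]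
  set δ := b * (1 / 2) ^ (m + 1) with hδ
  have hδ0 : 0 < δ := by positivity
  have e : ENNReal.ofReal (2 * b * (1 / 2) ^ m) ^ ϱ =
      ENNReal.ofReal (4 * 2 ^ ϱ) * ENNReal.ofReal ((1 / 2) ^ (ϱ - 2)) ^ m *
        ENNReal.ofReal (b ^ (ϱ - 2)) * ENNReal.ofReal (δ ^ 2) := by
    rw [ENNReal.ofReal_rpow_of_nonneg (by positivity) hϱ.le, ← ENNReal.ofReal_pow (by positivity),
      ← ENNReal.ofReal_mul (by positivity), ← ENNReal.ofReal_mul (by positivity),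
      ← ENNReal.ofReal_mul (by positivity)]
    congr 1
    rw [Real.mul_rpow (by positivity) (by positivity), Real.mul_rpow (by positivity) (by positivity),
      ← Real.rpow_natCast ((1 / 2) ^ (ϱ - 2)) m, ← Real.rpow_mul (by norm_num), hδ,
      ← Real.rpow_natCast (1 / 2) m, ← Real.rpow_mul (by norm_num)]
    have e1 : b ^ ϱ = b ^ (ϱ - 2) * b ^ 2 := by
      rw [← Real.rpow_natCast b 2, ← Real.rpow_add hb0]; norm_num
    have e2 : (1 / 2 : ℝ) ^ ((m : ℝ) * ϱ) = (1 / 2) ^ ((ϱ - 2) * m) * (((1 / 2 : ℝ) ^ m) ^ 2) := by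
      rw [← pow_mul, ← Real.rpow_natCast (1 / 2) (m * 2), ← Real.rpow_add (by norm_num)]
      congr 1; push_cast; ring
    rw [e1, e2]
    ring
  rw [e, mul_assoc _ (ENNReal.ofReal (δ ^ 2))]
  calc _ ≤ ENNReal.ofReal (4 * 2 ^ ϱ) * ENNReal.ofReal ((1 / 2) ^ (ϱ - 2)) ^ m *
        ENNReal.ofReal (b ^ (ϱ - 2)) * I :=
        mul_le_mul_right (lintegral_jmp_le hL hG hb hδ0 N) _
    _ = _ := by ring

end

section

variable {n : ℕ} {L : ℝ}

lemma mn_le (hL : 0 < L) (j : ℕ) {G : Rn n → ℝ} {b : ℝ} (hb : ∀ x, |G x| ≤ b) (x : Rn n) :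
    mn L j G x ≤ 3 ^ n * ENNReal.ofReal b := by
  have h1 : ∫⁻ y in nb 1 L j x, ‖G y‖ₑ ≤ ENNReal.ofReal b * volume (nb 1 L j x) := by
    rw [← setLIntegral_const]
    refine lintegral_mono fun y => ?_
    rw [Real.enorm_eq_ofReal_abs]
    exact ENNReal.ofReal_le_ofReal (hb y)
  unfold mn
  have hs := side_pos hL j
  calc _ ≤ ENNReal.ofReal (side L j ^ n)⁻¹ * (ENNReal.ofReal b * volume (nb 1 L j x)) := by gcongr
    _ = (ENNReal.ofReal (side L j ^ n)⁻¹ * volume (nb 1 L j x)) * ENNReal.ofReal b := by ring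
    _ = _ := by
      congr 1
      rw [volume_nb hL, ← ENNReal.ofReal_mul (by positivity), mul_pow,
        show (3 : ℝ≥0∞) ^ n = ENNReal.ofReal (3 ^ n) by
          rw [ENNReal.ofReal_pow (by norm_num)]; norm_num]
      congr 1
      push_cast
      field_simp
      norm_num

/-- Constant of the trivial one-level bound for bounded functions. -/
def cb (n : ℕ) : ℝ≥0∞ := ENNReal.ofReal (kc n * 2 ^ n) * 3 ^ n + ‖kap n‖ₑ

lemma cb_ne_top : cb n ≠ ∞ := by simp [cb, ENNReal.mul_eq_top]

lemma dev_bdd (hL : 0 < L) (hn : 0 < n) (j : ℕ) {G : Rn n → ℝ} {b : ℝ} (hG : Integrable G)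
    (hb : ∀ x, |G x| ≤ b) (x : Rn n) : Dev L j G x (cb n * ENNReal.ofReal b) := by
  have h1 : vn L j G x ≤ ENNReal.ofReal (kc n * 2 ^ n) * 3 ^ n * ENNReal.ofReal b := by
    refine (vn_le hL hn j hG x).trans ?_
    rw [mul_assoc]
    exact mul_le_mul_right (mn_le hL j hb x) _
  refine ⟨((vr_le_vn hL j G x).trans h1).trans ?_, ?_⟩
  · unfold cb
    rw [add_mul]
    exact le_self_add
  · refine (enorm_sub_le).trans ?_
    unfold cb
    rw [add_mul]
    refine add_le_add ((enorm_av_le_vn hL hn j hG x).trans h1) ?_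
    rw [enorm_mul]
    refine mul_le_mul_right ?_ _
    rw [Real.enorm_eq_ofReal_abs]
    exact ENNReal.ofReal_le_ofReal (abs_ev_le hL j hb x)

/-- Constant of the strong bound for the variation of the averages of a bounded function. -/
def cl (n : ℕ) (ϱ : ℝ) : ℝ≥0∞ :=
  (1 + 2 * 6 ^ ϱ) * (cb n ^ (ϱ - 2) * cq n) + 3 ^ ϱ * (‖kap n‖ₑ ^ ϱ * cm ϱ)

lemma cl_ne_top {ϱ : ℝ} (hϱ : 2 < ϱ) : cl n ϱ ≠ ∞ := by
  have h0 : 0 ≤ ϱ := by linarith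
  have h1 : (6 : ℝ≥0∞) ^ ϱ ≠ ∞ := ENNReal.rpow_ne_top_of_nonneg h0 (by norm_num)
  have h2 : (3 : ℝ≥0∞) ^ ϱ ≠ ∞ := ENNReal.rpow_ne_top_of_nonneg h0 (by norm_num)
  have h3 : cb n ^ (ϱ - 2) ≠ ∞ := ENNReal.rpow_ne_top_of_nonneg (by linarith) cb_ne_top
  have h4 : ‖kap n‖ₑ ^ ϱ ≠ ∞ := ENNReal.rpow_ne_top_of_nonneg h0 (by simp)
  unfold cl
  exact ENNReal.add_ne_top.2 ⟨ENNReal.mul_ne_top (ENNReal.add_ne_top.2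
    ⟨by simp, ENNReal.mul_ne_top (by norm_num) h1⟩) (ENNReal.mul_ne_top h3 cq_ne_top),
    ENNReal.mul_ne_top h2 (ENNReal.mul_ne_top h4 (cm_ne_top hϱ))⟩

lemma exists_vr_rpow_le (hL : 0 < L) (hn : 0 < n) {ϱ : ℝ} (hϱ : 2 < ϱ) {G : Rn n → ℝ} {b : ℝ}
    (hG : Integrable G) (hb0 : 0 < b) (hb : ∀ x, |G x| ≤ b) {N : ℕ} (hc : ConstOn L N G) :
    ∃ W : Rn n → ℝ≥0∞, Measurable W ∧
      (∀ x, vr ϱ (Icc (side L (N + 1)) (side L 0)) (av G x) ^ ϱ ≤ W x) ∧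
      ∫⁻ x, W x ≤ cl n ϱ * (ENNReal.ofReal b ^ (ϱ - 1) * ∫⁻ x, ‖G x‖ₑ) := by
  set O : ℕ → Rn n → ℝ≥0∞ := fun j x => min (od L G N j x) (cb n * ENNReal.ofReal b) with hO
  have mO : ∀ j, Measurable (O j) := fun j => (measurable_od G N j).min measurable_const
  have dO : ∀ j x, Dev L j G x (O j x) := fun j x => by
    have h1 := dev_od hL hn hG hc j x
    have h2 := dev_bdd hL hn j hG hb x
    exact ⟨le_min h1.1 h2.1, le_min h1.2 h2.2⟩
  have hϱ2 : 0 ≤ ϱ - 2 := by linarith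
  have hOle : ∀ j x, O j x ^ ϱ ≤ (cb n * ENNReal.ofReal b) ^ (ϱ - 2) * od L G N j x ^ 2 := by
    intro j x
    have e : ϱ = (ϱ - 2) + (2 : ℕ) := by push_cast; ring
    rw [e, ENNReal.rpow_add_of_nonneg _ _ hϱ2 (by simp), ENNReal.rpow_natCast, ← e]
    exact mul_le_mul' (ENNReal.rpow_le_rpow (min_le_right _ _) hϱ2)
      (pow_le_pow_left' (min_le_left _ _) 2)
  set W : Rn n → ℝ≥0∞ := fun x => (1 + 2 * 6 ^ ϱ) * ∑ j ∈ Finset.range (N + 1), O j x ^ ϱ +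
    3 ^ ϱ * (‖kap n‖ₑ ^ ϱ * mv L ϱ b G N x) with hW
  have mS : Measurable fun x => ∑ j ∈ Finset.range (N + 1), O j x ^ ϱ :=
    Finset.measurable_fun_sum _ fun j _ => (mO j).pow_const ϱ
  have mM := measurable_mv (L := L) ϱ b G N
  refine ⟨W, (mS.const_mul _).add ((mM.const_mul _).const_mul _), fun x => ?_, ?_⟩
  · refine vr_assemble (E := fun j => kap n * ev L j G x) hL (by linarith) (fun j => (dO j x).1)
      (fun j => (dO j x).2) fun M j hj hN => ?_
    refine le_trans (le_of_eq ?_)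
      (mul_le_mul_right (sum_ev_le_mv hL (by linarith) hb0 hb N M hj hN x) _)
    rw [Finset.mul_sum]
    refine Finset.sum_congr rfl fun i _ => ?_
    rw [← mul_sub, enorm_mul, ENNReal.mul_rpow_of_nonneg _ _ (by linarith)]
  · have hS : ∫⁻ x, ∑ j ∈ Finset.range (N + 1), O j x ^ ϱ ≤
        (cb n * ENNReal.ofReal b) ^ (ϱ - 2) * (cq n * ∫⁻ x, ‖ev L N G x‖ₑ ^ 2) := by
      rw [lintegral_finsetSum _ fun j _ => (mO j).pow_const ϱ]
      refine le_trans ?_ (mul_le_mul_right (sum_lintegral_od_sq_le hL hG hb N) _)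
      rw [Finset.mul_sum]
      refine Finset.sum_le_sum fun j _ => ?_
      rw [← lintegral_const_mul _ ((measurable_od G N j).pow_const 2)]
      exact lintegral_mono fun x => hOle j x
    have hM := lintegral_mv_le hL (show 0 < ϱ by linarith) hb0 hG hb N
    have hsq := lintegral_ev_sq_le hL hb N
    have eb : ENNReal.ofReal (b ^ (ϱ - 2)) = ENNReal.ofReal b ^ (ϱ - 2) :=
      (ENNReal.ofReal_rpow_of_pos hb0).symm
    have eb1 : ENNReal.ofReal b ^ (ϱ - 1) = ENNReal.ofReal b ^ (ϱ - 2) * ENNReal.ofReal b := by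
      rw [show ϱ - 1 = (ϱ - 2) + (1 : ℕ) by push_cast; ring,
        ENNReal.rpow_add_of_nonneg _ _ hϱ2 (by simp), ENNReal.rpow_natCast, pow_one]
    rw [hW, lintegral_add_left (mS.const_mul _), lintegral_const_mul _ mS,
      lintegral_const_mul _ (mM.const_mul _), lintegral_const_mul _ mM]
    rw [eb] at hM
    rw [ENNReal.mul_rpow_of_nonneg _ _ hϱ2] at hS
    refine (add_le_add (mul_le_mul_right (hS.trans (mul_le_mul_right
      (mul_le_mul_right hsq _) _)) _) (mul_le_mul_right (mul_le_mul_right (hM.trans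
      (mul_le_mul_right (mul_le_mul_right hsq _) _)) _) _)).trans (le_of_eq ?_)
    unfold cl
    rw [eb1]
    ring

end

section

variable {n : ℕ} {L : ℝ}

/-- Constant in the integral of the kernel `max(s, |x - y|) ^ (-(n + 1))`. -/
def ck (n : ℕ) : ℝ≥0∞ :=
  ENNReal.ofReal (2 ^ (n + 1)) * ∫⁻ z : Rn n, ENNReal.ofReal ((1 + ‖z‖) ^ (-((n : ℝ) + 1)))

lemma ck_ne_top : ck n ≠ ∞ := by
  refine ENNReal.mul_ne_top ENNReal.ofReal_ne_top ?_
  exact (finite_integral_one_add_norm (by simp)).ne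

lemma lintegral_max_le (x : Rn n) {s : ℝ} (hs : 0 < s) :
    ∫⁻ y, ENNReal.ofReal ((max s ‖x - y‖ ^ (n + 1))⁻¹) ≤ ck n * ENNReal.ofReal s⁻¹ := by
  have h1 : ∫⁻ y, ENNReal.ofReal ((max s ‖x - y‖ ^ (n + 1))⁻¹) =
      ∫⁻ z : Rn n, ENNReal.ofReal ((max s ‖z‖ ^ (n + 1))⁻¹) :=
    lintegral_sub_left_eq_self (fun z : Rn n => ENNReal.ofReal ((max s ‖z‖ ^ (n + 1))⁻¹)) x
  have hm : Measurable fun z : Rn n => ENNReal.ofReal ((max s ‖z‖ ^ (n + 1))⁻¹) := by fun_prop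
  have h2 : ∫⁻ z : Rn n, ENNReal.ofReal ((max s ‖z‖ ^ (n + 1))⁻¹) = ENNReal.ofReal (s ^ n) *
      ∫⁻ z : Rn n, ENNReal.ofReal ((max s ‖s • z‖ ^ (n + 1))⁻¹) := by
    rw [← lintegral_map (f := fun z : Rn n => ENNReal.ofReal ((max s ‖z‖ ^ (n + 1))⁻¹))
      hm (measurable_const_smul s), Measure.map_addHaar_smul _ hs.ne',
      lintegral_smul_measure, smul_eq_mul, ← mul_assoc,
      ← ENNReal.ofReal_mul (by positivity)]
    simp only [finrank_euclideanSpace, Fintype.card_fin]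
    rw [abs_of_pos (by positivity), mul_inv_cancel₀ (by positivity), ENNReal.ofReal_one, one_mul]
  have h3 : ∀ z : Rn n, ENNReal.ofReal ((max s ‖s • z‖ ^ (n + 1))⁻¹) ≤
      ENNReal.ofReal (2 ^ (n + 1) * (s ^ (n + 1))⁻¹) *
        ENNReal.ofReal ((1 + ‖z‖) ^ (-((n : ℝ) + 1))) := by
    intro z
    rw [← ENNReal.ofReal_mul (by positivity)]
    refine ENNReal.ofReal_le_ofReal ?_
    rw [Real.rpow_neg (by positivity), show (n : ℝ) + 1 = ((n + 1 : ℕ) : ℝ) by push_cast; ring,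
      Real.rpow_natCast, norm_smul, Real.norm_of_nonneg hs.le, mul_assoc, ← mul_inv, ← mul_pow,
      ← div_eq_mul_inv, ← div_pow, ← inv_pow]
    have hp : 0 < s * (1 + ‖z‖) := by positivity
    have hp' : 0 < max s (s * ‖z‖) := lt_max_of_lt_left hs
    refine pow_le_pow_left₀ (by positivity) ?_ _
    rw [inv_le_comm₀ hp' (by positivity), inv_div, div_le_iff₀ (by norm_num)]
    have := le_max_left s (s * ‖z‖)
    have := le_max_right s (s * ‖z‖)
    linarith
  rw [h1, h2]
  refine (mul_le_mul_right (lintegral_mono h3) _).trans (le_of_eq ?_)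
  rw [lintegral_const_mul' _ _ ENNReal.ofReal_ne_top, ck, ← mul_assoc,
    ← ENNReal.ofReal_mul (by positivity), mul_right_comm, ← ENNReal.ofReal_mul (by positivity)]
  congr 2
  rw [pow_succ s]
  field_simp

/-- Average of `|g|` over the level-`j` cell of `x`. -/
def am (L : ℝ) (j : ℕ) (g : Rn n → ℝ) (x : Rn n) : ℝ≥0∞ :=
  ENNReal.ofReal (side L j ^ n)⁻¹ * ∫⁻ y in cell L j x, ‖g y‖ₑ

lemma constOn_am (j : ℕ) (g : Rn n → ℝ) : ConstOn L j (am L j g) := fun x y hy => by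
  simp only [am, cell_eq hy]

lemma am_succ_le (hL : 0 < L) (j : ℕ) (g : Rn n → ℝ) (x : Rn n) :
    am L (j + 1) g x ≤ 2 ^ n * am L j g x := by
  unfold am
  rw [← mul_assoc]
  refine mul_le_mul' (le_of_eq ?_) (lintegral_mono_set (cell_succ_subset j x))
  have := side_pos hL (j + 1)
  rw [show (2 : ℝ≥0∞) ^ n = ENNReal.ofReal (2 ^ n) by
      rw [ENNReal.ofReal_pow (by norm_num)]; norm_num, ← ENNReal.ofReal_mul (by positivity),
    side_succ j, mul_pow]
  congr 1
  field_simp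

lemma setLIntegral_cell_eq_am (hL : 0 < L) (j : ℕ) (g : Rn n → ℝ) (x : Rn n) :
    ∫⁻ y in cell L j x, ‖g y‖ₑ = ENNReal.ofReal (side L j ^ n) * am L j g x :=
  (ofReal_pow_inv_mul (side_pos hL j) _).symm

lemma setLIntegral_cell_const (hL : 0 < L) (j : ℕ) (a : ℝ≥0∞) (x : Rn n) :
    ∫⁻ _ in cell L j x, a = ENNReal.ofReal (side L j ^ n) * a := by
  rw [setLIntegral_const, volume_cell hL, mul_comm]

/-- The Calderón–Zygmund stopping sets: the cells on which the stopping time is `j`. -/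
def stp (L : ℝ) (N : ℕ) (g : Rn n → ℝ) (a : ℝ≥0∞) (j : ℕ) : Set (Rn n) :=
  {y | (j = N ∨ a < am L j g y) ∧ ∀ i < j, ¬ a < am L i g y}

lemma constOn_stp (N : ℕ) (g : Rn n → ℝ) (a : ℝ≥0∞) (j : ℕ) (x y : Rn n) (h : y ∈ cell L j x) :
    y ∈ stp L N g a j ↔ x ∈ stp L N g a j := by
  have h1 : ∀ i ≤ j, am L i g y = am L i g x := fun i hi =>
    constOn_am i g x y (cell_subset hi x h)
  simp only [stp, mem_ofPred_eq, h1 j le_rfl]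
  refine and_congr_right fun _ => forall₂_congr fun i hi => ?_
  rw [h1 i hi.le]

lemma measurableSet_stp (N : ℕ) (g : Rn n → ℝ) (a : ℝ≥0∞) (j : ℕ) :
    MeasurableSet (stp L N g a j) := measurableSet_of_const (L := L) j (constOn_stp N g a j)

lemma exists_mem_stp (N : ℕ) (g : Rn n → ℝ) (a : ℝ≥0∞) (y : Rn n) :
    ∃ j ∈ Finset.range (N + 1), y ∈ stp L N g a j ∧
      ∀ i ∈ Finset.range (N + 1), i ≠ j → y ∉ stp L N g a i := by
  classical
  have hex : ∃ j, j = N ∨ a < am L j g y := ⟨N, Or.inl rfl⟩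
  refine ⟨Nat.find hex, ?_, ⟨Nat.find_spec hex, ?_⟩, ?_⟩
  · have := Nat.find_min' hex (Or.inl rfl : N = N ∨ _)
    simp only [Finset.mem_range]; omega
  · intro i hi h
    exact Nat.find_min hex hi (Or.inr h)
  · intro i hi hne hm
    rcases lt_trichotomy i (Nat.find hex) with h | h | h
    · exact Nat.find_min hex h hm.1
    · exact hne h
    · have h2 := hm.2 _ h
      rcases Nat.find_spec hex with h3 | h3
      · have := Finset.mem_range.1 hi; omega
      · exact h2 h3

lemma sum_indicator_stp {β : Type*} [AddCommMonoid β] (N : ℕ) (g : Rn n → ℝ) (a : ℝ≥0∞)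
    (f : ℕ → Rn n → β) (y : Rn n) : ∃ j ∈ Finset.range (N + 1), y ∈ stp L N g a j ∧
      ∑ i ∈ Finset.range (N + 1), (stp L N g a i).indicator (f i) y = f j y := by
  obtain ⟨j, hj, hy, hne⟩ := exists_mem_stp (L := L) N g a y
  refine ⟨j, hj, hy, ?_⟩
  rw [Finset.sum_eq_single_of_mem j hj fun i hi h => indicator_of_notMem (hne i hi h) _,
    indicator_of_mem hy]

/-- Good part of the stopped decomposition. -/
def gd (L : ℝ) (N : ℕ) (g : Rn n → ℝ) (a : ℝ≥0∞) (y : Rn n) : ℝ :=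
  ∑ j ∈ Finset.range (N + 1), (stp L N g a j).indicator (ev L j g) y

/-- Bad part of level `j` of the stopped decomposition. -/
def bd (L : ℝ) (N : ℕ) (g : Rn n → ℝ) (a : ℝ≥0∞) (j : ℕ) (y : Rn n) : ℝ :=
  (stp L N g a j).indicator (fun y => g y - ev L j g y) y

lemma gd_add_bd (N : ℕ) (g : Rn n → ℝ) (a : ℝ≥0∞) (y : Rn n) :
    gd L N g a y + ∑ j ∈ Finset.range (N + 1), bd L N g a j y = g y := by
  unfold gd bd
  rw [← Finset.sum_add_distrib]
  have : ∀ j, (stp L N g a j).indicator (ev L j g) y +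
      (stp L N g a j).indicator (fun y => g y - ev L j g y) y =
      (stp L N g a j).indicator g y := fun j => by
    by_cases h : y ∈ stp L N g a j <;> simp [h]
  simp only [this]
  obtain ⟨j, -, -, h⟩ := sum_indicator_stp (L := L) N g a (fun _ => g) y
  exact h

lemma integrable_bd (hL : 0 < L) (N : ℕ) {g : Rn n → ℝ} (hg : Integrable g) (a : ℝ≥0∞) (j : ℕ) :
    Integrable (bd L N g a j) :=
  (hg.sub (integrable_ev hL j hg)).indicator (measurableSet_stp N g a j)

lemma integrable_gd (hL : 0 < L) (N : ℕ) {g : Rn n → ℝ} (hg : Integrable g) (a : ℝ≥0∞) :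
    Integrable (gd L N g a) :=
  integrable_finsetSum _ fun j _ => (integrable_ev hL j hg).indicator (measurableSet_stp N g a j)

lemma constOn_gd (N : ℕ) (g : Rn n → ℝ) (a : ℝ≥0∞) : ConstOn L N (gd L N g a) := by
  intro x y hy
  unfold gd
  refine Finset.sum_congr rfl fun j hj => ?_
  have hy' := cell_subset (Nat.lt_succ_iff.1 (Finset.mem_range.1 hj)) x hy
  have h1 := constOn_stp N g a j x y hy'
  have h2 := ev_constOn j g x y hy'
  by_cases h : x ∈ stp L N g a j
  · rw [indicator_of_mem h, indicator_of_mem (h1.2 h), h2]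
  · rw [indicator_of_notMem h, indicator_of_notMem (h1.not.2 h)]

lemma meanZero_bd (hL : 0 < L) (N : ℕ) {g : Rn n → ℝ} (hg : Integrable g) (a : ℝ≥0∞) (j : ℕ) :
    MeanZero L j (bd L N g a j) := by
  refine MeanZero.indicator (fun x => ?_) (constOn_stp N g a j)
  rw [integral_sub hg.integrableOn (integrable_ev hL j hg).integrableOn,
    setIntegral_cell_ev hL, sub_self]

lemma abs_gd_le (hL : 0 < L) (N : ℕ) {g : Rn n → ℝ} {a : ℝ} (ha : 0 ≤ a)
    (h0 : ∀ x, am L 0 g x ≤ ENNReal.ofReal a) (y : Rn n) :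
    |gd L N g (ENNReal.ofReal a) y| ≤ 2 ^ n * a := by
  obtain ⟨j, -, hy, h⟩ := sum_indicator_stp (L := L) N g (ENNReal.ofReal a) (fun j => ev L j g) y
  have h1 : ‖ev L j g y‖ₑ ≤ ENNReal.ofReal (2 ^ n * a) := by
    refine (enorm_ev_le hL j g y).trans ?_
    change am L j g y ≤ _
    rw [ENNReal.ofReal_mul (by positivity), ENNReal.ofReal_pow (by norm_num), ENNReal.ofReal_ofNat]
    cases j with
    | zero =>
      exact (h0 y).trans (le_mul_of_one_le_left zero_le (one_le_pow₀ (by norm_num)))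
    | succ j =>
      exact (am_succ_le hL j g y).trans (mul_le_mul_right (not_lt.1 (hy.2 j (Nat.lt_succ_self j))) _)
  unfold gd
  rw [h]
  rw [Real.enorm_eq_ofReal_abs] at h1
  exact (ENNReal.ofReal_le_ofReal_iff (by positivity)).1 h1

/-- Mass attached to the stopping cells of level `j`. -/
def dm (L : ℝ) (N : ℕ) (g : Rn n → ℝ) (a : ℝ≥0∞) (j : ℕ) (y : Rn n) : ℝ≥0∞ :=
  (stp L N g a j).indicator (fun y => ‖g y‖ₑ + ‖ev L j g y‖ₑ +
    {y | a < am L j g y}.indicator (fun _ => a) y) y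

lemma measurable_dm (N : ℕ) {g : Rn n → ℝ} (hg : Measurable g) (a : ℝ≥0∞) (j : ℕ) :
    Measurable (dm L N g a j) := by
  refine Measurable.indicator ?_ (measurableSet_stp N g a j)
  refine (hg.enorm.add (measurable_ev j g).enorm).add (measurable_const.indicator ?_)
  exact measurableSet_lt measurable_const (measurable_of_const (L := L) j (constOn_am j g))

lemma lintegral_dm_le (hL : 0 < L) (N : ℕ) {g : Rn n → ℝ} (hg : Measurable g) (a : ℝ≥0∞) :
    ∑ j ∈ Finset.range (N + 1), ∫⁻ y, dm L N g a j y ≤ 3 * ∫⁻ y, ‖g y‖ₑ := by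
  have h1 : ∀ j, ∫⁻ y, dm L N g a j y ≤ 3 * ∫⁻ y, (stp L N g a j).indicator (fun y => ‖g y‖ₑ) y := by
    intro j
    unfold dm
    rw [lintegral_indicator (measurableSet_stp N g a j),
      lintegral_indicator (measurableSet_stp N g a j),
      lintegral_add_left (f := fun y => ‖g y‖ₑ + ‖ev L j g y‖ₑ)
        (hg.enorm.add (measurable_ev j g).enorm), lintegral_add_left hg.enorm]
    have e1 : ∫⁻ y in stp L N g a j, ‖ev L j g y‖ₑ ≤ ∫⁻ y in stp L N g a j, ‖g y‖ₑ :=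
      setLIntegral_le_of_cell j _ _ (constOn_stp N g a j)
        fun x _ => setLIntegral_cell_enorm_ev_le hL j g x
    have e2 : ∫⁻ y in stp L N g a j, {y | a < am L j g y}.indicator (fun _ => a) y ≤
        ∫⁻ y in stp L N g a j, ‖g y‖ₑ := by
      refine setLIntegral_le_of_cell j _ _ (constOn_stp N g a j) fun x _ => ?_
      rw [setLIntegral_cell_eq_am hL, ← setLIntegral_cell_const hL]
      refine setLIntegral_mono_ae (by fun_prop) (Filter.Eventually.of_forall fun y hy => ?_)
      refine indicator_le' (f := fun _ => a) (g := am L j g) ?_ ?_ y |>.trans_eq (constOn_am j g x y hy)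
      · intro z hz; exact (le_of_lt hz)
      · intro z _; exact zero_le
    calc _ ≤ (∫⁻ y in stp L N g a j, ‖g y‖ₑ) + (∫⁻ y in stp L N g a j, ‖g y‖ₑ) +
          ∫⁻ y in stp L N g a j, ‖g y‖ₑ := by gcongr
      _ = _ := by ring
  refine (Finset.sum_le_sum fun j _ => h1 j).trans ?_
  rw [← Finset.mul_sum, ← lintegral_finsetSum _ fun j _ =>
    hg.enorm.indicator (measurableSet_stp N g a j)]
  refine mul_le_mul_right (lintegral_mono fun y => ?_) _
  obtain ⟨j, -, -, h⟩ := sum_indicator_stp (L := L) N g a (fun _ y => ‖g y‖ₑ) y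
  exact h.le

lemma lintegral_gd_le (hL : 0 < L) (N : ℕ) {g : Rn n → ℝ} (hg : Measurable g) (a : ℝ≥0∞) :
    ∫⁻ y, ‖gd L N g a y‖ₑ ≤ 3 * ∫⁻ y, ‖g y‖ₑ := by
  refine le_trans ?_ (lintegral_dm_le hL N hg a)
  rw [← lintegral_finsetSum _ fun j _ => measurable_dm N hg a j]
  refine lintegral_mono fun y => (enorm_sum_le _ _).trans (Finset.sum_le_sum fun j _ => ?_)
  unfold dm
  by_cases h : y ∈ stp L N g a j
  · simp only [indicator_of_mem h]
    exact le_add_right le_add_self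
  · simp [h]

end

section

variable {n : ℕ} {L : ℝ}

/-- Marcinkiewicz-type function of the stopping cells. -/
def mar (L : ℝ) (N : ℕ) (g : Rn n → ℝ) (a : ℝ≥0∞) (x : Rn n) : ℝ≥0∞ :=
  ∑ j ∈ Finset.range (N + 1), ∫⁻ y, ENNReal.ofReal (side L j * (max (side L j) ‖x - y‖ ^ (n + 1))⁻¹) *
    dm L N g a j y

lemma measurable_mar (N : ℕ) {g : Rn n → ℝ} (hg : Measurable g) (a : ℝ≥0∞) :
    Measurable (mar L N g a) := by
  refine Finset.measurable_fun_sum _ fun j _ => ?_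
  have := measurable_dm (L := L) N hg a j
  refine Measurable.lintegral_prod_right' (f := fun p : Rn n × Rn n =>
    ENNReal.ofReal (side L j * (max (side L j) ‖p.1 - p.2‖ ^ (n + 1))⁻¹) * dm L N g a j p.2) ?_
  fun_prop

lemma lintegral_mar_le (hL : 0 < L) (N : ℕ) {g : Rn n → ℝ} (hg : Measurable g) (a : ℝ≥0∞) :
    ∫⁻ x, mar L N g a x ≤ ck n * (3 * ∫⁻ y, ‖g y‖ₑ) := by
  have hm : ∀ j, Measurable fun p : Rn n × Rn n =>
    ENNReal.ofReal (side L j * (max (side L j) ‖p.1 - p.2‖ ^ (n + 1))⁻¹) * dm L N g a j p.2 := by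
    intro j
    have := measurable_dm (L := L) N hg a j
    fun_prop
  unfold mar
  rw [lintegral_finsetSum _ fun j _ => Measurable.lintegral_prod_right' (hm j)]
  refine le_trans ?_ (mul_le_mul_right (lintegral_dm_le hL N hg a) _)
  rw [Finset.mul_sum]
  refine Finset.sum_le_sum fun j _ => ?_
  have hs := side_pos hL j
  rw [lintegral_lintegral_swap (hm j).aemeasurable, ← lintegral_const_mul _ (measurable_dm N hg a j)]
  refine lintegral_mono fun y => ?_
  dsimp only
  rw [lintegral_mul_const _ (by fun_prop)]
  refine mul_le_mul_left ?_ _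
  have h1 := lintegral_max_le y hs
  simp only [norm_sub_rev y] at h1
  simp only [ENNReal.ofReal_mul hs.le]
  rw [lintegral_const_mul _ (by fun_prop)]
  refine (mul_le_mul_right h1 _).trans (le_of_eq ?_)
  rw [mul_left_comm, ← ENNReal.ofReal_mul hs.le, mul_inv_cancel₀ hs.ne', ENNReal.ofReal_one, mul_one]

lemma far_of_mar_lt (hL : 0 < L) (hn : 0 < n) {N : ℕ} {g : Rn n → ℝ} {a : ℝ}
    {x y : Rn n} (hx : mar L N g (ENNReal.ofReal a) x < ENNReal.ofReal (a * ((5 * (n : ℝ)) ^ (n + 1))⁻¹))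
    {j : ℕ} (hj : j ≤ N) (hy : y ∈ stp L N g (ENNReal.ofReal a) j)
    (hs : ENNReal.ofReal a < am L j g y) : 4 * n * side L j < ‖x - y‖ := by
  by_contra hc
  push Not at hc
  refine absurd hx (not_lt.2 ?_)
  have hp := side_pos hL j
  have hn1 : (1 : ℝ) ≤ n := by exact_mod_cast hn
  unfold mar
  refine le_trans ?_ (Finset.single_le_sum (f := fun j => ∫⁻ y, ENNReal.ofReal (side L j *
    (max (side L j) ‖x - y‖ ^ (n + 1))⁻¹) * dm L N g (ENNReal.ofReal a) j y)
    (fun _ _ => zero_le) (Finset.mem_range.2 (Nat.lt_succ_of_le hj)))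
  beta_reduce
  refine le_trans ?_ (setLIntegral_le_lintegral (cell L j y) _)
  calc ENNReal.ofReal (a * ((5 * (n : ℝ)) ^ (n + 1))⁻¹)
      = ∫⁻ _ in cell L j y, ENNReal.ofReal (side L j * ((5 * n * side L j) ^ (n + 1))⁻¹) *
          ENNReal.ofReal a := by
        rw [setLIntegral_cell_const hL, ← ENNReal.ofReal_mul (by positivity),
          ← ENNReal.ofReal_mul (by positivity)]
        congr 1
        rw [mul_pow _ (side L j), pow_succ (side L j)]
        field_simp
    _ ≤ _ := by
        refine setLIntegral_mono' (measurableSet_cell j y) fun z hz => ?_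
        have hz1 := (constOn_stp N g (ENNReal.ofReal a) j y z hz).2 hy
        have hz2 : ENNReal.ofReal a < am L j g z := by rwa [constOn_am j g y z hz]
        refine mul_le_mul' (ENNReal.ofReal_le_ofReal ?_) ?_
        · have hd : ‖x - z‖ ≤ 5 * n * side L j := by
            have h1 := norm_sub_le_of_mem_cell hL hz
            have h2 := norm_sub_le_norm_sub_add_norm_sub x y z
            rw [norm_sub_rev y z] at h2
            linarith
          have hm : max (side L j) ‖x - z‖ ≤ 5 * n * side L j := max_le (by nlinarith) hd
          have : 0 < max (side L j) ‖x - z‖ := lt_max_of_lt_left hp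
          gcongr
        · unfold dm
          rw [indicator_of_mem hz1, indicator_of_mem (show z ∈ {y | _ < am L j g y} from hz2)]
          exact le_add_self

lemma max_geom {ν s ℓ d d' : ℝ} (hν : 1 ≤ ν) (hs : 0 < s) (hℓ : 0 < ℓ)
    (hd : |d - d'| ≤ 2 * ν * s) (h : ℓ ≤ 2 * s ∨ (2 * s ≤ ℓ ∧ 4 * ν * ℓ < d)) :
    max ℓ d ≤ 16 * ν * max s (d' - ν * ℓ) := by
  have h1 := le_max_left s (d' - ν * ℓ)
  have h2 := le_max_right s (d' - ν * ℓ)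
  set m := max s (d' - ν * ℓ)
  have h3 := (abs_le.1 hd).2
  have hm : 0 < m := hs.trans_le h1
  have hνm : m ≤ ν * m := by nlinarith
  have hνs : ν * s ≤ ν * m := by nlinarith
  rcases h with h | ⟨h, h'⟩
  · have : ν * ℓ ≤ 2 * (ν * s) := by nlinarith
    refine max_le ?_ ?_ <;> nlinarith
  · have e1 : 2 * (ν * s) ≤ ν * ℓ := by nlinarith
    have e2 : ℓ ≤ ν * ℓ := by nlinarith
    refine max_le ?_ ?_ <;> nlinarith

lemma abs_norm_sub_cell (hL : 0 < L) {k : ℕ} {x x' : Rn n} (hx' : x' ∈ cell L k x) (y : Rn n) :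
    |‖x - y‖ - ‖x' - y‖| ≤ 2 * n * side L (k + 1) := by
  refine (abs_norm_sub_norm_le _ _).trans ?_
  have h := norm_sub_le_of_mem_cell hL hx'
  rw [side_succ] at h
  rw [show x - y - (x' - y) = -(x' - x) by abel, norm_neg]
  linarith

lemma vr_bd_le (hL : 0 < L) (hn : 0 < n) {N : ℕ} {g : Rn n → ℝ} (hg : Integrable g) {a : ℝ}
    {x x' : Rn n}
    (hx : mar L N g (ENNReal.ofReal a) x < ENNReal.ofReal (a * ((5 * (n : ℝ)) ^ (n + 1))⁻¹))
    {k : ℕ} (hk : k ≤ N) (hx' : x' ∈ cell L k x) :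
    vr 1 (Ici (side L (k + 1)))
      (av (fun y => ∑ j ∈ Finset.range (N + 1), bd L N g (ENNReal.ofReal a) j y) x') ≤
    ENNReal.ofReal (kc n * n * (16 * (n : ℝ)) ^ (n + 1)) * mar L N g (ENNReal.ofReal a) x := by
  have hp := side_pos hL (k + 1)
  have hn1 : (1 : ℝ) ≤ n := by exact_mod_cast hn
  have hkc := kc_pos (n := n)
  have e : EqOn (av (fun y => ∑ j ∈ Finset.range (N + 1), bd L N g (ENNReal.ofReal a) j y) x')
      (fun r => ∑ j ∈ Finset.range (N + 1), av (bd L N g (ENNReal.ofReal a) j) x' r)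
      (Ici (side L (k + 1))) := fun r hr =>
    av_finset_sum _ (fun j _ => integrable_bd hL N hg _ j) x' (hp.trans_le (mem_Ici.1 hr))
  rw [vr_congr 1 e]
  refine (vr_finset_sum_le le_rfl _ _ _).trans ?_
  unfold mar
  rw [Finset.mul_sum]
  refine Finset.sum_le_sum fun j hj => ?_
  have hjN := Nat.lt_succ_iff.1 (Finset.mem_range.1 hj)
  refine (vr_av_meanZero_le hL (integrable_bd hL N hg _ j) (meanZero_bd hL N hg _ j) x' hp).trans ?_
  rw [← lintegral_const_mul' _ _ ENNReal.ofReal_ne_top]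
  refine lintegral_mono fun y => ?_
  beta_reduce
  by_cases hy : y ∈ stp L N g (ENNReal.ofReal a) j
  swap
  · simp [bd, hy]
  have hb : ‖bd L N g (ENNReal.ofReal a) j y‖ₑ ≤ dm L N g (ENNReal.ofReal a) j y := by
    unfold bd dm
    rw [indicator_of_mem hy, indicator_of_mem hy]
    exact enorm_sub_le.trans le_self_add
  rw [← mul_assoc (ENNReal.ofReal _)]
  refine mul_le_mul' ?_ hb
  have hpj := side_pos hL j
  rw [← ENNReal.ofReal_mul (by positivity)]
  refine ENNReal.ofReal_le_ofReal ?_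
  have key : max (side L j) ‖x - y‖ ≤
      16 * n * max (side L (k + 1)) (‖x' - y‖ - n * side L j) := by
    refine max_geom hn1 hp hpj (abs_norm_sub_cell hL hx' y) ?_
    rw [← side_succ]
    rcases le_total k j with h | h
    · exact Or.inl (side_anti hL h)
    · rcases hy.1 with h1 | h1
      · exact Or.inl (side_anti hL (by omega))
      · exact Or.inr ⟨side_anti hL h, far_of_mar_lt hL hn hx hjN hy h1⟩
  have h0 : 0 < max (side L j) ‖x - y‖ := lt_max_of_lt_left hpj
  have h0' : 0 < max (side L (k + 1)) (‖x' - y‖ - n * side L j) := lt_max_of_lt_left hp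
  have h1 : (max (side L (k + 1)) (‖x' - y‖ - n * side L j) ^ (n + 1))⁻¹ ≤
      (16 * (n : ℝ)) ^ (n + 1) * (max (side L j) ‖x - y‖ ^ (n + 1))⁻¹ := by
    rw [inv_le_iff_one_le_mul₀ (by positivity), mul_right_comm, ← mul_pow, ← div_eq_mul_inv,
      one_le_div (by positivity)]
    exact pow_le_pow_left₀ h0.le key _
  calc _ ≤ kc n * (n * side L j) * ((16 * (n : ℝ)) ^ (n + 1) * (max (side L j) ‖x - y‖ ^ (n + 1))⁻¹) := by
        gcongr
    _ = _ := by ring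

lemma vr_av_sub_bdd_le (hL : 0 < L) {G : Rn n → ℝ} (hG : Integrable G) {b : ℝ}
    (hb : ∀ x, |G x| ≤ b) {k : ℕ} {x x' : Rn n} (hx' : x' ∈ cell L k x) :
    vr 1 (Ici (side L (k + 1))) (fun r => av G x' r - av G x r) ≤
      ENNReal.ofReal (kc n * (2 * n) * b) * (2 * ck n) := by
  have hs := side_pos hL (k + 1)
  have hkc := kc_pos (n := n)
  have hb0 : 0 ≤ b := (abs_nonneg _).trans (hb x)
  set s := side L (k + 1) with hsd
  have hd : ‖x' - x‖ ≤ 2 * n * s := by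
    have h := norm_sub_le_of_mem_cell hL hx'
    rw [side_succ] at h
    linarith
  refine (vr_av_sub_le hG x' x hs).trans ?_
  have hpt : ∀ y, ENNReal.ofReal (kc n * ‖x' - x‖ *
      ((max s (min ‖x' - y‖ ‖x - y‖)) ^ (n + 1))⁻¹) * ‖G y‖ₑ ≤
      ENNReal.ofReal (kc n * (2 * n) * b * s) * (ENNReal.ofReal ((max s ‖x' - y‖ ^ (n + 1))⁻¹) +
        ENNReal.ofReal ((max s ‖x - y‖ ^ (n + 1))⁻¹)) := by
    intro y
    have p1 : 0 < max s ‖x' - y‖ := lt_max_of_lt_left hs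
    have p2 : 0 < max s ‖x - y‖ := lt_max_of_lt_left hs
    have p3 : 0 < max s (min ‖x' - y‖ ‖x - y‖) := lt_max_of_lt_left hs
    rw [Real.enorm_eq_ofReal_abs, ← ENNReal.ofReal_mul (by positivity),
      ← ENNReal.ofReal_add (by positivity) (by positivity), ← ENNReal.ofReal_mul (by positivity)]
    refine ENNReal.ofReal_le_ofReal ?_
    have h1 : ((max s (min ‖x' - y‖ ‖x - y‖)) ^ (n + 1))⁻¹ ≤
        (max s ‖x' - y‖ ^ (n + 1))⁻¹ + (max s ‖x - y‖ ^ (n + 1))⁻¹ := by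
      rcases min_choice ‖x' - y‖ ‖x - y‖ with h | h <;> rw [h]
      · exact le_add_of_nonneg_right (by positivity)
      · exact le_add_of_nonneg_left (by positivity)
    calc _ ≤ kc n * (2 * n * s) * ((max s ‖x' - y‖ ^ (n + 1))⁻¹ + (max s ‖x - y‖ ^ (n + 1))⁻¹) * b := by
          gcongr
          exact hb y
      _ = _ := by ring
  refine (lintegral_mono hpt).trans ?_
  rw [lintegral_const_mul _ (by fun_prop), lintegral_add_left (by fun_prop)]
  refine (mul_le_mul_right (add_le_add (lintegral_max_le x' hs) (lintegral_max_le x hs)) _).trans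
    (le_of_eq ?_)
  rw [← two_mul, ENNReal.ofReal_mul (by positivity), mul_assoc]
  congr 1
  calc ENNReal.ofReal s * (2 * (ck n * ENNReal.ofReal s⁻¹))
      = (ENNReal.ofReal s * ENNReal.ofReal s⁻¹) * (2 * ck n) := by ring
    _ = _ := by rw [← ENNReal.ofReal_mul hs.le, mul_inv_cancel₀ hs.ne', ENNReal.ofReal_one, one_mul]

end

section

variable {n : ℕ} {L : ℝ}

lemma volume_ge_le_div_four {W : Rn n → ℝ≥0∞} (hW : Measurable W) {K : ℝ} (hK : 0 < K) {V : ℝ≥0∞}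
    (h : ∫⁻ x, W x ≤ ENNReal.ofReal (K / 4) * V) :
    volume {x | ENNReal.ofReal K ≤ W x} ≤ V / 4 := by
  have h1 := (mul_meas_ge_le_lintegral (μ := volume) hW (ENNReal.ofReal K)).trans h
  have h2 : ENNReal.ofReal (K / 4) * V = ENNReal.ofReal K * (V / 4) := by
    rw [ENNReal.ofReal_div_of_pos (by norm_num)]
    simp only [div_eq_mul_inv]
    rw [show ENNReal.ofReal 4 = 4 by simp]
    ring
  rw [h2] at h1
  exact (ENNReal.mul_le_mul_iff_right (by simpa using hK) ENNReal.ofReal_ne_top).1 h1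

/-- Outside a set of at most half of the measure, the truncated variation is bounded. -/
lemma exists_bad_set (hn : 0 < n) {ϱ : ℝ} (hϱ : 2 < ϱ) :
    ∃ C : ℝ, 0 < C ∧ ∀ (L : ℝ), 0 < L → ∀ (N : ℕ) (g : Rn n → ℝ), Integrable g → Measurable g →
      ∫⁻ y, ‖g y‖ₑ ≤ ENNReal.ofReal (L ^ n) →
      ∃ B : Set (Rn n), MeasurableSet B ∧ volume B ≤ ENNReal.ofReal (L ^ n) / 2 ∧
        ∀ x ∉ B, ∀ k ≤ N, ∀ x' ∈ cell L k x,
          vr ϱ (Icc (side L (k + 1)) (side L 0)) (av g x') ≤ ENNReal.ofReal C := by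
  have hn1 : (1 : ℝ) ≤ n := by exact_mod_cast hn
  have hϱ0 : 0 < ϱ := by linarith
  have hkc := kc_pos (n := n)
  set c := (ck n).toReal with hc
  have hc0 : 0 ≤ c := ENNReal.toReal_nonneg
  have hck : ck n = ENNReal.ofReal c := (ENNReal.ofReal_toReal ck_ne_top).symm
  have hcl : cl n ϱ = ENNReal.ofReal (cl n ϱ).toReal := (ENNReal.ofReal_toReal (cl_ne_top hϱ)).symm
  have hcl0 : 0 ≤ (cl n ϱ).toReal := ENNReal.toReal_nonneg
  set d := (cl n ϱ).toReal with hd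
  set T : ℝ := 12 * c + 1 with hT
  have hT0 : 1 ≤ T := by linarith
  set q : ℝ := (5 * (n : ℝ)) ^ (n + 1) with hq
  have hq1 : 1 ≤ q := one_le_pow₀ (by linarith)
  set A : ℝ := T * q with hA
  have hA1 : 1 ≤ A := by nlinarith
  have hAT : A * q⁻¹ = T := by rw [hA, mul_assoc, mul_inv_cancel₀ (by positivity), mul_one]
  set b : ℝ := 2 ^ n * A with hb
  have hb0 : 0 < b := by positivity
  set K : ℝ := 12 * d * b ^ (ϱ - 1) + 1 with hK
  have hK0 : 0 < K := by positivity
  refine ⟨kc n * (2 * n) * b * (2 * c) + K ^ (1 / ϱ) + kc n * n * (16 * (n : ℝ)) ^ (n + 1) * T,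
    by positivity, fun L hL N g hg hgm hgL => ?_⟩
  have hgd := integrable_gd hL N hg (ENNReal.ofReal A)
  have ham : ∀ x, am L 0 g x ≤ ENNReal.ofReal A := by
    intro x
    have h1 : ENNReal.ofReal (L ^ n)⁻¹ * ENNReal.ofReal (L ^ n) = 1 := by
      rw [← ENNReal.ofReal_mul (by positivity), inv_mul_cancel₀ (by positivity), ENNReal.ofReal_one]
    calc am L 0 g x ≤ ENNReal.ofReal (L ^ n)⁻¹ * ENNReal.ofReal (L ^ n) := by
          unfold am
          rw [side_zero]
          exact mul_le_mul_right ((setLIntegral_le_lintegral _ _).trans hgL) _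
      _ ≤ _ := by rw [h1]; simpa using hA1
  have hgb := abs_gd_le hL N (by linarith) ham
  obtain ⟨W, hWm, hW, hWi⟩ := exists_vr_rpow_le hL hn hϱ hgd hb0 hgb (constOn_gd N g _)
  have hmm := measurable_mar (L := L) N hgm (ENNReal.ofReal A)
  refine ⟨{x | ENNReal.ofReal T ≤ mar L N g (ENNReal.ofReal A) x} ∪ {x | ENNReal.ofReal K ≤ W x},
    (measurableSet_le measurable_const hmm).union (measurableSet_le measurable_const hWm), ?_, ?_⟩
  · refine (measure_union_le _ _).trans ?_
    have h1 := volume_ge_le_div_four (V := ENNReal.ofReal (L ^ n)) hmm (K := T) (by linarith) (by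
      refine (lintegral_mar_le hL N hgm _).trans ?_
      calc ck n * (3 * ∫⁻ y, ‖g y‖ₑ) ≤ ENNReal.ofReal (c * 3) * ENNReal.ofReal (L ^ n) := by
            rw [← mul_assoc, hck, ENNReal.ofReal_mul hc0, show ENNReal.ofReal 3 = 3 by simp]
            exact mul_le_mul_right hgL _
        _ ≤ _ := mul_le_mul_left (ENNReal.ofReal_le_ofReal (by linarith)) _)
    have h2 := volume_ge_le_div_four (V := ENNReal.ofReal (L ^ n)) hWm hK0 (by
      refine hWi.trans ?_
      calc cl n ϱ * (ENNReal.ofReal b ^ (ϱ - 1) * ∫⁻ x, ‖gd L N g (ENNReal.ofReal A) x‖ₑ)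
          ≤ cl n ϱ * (ENNReal.ofReal b ^ (ϱ - 1) * (3 * ENNReal.ofReal (L ^ n))) :=
            mul_le_mul_right (mul_le_mul_right ((lintegral_gd_le hL N hgm _).trans
              (mul_le_mul_right hgL _)) _) _
        _ = ENNReal.ofReal (d * b ^ (ϱ - 1) * 3) * ENNReal.ofReal (L ^ n) := by
            rw [hcl, ENNReal.ofReal_rpow_of_pos hb0, ENNReal.ofReal_mul (by positivity),
              ENNReal.ofReal_mul hcl0, show ENNReal.ofReal 3 = 3 by simp]
            ring
        _ ≤ _ := mul_le_mul_left (ENNReal.ofReal_le_ofReal (by linarith)) _)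
    refine (add_le_add h1 h2).trans (le_of_eq ?_)
    rw [← two_mul, ← mul_div_assoc, mul_comm, mul_div_assoc, div_eq_mul_inv (ENNReal.ofReal (L ^ n)) 2]
    congr 1
    rw [ENNReal.div_eq_inv_mul, show (4 : ℝ≥0∞) = 2 * 2 by norm_num,
      ENNReal.mul_inv (by simp) (by simp), mul_assoc, ENNReal.inv_mul_cancel (by simp) (by simp), mul_one]
  · intro x hx k hk x' hx'
    simp only [mem_union, mem_ofPred_eq, not_or, not_le] at hx
    have hsub : Icc (side L (k + 1)) (side L 0) ⊆ Ici (side L (k + 1)) := fun r hr => hr.1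
    have hsub2 : Icc (side L (k + 1)) (side L 0) ⊆ Icc (side L (N + 1)) (side L 0) :=
      Icc_subset_Icc_left (side_anti hL (by omega))
    have hmar := hx.1
    rw [← hAT] at hmar
    have e : EqOn (av g x') (fun r => ((av (gd L N g (ENNReal.ofReal A)) x' r -
        av (gd L N g (ENNReal.ofReal A)) x r) + av (gd L N g (ENNReal.ofReal A)) x r) +
        av (fun y => ∑ j ∈ Finset.range (N + 1), bd L N g (ENNReal.ofReal A) j y) x' r)
        (Icc (side L (k + 1)) (side L 0)) := by
      intro r hr
      have hr0 : 0 < r := (side_pos hL _).trans_le hr.1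
      dsimp only
      rw [sub_add_cancel, ← av_add hgd (integrable_finsetSum _ fun j _ => integrable_bd hL N hg _ j) x' hr0]
      simp only [gd_add_bd]
    rw [vr_congr ϱ e]
    refine (vr_add_le (by linarith) _ _ _).trans ?_
    refine (add_le_add (vr_add_le (by linarith) _ _ _) le_rfl).trans ?_
    rw [ENNReal.ofReal_add (by positivity) (by positivity),
      ENNReal.ofReal_add (by positivity) (by positivity)]
    refine add_le_add (add_le_add ?_ ?_) ?_
    · refine (vr_le_vr_one (by linarith) _ _).trans ((vr_mono 1 hsub _).trans ?_)
      refine (vr_av_sub_bdd_le hL hgd hgb hx').trans (le_of_eq ?_)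
      rw [hck, ENNReal.ofReal_mul (q := 2 * c) (by positivity), ENNReal.ofReal_mul (q := c) (by norm_num), hb]
      simp
    · refine (vr_mono ϱ hsub2 _).trans ?_
      have h1 : vr ϱ (Icc (side L (N + 1)) (side L 0)) (av (gd L N g (ENNReal.ofReal A)) x) ^ ϱ ≤
          ENNReal.ofReal K := (hW x).trans hx.2.le
      rw [← ENNReal.ofReal_rpow_of_pos hK0, one_div, ENNReal.le_rpow_inv_iff hϱ0]
      exact h1
    · refine (vr_le_vr_one (by linarith) _ _).trans ((vr_mono 1 hsub _).trans ?_)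
      refine (vr_bd_le hL hn hg hmar hk hx').trans ?_
      rw [ENNReal.ofReal_mul (q := T) (by positivity)]
      exact mul_le_mul_right hx.1.le _

end

section

variable {n : ℕ} {L : ℝ}

lemma av_const_mul (c : ℝ) (g : Rn n → ℝ) (x : Rn n) (r : ℝ) :
    av (fun y => c * g y) x r = c * av g x r := by
  unfold av
  rw [← integral_const_mul]
  congr 1
  ext y
  ring

lemma vr_eq_zero {ϱ : ℝ} (hϱ : 1 ≤ ϱ) {S : Set ℝ} {h : ℝ → ℝ} (e : ∀ r ∈ S, h r = 0) :
    vr ϱ S h = 0 := by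
  rw [vr_congr ϱ (k := fun _ => 0) e]
  exact le_antisymm ((vr_le_vr_one hϱ _ _).trans (vr_const S 0).le) zero_le

lemma mn_zero_side (q : ℕ) (g : Rn n → ℝ) (x : Rn n) : mn (side L q) 0 g x = mn L q g x := by
  simp only [mn, side_zero, nb_add, add_zero]

lemma mn_ne_top (j : ℕ) {g : Rn n → ℝ} (hg : Integrable g) (x : Rn n) : mn L j g x ≠ ∞ := by
  unfold mn
  exact ENNReal.mul_ne_top ENNReal.ofReal_ne_top
    ((setLIntegral_le_lintegral _ _).trans_lt hg.2).ne

lemma setLIntegral_nb_eq_mn (hL : 0 < L) (j : ℕ) (g : Rn n → ℝ) (x : Rn n) :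
    ∫⁻ y in nb 1 L j x, ‖g y‖ₑ = ENNReal.ofReal (side L j ^ n) * mn L j g x := by
  have := side_pos hL j
  unfold mn
  rw [← mul_assoc, ← ENNReal.ofReal_mul (by positivity), mul_inv_cancel₀ (by positivity),
    ENNReal.ofReal_one, one_mul]

/-- Localized version of `exists_bad_set` on a cell. -/
lemma exists_bad_cell (hn : 0 < n) {ϱ : ℝ} (hϱ : 2 < ϱ) :
    ∃ C : ℝ, 0 < C ∧ ∀ (L : ℝ), 0 < L → ∀ (N q : ℕ) (g : Rn n → ℝ), Integrable g → Measurable g →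
      ∀ x₀ : Rn n, ∃ B : Set (Rn n), MeasurableSet B ∧ volume B ≤ volume (cell L q x₀) / 2 ∧
        ∀ x ∈ cell L q x₀, x ∉ B → ∀ k, q ≤ k → k ≤ N → ∀ x' ∈ cell L k x,
          vr ϱ (Icc (side L (k + 1)) (side L q)) (av g x') ≤ ENNReal.ofReal C * mn L q g x₀ := by
  obtain ⟨C, hC, H⟩ := exists_bad_set hn hϱ
  refine ⟨C, hC, fun L₀ hL₀ N q g hg hgm x₀ => ?_⟩
  suffices key : ∀ L : ℝ, 0 < L → ∃ B : Set (Rn n), MeasurableSet B ∧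
      volume B ≤ volume (cell L 0 x₀) / 2 ∧
        ∀ x ∈ cell L 0 x₀, x ∉ B → ∀ k, k ≤ N → ∀ x' ∈ cell L k x,
          vr ϱ (Icc (side L (k + 1)) (side L 0)) (av g x') ≤ ENNReal.ofReal C * mn L 0 g x₀ by
    obtain ⟨B, hB, hv, h⟩ := key (side L₀ q) (side_pos hL₀ q)
    rw [cell_add, add_zero] at hv h
    refine ⟨B, hB, hv, fun x hx hxB k hqk hk x' hx' => ?_⟩
    have := h x hx hxB (k - q) (by omega) x' (by rwa [cell_add, Nat.add_sub_cancel' hqk])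
    rwa [side_add, side_zero, mn_zero_side, ← add_assoc, Nat.add_sub_cancel' hqk] at this
  intro L hL
  have hLn : 0 < L ^ n := by positivity
  set lam := (mn L 0 g x₀).toReal with hlam
  have hl : ENNReal.ofReal lam = mn L 0 g x₀ := ENNReal.ofReal_toReal (mn_ne_top 0 hg x₀)
  have hnb : ∀ x ∈ cell L 0 x₀, ∀ k, ∀ x' ∈ cell L k x, nb 1 L 0 x' = nb 1 L 0 x₀ := by
    intro x hx k x' hx'
    rw [nb_eq (cell_subset (Nat.zero_le k) x hx'), nb_eq hx]
  have hav : ∀ x ∈ cell L 0 x₀, ∀ k, ∀ x' ∈ cell L k x, ∀ r ∈ Icc (side L (k + 1)) (side L 0),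
      av g x' r = av ((nb 1 L 0 x₀).indicator g) x' r := by
    intro x hx k x' hx' r hr
    rw [av_eq_nb hL g x' ((side_pos hL _).trans_le hr.1) hr.2, hnb x hx k x' hx']
  rcases (ENNReal.toReal_nonneg (a := mn L 0 g x₀)).eq_or_lt with h0 | h0
  · refine ⟨∅, MeasurableSet.empty, by simp, fun x hx _ k _ x' hx' => ?_⟩
    rw [vr_eq_zero (by linarith)]
    · exact zero_le
    intro r hr
    rw [hav x hx k x' hx' r hr, ← enorm_eq_zero]
    refine le_antisymm ((enorm_av_le x' ((side_pos hL _).trans_le hr.1)).trans ?_) zero_le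
    rw [lintegral_indicator_enorm, setLIntegral_nb_eq_mn hL, ← hl, hlam, ← h0]
    simp
  · have h0' : 0 < lam := h0
    have hg1 : Integrable ((nb 1 L 0 x₀).indicator g) := hg.indicator (measurableSet_nb 1 0 x₀)
    obtain ⟨B, hB, hv, h⟩ := H L hL N (fun y => lam⁻¹ * (nb 1 L 0 x₀).indicator g y)
      (hg1.const_mul _) ((hgm.indicator (measurableSet_nb 1 0 x₀)).const_mul _) (by
        simp only [enorm_mul]
        rw [lintegral_const_mul' _ _ enorm_ne_top, lintegral_indicator_enorm,
          setLIntegral_nb_eq_mn hL, ← hl, side_zero, Real.enorm_eq_ofReal (by positivity),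
          ← ENNReal.ofReal_mul hLn.le, ← ENNReal.ofReal_mul (by positivity)]
        refine ENNReal.ofReal_le_ofReal (le_of_eq ?_)
        field_simp)
    refine ⟨B, hB, by rwa [volume_cell hL, side_zero], fun x hx hxB k hk x' hx' => ?_⟩
    have e : EqOn (av g x') (fun r => lam * av (fun y => lam⁻¹ * (nb 1 L 0 x₀).indicator g y) x' r)
        (Icc (side L (k + 1)) (side L 0)) := by
      intro r hr
      dsimp only
      rw [hav x hx k x' hx' r hr, av_const_mul, ← mul_assoc, mul_inv_cancel₀ h0'.ne', one_mul]
    rw [vr_congr ϱ e]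
    refine (vr_const_mul (by linarith) _ _ _).trans ?_
    rw [Real.enorm_eq_ofReal h0'.le, hl, mul_comm]
    exact mul_le_mul_left (h x hxB k hk x' hx') _

end

section

variable {n : ℕ} {L : ℝ}

/-- A set which is a union of grid cells of level `j`. -/
def Lv (L : ℝ) (j : ℕ) (T : Set (Rn n)) : Prop := ∀ x y, y ∈ cell L j x → (y ∈ T ↔ x ∈ T)

lemma Lv.mono {i j : ℕ} (h : i ≤ j) {T : Set (Rn n)} (hT : Lv L i T) : Lv L j T :=
  fun x y hy => hT x y (cell_subset h x hy)

lemma Lv.measurableSet {j : ℕ} {T : Set (Rn n)} (hT : Lv L j T) : MeasurableSet T :=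
  measurableSet_of_const j hT

lemma lv_cell (j : ℕ) (x : Rn n) : Lv L j (cell L j x) := fun z y hy => by
  rw [mem_cell_comm, cell_eq hy, mem_cell_comm]

lemma Lv.inter {j : ℕ} {S T : Set (Rn n)} (hS : Lv L j S) (hT : Lv L j T) : Lv L j (S ∩ T) :=
  fun x y hy => and_congr (hS x y hy) (hT x y hy)

lemma Lv.compl {j : ℕ} {S : Set (Rn n)} (hS : Lv L j S) : Lv L j Sᶜ :=
  fun x y hy => not_congr (hS x y hy)

/-- Points lying in some `c k` with `j ≤ k ≤ N`. -/
def some_ge (c : ℕ → Set (Rn n)) (N j : ℕ) : Set (Rn n) := {y | ∃ k, j ≤ k ∧ k ≤ N ∧ y ∈ c k}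

lemma measurableSet_some_ge {c : ℕ → Set (Rn n)} (hc : ∀ k, Lv L k (c k)) (N j : ℕ) :
    MeasurableSet (some_ge c N j) := by
  have : some_ge c N j = ⋃ k, ⋃ (_ : j ≤ k), ⋃ (_ : k ≤ N), c k := by
    ext y
    simp only [some_ge, mem_ofPred_eq, mem_iUnion, exists_prop]
  rw [this]
  exact MeasurableSet.iUnion fun k => MeasurableSet.iUnion fun _ => MeasurableSet.iUnion fun _ =>
    (hc k).measurableSet

/-- Points whose first `c k` with `k ≥ j` is `c k`. -/
def fst_ge (c : ℕ → Set (Rn n)) (j k : ℕ) : Set (Rn n) := {y | y ∈ c k ∧ ∀ i, j ≤ i → i < k → y ∉ c i}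

lemma lv_fst_ge {c : ℕ → Set (Rn n)} (hc : ∀ k, Lv L k (c k)) (j k : ℕ) : Lv L k (fst_ge c j k) := by
  intro x y hy
  refine and_congr (hc k x y hy) ⟨fun h i hi hk => ?_, fun h i hi hk => ?_⟩
  · rw [← (hc i).mono hk.le x y hy]; exact h i hi hk
  · rw [(hc i).mono hk.le x y hy]; exact h i hi hk

lemma exists_fst_ge {c : ℕ → Set (Rn n)} {N j : ℕ} {y : Rn n} (h : y ∈ some_ge c N j) :
    ∃ k, j ≤ k ∧ k ≤ N ∧ y ∈ fst_ge c j k := by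
  classical
  have h' : ∃ k, j ≤ k ∧ k ≤ N ∧ y ∈ c k := h
  refine ⟨Nat.find h', (Nat.find_spec h').1, (Nat.find_spec h').2.1, (Nat.find_spec h').2.2, ?_⟩
  intro i hi hk hy
  exact Nat.find_min h' hk ⟨hi, hk.le.trans (Nat.find_spec h').2.1, hy⟩

lemma measure_inter_some_ge_le {c : ℕ → Set (Rn n)} (hc : ∀ k, Lv L k (c k)) {N j : ℕ}
    {T A : Set (Rn n)} (hT : Lv L j T) (hA : MeasurableSet A) (θ : ℝ≥0∞)
    (H : ∀ k, j ≤ k → k ≤ N → ∀ x ∈ T, x ∈ fst_ge c j k →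
      volume (A ∩ cell L k x) ≤ θ * volume (cell L k x)) :
    volume (A ∩ T ∩ some_ge c N j) ≤ θ * volume (T ∩ some_ge c N j) := by
  have hF : ∀ k, j ≤ k → Lv L k (T ∩ fst_ge c j k) := fun k hk => (hT.mono hk).inter (lv_fst_ge hc j k)
  have hsub : A ∩ T ∩ some_ge c N j ⊆ ⋃ k ∈ Finset.Icc j N, A ∩ (T ∩ fst_ge c j k) := by
    rintro y ⟨⟨hyA, hyT⟩, hy⟩
    obtain ⟨k, hk, hkN, h⟩ := exists_fst_ge hy
    exact mem_iUnion₂.2 ⟨k, Finset.mem_Icc.2 ⟨hk, hkN⟩, hyA, hyT, h⟩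
  have hsub2 : ⋃ k ∈ Finset.Icc j N, T ∩ fst_ge c j k ⊆ T ∩ some_ge c N j := by
    intro y hy
    obtain ⟨k, hk, h⟩ := mem_iUnion₂.1 hy
    exact ⟨h.1, k, (Finset.mem_Icc.1 hk).1, (Finset.mem_Icc.1 hk).2, h.2.1⟩
  have hd : (↑(Finset.Icc j N) : Set ℕ).PairwiseDisjoint fun k => T ∩ fst_ge c j k := by
    intro k hk k' hk' hne
    refine Set.disjoint_left.2 fun y hy hy' => ?_
    have h1 := (Finset.mem_Icc.1 (Finset.mem_coe.1 hk)).1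
    have h2 := (Finset.mem_Icc.1 (Finset.mem_coe.1 hk')).1
    rcases lt_or_gt_of_ne hne with h | h
    · exact hy'.2.2 k h1 h hy.2.1
    · exact hy.2.2 k' h2 h hy'.2.1
  calc volume (A ∩ T ∩ some_ge c N j)
      ≤ ∑ k ∈ Finset.Icc j N, volume (A ∩ (T ∩ fst_ge c j k)) :=
        (measure_mono hsub).trans (measure_biUnion_finset_le _ _)
    _ ≤ ∑ k ∈ Finset.Icc j N, θ * volume (T ∩ fst_ge c j k) := by
        refine Finset.sum_le_sum fun k hk => ?_
        obtain ⟨h1, h2⟩ := Finset.mem_Icc.1 hk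
        exact setMeasure_le_of_cell k θ hA (hF k h1) fun x hx => H k h1 h2 x hx.1 hx.2
    _ = θ * volume (⋃ k ∈ Finset.Icc j N, T ∩ fst_ge c j k) := by
        rw [← Finset.mul_sum, measure_biUnion_finset hd fun k hk =>
          (hF k (Finset.mem_Icc.1 hk).1).measurableSet]
    _ ≤ _ := mul_le_mul_right (measure_mono hsub2) _

open Classical in
/-- Number of levels `k ∈ [j, N]` with `y ∈ c k`. -/
def cnt (c : ℕ → Set (Rn n)) (N j : ℕ) (y : Rn n) : ℕ := ((Finset.Icc j N).filter (y ∈ c ·)).card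

lemma cnt_eq_of_fst {c : ℕ → Set (Rn n)} {N j k : ℕ} (hk : j ≤ k) (hkN : k ≤ N) {y : Rn n}
    (h : y ∈ fst_ge c j k) : cnt c N j y = cnt c N (k + 1) y + 1 := by
  classical
  unfold cnt
  rw [← Finset.card_insert_of_notMem (a := k) (by simp)]
  congr 1
  ext i
  simp only [Finset.mem_filter, Finset.mem_Icc, Finset.mem_insert]
  constructor
  · rintro ⟨⟨h1, h2⟩, h3⟩
    rcases lt_trichotomy i k with h4 | h4 | h4
    · exact absurd h3 (h.2 i h1 h4)
    · exact Or.inl h4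
    · exact Or.inr ⟨⟨h4, h2⟩, h3⟩
  · rintro (rfl | ⟨⟨h1, h2⟩, h3⟩)
    · exact ⟨⟨hk, hkN⟩, h.1⟩
    · exact ⟨⟨by omega, h2⟩, h3⟩

lemma one_le_cnt_iff {c : ℕ → Set (Rn n)} {N j : ℕ} {y : Rn n} :
    1 ≤ cnt c N j y ↔ y ∈ some_ge c N j := by
  classical
  unfold cnt some_ge
  rw [Nat.one_le_iff_ne_zero, Finset.card_ne_zero]
  simp only [Finset.Nonempty, Finset.mem_filter, Finset.mem_Icc, mem_ofPred_eq, and_assoc]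

lemma measurable_cnt {c : ℕ → Set (Rn n)} (hc : ∀ k, Lv L k (c k)) (N j : ℕ) :
    Measurable (cnt c N j) := by
  classical
  have : cnt c N j = fun y => ∑ k ∈ Finset.Icc j N, if y ∈ c k then 1 else 0 := by
    ext y
    exact Finset.card_filter _ _
  rw [this]
  exact Finset.measurable_fun_sum _ fun k _ =>
    Measurable.ite (hc k).measurableSet measurable_const measurable_const

/-- Sparseness of a family of grid cells. -/
def Sps (L : ℝ) (N : ℕ) (c : ℕ → Set (Rn n)) : Prop :=
  ∀ q ≤ N, ∀ x ∈ c q, volume (cell L q x ∩ some_ge c N (q + 1)) ≤ volume (cell L q x) / 2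

lemma Sps.mono {N : ℕ} {c c' : ℕ → Set (Rn n)} (h : ∀ k, c' k ⊆ c k) (hs : Sps L N c) :
    Sps L N c' := by
  have hsub : ∀ q, some_ge c' N q ⊆ some_ge c N q :=
    fun q y ⟨k, h1, h2, h3⟩ => ⟨k, h1, h2, h k h3⟩
  exact fun q hq x hx =>
    (measure_mono (inter_subset_inter_right _ (hsub (q + 1)))).trans (hs q hq x (h q hx))

lemma measure_cnt_le {c : ℕ → Set (Rn n)} (hc : ∀ k, Lv L k (c k)) {N : ℕ} (hs : Sps L N c)
    (i : ℕ) : ∀ {j : ℕ} {T : Set (Rn n)}, Lv L j T →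
    volume ({y | i + 1 ≤ cnt c N j y} ∩ T) ≤ (2⁻¹) ^ i * volume (T ∩ some_ge c N j) := by
  induction i with
  | zero =>
    intro j T hT
    rw [pow_zero, one_mul]
    refine measure_mono ?_
    rintro y ⟨h1, h2⟩
    exact ⟨h2, one_le_cnt_iff.1 (by simpa using h1)⟩
  | succ i ih =>
    intro j T hT
    have hm : MeasurableSet {y | i + 1 + 1 ≤ cnt c N j y} :=
      measurableSet_le measurable_const (measurable_cnt hc N j)
    refine le_trans (measure_mono (t := {y | i + 1 + 1 ≤ cnt c N j y} ∩ T ∩ some_ge c N j) ?_)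
      (measure_inter_some_ge_le hc hT hm _ ?_)
    · exact fun y hy => ⟨hy, one_le_cnt_iff.1 (le_trans (by omega) hy.1)⟩
    · intro k hk hkN x _ hx
      have hsub : {y | i + 1 + 1 ≤ cnt c N j y} ∩ cell L k x ⊆
          {y | i + 1 ≤ cnt c N (k + 1) y} ∩ cell L k x := by
        rintro y ⟨h1, h2⟩
        have h3 := cnt_eq_of_fst hk hkN ((lv_fst_ge hc j k x y h2).2 hx)
        simp only [mem_ofPred_eq] at h1
        exact ⟨by simp only [mem_ofPred_eq]; omega, h2⟩
      refine (measure_mono hsub).trans ((ih ((lv_cell k x).mono (Nat.le_succ k))).trans ?_)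
      refine (mul_le_mul_right (hs k hkN x hx.1) _).trans (le_of_eq ?_)
      rw [pow_succ, ENNReal.div_eq_inv_mul, mul_assoc]

lemma measure_cnt_le' {c : ℕ → Set (Rn n)} (hc : ∀ k, Lv L k (c k)) {N : ℕ} (hs : Sps L N c)
    (i : ℕ) {j : ℕ} {T : Set (Rn n)} (hT : Lv L j T) :
    volume ({y | i + 1 ≤ cnt c N j y} ∩ T) ≤ (2⁻¹) ^ i * volume T :=
  (measure_cnt_le hc hs i hT).trans (mul_le_mul_right (measure_mono inter_subset_left) _)

open Classical in
/-- Current stopping level. -/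
def cur (L ϱ C : ℝ) (g : Rn n → ℝ) : ℕ → Rn n → ℕ
  | 0, _ => 0
  | k + 1, x => if ∃ x' ∈ cell L (k + 1) x, ENNReal.ofReal C * mn L (cur L ϱ C g k x) g x' <
      vr ϱ (Icc (side L (k + 1 + 1)) (side L (cur L ϱ C g k x))) (av g x') then k + 1
      else cur L ϱ C g k x

section
variable {ϱ C : ℝ} {g : Rn n → ℝ}

lemma cur_const (k : ℕ) {x y : Rn n} (h : y ∈ cell L k x) : cur L ϱ C g k y = cur L ϱ C g k x := by
  induction k with
  | zero => rfl
  | succ k ih => rw [cur, cur, ih (cell_succ_subset k x h), cell_eq h]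

lemma cur_le (k : ℕ) (x : Rn n) : cur L ϱ C g k x ≤ k := by
  induction k with
  | zero => simp [cur]
  | succ k ih =>
    rw [cur]
    split_ifs <;> omega

lemma cur_cur (k : ℕ) (x : Rn n) : cur L ϱ C g (cur L ϱ C g k x) x = cur L ϱ C g k x := by
  induction k with
  | zero => simp [cur]
  | succ k ih =>
    by_cases h : ∃ x' ∈ cell L (k + 1) x, ENNReal.ofReal C * mn L (cur L ϱ C g k x) g x' <
      vr ϱ (Icc (side L (k + 1 + 1)) (side L (cur L ϱ C g k x))) (av g x')
    · have : cur L ϱ C g (k + 1) x = k + 1 := by rw [cur, if_pos h]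
      rw [this, this]
    · have : cur L ϱ C g (k + 1) x = cur L ϱ C g k x := by rw [cur, if_neg h]
      rw [this, ih]

/-- Selected cells. -/
def sel (L ϱ C : ℝ) (g : Rn n → ℝ) (k : ℕ) : Set (Rn n) := {x | cur L ϱ C g k x = k}

lemma lv_sel (k : ℕ) : Lv L k (sel L ϱ C g k) := fun x y hy => by
  simp only [sel, mem_ofPred_eq, cur_const k hy]

lemma cur_eq_of_notMem {q k : ℕ} (hk : q ≤ k) {x : Rn n} (hx : x ∈ sel L ϱ C g q)
    (h : ∀ i, q + 1 ≤ i → i ≤ k → x ∉ sel L ϱ C g i) : cur L ϱ C g k x = q := by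
  induction k, hk using Nat.le_induction with
  | base => exact hx
  | succ k hk ih =>
    have h1 := h (k + 1) (by omega) le_rfl
    simp only [sel, mem_ofPred_eq] at h1
    have h2 := ih fun i hi hk => h i hi (by omega)
    rw [cur] at h1 ⊢
    split_ifs at h1 ⊢ with h3
    · exact absurd rfl h1
    · exact h2

lemma vr_singleton (ϱ : ℝ) (hϱ : 1 ≤ ϱ) (a : ℝ) (h : ℝ → ℝ) : vr ϱ (Icc a a) h = 0 := by
  rw [vr_congr ϱ (k := fun _ => h a) (fun r hr => by rw [le_antisymm hr.2 hr.1])]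
  exact le_antisymm ((vr_le_vr_one hϱ _ _).trans (vr_const _ _).le) zero_le

lemma vr_le_sum_sel (hL : 0 < L) (hn : 0 < n) (hϱ : 1 ≤ ϱ) (hC : kc n * 2 ^ n ≤ C) (hg : Integrable g)
    (k : ℕ) (x : Rn n) :
    vr ϱ (Icc (side L (cur L ϱ C g k x)) (side L 0)) (av g x) ≤
      ∑ i ∈ Finset.range (cur L ϱ C g k x), ENNReal.ofReal C * (sel L ϱ C g i).indicator (mn L i g) x ∧
    vr ϱ (Icc (side L (k + 1)) (side L (cur L ϱ C g k x))) (av g x) ≤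
      ENNReal.ofReal C * mn L (cur L ϱ C g k x) g x := by
  have h1 : ∀ j, vr ϱ (Icc (side L (j + 1)) (side L j)) (av g x) ≤ ENNReal.ofReal C * mn L j g x :=
    fun j => (vr_le_vr_one hϱ _ _).trans ((vr_le_vn hL j g x).trans ((vn_le hL hn j hg x).trans
      (mul_le_mul_left (ENNReal.ofReal_le_ofReal hC) _)))
  induction k with
  | zero =>
    simp only [cur, Finset.range_zero, Finset.sum_empty]
    exact ⟨(vr_singleton ϱ hϱ _ _).le, h1 0⟩
  | succ k ih =>
    by_cases h : ∃ x' ∈ cell L (k + 1) x, ENNReal.ofReal C * mn L (cur L ϱ C g k x) g x' <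
      vr ϱ (Icc (side L (k + 1 + 1)) (side L (cur L ϱ C g k x))) (av g x')
    · have e : cur L ϱ C g (k + 1) x = k + 1 := by rw [cur, if_pos h]
      have hle := cur_le (L := L) (ϱ := ϱ) (C := C) (g := g) k x
      have hcc : x ∈ sel L ϱ C g (cur L ϱ C g k x) := cur_cur k x
      rw [e]
      refine ⟨?_, h1 _⟩
      refine (vr_Icc_le hϱ (side_anti hL (by omega : cur L ϱ C g k x ≤ k + 1))
        (side_anti hL (Nat.zero_le _)) _).trans ?_
      refine (add_le_add ih.2 ih.1).trans ?_
      rw [add_comm]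
      have : ENNReal.ofReal C * mn L (cur L ϱ C g k x) g x = ENNReal.ofReal C *
          (sel L ϱ C g (cur L ϱ C g k x)).indicator (mn L (cur L ϱ C g k x) g) x := by
        rw [indicator_of_mem hcc]
      rw [this, ← Finset.sum_range_succ (fun i => ENNReal.ofReal C * (sel L ϱ C g i).indicator (mn L i g) x)]
      exact Finset.sum_le_sum_of_subset (Finset.range_mono (by omega))
    · have e : cur L ϱ C g (k + 1) x = cur L ϱ C g k x := by rw [cur, if_neg h]
      rw [e]
      push Not at h
      exact ⟨ih.1, h x (mem_cell_self _ x)⟩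

end

/-- Sparse domination of the truncated variation of the averages. -/
lemma exists_sparse (hn : 0 < n) {ϱ : ℝ} (hϱ : 2 < ϱ) :
    ∃ C : ℝ, 0 < C ∧ ∀ (L : ℝ), 0 < L → ∀ (N : ℕ) (g : Rn n → ℝ), Integrable g → Measurable g →
      ∃ c : ℕ → Set (Rn n), (∀ k, Lv L k (c k)) ∧ Sps L N c ∧
        ∀ x, vr ϱ (Icc (side L (N + 1)) (side L 0)) (av g x) ≤
          ENNReal.ofReal C * ∑ k ∈ Finset.range (N + 1), (c k).indicator (mn L k g) x := by
  obtain ⟨C₀, hC₀, H⟩ := exists_bad_cell hn hϱ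
  set C := C₀ + kc n * 2 ^ n with hC
  have hkc := kc_pos (n := n)
  have hC1 : kc n * 2 ^ n ≤ C := by linarith
  have hC0 : C₀ ≤ C := by rw [hC]; linarith [show 0 < kc n * 2 ^ n by positivity]
  refine ⟨C, by positivity, fun L hL N g hg hgm => ⟨sel L ϱ C g, lv_sel, ?_, fun x => ?_⟩⟩
  · intro q hq x hx
    obtain ⟨B, -, hv, hB⟩ := H L hL N q g hg hgm x
    refine le_trans (measure_mono ?_) hv
    rintro y ⟨hy, hy'⟩
    by_contra hyB
    obtain ⟨k, hk, hkN, hyk⟩ := exists_fst_ge hy'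
    obtain ⟨m, rfl⟩ : ∃ m, k = m + 1 := ⟨k - 1, by omega⟩
    have hyq : y ∈ sel L ϱ C g q := (lv_sel q x y hy).2 hx
    have hm : cur L ϱ C g m y = q :=
      cur_eq_of_notMem (by omega) hyq fun i hi him => hyk.2 i hi (by omega)
    have h1 := hyk.1
    simp only [sel, mem_ofPred_eq] at h1
    rw [cur, hm] at h1
    split_ifs at h1 with h3
    · obtain ⟨x', hx', h4⟩ := h3
      have h5 := hB y hy hyB (m + 1) (by omega) hkN x' hx'
      have h6 : mn L q g x' = mn L q g x :=
        (constOn_mn q g y x' (cell_subset (by omega) y hx')).trans (constOn_mn q g x y hy)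
      rw [h6] at h4
      exact absurd (h4.trans_le h5) (not_lt.2 (mul_le_mul_left (ENNReal.ofReal_le_ofReal hC0) _))
    · omega
  · obtain ⟨h1, h2⟩ := vr_le_sum_sel (ϱ := ϱ) hL hn (by linarith) hC1 hg N x
    have hle := cur_le (L := L) (ϱ := ϱ) (C := C) (g := g) N x
    have hcc : x ∈ sel L ϱ C g (cur L ϱ C g N x) := cur_cur N x
    refine (vr_Icc_le (by linarith) (side_anti hL (by omega : cur L ϱ C g N x ≤ N + 1))
        (side_anti hL (Nat.zero_le _)) _).trans ?_
    refine (add_le_add h2 h1).trans ?_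
    rw [add_comm, Finset.mul_sum]
    have : ENNReal.ofReal C * mn L (cur L ϱ C g N x) g x = ENNReal.ofReal C *
        (sel L ϱ C g (cur L ϱ C g N x)).indicator (mn L (cur L ϱ C g N x) g) x := by
      rw [indicator_of_mem hcc]
    rw [this, ← Finset.sum_range_succ (fun i => ENNReal.ofReal C * (sel L ϱ C g i).indicator (mn L i g) x)]
    exact Finset.sum_le_sum_of_subset (Finset.range_mono (by omega))

end

section

variable {n : ℕ} {L : ℝ}

lemma measure_le_of_cell (j : ℕ) {m₁ m₂ : Measure (Rn n)} {T : Set (Rn n)} (hT : Lv L j T)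
    (H : ∀ x ∈ T, m₁ (cell L j x) ≤ m₂ (cell L j x)) : m₁ T ≤ m₂ T := by
  have hm : ∀ z, MeasurableSet (T ∩ fib L j z) := fun z => hT.measurableSet.inter (measurableSet_fib j z)
  have hd : Pairwise (Function.onFun Disjoint fun z => T ∩ fib L j z) := fun z z' h =>
    ((pairwise_disjoint_fib j) h).mono inter_subset_right inter_subset_right
  have e : T = ⋃ z, T ∩ fib L j z := by rw [← inter_iUnion, iUnion_fib, inter_univ]
  rw [e, measure_iUnion hd hm, measure_iUnion hd hm]
  refine ENNReal.tsum_le_tsum fun z => ?_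
  rcases (T ∩ fib L j z).eq_empty_or_nonempty with h | ⟨x, hx, hxz⟩
  · simp [h]
  · have h1 : T ∩ fib L j z = cell L j x := by
      ext y
      constructor
      · rintro ⟨-, hy⟩
        exact Eq.trans hy (Eq.symm hxz)
      · intro hy
        exact ⟨(hT x y hy).2 hx, Eq.trans hy hxz⟩
    rw [h1]
    exact H x hx

lemma measure_some_ge_le {c : ℕ → Set (Rn n)} (hc : ∀ k, Lv L k (c k)) {N j : ℕ}
    {T : Set (Rn n)} (hT : Lv L j T) {m₁ m₂ : Measure (Rn n)}
    (H : ∀ k, j ≤ k → k ≤ N → ∀ x ∈ T, x ∈ fst_ge c j k → m₁ (cell L k x) ≤ m₂ (cell L k x)) :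
    m₁ (T ∩ some_ge c N j) ≤ m₂ (T ∩ some_ge c N j) := by
  have hF : ∀ k, j ≤ k → Lv L k (T ∩ fst_ge c j k) := fun k hk => (hT.mono hk).inter (lv_fst_ge hc j k)
  have e : T ∩ some_ge c N j = ⋃ k ∈ Finset.Icc j N, (T ∩ fst_ge c j k) := by
    ext y
    constructor
    · rintro ⟨hyT, hy⟩
      obtain ⟨k, hk, hkN, h⟩ := exists_fst_ge hy
      exact mem_iUnion₂.2 ⟨k, Finset.mem_Icc.2 ⟨hk, hkN⟩, hyT, h⟩
    · intro hy
      obtain ⟨k, hk, h⟩ := mem_iUnion₂.1 hy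
      exact ⟨h.1, k, (Finset.mem_Icc.1 hk).1, (Finset.mem_Icc.1 hk).2, h.2.1⟩
  have hd : (↑(Finset.Icc j N) : Set ℕ).PairwiseDisjoint fun k => T ∩ fst_ge c j k := by
    intro k hk k' hk' hne
    refine Set.disjoint_left.2 fun y hy hy' => ?_
    have h1 := (Finset.mem_Icc.1 (Finset.mem_coe.1 hk)).1
    have h2 := (Finset.mem_Icc.1 (Finset.mem_coe.1 hk')).1
    rcases lt_or_gt_of_ne hne with h | h
    · exact hy'.2.2 k h1 h hy.2.1
    · exact hy.2.2 k' h2 h hy'.2.1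
  have hms : ∀ k ∈ Finset.Icc j N, MeasurableSet (T ∩ fst_ge c j k) := fun k hk =>
    (hF k (Finset.mem_Icc.1 hk).1).measurableSet
  rw [e, measure_biUnion_finset hd hms, measure_biUnion_finset hd hms]
  refine Finset.sum_le_sum fun k hk => ?_
  obtain ⟨h1, h2⟩ := Finset.mem_Icc.1 hk
  exact measure_le_of_cell k (hF k h1) fun x hx => H k h1 h2 x hx.1 hx.2

/-- Quantitative comparison of `w` with Lebesgue measure on `nb 1 L j x`. -/
def Dbl (p C : ℝ) (w : Measure (Rn n)) (L : ℝ) (j : ℕ) (x : Rn n) : Prop :=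
  ∀ E ⊆ nb 1 L j x, MeasurableSet E →
    volume E ^ p * w (nb 1 L j x) ≤ ENNReal.ofReal C * w E * volume (nb 1 L j x) ^ p

lemma Dbl.half (hL : 0 < L) {p C : ℝ} (hp : 0 ≤ p) (hC : 1 ≤ C) {w : Measure (Rn n)} {j : ℕ} {x : Rn n}
    (h : Dbl p C w L j x) (hfin : w (nb 1 L j x) ≠ ∞) {F : Set (Rn n)} (hF : F ⊆ cell L j x)
    (hFm : MeasurableSet F) (hv : volume F ≤ volume (cell L j x) / 2) :
    w F ≤ ENNReal.ofReal (1 - (C * (2 * 3 ^ n : ℝ) ^ p)⁻¹) * w (cell L j x) := by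
  have hM : (1 : ℝ) ≤ (2 * 3 ^ n : ℝ) ^ p := by
    refine Real.one_le_rpow ?_ hp
    have : (1 : ℝ) ≤ 3 ^ n := one_le_pow₀ (by norm_num)
    linarith
  set D := C * (2 * 3 ^ n : ℝ) ^ p with hD
  have hD1 : 1 ≤ D := by nlinarith
  set Q := cell L j x with hQ
  have hQm : MeasurableSet Q := measurableSet_cell j x
  have hQt : volume Q ≠ ∞ := volume_cell_ne_top hL j x
  have hQ0 : volume Q ≠ 0 := (volume_cell_pos hL j x).ne'
  set G := Q \ F with hG
  have hGm : MeasurableSet G := hQm.diff hFm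
  have hsum : ∀ m : Measure (Rn n), m F + m G = m Q := fun m => by
    rw [← measure_union disjoint_sdiff_right hGm, union_sdiff_cancel hF]
  have hvG : volume Q / 2 ≤ volume G := by
    have h1 := hsum volume
    refine (ENNReal.add_le_add_iff_left (a := volume Q / 2) (ENNReal.div_ne_top hQt (by simp))).1 ?_
    calc volume Q / 2 + volume Q / 2 = volume F + volume G := by rw [ENNReal.add_halves, h1]
      _ ≤ _ := add_le_add hv le_rfl
  have hG0 : volume G ≠ 0 := fun h0 => by
    rw [h0] at hvG
    exact (ENNReal.half_pos hQ0).not_ge hvG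
  have hGt : volume G ≠ ∞ := ((measure_mono sdiff_subset).trans_lt hQt.lt_top).ne
  have hnb : volume (nb 1 L j x) ≤ ENNReal.ofReal (2 * 3 ^ n) * volume G := by
    rw [volume_nb_cell hL]
    calc _ = ENNReal.ofReal (2 * 3 ^ n) * (volume Q / 2) := by
          rw [ENNReal.ofReal_mul (by norm_num), ENNReal.ofReal_pow (by norm_num), mul_comm (ENNReal.ofReal 2),
            mul_assoc, show ENNReal.ofReal 2 = 2 by simp, ENNReal.mul_div_cancel (by simp) (by simp), hQ]
          norm_num
      _ ≤ _ := mul_le_mul_right hvG _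
  have h1 : w Q ≤ ENNReal.ofReal D * w G := by
    have h2 := h G (sdiff_subset.trans (cell_subset_nb 1 j x)) hGm
    have h3 : volume G ^ p * w (nb 1 L j x) ≤ volume G ^ p * (ENNReal.ofReal D * w G) := by
      refine h2.trans ((mul_le_mul_right (ENNReal.rpow_le_rpow hnb hp) _).trans (le_of_eq ?_))
      rw [ENNReal.mul_rpow_of_nonneg _ _ hp, ENNReal.ofReal_rpow_of_pos (by positivity), hD,
        ENNReal.ofReal_mul (by linarith)]
      ring
    refine (measure_mono (cell_subset_nb 1 j x)).trans ((ENNReal.mul_le_mul_iff_right ?_ ?_).1 h3)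
    · exact (ENNReal.rpow_pos (pos_iff_ne_zero.2 hG0) hGt).ne'
    · exact ENNReal.rpow_ne_top_of_nonneg hp hGt
  have h4 : ENNReal.ofReal D⁻¹ * w Q ≤ w G := by
    refine (mul_le_mul_right h1 _).trans (le_of_eq ?_)
    rw [← mul_assoc, ← ENNReal.ofReal_mul (by positivity), inv_mul_cancel₀ (by positivity),
      ENNReal.ofReal_one, one_mul]
  have hwQ : w Q ≠ ∞ := ((measure_mono (cell_subset_nb 1 j x)).trans_lt hfin.lt_top).ne
  refine (ENNReal.add_le_add_iff_right (a := ENNReal.ofReal D⁻¹ * w Q)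
    (ENNReal.mul_ne_top ENNReal.ofReal_ne_top hwQ)).1 ?_
  rw [← add_mul, ← ENNReal.ofReal_add (by rw [sub_nonneg]; exact inv_le_one_of_one_le₀ hD1)
    (by positivity), sub_add_cancel, ENNReal.ofReal_one, one_mul]
  calc w F + ENNReal.ofReal D⁻¹ * w Q ≤ w F + w G := add_le_add_right h4 _
    _ = w Q := hsum w

/-- The cells of `k`-th level in which `E` has density greater than `2^{-n-1}`. -/
def dense (L : ℝ) (E : Set (Rn n)) (k : ℕ) : Set (Rn n) :=
  {y | volume (cell L k y) < 2 ^ (n + 1) * volume (E ∩ cell L k y)}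

lemma lv_dense (E : Set (Rn n)) (k : ℕ) : Lv L k (dense L E k) := fun x y hy => by
  simp only [dense, mem_ofPred_eq, cell_eq hy]

section
variable {w : Measure (Rn n)} {θ : ℝ≥0∞} {Z : Set (Rn n)}

lemma decay_lv (hL : 0 < L)
    (H : ∀ j, ∀ x ∈ Z, ∀ F ⊆ cell L j x, MeasurableSet F → volume F ≤ volume (cell L j x) / 2 →
      w F ≤ θ * w (cell L j x)) (hZ : Lv L 0 Z) {j N : ℕ} (hjN : j ≤ N) {x : Rn n} (hx : x ∈ Z) (i : ℕ) :
    ∀ E, E ⊆ cell L j x → Lv L N E → 2 ^ ((n + 1) * i) * volume E ≤ volume (cell L j x) →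
      w E ≤ θ ^ i * w (cell L j x) := by
  induction i with
  | zero =>
    intro E hE _ _
    simpa using measure_mono hE
  | succ i ih =>
    intro E hE hEN hv
    have hEm := hEN.measurableSet
    have hcell : cell L j x ⊆ Z := fun y hy => (hZ x y (cell_subset (Nat.zero_le j) x hy)).2 hx
    have hj : ∀ y ∈ cell L j x, y ∉ dense L E j := by
      intro y hy hd
      have h1 := (lv_dense E j x y hy).1 hd
      simp only [dense, mem_ofPred_eq, inter_eq_self_of_subset_left hE] at h1
      refine absurd h1 (not_lt.2 (le_trans ?_ hv))
      refine mul_le_mul_left (pow_le_pow_right₀ (by norm_num) ?_) _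
      nlinarith
    set Ω := cell L j x ∩ some_ge (dense L E) N j with hΩ
    have hEΩ : E ⊆ Ω := by
      intro y hy
      refine ⟨hE hy, N, hjN, le_rfl, ?_⟩
      have h1 : cell L N y ⊆ E := fun z hz => (hEN y z hz).2 hy
      simp only [dense, mem_ofPred_eq, inter_eq_self_of_subset_right h1]
      have h0 := (volume_cell_pos hL N y).ne'
      have ht := volume_cell_ne_top hL N y
      calc volume (cell L N y) = 1 * volume (cell L N y) := (one_mul _).symm
        _ < _ := (ENNReal.mul_lt_mul_iff_left h0 ht).2 (one_lt_pow₀ (by norm_num) (by omega))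
    have hvΩ : volume Ω ≤ 2 ^ (n + 1) * volume E := by
      have h1 := measure_some_ge_le (lv_dense (L := L) E) (N := N) (lv_cell j x) (m₁ := volume)
        (m₂ := (2 ^ (n + 1) : ℝ≥0∞) • volume.restrict E) (by
          intro k _ _ y _ hy
          have h2 := hy.1
          simp only [dense, mem_ofPred_eq] at h2
          rw [Measure.smul_apply, Measure.restrict_apply (measurableSet_cell k y), inter_comm]
          exact h2.le)
      refine h1.trans ?_
      rw [Measure.smul_apply, Measure.restrict_apply' hEm, smul_eq_mul]
      exact mul_le_mul_right (measure_mono inter_subset_right) _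
    have hwE : w E ≤ θ * w Ω := by
      have h1 := measure_some_ge_le (lv_dense (L := L) E) (N := N) (lv_cell j x) (m₁ := w.restrict E)
        (m₂ := θ • w) (by
          intro k hk _ y hyj hy
          rw [Measure.smul_apply, Measure.restrict_apply (measurableSet_cell k y), inter_comm, smul_eq_mul]
          refine H k y (hcell hyj) _ inter_subset_right (hEm.inter (measurableSet_cell k y)) ?_
          have hkj : j ≠ k := by
            rintro rfl
            exact hj y hyj hy.1
          obtain ⟨m, rfl⟩ : ∃ m, k = m + 1 := ⟨k - 1, by omega⟩
          have h2 := hy.2 m (by omega) (by omega)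
          simp only [dense, mem_ofPred_eq, not_lt] at h2
          rw [volume_cell_succ hL] at h2
          have h3 : 2 ^ (n + 1) * volume (E ∩ cell L (m + 1) y) ≤ 2 ^ n * volume (cell L (m + 1) y) :=
            (mul_le_mul_right (measure_mono (inter_subset_inter_right _ (cell_succ_subset m y))) _).trans h2
          rw [pow_succ, mul_assoc, ENNReal.mul_le_mul_iff_right (by simp) (by simp)] at h3
          rwa [ENNReal.le_div_iff_mul_le (by simp) (by simp), mul_comm])
      rw [Measure.smul_apply, Measure.restrict_apply' hEm, smul_eq_mul,
        inter_eq_self_of_subset_right hEΩ] at h1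
      exact h1
    have hΩN : Lv L N Ω := by
      refine ((lv_cell j x).mono hjN).inter fun z y hy => ?_
      exact exists_congr fun k => and_congr_right fun _ => and_congr_right fun hk =>
        (lv_dense E k).mono hk z y hy
    have h5 := ih Ω inter_subset_left hΩN (by
      refine (mul_le_mul_right hvΩ _).trans (le_trans (le_of_eq ?_) hv)
      rw [← mul_assoc, ← pow_add]
      congr 2)
    calc w E ≤ θ * w Ω := hwE
      _ ≤ θ * (θ ^ i * w (cell L j x)) := mul_le_mul_right h5 _
      _ = _ := by rw [pow_succ]; ring

lemma decay_measurable (hL : 0 < L)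
    (H : ∀ j, ∀ x ∈ Z, ∀ F ⊆ cell L j x, MeasurableSet F → volume F ≤ volume (cell L j x) / 2 →
      w F ≤ θ * w (cell L j x)) (hZ : Lv L 0 Z) {j : ℕ} {x : Rn n} (hx : x ∈ Z) (i : ℕ)
    {E : Set (Rn n)} (hE : E ⊆ cell L j x)
    (hv : 2 ^ ((n + 1) * i) * volume E < volume (cell L j x)) :
    w E ≤ θ ^ i * w (cell L j x) := by
  have hpow0 : (2 : ℝ≥0∞) ^ ((n + 1) * i) ≠ 0 := by simp
  have hpowt : (2 : ℝ≥0∞) ^ ((n + 1) * i) ≠ ∞ := by simp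
  have hlt : volume E < volume (cell L j x) / 2 ^ ((n + 1) * i) := by
    rw [ENNReal.lt_div_iff_mul_lt (Or.inl hpow0) (Or.inl hpowt), mul_comm]
    exact hv
  obtain ⟨O, hEO, hO, hvO⟩ := E.exists_isOpen_lt_of_lt _ hlt
  let OO : ℕ → Set (Rn n) := fun m => cell L j x ∩ {y | cell L (j + m) y ⊆ O}
  have hmono : Monotone OO := monotone_nat_of_le_succ fun m y hy =>
    ⟨hy.1, (cell_subset (by omega) y).trans hy.2⟩
  have hOO : E ⊆ ⋃ m, OO m := by
    intro y hy
    obtain ⟨ε, hε, hb⟩ := Metric.isOpen_iff.1 hO y (hEO hy)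
    obtain ⟨m, hm⟩ := exists_nat_gt ((n * L) / ε)
    refine mem_iUnion.2 ⟨m, hE hy, fun z hz => hb ?_⟩
    have h1 := norm_sub_le_of_mem_cell hL hz
    rw [mem_ball_iff_norm]
    refine h1.trans_lt ?_
    have h2 : (m : ℝ) < 2 ^ m := by exact_mod_cast Nat.lt_two_pow_self
    have h3 : side L (j + m) ≤ side L m := side_anti hL (by omega)
    refine (mul_le_mul_of_nonneg_left h3 (Nat.cast_nonneg n)).trans_lt ?_
    unfold side
    rw [← mul_div_assoc, div_lt_iff₀ (by positivity)]
    rw [div_lt_iff₀ hε] at hm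
    nlinarith
  refine (measure_mono hOO).trans ?_
  rw [hmono.measure_iUnion]
  refine iSup_le fun m => ?_
  refine decay_lv hL H hZ (Nat.le_add_right j m) hx i _ inter_subset_left ?_ ?_
  · refine ((lv_cell j x).mono (Nat.le_add_right j m)).inter fun z y hy => ?_
    simp only [mem_ofPred_eq, cell_eq hy]
  · have h1 : volume (OO m) ≤ volume (cell L j x) / 2 ^ ((n + 1) * i) :=
      (measure_mono fun y hy => hy.2 (mem_cell_self _ y)).trans hvO.le
    rw [ENNReal.le_div_iff_mul_le (Or.inl hpow0) (Or.inl hpowt)] at h1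
    rwa [mul_comm]

end

/-- `A_∞` type estimate on cells and their neighbourhoods. -/
lemma exists_ainf (n : ℕ) {p C : ℝ} (hp : 0 ≤ p) (hC : 1 ≤ C) :
    ∃ ε D : ℝ, 0 < ε ∧ 1 ≤ D ∧ ∀ (L : ℝ), 0 < L → ∀ (w : Measure (Rn n)) (Z : Set (Rn n)), Lv L 0 Z →
      (∀ j, ∀ x ∈ Z, w (nb 1 L j x) ≠ ∞ ∧ Dbl p C w L j x) →
      ∀ j x, nb 1 L j x ⊆ Z → ∀ E ⊆ nb 1 L j x, MeasurableSet E → ∀ t : ℝ, 0 < t →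
        volume E ≤ ENNReal.ofReal t * volume (cell L j x) →
        w E ≤ ENNReal.ofReal (D * t ^ ε) * w (nb 1 L j x) := by
  have hM : (1 : ℝ) < C * (2 * 3 ^ n : ℝ) ^ p + 1 := by
    have : (0 : ℝ) < (2 * 3 ^ n : ℝ) ^ p := by positivity
    nlinarith
  set κ : ℝ := (C * (2 * 3 ^ n : ℝ) ^ p + 1)⁻¹ with hκ
  have hκ0 : 0 < κ := by positivity
  have hκ1 : κ < 1 := inv_lt_one_of_one_lt₀ hM
  set θ : ℝ := 1 - κ with hθ
  have hθ0 : 0 < θ := by linarith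
  have hθ1 : θ < 1 := by linarith
  set y : ℝ := (2 ^ (n + 1))⁻¹ with hy
  have hy0 : 0 < y := by positivity
  have hy1 : y < 1 := inv_lt_one_of_one_lt₀ (one_lt_pow₀ (by norm_num) (by omega))
  set ε : ℝ := Real.log θ / Real.log y with hε
  have hlθ := Real.log_neg hθ0 hθ1
  have hly := Real.log_neg hy0 hy1
  have hε0 : 0 < ε := div_pos_of_neg_of_neg hlθ hly
  have hyε : y ^ ε = θ := by
    rw [Real.rpow_def_of_pos hy0, hε, mul_div_cancel₀ _ hly.ne, Real.exp_log hθ0]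
  refine ⟨ε, (θ ^ 2)⁻¹, hε0, (one_le_inv₀ (by positivity)).2 (pow_le_one₀ hθ0.le hθ1.le),
    fun L hL w Z hZ hw j x hxZ E hE hEm t ht hv => ?_⟩
  have H : ∀ j, ∀ x ∈ Z, ∀ F ⊆ cell L j x, MeasurableSet F → volume F ≤ volume (cell L j x) / 2 →
      w F ≤ ENNReal.ofReal θ * w (cell L j x) := by
    intro j x hx F hF hFm hFv
    refine ((hw j x hx).2.half hL hp hC (hw j x hx).1 hF hFm hFv).trans ?_
    refine mul_le_mul_left (ENNReal.ofReal_le_ofReal ?_) _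
    rw [hθ, hκ]
    have : (C * (2 * 3 ^ n : ℝ) ^ p + 1)⁻¹ ≤ (C * (2 * 3 ^ n : ℝ) ^ p)⁻¹ :=
      inv_anti₀ (by positivity) (by linarith)
    linarith
  have hlvnb : Lv L j (nb 1 L j x) := fun z y hy => by
    rw [mem_nb_comm, nb_eq hy, mem_nb_comm]
  have key := measure_le_of_cell j hlvnb (m₁ := w.restrict E)
    (m₂ := ENNReal.ofReal ((θ ^ 2)⁻¹ * t ^ ε) • w) (by
    intro z hz
    have hzZ := hxZ hz
    rw [Measure.smul_apply, Measure.restrict_apply (measurableSet_cell j z), smul_eq_mul, inter_comm]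
    have hv1 : volume (E ∩ cell L j z) ≤ ENNReal.ofReal t * volume (cell L j z) := by
      rw [volume_cell hL] at hv ⊢
      exact (measure_mono inter_subset_left).trans hv
    rcases le_or_gt 1 t with h1 | h1
    · refine (measure_mono inter_subset_right).trans ?_
      conv_lhs => rw [← one_mul (w (cell L j z))]
      refine mul_le_mul_left ?_ _
      rw [ENNReal.one_le_ofReal]
      have h2 : 1 ≤ (θ ^ 2)⁻¹ := (one_le_inv₀ (by positivity)).2 (pow_le_one₀ hθ0.le hθ1.le)
      have h3 := Real.one_le_rpow h1 hε0.le
      nlinarith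
    · obtain ⟨m, hm1, hm2⟩ := exists_nat_pow_near_of_lt_one ht h1.le hy0 hy1
      have hθt : θ ^ (m + 1) ≤ t ^ ε := by
        calc θ ^ (m + 1) = (y ^ (m + 1)) ^ ε := by
              rw [← hyε, ← Real.rpow_natCast, ← Real.rpow_natCast, ← Real.rpow_mul hy0.le,
                ← Real.rpow_mul hy0.le, mul_comm]
          _ ≤ _ := Real.rpow_le_rpow (by positivity) hm1.le hε0.le
      have hfac : θ ^ (m - 1) ≤ (θ ^ 2)⁻¹ * t ^ ε := by
        rw [inv_mul_eq_div, le_div_iff₀ (by positivity), ← pow_add]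
        refine le_trans ?_ hθt
        exact pow_le_pow_of_le_one hθ0.le hθ1.le (by omega)
      have hdec : w (E ∩ cell L j z) ≤ ENNReal.ofReal θ ^ (m - 1) * w (cell L j z) := by
        rcases Nat.eq_zero_or_pos m with rfl | hm
        · simpa using measure_mono inter_subset_right
        refine decay_measurable hL H hZ hzZ (m - 1) inter_subset_right ?_
        refine (mul_le_mul_right hv1 _).trans_lt ?_
        rw [← mul_assoc]
        conv_rhs => rw [← one_mul (volume (cell L j z))]
        refine (ENNReal.mul_lt_mul_iff_left (volume_cell_pos hL j z).ne' (volume_cell_ne_top hL j z)).2 ?_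
        rw [show (2 : ℝ≥0∞) = ENNReal.ofReal 2 by simp, ← ENNReal.ofReal_pow (by norm_num),
          ← ENNReal.ofReal_mul (by positivity), ← ENNReal.ofReal_one,
          ENNReal.ofReal_lt_ofReal_iff (by norm_num)]
        have e1 : ((2 : ℝ) ^ ((n + 1) * (m - 1))) * y ^ (m - 1) = 1 := by
          rw [pow_mul, ← mul_pow, hy, mul_inv_cancel₀ (by positivity), one_pow]
        have e2 : y ^ m = y ^ (m - 1) * y := by rw [← pow_succ]; congr 1; omega
        calc (2 : ℝ) ^ ((n + 1) * (m - 1)) * t ≤ 2 ^ ((n + 1) * (m - 1)) * y ^ m := by gcongr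
          _ = y := by rw [e2, ← mul_assoc, e1, one_mul]
          _ < 1 := hy1
      refine hdec.trans (mul_le_mul_left ?_ _)
      rw [← ENNReal.ofReal_pow hθ0.le]
      exact ENNReal.ofReal_le_ofReal hfac)
  rw [Measure.smul_apply, Measure.restrict_apply' hEm, inter_eq_self_of_subset_right hE,
    smul_eq_mul] at key
  exact key

end

section

variable {n : ℕ} {L : ℝ}

/-- The weighted measure `U dx`. -/
def dn (U : Rn n → ℝ≥0∞) : Measure (Rn n) := volume.withDensity U

lemma dn_apply (U : Rn n → ℝ≥0∞) {E : Set (Rn n)} (hE : MeasurableSet E) :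
    dn U E = ∫⁻ y in E, U y := withDensity_apply U hE

/-- The real number `2 ^ k` as an extended nonnegative real. -/
def tw (k : ℤ) : ℝ≥0∞ := ENNReal.ofReal ((2 : ℝ) ^ k)

lemma tw_ne_zero (k : ℤ) : tw k ≠ 0 := (ENNReal.ofReal_pos.2 (by positivity)).ne'

lemma tw_ne_top (k : ℤ) : tw k ≠ ∞ := ENNReal.ofReal_ne_top

lemma tw_add (k m : ℤ) : tw (k + m) = tw k * tw m := by
  unfold tw
  rw [← ENNReal.ofReal_mul (by positivity), zpow_add₀ (by norm_num)]

lemma tw_one : tw 1 = 2 := by simp [tw]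

lemma tw_succ (k : ℤ) : tw (k + 1) = 2 * tw k := by rw [tw_add, tw_one, mul_comm]

lemma tw_mono : Monotone tw := fun k m h =>
  ENNReal.ofReal_le_ofReal (zpow_le_zpow_right₀ (by norm_num) h)

lemma exists_tw {a : ℝ≥0∞} (h0 : a ≠ 0) (ht : a ≠ ∞) : ∃ k : ℤ, tw k < a ∧ a ≤ tw (k + 1) := by
  have hpos : 0 < a.toReal := ENNReal.toReal_pos h0 ht
  obtain ⟨k, hk1, hk2⟩ := exists_mem_Ioc_zpow hpos (by norm_num : (1 : ℝ) < 2)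
  refine ⟨k, ?_, ?_⟩
  · unfold tw
    rwa [ENNReal.ofReal_lt_iff_lt_toReal (by positivity) ht]
  · unfold tw
    rwa [ENNReal.le_ofReal_iff_toReal_le ht (by positivity)]

/-- Standing assumptions for the local estimate around the cell of `x₀`. -/
structure Ctx (p C ε D L : ℝ) (x₀ : Rn n) (U V : Rn n → ℝ≥0∞) : Prop where
  hL : 0 < L
  hp : 1 ≤ p
  hC : 1 ≤ C
  hε : 0 < ε
  hD : 1 ≤ D
  mU : Measurable U
  mV : Measurable V
  finU : ∀ j, ∀ x ∈ nb 2 L 0 x₀, dn U (nb 1 L j x) ≠ ∞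
  finV : ∀ j, ∀ x ∈ nb 2 L 0 x₀, dn V (nb 1 L j x) ≠ ∞
  posV : ∀ j, ∀ x ∈ nb 2 L 0 x₀, dn V (nb 1 L j x) ≠ 0
  aOne : ∀ j, ∀ x ∈ nb 2 L 0 x₀, ∀ᵐ y, y ∈ nb 1 L j x →
    dn U (nb 1 L j x) ≤ ENNReal.ofReal C * volume (cell L j x) * U y
  dbl : ∀ j, ∀ x ∈ nb 2 L 0 x₀, Dbl p C (dn V) L j x
  infU : ∀ j, ∀ x ∈ nb 1 L 0 x₀, ∀ E ⊆ nb 1 L j x, MeasurableSet E → ∀ t : ℝ, 0 < t →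
    volume E ≤ ENNReal.ofReal t * volume (cell L j x) →
    dn U E ≤ ENNReal.ofReal (D * t ^ ε) * dn U (nb 1 L j x)
  infV : ∀ j, ∀ x ∈ nb 1 L 0 x₀, ∀ E ⊆ nb 1 L j x, MeasurableSet E → ∀ t : ℝ, 0 < t →
    volume E ≤ ENNReal.ofReal t * volume (cell L j x) →
    dn V E ≤ ENNReal.ofReal (D * t ^ ε) * dn V (nb 1 L j x)

/-- The level set `2 ^ k < V ≤ 2 ^ (k + 1)`. -/
def dyad (V : Rn n → ℝ≥0∞) (k : ℤ) : Set (Rn n) := {x | tw k < V x ∧ V x ≤ tw (k + 1)}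

lemma measurableSet_dyad {V : Rn n → ℝ≥0∞} (hV : Measurable V) (k : ℤ) : MeasurableSet (dyad V k) :=
  (measurableSet_lt measurable_const hV).inter (measurableSet_le hV measurable_const)

/-- The ratio `2 ^ (-1/p)`. -/
def rp (p : ℝ) : ℝ := (1 / 2 : ℝ) ^ (1 / p)

lemma rp_pos (p : ℝ) : 0 < rp p := by unfold rp; positivity

lemma rp_lt_one {p : ℝ} (hp : 1 ≤ p) : rp p < 1 :=
  Real.rpow_lt_one (by norm_num) (by norm_num) (by positivity)

lemma half_le_rp {p : ℝ} (hp : 1 ≤ p) : 1 / 2 ≤ rp p := by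
  have h : 1 / p ≤ 1 := by rw [div_le_one (by linarith)]; exact hp
  calc (1 / 2 : ℝ) = (1 / 2 : ℝ) ^ (1 : ℝ) := (Real.rpow_one _).symm
    _ ≤ _ := Real.rpow_le_rpow_of_exponent_ge (by norm_num) (by norm_num) h

/-- Constant in `Ctx.volume_lev_le`. -/
def kl (n : ℕ) (p C : ℝ) : ℝ := 2 * C * 3 ^ n * ((3 : ℝ) ^ n) ^ p

lemma real_lev_bound {n : ℕ} {p C f q : ℝ} (hp : 1 ≤ p) (hC : 1 ≤ C) (hf : 0 ≤ f) (hq : 0 < q)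
    (hfq : f ≤ 3 ^ n * q) {k e : ℤ} (hke : k ≤ e)
    (h : f ^ p * (2 ^ e * q) ≤ C * (2 ^ (k + 1) * f) * (3 ^ n * q) ^ p) :
    f ≤ kl n p C * rp p ^ (e - k).toNat * q := by
  have hp0 : p ≠ 0 := by linarith
  have h3 : (0 : ℝ) < 3 ^ n := by positivity
  have h31 : (1 : ℝ) ≤ 3 ^ n := one_le_pow₀ (by norm_num)
  have h3p : (1 : ℝ) ≤ ((3 : ℝ) ^ n) ^ p := Real.one_le_rpow h31 (by linarith)
  set s := f / q with hs
  have hfs : f = s * q := by rw [hs]; field_simp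
  have hs0 : 0 ≤ s := by positivity
  have hs3 : s ≤ 3 ^ n := by rw [hs, div_le_iff₀ hq]; exact hfq
  have hK : 1 ≤ kl n p C := by
    unfold kl
    have : 1 ≤ C * 3 ^ n := one_le_mul_of_one_le_of_one_le hC h31
    nlinarith [one_le_mul_of_one_le_of_one_le this h3p]
  have h2e : (0 : ℝ) < 2 ^ e := by positivity
  have hqp : 0 < q ^ p := by positivity
  have h1 : s ^ p ≤ kl n p C * (1 / 2) ^ (e - k).toNat := by
    have e1 : ((1 : ℝ) / 2) ^ (e - k).toNat * 2 ^ e = 2 ^ k := by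
      rw [one_div, inv_pow, ← zpow_natCast, Int.toNat_of_nonneg (by omega), ← zpow_neg, ← zpow_add₀ (by norm_num)]
      congr 1; ring
    rw [hfs, Real.mul_rpow hs0 hq.le, Real.mul_rpow h3.le hq.le, zpow_add_one₀ (by norm_num)] at h
    have h4 : s ^ p * 2 ^ e * (q ^ p * q) ≤ C * (2 ^ k * 2 * s) * (3 ^ n) ^ p * (q ^ p * q) := by
      nlinarith
    have h5 := le_of_mul_le_mul_right h4 (by positivity)
    have h6 : C * (2 ^ k * 2 * s) * (3 ^ n) ^ p ≤ C * (2 ^ k * 2 * 3 ^ n) * (3 ^ n) ^ p := by gcongr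
    refine le_of_mul_le_mul_right (h5.trans (h6.trans (le_of_eq ?_))) h2e
    rw [mul_assoc (kl n p C), e1, kl]
    ring
  have h2 : s ≤ kl n p C * rp p ^ (e - k).toNat := by
    have h3 : (s ^ p) ^ (1 / p) ≤ (kl n p C * (1 / 2) ^ (e - k).toNat) ^ (1 / p) :=
      Real.rpow_le_rpow (by positivity) h1 (by positivity)
    rw [← Real.rpow_mul hs0, mul_one_div_cancel hp0, Real.rpow_one,
      Real.mul_rpow (by linarith) (by positivity)] at h3
    refine h3.trans (mul_le_mul ?_ (le_of_eq ?_) (by positivity) (by linarith))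
    · calc kl n p C ^ (1 / p) ≤ kl n p C ^ (1 : ℝ) :=
          Real.rpow_le_rpow_of_exponent_le hK (by rw [div_le_one (by linarith)]; exact hp)
        _ = _ := Real.rpow_one _
    · unfold rp
      rw [← Real.rpow_natCast, ← Real.rpow_natCast, ← Real.rpow_mul (by norm_num),
        ← Real.rpow_mul (by norm_num), mul_comm]
  rw [hfs]
  exact mul_le_mul_of_nonneg_right h2 hq.le

section
variable {p C ε D : ℝ} {x₀ : Rn n} {U V : Rn n → ℝ≥0∞}

lemma Ctx.volume_lev_le (H : Ctx p C ε D L x₀ U V) {j : ℕ} {y : Rn n} (hy : y ∈ nb 2 L 0 x₀)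
    {k e : ℤ} (he1 : tw e * volume (cell L j y) ≤ dn V (nb 1 L j y))
    (he2 : dn V (nb 1 L j y) ≤ tw (e + 1) * volume (cell L j y)) :
    volume (dyad V k ∩ nb 1 L j y) ≤
      ENNReal.ofReal (kl n p C * rp p ^ (k - e).natAbs) * volume (cell L j y) := by
  have hL := H.hL
  have hp := H.hp
  have hC := H.hC
  set F := dyad V k ∩ nb 1 L j y with hF
  have hFm : MeasurableSet F := (measurableSet_dyad H.mV k).inter (measurableSet_nb 1 j y)
  have hFnb : F ⊆ nb 1 L j y := inter_subset_right
  have hFt : volume F ≠ ∞ := ((measure_mono hFnb).trans_lt (volume_nb_ne_top hL 1 j y).lt_top).ne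
  have hq : 0 < side L j ^ n := pow_pos (side_pos hL j) n
  have hQ : volume (cell L j y) = ENNReal.ofReal (side L j ^ n) := volume_cell hL j y
  have h31 : (1 : ℝ) ≤ 3 ^ n := one_le_pow₀ (by norm_num)
  have h3p : (1 : ℝ) ≤ ((3 : ℝ) ^ n) ^ p := Real.one_le_rpow h31 (by linarith)
  have hK : 2 ≤ kl n p C := by
    unfold kl
    have : 1 ≤ C * 3 ^ n := one_le_mul_of_one_le_of_one_le hC h31
    nlinarith [one_le_mul_of_one_le_of_one_le this h3p]
  rcases le_or_gt e k with hek | hek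
  · have h1 : tw k * volume F ≤ tw (e + 1) * volume (cell L j y) := by
      refine le_trans ?_ he2
      refine le_trans ?_ (measure_mono hFnb)
      rw [dn_apply V hFm, ← setLIntegral_const]
      exact setLIntegral_mono H.mV fun x hx => hx.1.1.le
    have h2 : volume F ≤ ENNReal.ofReal (2 * (1 / 2) ^ (k - e).natAbs) * volume (cell L j y) := by
      refine (ENNReal.mul_le_mul_iff_right (tw_ne_zero k) (tw_ne_top k)).1 (h1.trans (le_of_eq ?_))
      rw [← mul_assoc]
      congr 1
      unfold tw
      rw [← ENNReal.ofReal_mul (by positivity)]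
      congr 1
      rw [one_div, inv_pow, ← zpow_natCast, Int.natAbs_of_nonneg (by omega), ← zpow_neg,
        zpow_add_one₀ (by norm_num), mul_left_comm, ← zpow_add₀ (by norm_num), mul_comm]
      congr 2
      ring
    refine h2.trans (mul_le_mul_left (ENNReal.ofReal_le_ofReal ?_) _)
    exact mul_le_mul hK (pow_le_pow_left₀ (by norm_num) (half_le_rp hp) _) (by positivity) (by linarith)
  · have hvF : dn V F ≤ tw (k + 1) * volume F := by
      rw [dn_apply V hFm, ← setLIntegral_const]
      exact setLIntegral_mono measurable_const fun x hx => hx.1.2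
    have h1 := H.dbl j y hy F hFnb hFm
    have h2 : volume F ^ p * (tw e * volume (cell L j y)) ≤
        ENNReal.ofReal C * (tw (k + 1) * volume F) * volume (nb 1 L j y) ^ p :=
      (mul_le_mul_right he1 _).trans (h1.trans (mul_le_mul_left (mul_le_mul_right hvF _) _))
    have hfe : volume F = ENNReal.ofReal (volume F).toReal := (ENNReal.ofReal_toReal hFt).symm
    have hnb : volume (nb 1 L j y) = ENNReal.ofReal (3 ^ n * side L j ^ n) := by
      rw [volume_nb hL, ← mul_pow]; norm_num
    have hf0 : 0 ≤ (volume F).toReal := ENNReal.toReal_nonneg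
    have hf3 : (volume F).toReal ≤ 3 ^ n * side L j ^ n := by
      refine ENNReal.toReal_le_of_le_ofReal (by positivity) ?_
      rw [← hnb]
      exact measure_mono hFnb
    have e1 : (k - e).natAbs = (e - k).toNat := by omega
    rw [e1, hQ, hfe, ← ENNReal.ofReal_mul (mul_nonneg (by linarith) (pow_nonneg (rp_pos p).le _))]
    refine ENNReal.ofReal_le_ofReal (real_lev_bound hp hC hf0 hq hf3 hek.le ?_)
    rw [hQ, hnb, hfe, tw, tw, ENNReal.ofReal_rpow_of_nonneg hf0 (by linarith),
      ENNReal.ofReal_rpow_of_nonneg (by positivity) (by linarith), ← ENNReal.ofReal_mul (by positivity),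
      ← ENNReal.ofReal_mul (by positivity), ← ENNReal.ofReal_mul (by positivity),
      ← ENNReal.ofReal_mul (by linarith), ← ENNReal.ofReal_mul (by positivity),
      ENNReal.ofReal_le_ofReal_iff (by positivity)] at h2
    exact h2

lemma Ctx.infU_two (H : Ctx p C ε D L x₀ U V) {j : ℕ} {y : Rn n} (hy : y ∈ nb 1 L 0 x₀)
    {E : Set (Rn n)} (hE : E ⊆ nb 1 L j y) (hEm : MeasurableSet E) {t s : ℝ} (ht : 0 < t) (hs : 0 < s)
    (h1 : volume E ≤ ENNReal.ofReal t * volume (cell L j y))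
    (h2 : volume E ≤ ENNReal.ofReal s * volume (cell L j y)) :
    dn U E ≤ ENNReal.ofReal (D * t ^ (ε / 2) * s ^ (ε / 2)) * dn U (nb 1 L j y) := by
  have hε := H.hε
  have hD := H.hD
  have key : ∀ a b : ℝ, 0 < a → a ≤ b → D * a ^ ε ≤ D * a ^ (ε / 2) * b ^ (ε / 2) := by
    intro a b ha hab
    rw [mul_assoc]
    refine mul_le_mul_of_nonneg_left ?_ (by linarith)
    calc a ^ ε = a ^ (ε / 2) * a ^ (ε / 2) := by rw [← Real.rpow_add ha]; congr 1; ring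
      _ ≤ _ := by gcongr
  rcases le_total t s with h | h
  · refine (H.infU j y hy E hE hEm t ht h1).trans (mul_le_mul_left (ENNReal.ofReal_le_ofReal ?_) _)
    exact key t s ht h
  · refine (H.infU j y hy E hE hEm s hs h2).trans (mul_le_mul_left (ENNReal.ofReal_le_ofReal ?_) _)
    refine (key s t hs h).trans (le_of_eq ?_)
    ring

/-- The decay ratio in `Ctx.dn_lev_cnt_le`. -/
def qr (p ε : ℝ) : ℝ := rp p ^ (ε / 2)

lemma qr_pos (p ε : ℝ) : 0 < qr p ε := Real.rpow_pos_of_pos (rp_pos p) _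

lemma qr_lt_one {p ε : ℝ} (hp : 1 ≤ p) (hε : 0 < ε) : qr p ε < 1 :=
  Real.rpow_lt_one (rp_pos p).le (rp_lt_one hp) (by linarith)

/-- Constant in `Ctx.dn_lev_cnt_le`. -/
def kd (n : ℕ) (p C ε D : ℝ) : ℝ := D * ((3 : ℝ) ^ n) ^ (ε / 2) * kl n p C ^ (ε / 2)

lemma Ctx.dn_lev_cnt_le (H : Ctx p C ε D L x₀ U V) {K : ℕ} (hK : ((1 / 2 : ℝ) ^ K) ^ (ε / 2) ≤ 1 / 4)
    {d₁ : ℤ} {c : ℕ → Set (Rn n)} (hc : ∀ k, Lv L k (c k)) {N : ℕ} (hs : Sps L N c)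
    {j : ℕ} {y : Rn n} (hy : y ∈ nb 1 L 0 x₀) {m l d : ℤ}
    (he1 : tw (m + l) * volume (cell L j y) ≤ dn V (nb 1 L j y))
    (he2 : dn V (nb 1 L j y) ≤ tw (m + l + 1) * volume (cell L j y)) :
    tw d * dn U (dyad V (m + d) ∩ {x | K * (d - d₁).toNat + 1 ≤ cnt c N j x} ∩ nb 1 L j y) ≤
      ENNReal.ofReal (2 ^ d₁ * kd n p C ε D * (1 / 2) ^ (d - d₁).natAbs * qr p ε ^ (d - l).natAbs) *
        dn U (nb 1 L j y) := by
  have hε := H.hε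
  have hD := H.hD
  have hC := H.hC
  have hL := H.hL
  have hkl : 0 < kl n p C := by unfold kl; positivity
  set i := (d - d₁).toNat with hi
  set W : Set (Rn n) := {x | K * i + 1 ≤ cnt c N j x} with hW
  have hWm : MeasurableSet W := measurableSet_le measurable_const (measurable_cnt hc N j)
  have hEm : MeasurableSet (dyad V (m + d) ∩ W ∩ nb 1 L j y) :=
    ((measurableSet_dyad H.mV _).inter hWm).inter (measurableSet_nb 1 j y)
  have hlv : Lv L j (nb 1 L j y) := fun z w hw => by rw [mem_nb_comm, nb_eq hw, mem_nb_comm]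
  have h1 : volume (dyad V (m + d) ∩ W ∩ nb 1 L j y) ≤
      ENNReal.ofReal (3 ^ n * (1 / 2) ^ (K * i)) * volume (cell L j y) := by
    refine (measure_mono (inter_subset_inter_left _ inter_subset_right)).trans ?_
    refine (measure_cnt_le' hc hs (K * i) hlv).trans (le_of_eq ?_)
    rw [volume_nb_cell hL, ENNReal.ofReal_mul (by positivity), ENNReal.ofReal_pow (by norm_num),
      ENNReal.ofReal_pow (by norm_num), ← mul_assoc, mul_comm (ENNReal.ofReal 3 ^ n)]
    congr 3
    · rw [one_div, ENNReal.ofReal_inv_of_pos (by norm_num)]; simp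
    · norm_num
  have h2 : volume (dyad V (m + d) ∩ W ∩ nb 1 L j y) ≤
      ENNReal.ofReal (kl n p C * rp p ^ (d - l).natAbs) * volume (cell L j y) := by
    refine (measure_mono (inter_subset_inter_left _ inter_subset_left)).trans ?_
    have := H.volume_lev_le (nb_mono (by norm_num) 0 x₀ hy) (k := m + d) he1 he2
    rwa [show m + d - (m + l) = d - l by ring] at this
  have h3 := H.infU_two hy inter_subset_right hEm (by positivity)
    (mul_pos hkl (pow_pos (rp_pos p) _)) h1 h2
  refine (mul_le_mul_right h3 _).trans ?_
  rw [← mul_assoc]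
  refine mul_le_mul_left ?_ _
  rw [tw, ← ENNReal.ofReal_mul (by positivity)]
  refine ENNReal.ofReal_le_ofReal ?_
  have hr := rp_pos p
  have e1 : (kl n p C * rp p ^ (d - l).natAbs) ^ (ε / 2) = kl n p C ^ (ε / 2) * qr p ε ^ (d - l).natAbs := by
    rw [Real.mul_rpow hkl.le (by positivity), qr, ← Real.rpow_natCast, ← Real.rpow_natCast,
      ← Real.rpow_mul hr.le, ← Real.rpow_mul hr.le, mul_comm (ε / 2)]
  have e2 : ((3 : ℝ) ^ n * (1 / 2) ^ (K * i)) ^ (ε / 2) ≤ ((3 : ℝ) ^ n) ^ (ε / 2) * (1 / 4) ^ i := by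
    rw [Real.mul_rpow (by positivity) (by positivity)]
    refine mul_le_mul_of_nonneg_left ?_ (by positivity)
    calc (((1 : ℝ) / 2) ^ (K * i)) ^ (ε / 2) = (((1 / 2) ^ K) ^ (ε / 2)) ^ i := by
          rw [pow_mul, ← Real.rpow_natCast (((1 / 2) ^ K) ^ (ε / 2)), ← Real.rpow_mul (by positivity),
            mul_comm (ε / 2), Real.rpow_mul (by positivity), Real.rpow_natCast]
      _ ≤ _ := pow_le_pow_left₀ (by positivity) hK i
  have e3 : (2 : ℝ) ^ d * (1 / 4) ^ i ≤ 2 ^ d₁ * (1 / 2) ^ (d - d₁).natAbs := by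
    rcases le_total d₁ d with h | h
    · have hd : d = d₁ + i := by omega
      have hd' : (d - d₁).natAbs = i := by omega
      rw [hd', hd, zpow_add₀ (by norm_num), zpow_natCast, mul_assoc, ← mul_pow]
      norm_num
    · have hi0 : i = 0 := by omega
      have hd : d = d₁ + -((d - d₁).natAbs : ℤ) := by omega
      rw [hi0, pow_zero, mul_one]
      conv_lhs => rw [hd]
      rw [zpow_add₀ (by norm_num), zpow_neg, zpow_natCast, one_div, inv_pow]
  have hq := qr_pos p ε
  rw [e1]
  calc (2 : ℝ) ^ d * (D * (3 ^ n * (1 / 2) ^ (K * i)) ^ (ε / 2) *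
        (kl n p C ^ (ε / 2) * qr p ε ^ (d - l).natAbs))
      ≤ 2 ^ d * (D * (((3 : ℝ) ^ n) ^ (ε / 2) * (1 / 4) ^ i) *
        (kl n p C ^ (ε / 2) * qr p ε ^ (d - l).natAbs)) := by gcongr
    _ = (2 ^ d * (1 / 4) ^ i) * (kd n p C ε D * qr p ε ^ (d - l).natAbs) := by unfold kd; ring
    _ ≤ (2 ^ d₁ * (1 / 2) ^ (d - d₁).natAbs) * (kd n p C ε D * qr p ε ^ (d - l).natAbs) := by
        refine mul_le_mul_of_nonneg_right e3 ?_
        unfold kd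
        positivity
    _ = _ := by ring

end

end

section

variable {n : ℕ} {L : ℝ}

/-- Cells on which the average of `|g|` exceeds `3 ^ (-n) * 2 ^ m`. -/
def hi (L : ℝ) (g : Rn n → ℝ) (m : ℤ) (j : ℕ) : Set (Rn n) := {y | tw m < 3 ^ n * am L j g y}

lemma lv_hi (g : Rn n → ℝ) (m : ℤ) (j : ℕ) : Lv L j (hi L g m j) := fun x y hy => by
  simp only [hi, mem_ofPred_eq, constOn_am j g x y hy]

lemma hi_anti (g : Rn n → ℝ) {m m' : ℤ} (h : m ≤ m') (j : ℕ) : hi L g m' j ⊆ hi L g m j :=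
  fun _ hy => (tw_mono h).trans_lt hy

/-- Maximal cells of `hi`, near `x₀`. -/
def st (L : ℝ) (g : Rn n → ℝ) (x₀ : Rn n) (m : ℤ) (j : ℕ) : Set (Rn n) :=
  fst_ge (hi L g m) 0 j ∩ nb 1 L 0 x₀

lemma lv_nb (m j : ℕ) (x : Rn n) : Lv L j (nb m L j x) := fun z w hw => by
  rw [mem_nb_comm, nb_eq hw, mem_nb_comm]

lemma lv_st (g : Rn n → ℝ) (x₀ : Rn n) (m : ℤ) (j : ℕ) : Lv L j (st L g x₀ m j) :=
  (lv_fst_ge (lv_hi g m) 0 j).inter ((lv_nb 1 0 x₀).mono (Nat.zero_le j))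

/-- Cells of `st` whose neighbourhood has `V`-average comparable to `2 ^ (m + l)`. -/
def stl (L : ℝ) (V : Rn n → ℝ≥0∞) (g : Rn n → ℝ) (x₀ : Rn n) (m l : ℤ) (j : ℕ) : Set (Rn n) :=
  st L g x₀ m j ∩ {y | tw (m + l) * volume (cell L j y) < dn V (nb 1 L j y) ∧
    dn V (nb 1 L j y) ≤ tw (m + l + 1) * volume (cell L j y)}

lemma lv_stl (V : Rn n → ℝ≥0∞) (g : Rn n → ℝ) (x₀ : Rn n) (m l : ℤ) (j : ℕ) :
    Lv L j (stl L V g x₀ m l j) :=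
  (lv_st g x₀ m j).inter fun x y hy => by simp only [mem_ofPred_eq, cell_eq hy, nb_eq hy]

/-- Normalized `U`-mass of a neighbourhood. -/
def nu (L : ℝ) (U : Rn n → ℝ≥0∞) (j : ℕ) (y : Rn n) : ℝ≥0∞ := (volume (cell L j y))⁻¹ * dn U (nb 1 L j y)

lemma constOn_nu (U : Rn n → ℝ≥0∞) (j : ℕ) : ConstOn L j (nu L U j) := fun x y hy => by
  simp only [nu, cell_eq hy, nb_eq hy]

lemma measurable_nu (U : Rn n → ℝ≥0∞) (j : ℕ) : Measurable (nu L U j) :=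
  measurable_of_const (L := L) j (constOn_nu U j)

lemma setLIntegral_cell_mul_const {j : ℕ} {x : Rn n} {b : Rn n → ℝ≥0∞} (hb : ConstOn L j b)
    {f : Rn n → ℝ≥0∞} (hf : Measurable f) :
    ∫⁻ y in cell L j x, f y * b y = (∫⁻ y in cell L j x, f y) * b x := by
  rw [← lintegral_mul_const _ hf]
  exact setLIntegral_congr_fun (measurableSet_cell j x) fun y hy => by
    rw [hb x y hy]

lemma setLIntegral_le_of_cell_mul (j : ℕ) {S : Set (Rn n)} (hS : Lv L j S) {b f h : Rn n → ℝ≥0∞}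
    (hb : ConstOn L j b) (hf : Measurable f) (hh : Measurable h)
    (H : ∀ x ∈ S, ∫⁻ y in cell L j x, f y ≤ ∫⁻ y in cell L j x, h y) :
    ∫⁻ y in S, f y * b y ≤ ∫⁻ y in S, h y * b y := by
  refine setLIntegral_le_of_cell j _ _ hS fun x hx => ?_
  rw [setLIntegral_cell_mul_const hb hf, setLIntegral_cell_mul_const hb hh]
  exact mul_le_mul_left (H x hx) _

lemma dn_le_of_cover (hL : 0 < L) (U : Rn n → ℝ≥0∞) (j : ℕ) {S A T : Set (Rn n)} (hS : Lv L j S)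
    (hT : ∀ x ∈ T, x ∈ A ∧ ∃ y ∈ S, x ∈ nb 1 L j y) :
    dn U T ≤ ∫⁻ y in S, (volume (cell L j y))⁻¹ * dn U (A ∩ nb 1 L j y) := by
  let B : (Fin n → ℤ) → Set (Rn n) := fun z => {x | x ∈ A ∧ ∃ y ∈ S ∩ fib L j z, x ∈ nb 1 L j y}
  have hTB : T ⊆ ⋃ z, B z := fun x hx => by
    obtain ⟨hA, y, hy, hxy⟩ := hT x hx
    exact mem_iUnion.2 ⟨idx L j y, hA, y, ⟨hy, rfl⟩, hxy⟩
  rw [← lintegral_indicator hS.measurableSet, lintegral_eq_tsum_fib j]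
  refine (measure_mono hTB).trans ((measure_iUnion_le _).trans (ENNReal.tsum_le_tsum fun z => ?_))
  rcases (S ∩ fib L j z).eq_empty_or_nonempty with h | ⟨y, hyS, hyz⟩
  · have : B z = ∅ := by
      refine eq_empty_of_forall_notMem ?_
      rintro x ⟨-, y, hy, -⟩
      rw [h] at hy
      exact hy
    simp [this]
  · have e : fib L j z = cell L j y := by
      ext w
      exact ⟨fun h => Eq.trans h (Eq.symm hyz), fun h => Eq.trans h hyz⟩
    have hB : B z ⊆ A ∩ nb 1 L j y := by
      rintro x ⟨hA, y', ⟨-, hy'⟩, hx⟩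
      rw [e] at hy'
      rw [nb_eq hy'] at hx
      exact ⟨hA, hx⟩
    refine (measure_mono hB).trans ?_
    rw [e]
    have : ∫⁻ x in cell L j y, S.indicator
        (fun y => (volume (cell L j y))⁻¹ * dn U (A ∩ nb 1 L j y)) x =
        ∫⁻ _ in cell L j y, (volume (cell L j y))⁻¹ * dn U (A ∩ nb 1 L j y) := by
      refine setLIntegral_congr_fun (measurableSet_cell j y) fun x hx => ?_
      rw [indicator_of_mem ((hS y x hx).2 hyS), cell_eq hx, nb_eq hx]
    rw [this, setLIntegral_const, mul_right_comm, ENNReal.inv_mul_cancel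
      (volume_cell_pos hL j y).ne' (volume_cell_ne_top hL j y), one_mul]

lemma tsum_setLIntegral_le {E : ℤ → Set (Rn n)} (hE : ∀ m, MeasurableSet (E m)) {M : ℕ}
    (h : ∀ w m m', w ∈ E m → w ∈ E m' → m' < m + M) {B : Set (Rn n)} (hB : MeasurableSet B)
    (hEB : ∀ m, E m ⊆ B) {F : Rn n → ℝ≥0∞} (hF : Measurable F) :
    ∑' m, ∫⁻ y in E m, F y ≤ (2 * M : ℕ) * ∫⁻ y in B, F y := by
  have e : ∀ m, ∫⁻ y in E m, F y = ∫⁻ y, (E m).indicator F y := fun m =>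
    (lintegral_indicator (hE m) _).symm
  simp only [e]
  rw [← lintegral_tsum fun m => (hF.indicator (hE m)).aemeasurable, ← lintegral_indicator hB,
    ← lintegral_const_mul _ (hF.indicator hB)]
  refine lintegral_mono fun w => ?_
  dsimp only
  by_cases hw : ∃ m, w ∈ E m
  · obtain ⟨m₀, hm₀⟩ := hw
    rw [tsum_eq_sum (s := Finset.Ico (m₀ - M) (m₀ + M)), indicator_of_mem (hEB m₀ hm₀)]
    · refine (Finset.sum_le_card_nsmul _ _ (F w) fun m _ => indicator_le_self _ _ _).trans (le_of_eq ?_)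
      rw [Int.card_Ico, nsmul_eq_mul]
      congr 2
      omega
    · intro m hm
      refine indicator_of_notMem (fun hw => hm ?_) _
      have h1 := h w m₀ m hm₀ hw
      have h2 := h w m m₀ hw hm₀
      exact Finset.mem_Ico.2 ⟨by omega, h1⟩
  · push Not at hw
    simp [hw]

lemma setLIntegral_le_of_st (hL : 0 < L) {g : Rn n → ℝ} {m : ℤ} {j : ℕ} {y : Rn n}
    (hy : y ∈ fst_ge (hi L g m) 0 (j + 1)) :
    ∫⁻ x in cell L (j + 1) y, ‖g x‖ₑ ≤ tw m * volume (cell L (j + 1) y) := by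
  rw [setLIntegral_cell_eq_am hL, volume_cell hL, mul_comm]
  refine mul_le_mul_left ((am_succ_le hL j g y).trans ?_) _
  have h := hy.2 j (Nat.zero_le j) j.lt_succ_self
  simp only [hi, mem_ofPred_eq, not_lt] at h
  refine le_trans (mul_le_mul_left ?_ _) h
  exact pow_le_pow_left' (by norm_num) n

lemma mul_volume_le_of_hi (hL : 0 < L) {g : Rn n → ℝ} {m : ℤ} {j : ℕ} {y : Rn n}
    (hy : y ∈ hi L g m j) : tw m * volume (cell L j y) ≤ 3 ^ n * ∫⁻ x in cell L j y, ‖g x‖ₑ := by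
  rw [setLIntegral_cell_eq_am hL, volume_cell hL, mul_left_comm, mul_comm]
  exact mul_le_mul_right (le_of_lt hy) _

section
variable {p C ε D : ℝ} {x₀ : Rn n} {U V : Rn n → ℝ≥0∞}

lemma Ctx.ae_nu_le (H : Ctx p C ε D L x₀ U V) :
    ∀ᵐ y, ∀ j, y ∈ nb 1 L 0 x₀ → nu L U j y ≤ ENNReal.ofReal C * U y := by
  rw [ae_all_iff]
  intro j
  have h1 : ∀ z : Fin n → ℤ, ∀ᵐ y, y ∈ fib L j z → y ∈ nb 1 L 0 x₀ →
      nu L U j y ≤ ENNReal.ofReal C * U y := by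
    intro z
    by_cases hz : ∃ x, x ∈ fib L j z ∧ x ∈ nb 2 L 0 x₀
    · obtain ⟨x, hxz, hx⟩ := hz
      filter_upwards [H.aOne j x hx] with y hy hyz _
      have hyx : y ∈ cell L j x := Eq.trans hyz (Eq.symm hxz)
      have h2 := hy (cell_subset_nb 1 j x hyx)
      rw [nu, nb_eq hyx, cell_eq hyx, mul_comm, ← div_eq_mul_inv]
      refine ENNReal.div_le_of_le_mul ?_
      rw [mul_right_comm]
      exact h2
    · push Not at hz
      exact Filter.Eventually.of_forall fun y hyz hy => absurd (nb_mono (by norm_num) 0 x₀ hy) (hz y hyz)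
  filter_upwards [ae_all_iff.2 h1] with y hy
  exact hy (idx L j y) rfl

lemma Ctx.dn_nb_le (H : Ctx p C ε D L x₀ U V) {j : ℕ} {y : Rn n} (hy : y ∈ nb 2 L 0 x₀) :
    dn V (nb 1 L j y) ≤ ENNReal.ofReal (C * ((3 : ℝ) ^ n) ^ p) * dn V (cell L j y) := by
  have hp := H.hp
  have hC := H.hC
  have h := H.dbl j y hy (cell L j y) (cell_subset_nb 1 j y) (measurableSet_cell j y)
  have h0 := (volume_cell_pos H.hL j y).ne'
  have ht := volume_cell_ne_top H.hL j y
  refine (ENNReal.mul_le_mul_iff_right (ENNReal.rpow_pos (pos_iff_ne_zero.2 h0) ht).ne'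
    (ENNReal.rpow_ne_top_of_nonneg (by linarith) ht)).1 (h.trans (le_of_eq ?_))
  rw [volume_nb_cell H.hL, ENNReal.mul_rpow_of_nonneg _ _ (by linarith : 0 ≤ p),
    ENNReal.ofReal_mul (by linarith), ← ENNReal.ofReal_rpow_of_pos (by positivity),
    ENNReal.ofReal_pow (by norm_num)]
  norm_num
  ring

/-- Points covered by the sets `stl` with index at least `m`. -/
def dl (L : ℝ) (V : Rn n → ℝ≥0∞) (g : Rn n → ℝ) (x₀ : Rn n) (l m : ℤ) (k : ℕ) : Set (Rn n) :=
  ⋃ m' : ℤ, ⋃ _ : m ≤ m', stl L V g x₀ m' l k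

lemma mem_dl {V : Rn n → ℝ≥0∞} {g : Rn n → ℝ} {l m : ℤ} {k : ℕ} {y : Rn n} :
    y ∈ dl L V g x₀ l m k ↔ ∃ m', m ≤ m' ∧ y ∈ stl L V g x₀ m' l k := by
  simp only [dl, mem_iUnion, exists_prop]

lemma lv_dl (V : Rn n → ℝ≥0∞) (g : Rn n → ℝ) (x₀ : Rn n) (l m : ℤ) (k : ℕ) :
    Lv L k (dl L V g x₀ l m k) := fun x y hy => by
  rw [mem_dl, mem_dl]
  exact exists_congr fun m' => and_congr_right fun _ => lv_stl V g x₀ m' l k x y hy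

lemma stl_index_lt {g : Rn n → ℝ} {l m m' : ℤ} {j : ℕ} {y : Rn n}
    (h : y ∈ stl L V g x₀ m l j) (h' : y ∈ stl L V g x₀ m' l j) : m' < m + 1 := by
  by_contra hlt
  push Not at hlt
  have h1 := h'.2.1.trans_le h.2.2
  exact absurd h1 (not_lt.2 (mul_le_mul_left (tw_mono (by omega)) _))

lemma stl_level_lt {g : Rn n → ℝ} {l m m' : ℤ} (hm : m + 1 ≤ m') {j k : ℕ} {y w : Rn n}
    (h : y ∈ stl L V g x₀ m l j) (hw : w ∈ cell L j y) (h' : w ∈ stl L V g x₀ m' l k) : j < k := by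
  have hwj := (lv_stl V g x₀ m l j y w hw).2 h
  rcases lt_trichotomy j k with hjk | rfl | hjk
  · exact hjk
  · have := stl_index_lt hwj h'
    omega
  · exact absurd (hi_anti g (by omega) k h'.1.1.1) (hwj.1.1.2 k (Nat.zero_le k) hjk)

lemma Ctx.dn_dl_le (H : Ctx p C ε D L x₀ U V) {g : Rn n → ℝ} {M : ℕ} (hM1 : 1 ≤ M)
    (hM : 2 * 3 ^ n * (C * ((3 : ℝ) ^ n) ^ p) * (D * (3 ^ n * (1 / 2) ^ M) ^ ε) ≤ 1 / 2)
    {l m : ℤ} {j N : ℕ} {y : Rn n} (hy : y ∈ stl L V g x₀ m l (j + 1)) :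
    dn (fun x => ‖g x‖ₑ) (cell L (j + 1) y ∩ some_ge (dl L V g x₀ l (m + M)) N 1) ≤
      dn (fun x => ‖g x‖ₑ) (cell L (j + 1) y) / 2 := by
  have hL := H.hL
  have hC := H.hC
  have hD := H.hD
  set G := dn (fun x => ‖g x‖ₑ) with hG
  set Q := cell L (j + 1) y with hQ
  have hGQ : ∀ k x, G (cell L k x) = ∫⁻ x in cell L k x, ‖g x‖ₑ := fun k x =>
    dn_apply _ (measurableSet_cell k x)
  have hQnb : Q ⊆ nb 1 L 0 x₀ := fun w hw => ((lv_st g x₀ m (j + 1) y w hw).2 hy.1).2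
  set c := dl L V g x₀ l (m + M) with hc
  have hclv : ∀ k, Lv L k (c k) := lv_dl V g x₀ l (m + M)
  have hYeq : Q ∩ some_ge c N 1 = Q ∩ some_ge c N (j + 1 + 1) := by
    ext w
    refine and_congr_right fun hw => ⟨?_, ?_⟩
    · rintro ⟨k, -, hkN, hk⟩
      obtain ⟨m', hm', hk'⟩ := mem_dl.1 hk
      exact ⟨k, stl_level_lt (by omega) hy hw hk', hkN, hk⟩
    · rintro ⟨k, hk1, hkN, hk⟩
      exact ⟨k, by omega, hkN, hk⟩
  rw [hYeq]
  set Y := Q ∩ some_ge c N (j + 1 + 1) with hY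
  have hlvQ : Lv L (j + 1 + 1) Q := (lv_cell (j + 1) y).mono (by omega)
  have hYm : MeasurableSet Y := (measurableSet_cell _ _).inter (measurableSet_some_ge hclv _ _)
  have hGY : G Y ≤ (tw (-l) * ENNReal.ofReal (C * ((3 : ℝ) ^ n) ^ p)) * dn V Y := by
    have h1 := measure_some_ge_le hclv (N := N) hlvQ (m₁ := G)
      (m₂ := (tw (-l) * ENNReal.ofReal (C * ((3 : ℝ) ^ n) ^ p)) • dn V) (by
        intro k hk _ w hw hwk
        obtain ⟨m', hm', hk'⟩ := mem_dl.1 hwk.1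
        obtain ⟨k, rfl⟩ : ∃ k', k = k' + 1 := ⟨k - 1, by omega⟩
        rw [Measure.smul_apply, smul_eq_mul, hGQ]
        refine (setLIntegral_le_of_st hL hk'.1.1).trans ?_
        rw [mul_assoc]
        refine le_trans ?_ (mul_le_mul_right (H.dn_nb_le (nb_mono (by norm_num) 0 x₀ (hQnb hw))) _)
        refine le_trans (le_of_eq ?_) (mul_le_mul_right hk'.2.1.le _)
        rw [← mul_assoc, ← tw_add]
        congr 2
        ring)
    rwa [Measure.smul_apply, smul_eq_mul] at h1
  have hvY : tw (m + M) * volume Y ≤ 3 ^ n * G Q := by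
    have h1 := measure_some_ge_le hclv (N := N) hlvQ (m₁ := tw (m + M) • volume)
      (m₂ := (3 ^ n : ℝ≥0∞) • G) (by
        intro k hk _ w hw hwk
        obtain ⟨m', hm', hk'⟩ := mem_dl.1 hwk.1
        rw [Measure.smul_apply, smul_eq_mul, Measure.smul_apply, smul_eq_mul, hGQ]
        exact mul_volume_le_of_hi hL (hi_anti g hm' k hk'.1.1.1))
    rw [Measure.smul_apply, smul_eq_mul, Measure.smul_apply, smul_eq_mul] at h1
    exact h1.trans (mul_le_mul_right (measure_mono inter_subset_left) _)
  have hvY' : volume Y ≤ ENNReal.ofReal (3 ^ n * (1 / 2) ^ M) * volume Q := by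
    have h1 : tw (m + M) * volume Y ≤ 3 ^ n * (tw m * volume Q) := by
      refine hvY.trans (mul_le_mul_right ?_ _)
      rw [hGQ]
      exact setLIntegral_le_of_st hL hy.1.1
    refine (ENNReal.mul_le_mul_iff_right (tw_ne_zero (m + M)) (tw_ne_top (m + M))).1
      (h1.trans (le_of_eq ?_))
    rw [← mul_assoc, ← mul_assoc]
    congr 1
    unfold tw
    rw [← ENNReal.ofReal_mul (by positivity), show (3 : ℝ≥0∞) ^ n = ENNReal.ofReal (3 ^ n) by
      rw [ENNReal.ofReal_pow (by norm_num)]; norm_num, ← ENNReal.ofReal_mul (by positivity)]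
    congr 1
    rw [zpow_add₀ (by norm_num), zpow_natCast]
    have : (2 : ℝ) ^ M * (1 / 2) ^ M = 1 := by rw [← mul_pow]; norm_num
    linear_combination (-(3 : ℝ) ^ n * 2 ^ m) * this
  have hy1 : y ∈ nb 1 L 0 x₀ := hy.1.2
  have hVY := H.infV (j + 1) y hy1 Y (inter_subset_left.trans (cell_subset_nb 1 _ y)) hYm _ (by positivity) hvY'
  have hmQ := mul_volume_le_of_hi hL hy.1.1.1
  rw [← hGQ] at hmQ
  set a := ENNReal.ofReal (C * ((3 : ℝ) ^ n) ^ p)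
  set b := ENNReal.ofReal (D * (3 ^ n * (1 / 2) ^ M) ^ ε)
  have hab : 2 * 3 ^ n * a * b ≤ 2⁻¹ := by
    have h1 := ENNReal.ofReal_le_ofReal hM
    rw [ENNReal.ofReal_mul (by positivity), ENNReal.ofReal_mul (by positivity),
      ENNReal.ofReal_mul (by positivity), ENNReal.ofReal_pow (by norm_num)] at h1
    refine le_trans (le_of_eq ?_) (h1.trans (le_of_eq ?_))
    · norm_num
      rfl
    · rw [one_div, ENNReal.ofReal_inv_of_pos (by norm_num)]; norm_num
  calc G Y ≤ tw (-l) * a * dn V Y := hGY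
    _ ≤ tw (-l) * a * (b * (tw (m + l + 1) * volume Q)) :=
        mul_le_mul_right (hVY.trans (mul_le_mul_right hy.2.2 _)) _
    _ = 2 * a * b * (tw m * volume Q) := by
        have e : tw (-l) * tw (m + l + 1) = 2 * tw m := by
          rw [← tw_add, ← tw_succ]; congr 1; ring
        calc _ = (tw (-l) * tw (m + l + 1)) * a * b * volume Q := by ring
          _ = _ := by rw [e]; ring
    _ ≤ 2 * a * b * (3 ^ n * G Q) := mul_le_mul_right hmQ _
    _ = 2 * 3 ^ n * a * b * G Q := by ring
    _ ≤ 2⁻¹ * G Q := mul_le_mul_left hab _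
    _ = _ := by rw [mul_comm, div_eq_mul_inv]

/-- Carleson packing for the maximal cells with prescribed `V`-average. -/
lemma Ctx.packing (H : Ctx p C ε D L x₀ U V) {g : Rn n → ℝ} (hg : Measurable g) (hgi : Integrable g)
    {M : ℕ} (hM1 : 1 ≤ M)
    (hM : 2 * 3 ^ n * (C * ((3 : ℝ) ^ n) ^ p) * (D * (3 ^ n * (1 / 2) ^ M) ^ ε) ≤ 1 / 2)
    (l : ℤ) (N : ℕ) :
    ∑' m, ∑ j ∈ Finset.range (N + 1), ∫⁻ y in stl L V g x₀ m l j, ‖g y‖ₑ * nu L U j y ≤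
      (2 + 2 * (2 * M : ℕ)) * ENNReal.ofReal C * ∫⁻ y in nb 1 L 0 x₀, ‖g y‖ₑ * U y := by
  have hL := H.hL
  have hgm : Measurable fun y => ‖g y‖ₑ := hg.enorm
  have hF : Measurable fun y => ‖g y‖ₑ * (ENNReal.ofReal C * U y) := hgm.mul (H.mU.const_mul _)
  have hnb : ∀ m j, stl L V g x₀ m l j ⊆ nb 1 L 0 x₀ := fun m j y hy => hy.1.2
  have hnu : ∀ (S : Set (Rn n)) (j : ℕ), MeasurableSet S → S ⊆ nb 1 L 0 x₀ →
      ∫⁻ y in S, ‖g y‖ₑ * nu L U j y ≤ ∫⁻ y in S, ‖g y‖ₑ * (ENNReal.ofReal C * U y) := by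
    intro S j hS hSn
    refine setLIntegral_mono_ae hF.aemeasurable ?_
    filter_upwards [H.ae_nu_le] with y hy hyS
    exact mul_le_mul_right (hy j (hSn hyS)) _
  have hC' : ∫⁻ y in nb 1 L 0 x₀, ‖g y‖ₑ * (ENNReal.ofReal C * U y) =
      ENNReal.ofReal C * ∫⁻ y in nb 1 L 0 x₀, ‖g y‖ₑ * U y := by
    have hgU : Measurable fun y => ‖g y‖ₑ * U y := hgm.mul H.mU
    rw [← lintegral_const_mul _ hgU]
    congr 1
    ext y
    ring
  have h0 : ∑' m, ∫⁻ y in stl L V g x₀ m l 0, ‖g y‖ₑ * nu L U 0 y ≤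
      2 * (ENNReal.ofReal C * ∫⁻ y in nb 1 L 0 x₀, ‖g y‖ₑ * U y) := by
    refine (ENNReal.tsum_le_tsum fun m => hnu _ 0 (lv_stl V g x₀ m l 0).measurableSet (hnb m 0)).trans ?_
    rw [← hC']
    have := tsum_setLIntegral_le (fun m => (lv_stl (L := L) V g x₀ m l 0).measurableSet) (M := 1)
      (fun w m m' hw hw' => by exact_mod_cast stl_index_lt hw hw')
      (measurableSet_nb 1 0 x₀) (fun m => hnb m 0) hF
    simpa using this
  let Dm : ℤ → Set (Rn n) := fun m => some_ge (dl L V g x₀ l (m + M)) N 1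
  have hDm : ∀ m, MeasurableSet (Dm m) := fun m => measurableSet_some_ge (lv_dl V g x₀ l (m + M)) N 1
  have h1 : ∀ m j, ∫⁻ y in stl L V g x₀ m l (j + 1), ‖g y‖ₑ * nu L U (j + 1) y ≤
      2 * ∫⁻ y in stl L V g x₀ m l (j + 1) \ Dm m, ‖g y‖ₑ * (ENNReal.ofReal C * U y) := by
    intro m j
    have hS := lv_stl (L := L) V g x₀ m l (j + 1)
    have hh : Measurable fun y => 2 * (Dm m)ᶜ.indicator (fun y => ‖g y‖ₑ) y :=
      (hgm.indicator (hDm m).compl).const_mul _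
    have h2 := setLIntegral_le_of_cell_mul (j + 1) hS (constOn_nu U (j + 1)) hgm hh (by
      intro y hy
      rw [lintegral_const_mul _ (hgm.indicator (hDm m).compl), lintegral_indicator (hDm m).compl,
        Measure.restrict_restrict (hDm m).compl]
      have h3 := H.dn_dl_le hM1 hM (N := N) hy
      have hQ := measurableSet_cell (L := L) (j + 1) y
      rw [dn_apply _ (hQ.inter (hDm m)), dn_apply _ hQ] at h3
      have h4 := lintegral_inter_add_sdiff (μ := volume) (fun y => ‖g y‖ₑ) (cell L (j + 1) y) (hDm m)
      have hfin : ∫⁻ x in cell L (j + 1) y, ‖g x‖ₑ ≠ ∞ :=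
        ((setLIntegral_le_lintegral _ _).trans_lt hgi.2).ne
      rw [inter_comm, ← Set.sdiff_eq]
      set a := ∫⁻ x in cell L (j + 1) y, ‖g x‖ₑ
      have h5 : a / 2 + a / 2 ≤ a / 2 + ∫⁻ x in cell L (j + 1) y \ Dm m, ‖g x‖ₑ := by
        rw [ENNReal.add_halves]
        exact h4.symm.le.trans (add_le_add h3 le_rfl)
      have h6 := (ENNReal.add_le_add_iff_left (ENNReal.div_ne_top hfin (by norm_num))).1 h5
      calc a = 2 * (a / 2) := by rw [ENNReal.mul_div_cancel (by norm_num) (by norm_num)]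
        _ ≤ _ := mul_le_mul_right h6 _)
    refine h2.trans ?_
    have e : ∀ y, 2 * (Dm m)ᶜ.indicator (fun y => ‖g y‖ₑ) y * nu L U (j + 1) y =
        2 * (Dm m)ᶜ.indicator (fun y => ‖g y‖ₑ * nu L U (j + 1) y) y := by
      intro y
      by_cases hy : y ∈ (Dm m)ᶜ
      · simp only [indicator_of_mem hy, mul_assoc]
      · simp only [indicator_of_notMem hy, mul_zero, zero_mul]
    simp only [e]
    have hgn : Measurable fun y => ‖g y‖ₑ * nu L U (j + 1) y := hgm.mul (measurable_nu U (j + 1))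
    rw [lintegral_const_mul _ (hgn.indicator (hDm m).compl),
      lintegral_indicator (hDm m).compl, Measure.restrict_restrict (hDm m).compl, inter_comm, ← Set.sdiff_eq]
    exact mul_le_mul_right (hnu _ (j + 1) (hS.measurableSet.diff (hDm m))
      (sdiff_subset.trans (hnb m _))) _
  have h2 : ∀ m, ∑ j ∈ Finset.range N,
      ∫⁻ y in stl L V g x₀ m l (j + 1) \ Dm m, ‖g y‖ₑ * (ENNReal.ofReal C * U y) =
      ∫⁻ y in ⋃ j ∈ Finset.range N, stl L V g x₀ m l (j + 1) \ Dm m,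
        ‖g y‖ₑ * (ENNReal.ofReal C * U y) := by
    intro m
    refine (lintegral_biUnion_finset ?_ ?_ _).symm
    · intro k _ k' _ hne
      refine Set.disjoint_left.2 fun y hy hy' => ?_
      rcases lt_or_gt_of_ne hne with h | h
      · exact hy'.1.1.1.2 (k + 1) (Nat.zero_le _) (by omega) hy.1.1.1.1
      · exact hy.1.1.1.2 (k' + 1) (Nat.zero_le _) (by omega) hy'.1.1.1.1
    · exact fun j _ => (lv_stl V g x₀ m l (j + 1)).measurableSet.diff (hDm m)
  have h3 : ∑' m, ∫⁻ y in ⋃ j ∈ Finset.range N, stl L V g x₀ m l (j + 1) \ Dm m,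
      ‖g y‖ₑ * (ENNReal.ofReal C * U y) ≤ (2 * M : ℕ) *
        ∫⁻ y in nb 1 L 0 x₀, ‖g y‖ₑ * (ENNReal.ofReal C * U y) := by
    refine tsum_setLIntegral_le (fun m => ?_) ?_ (measurableSet_nb 1 0 x₀) ?_ hF
    · exact Finset.measurableSet_biUnion _ fun j _ =>
        (lv_stl V g x₀ m l (j + 1)).measurableSet.diff (hDm m)
    · intro w m m' hw hw'
      obtain ⟨j, -, hj⟩ := mem_iUnion₂.1 hw
      obtain ⟨j', hj'N, hj'⟩ := mem_iUnion₂.1 hw'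
      by_contra hlt
      push Not at hlt
      exact hj.2 ⟨j' + 1, by omega, by have := Finset.mem_range.1 hj'N; omega, mem_dl.2 ⟨m', hlt, hj'.1⟩⟩
    · intro m y hy
      obtain ⟨j, -, hj⟩ := mem_iUnion₂.1 hy
      exact hnb m _ hj.1
  calc ∑' m, ∑ j ∈ Finset.range (N + 1), ∫⁻ y in stl L V g x₀ m l j, ‖g y‖ₑ * nu L U j y
      ≤ ∑' m, ((∫⁻ y in stl L V g x₀ m l 0, ‖g y‖ₑ * nu L U 0 y) +
          2 * ∫⁻ y in ⋃ j ∈ Finset.range N, stl L V g x₀ m l (j + 1) \ Dm m,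
            ‖g y‖ₑ * (ENNReal.ofReal C * U y)) := by
        refine ENNReal.tsum_le_tsum fun m => ?_
        rw [Finset.sum_range_succ', add_comm, ← h2, Finset.mul_sum]
        exact add_le_add le_rfl (Finset.sum_le_sum fun j _ => h1 m j)
    _ ≤ 2 * (ENNReal.ofReal C * ∫⁻ y in nb 1 L 0 x₀, ‖g y‖ₑ * U y) +
          2 * ((2 * M : ℕ) * (ENNReal.ofReal C * ∫⁻ y in nb 1 L 0 x₀, ‖g y‖ₑ * U y)) := by
        rw [ENNReal.tsum_add, ENNReal.tsum_mul_left]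
        rw [hC'] at h3
        exact add_le_add h0 (mul_le_mul_right h3 _)
    _ = _ := by ring

end

end

section

variable {n : ℕ} {L : ℝ} {p C ε D : ℝ} {x₀ : Rn n} {U V : Rn n → ℝ≥0∞}

lemma tsum_natAbs_ne_top {r : ℝ} (h0 : 0 ≤ r) (h1 : r < 1) :
    ∑' e : ℤ, ENNReal.ofReal (r ^ e.natAbs) ≠ ∞ := by
  have hs : Summable fun e : ℤ => r ^ e.natAbs := by
    refine Summable.of_nat_of_neg ?_ ?_ <;> simpa using summable_geometric_of_lt_one h0 h1
  exact hs.tsum_ofReal_ne_top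

lemma tsum_toNat_ne_top : ∑' e : ℤ, (e.toNat : ℝ≥0∞) * tw (-e) ≠ ∞ := by
  have h : Function.support (fun e : ℤ => (e.toNat : ℝ≥0∞) * tw (-e)) ⊆ range ((↑) : ℕ → ℤ) := by
    intro e he
    refine ⟨e.toNat, Int.toNat_of_nonneg ?_⟩
    by_contra hlt
    exact he (by simp [Int.toNat_of_nonpos (not_le.1 hlt).le])
  rw [← Nat.cast_injective.tsum_eq h]
  have hs : Summable fun i : ℕ => (i : ℝ) ^ 1 * (1 / 2 : ℝ) ^ i :=
    summable_pow_mul_geometric_of_norm_lt_one 1 (by norm_num)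
  have e : ∀ i : ℕ, (((i : ℤ).toNat : ℕ) : ℝ≥0∞) * tw (-(i : ℤ)) =
      ENNReal.ofReal ((i : ℝ) ^ 1 * (1 / 2 : ℝ) ^ i) := by
    intro i
    rw [pow_one, ENNReal.ofReal_mul (by positivity), ENNReal.ofReal_natCast, tw, Int.toNat_natCast,
      zpow_neg, zpow_natCast, one_div, inv_pow]
  simp only [e]
  exact hs.tsum_ofReal_ne_top

/-- The part of a family on which the averages have size about `2^m`. -/
def mlev (L : ℝ) (g : Rn n → ℝ) (c : ℕ → Set (Rn n)) (m : ℤ) (k : ℕ) : Set (Rn n) :=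
  c k ∩ {x | tw m < mn L k g x ∧ mn L k g x ≤ tw (m + 1)}

lemma lv_mlev {c : ℕ → Set (Rn n)} (hc : ∀ k, Lv L k (c k)) (g : Rn n → ℝ) (m : ℤ) (k : ℕ) :
    Lv L k (mlev L g c m k) :=
  (hc k).inter fun x y hy => by
    simp only [mem_ofPred_eq, constOn_mn k g x y hy]

lemma sum_le_tsum_cnt {g : Rn n → ℝ} (hg : Integrable g) (c : ℕ → Set (Rn n)) (N : ℕ) (x : Rn n) :
    ∑ k ∈ Finset.range (N + 1), (c k).indicator (mn L k g) x ≤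
      ∑' m, (cnt (mlev L g c m) N 0 x : ℝ≥0∞) * tw (m + 1) := by
  classical
  have h1 : ∀ k, (c k).indicator (mn L k g) x ≤
      ∑' m, (mlev L g c m k).indicator (fun _ => tw (m + 1)) x := by
    intro k
    by_cases hx : x ∈ c k
    · rw [indicator_of_mem hx]
      rcases eq_or_ne (mn L k g x) 0 with h0 | h0
      · rw [h0]; exact zero_le
      obtain ⟨m, hm, hm'⟩ := exists_tw h0 (mn_ne_top k hg x)
      refine le_trans ?_ (ENNReal.le_tsum m)
      rw [indicator_of_mem (show x ∈ mlev L g c m k from ⟨hx, hm, hm'⟩)]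
      exact hm'
    · rw [indicator_of_notMem hx]; exact zero_le
  refine (Finset.sum_le_sum fun k _ => h1 k).trans ?_
  rw [← Summable.tsum_finsetSum fun _ _ => ENNReal.summable]
  refine ENNReal.tsum_le_tsum fun m => le_of_eq ?_
  rw [cnt, ← nsmul_eq_mul, ← Finset.sum_const, Finset.sum_filter]
  refine Finset.sum_congr ?_ fun k _ => ?_
  · ext k; simp
  · simp only [indicator_apply]

lemma exists_level {K : ℕ} {d₁ : ℤ}
    (hd : 2 * K * (∑' e : ℤ, (e.toNat : ℝ≥0∞) * tw (-e)) ≤ tw d₁) {g : Rn n → ℝ} (hg : Integrable g)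
    {c : ℕ → Set (Rn n)} {N : ℕ} {x : Rn n} {k : ℤ} (hk : x ∈ dyad V k)
    (h : V x < ∑ k ∈ Finset.range (N + 1), (c k).indicator (mn L k g) x) :
    ∃ d : ℤ, K * (d - d₁).toNat + 1 ≤ cnt (mlev L g c (k - d)) N 0 x := by
  by_contra hcon
  push Not at hcon
  refine absurd (hk.1.trans h) (not_lt.2 ((sum_le_tsum_cnt hg c N x).trans ?_))
  rw [← (Equiv.subLeft (k - d₁)).tsum_eq]
  have h1 : ∀ e : ℤ, (cnt (mlev L g c ((Equiv.subLeft (k - d₁)) e)) N 0 x : ℝ≥0∞) *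
      tw ((Equiv.subLeft (k - d₁)) e + 1) ≤
      (2 * K * tw (k - d₁)) * ((e.toNat : ℝ≥0∞) * tw (-e)) := by
    intro e
    have h2 := hcon (e + d₁)
    simp only [Equiv.subLeft_apply]
    have e1 : k - (e + d₁) = k - d₁ - e := by ring
    rw [e1, add_sub_cancel_right] at h2
    have h3 : (cnt (mlev L g c (k - d₁ - e)) N 0 x : ℝ≥0∞) ≤ K * e.toNat := by
      exact_mod_cast Nat.lt_succ_iff.1 h2
    rw [tw_succ, sub_eq_add_neg (k - d₁) e, tw_add]
    rw [sub_eq_add_neg (k - d₁) e] at h3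
    calc _ ≤ (K * e.toNat : ℝ≥0∞) * (2 * (tw (k - d₁) * tw (-e))) := mul_le_mul_left h3 _
      _ = _ := by ring
  refine (ENNReal.tsum_le_tsum h1).trans ?_
  rw [ENNReal.tsum_mul_left]
  calc _ = tw (k - d₁) * (2 * K * ∑' e : ℤ, (e.toNat : ℝ≥0∞) * tw (-e)) := by ring
    _ ≤ tw (k - d₁) * tw d₁ := mul_le_mul_right hd _
    _ = tw k := by rw [← tw_add]; congr 1; ring

lemma exists_mem_hi (hL : 0 < L) {g : Rn n → ℝ} {m : ℤ} {q : ℕ} {x : Rn n}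
    (h : tw m < mn L q g x) : ∃ y ∈ nb 1 L q x, y ∈ hi L g m q := by
  by_contra hcon
  push Not at hcon
  have h3 : (3 : ℝ≥0∞) ^ n ≠ 0 := by positivity
  have h3t : (3 : ℝ≥0∞) ^ n ≠ ∞ := ENNReal.pow_ne_top (by norm_num)
  have h1 := setLIntegral_le_of_cell q (fun y => ‖g y‖ₑ) (fun _ => ((3 : ℝ≥0∞) ^ n)⁻¹ * tw m)
    (lv_nb 1 q x) (by
      intro y hy
      have h2 : 3 ^ n * am L q g y ≤ tw m := not_lt.1 (hcon y hy)
      rw [setLIntegral_cell_eq_am hL, setLIntegral_const, ← volume_cell hL q y, mul_comm]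
      refine mul_le_mul_left ?_ _
      rw [← ENNReal.mul_le_mul_iff_right h3 h3t, ← mul_assoc, ENNReal.mul_inv_cancel h3 h3t, one_mul]
      exact h2)
  rw [setLIntegral_const, volume_nb_cell hL, setLIntegral_nb_eq_mn hL, volume_cell hL] at h1
  have h0 : ENNReal.ofReal (side L q ^ n) ≠ 0 := by rw [← volume_cell hL q x]; exact (volume_cell_pos hL q x).ne'
  have e : ((3 : ℝ≥0∞) ^ n)⁻¹ * tw m * (((2 * 1 + 1 : ℕ) : ℝ≥0∞) ^ n * ENNReal.ofReal (side L q ^ n)) =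
      ENNReal.ofReal (side L q ^ n) * tw m := by
    calc _ = (((3 : ℝ≥0∞) ^ n)⁻¹ * 3 ^ n) * (ENNReal.ofReal (side L q ^ n) * tw m) := by
          norm_num; ring
      _ = _ := by rw [ENNReal.inv_mul_cancel h3 h3t, one_mul]
  rw [e, ENNReal.mul_le_mul_iff_right h0 ENNReal.ofReal_ne_top] at h1
  exact absurd h (not_lt.2 h1)

/-- Points of the top cell where `V` is about `2^(m+d)` and many averages have size `2^m`. -/
def tset (L : ℝ) (V : Rn n → ℝ≥0∞) (g : Rn n → ℝ) (c : ℕ → Set (Rn n)) (N : ℕ) (x₀ : Rn n)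
    (K : ℕ) (d₁ m d : ℤ) : Set (Rn n) :=
  cell L 0 x₀ ∩ dyad V (m + d) ∩ {x | K * (d - d₁).toNat + 1 ≤ cnt (mlev L g c m) N 0 x}

lemma Ctx.exists_stl (H : Ctx p C ε D L x₀ U V) {g : Rn n → ℝ} {c : ℕ → Set (Rn n)} {N K : ℕ}
    {d₁ m d : ℤ} {x : Rn n} (hx : x ∈ tset L V g c N x₀ K d₁ m d) :
    ∃ j ∈ Finset.range (N + 1), ∃ l : ℤ, (x ∈ dyad V (m + d) ∩
      {x | K * (d - d₁).toNat + 1 ≤ cnt (mlev L g c m) N j x}) ∧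
      ∃ y ∈ stl L V g x₀ m l j, x ∈ nb 1 L j y := by
  obtain ⟨⟨hx0, hxd⟩, hxc⟩ := hx
  have hxc' : K * (d - d₁).toNat + 1 ≤ cnt (mlev L g c m) N 0 x := hxc
  have hL := H.hL
  obtain ⟨q, -, hqN, hq⟩ := exists_fst_ge (one_le_cnt_iff.1 ((Nat.le_add_left 1 _).trans hxc'))
  obtain ⟨y, hyx, hy⟩ := exists_mem_hi hL hq.1.2.1
  obtain ⟨j, -, hjq, hj⟩ := exists_fst_ge (c := hi L g m) (N := q) (j := 0) (y := y)
    ⟨q, Nat.zero_le _, le_rfl, hy⟩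
  have hy0 : y ∈ nb 1 L 0 x₀ := by
    rw [← nb_eq hx0]
    exact nb_subset 1 (Nat.zero_le q) x hyx
  have hy2 : y ∈ nb 2 L 0 x₀ := nb_mono (by norm_num) 0 x₀ hy0
  have hv0 := (volume_cell_pos hL j y).ne'
  have hvt := volume_cell_ne_top hL j y
  obtain ⟨k, hk, hk'⟩ := exists_tw (a := dn V (nb 1 L j y) / volume (cell L j y))
    (ENNReal.div_ne_zero.2 ⟨H.posV j y hy2, hvt⟩) (ENNReal.div_ne_top (H.finV j y hy2) hv0)
  refine ⟨j, Finset.mem_range.2 (by omega), k - m, ⟨hxd, ?_⟩, y, ⟨⟨hj, hy0⟩, ?_, ?_⟩, ?_⟩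
  · have h1 : x ∈ fst_ge (mlev L g c m) j q := ⟨hq.1, fun i hi => hq.2 i (Nat.zero_le _)⟩
    change _ ≤ cnt (mlev L g c m) N j x
    rw [cnt_eq_of_fst hjq hqN h1, ← cnt_eq_of_fst (Nat.zero_le _) hqN hq]
    exact hxc'
  · rw [add_sub_cancel]
    exact (ENNReal.lt_div_iff_mul_lt (Or.inl hv0) (Or.inl hvt)).1 hk
  · rw [add_sub_cancel]
    exact (ENNReal.div_le_iff hv0 hvt).1 hk'
  · exact mem_nb_comm.1 (nb_subset 1 hjq x hyx)

lemma Ctx.dn_tset_le (H : Ctx p C ε D L x₀ U V) {K : ℕ} (hK : ((1 / 2 : ℝ) ^ K) ^ (ε / 2) ≤ 1 / 4)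
    {g : Rn n → ℝ} (hg : Measurable g) {c : ℕ → Set (Rn n)} (hc : ∀ k, Lv L k (c k)) {N : ℕ}
    (hs : Sps L N c) (d₁ m d : ℤ) :
    tw m * tw d * dn U (tset L V g c N x₀ K d₁ m d) ≤
      ∑ j ∈ Finset.range (N + 1), ∑' l : ℤ, 3 ^ n *
        ENNReal.ofReal (2 ^ d₁ * kd n p C ε D * (1 / 2) ^ (d - d₁).natAbs * qr p ε ^ (d - l).natAbs) *
        ∫⁻ y in stl L V g x₀ m l j, ‖g y‖ₑ * nu L U j y := by
  have hL := H.hL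
  have hcm := lv_mlev hc g m
  have hsm : Sps L N (mlev L g c m) := hs.mono fun k => inter_subset_left
  set A : ℕ → Set (Rn n) := fun j =>
    dyad V (m + d) ∩ {x | K * (d - d₁).toNat + 1 ≤ cnt (mlev L g c m) N j x}
  let T : ℕ → ℤ → Set (Rn n) := fun j l => {x | x ∈ A j ∧ ∃ y ∈ stl L V g x₀ m l j, x ∈ nb 1 L j y}
  have hsub : tset L V g c N x₀ K d₁ m d ⊆ ⋃ j ∈ Finset.range (N + 1), ⋃ l, T j l := by
    intro x hx
    obtain ⟨j, hj, l, h⟩ := H.exists_stl hx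
    exact mem_iUnion₂.2 ⟨j, hj, mem_iUnion.2 ⟨l, h⟩⟩
  have h1 : dn U (tset L V g c N x₀ K d₁ m d) ≤
      ∑ j ∈ Finset.range (N + 1), ∑' l, dn U (T j l) :=
    (measure_mono hsub).trans ((measure_biUnion_finset_le _ _).trans
      (Finset.sum_le_sum fun j _ => measure_iUnion_le _))
  refine (mul_le_mul_right h1 _).trans ?_
  rw [Finset.mul_sum]
  refine Finset.sum_le_sum fun j _ => ?_
  rw [← ENNReal.tsum_mul_left]
  refine ENNReal.tsum_le_tsum fun l => ?_
  set a := ENNReal.ofReal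
    (2 ^ d₁ * kd n p C ε D * (1 / 2) ^ (d - d₁).natAbs * qr p ε ^ (d - l).natAbs)
  have hS := lv_stl (L := L) V g x₀ m l j
  have hnum := measurable_nu (L := L) U j
  have h2 : tw d * dn U (T j l) ≤ a * ∫⁻ y in stl L V g x₀ m l j, nu L U j y := by
    refine (mul_le_mul_right (dn_le_of_cover hL U j hS fun x hx => hx) _).trans ?_
    rw [← lintegral_const_mul' _ _ (tw_ne_top d), ← lintegral_const_mul _ hnum]
    refine setLIntegral_mono' hS.measurableSet fun y hy => ?_
    have h3 := H.dn_lev_cnt_le hK (d₁ := d₁) hcm hsm hy.1.2 hy.2.1.le hy.2.2 (d := d)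
    calc _ = (volume (cell L j y))⁻¹ * (tw d * dn U (A j ∩ nb 1 L j y)) := by ring
      _ ≤ (volume (cell L j y))⁻¹ * (a * dn U (nb 1 L j y)) := mul_le_mul_right h3 _
      _ = _ := by rw [nu]; ring
  have h4 : tw m * ∫⁻ y in stl L V g x₀ m l j, nu L U j y ≤
      3 ^ n * ∫⁻ y in stl L V g x₀ m l j, ‖g y‖ₑ * nu L U j y := by
    have hgm : Measurable fun y => ‖g y‖ₑ := hg.enorm
    have hgn : Measurable fun y => ‖g y‖ₑ * nu L U j y := hgm.mul hnum
    have h5 := setLIntegral_le_of_cell_mul j hS (constOn_nu U j) (f := fun _ => tw m)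
      (h := fun y => 3 ^ n * ‖g y‖ₑ) measurable_const (hgm.const_mul _) (by
        intro y hy
        rw [setLIntegral_const, lintegral_const_mul _ hgm]
        exact mul_volume_le_of_hi hL hy.1.1.1)
    simp only [mul_assoc] at h5
    rwa [lintegral_const_mul _ hnum, lintegral_const_mul _ hgn] at h5
  calc _ = tw m * (tw d * dn U (T j l)) := by ring
    _ ≤ tw m * (a * ∫⁻ y in stl L V g x₀ m l j, nu L U j y) := mul_le_mul_right h2 _
    _ = a * (tw m * ∫⁻ y in stl L V g x₀ m l j, nu L U j y) := by ring
    _ ≤ a * (3 ^ n * ∫⁻ y in stl L V g x₀ m l j, ‖g y‖ₑ * nu L U j y) := mul_le_mul_right h4 _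
    _ = _ := by ring

lemma measurableSet_tset (hV : Measurable V) {g : Rn n → ℝ} {c : ℕ → Set (Rn n)}
    (hc : ∀ k, Lv L k (c k)) (N K : ℕ) (d₁ m d : ℤ) :
    MeasurableSet (tset L V g c N x₀ K d₁ m d) :=
  ((measurableSet_cell 0 x₀).inter (measurableSet_dyad hV _)).inter
    (measurable_cnt (lv_mlev hc g m) N 0 measurableSet_Ici)

lemma exists_tw_ge {a : ℝ≥0∞} (h : a ≠ ∞) : ∃ k : ℤ, a ≤ tw k := by
  rcases eq_or_ne a 0 with h0 | h0
  · exact ⟨0, by rw [h0]; exact zero_le⟩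
  · obtain ⟨k, -, hk⟩ := exists_tw h0 h
    exact ⟨k + 1, hk⟩

lemma exists_sparse_mixed (n : ℕ) {p C ε D : ℝ} (hp : 1 ≤ p) (hε : 0 < ε) :
    ∃ B : ℝ≥0∞, B ≠ ∞ ∧ ∀ (L : ℝ) (x₀ : Rn n) (U V : Rn n → ℝ≥0∞), Ctx p C ε D L x₀ U V →
      ∀ (N : ℕ) (g : Rn n → ℝ), Measurable g → Integrable g →
      ∀ c : ℕ → Set (Rn n), (∀ k, Lv L k (c k)) → Sps L N c →
        ∫⁻ x in {x | x ∈ cell L 0 x₀ ∧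
          V x < ∑ k ∈ Finset.range (N + 1), (c k).indicator (mn L k g) x}, U x * V x ≤
        B * ∫⁻ y in nb 1 L 0 x₀, ‖g y‖ₑ * U y := by
  obtain ⟨K, hK⟩ : ∃ K : ℕ, ((1 / 2 : ℝ) ^ K) ^ (ε / 2) ≤ 1 / 4 := by
    have h1 : Filter.Tendsto (fun K : ℕ => ((1 / 2 : ℝ) ^ K) ^ (ε / 2)) Filter.atTop (nhds 0) := by
      have := (tendsto_pow_atTop_nhds_zero_of_lt_one (r := (1 / 2 : ℝ)) (by norm_num)
        (by norm_num)).rpow_const (p := ε / 2) (Or.inr (by positivity))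
      rwa [Real.zero_rpow (by positivity)] at this
    obtain ⟨K, hK⟩ := (h1.eventually_lt_const (show (0 : ℝ) < 1 / 4 by norm_num)).exists
    exact ⟨K, hK.le⟩
  obtain ⟨M, hM1, hM⟩ : ∃ M : ℕ, 1 ≤ M ∧
      2 * 3 ^ n * (C * ((3 : ℝ) ^ n) ^ p) * (D * (3 ^ n * (1 / 2) ^ M) ^ ε) ≤ 1 / 2 := by
    have h1 : Filter.Tendsto (fun M : ℕ => 2 * 3 ^ n * (C * ((3 : ℝ) ^ n) ^ p) *
        (D * (3 ^ n * (1 / 2) ^ M) ^ ε)) Filter.atTop (nhds 0) := by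
      have := ((tendsto_pow_atTop_nhds_zero_of_lt_one (r := (1 / 2 : ℝ)) (by norm_num)
        (by norm_num)).const_mul ((3 : ℝ) ^ n)).rpow_const (p := ε) (Or.inr hε.le)
      have := (this.const_mul D).const_mul (2 * 3 ^ n * (C * ((3 : ℝ) ^ n) ^ p))
      rwa [mul_zero, Real.zero_rpow hε.ne', mul_zero, mul_zero] at this
    obtain ⟨M, hM, hM1⟩ := ((h1.eventually_lt_const (show (0 : ℝ) < 1 / 2 by norm_num)).and
      (Filter.eventually_ge_atTop 1)).exists
    exact ⟨M, hM1, hM.le⟩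
  obtain ⟨d₁, hd⟩ := exists_tw_ge (a := 2 * K * (∑' e : ℤ, (e.toNat : ℝ≥0∞) * tw (-e)))
    (ENNReal.mul_ne_top (ENNReal.mul_ne_top (by norm_num) (ENNReal.natCast_ne_top _))
      tsum_toNat_ne_top)
  set s₁ := ∑' e : ℤ, ENNReal.ofReal ((1 / 2 : ℝ) ^ e.natAbs) with hs₁
  set s₂ := ∑' e : ℤ, ENNReal.ofReal (qr p ε ^ e.natAbs) with hs₂
  have hs₁t : s₁ ≠ ∞ := tsum_natAbs_ne_top (by norm_num) (by norm_num)
  have hs₂t : s₂ ≠ ∞ := tsum_natAbs_ne_top (qr_pos p ε).le (qr_lt_one hp hε)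
  set b : ℝ≥0∞ := (2 + 2 * (2 * M : ℕ)) * ENNReal.ofReal C
  set e₀ := ENNReal.ofReal (2 ^ d₁ * kd n p C ε D)
  refine ⟨2 * 3 ^ n * e₀ * s₁ * s₂ * b, ?_, ?_⟩
  · refine ENNReal.mul_ne_top (ENNReal.mul_ne_top (ENNReal.mul_ne_top (ENNReal.mul_ne_top
      (ENNReal.mul_ne_top (by norm_num) (ENNReal.pow_ne_top (by norm_num))) ENNReal.ofReal_ne_top)
      hs₁t) hs₂t) (ENNReal.mul_ne_top ?_ ENNReal.ofReal_ne_top)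
    exact ENNReal.add_ne_top.2 ⟨by norm_num, ENNReal.mul_ne_top (by norm_num)
      (ENNReal.natCast_ne_top _)⟩
  intro L x₀ U V H N g hg hgi c hc hs
  set G := ∫⁻ y in nb 1 L 0 x₀, ‖g y‖ₑ * U y
  let T : ℤ × ℤ → Set (Rn n) := fun q => tset L V g c N x₀ K d₁ q.1 q.2
  have hT : ∀ q, MeasurableSet (T q) := fun q => measurableSet_tset H.mV hc N K d₁ q.1 q.2
  have hsub : {x | x ∈ cell L 0 x₀ ∧
      V x < ∑ k ∈ Finset.range (N + 1), (c k).indicator (mn L k g) x} ⊆ {x | V x = 0} ∪ ⋃ q, T q := by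
    rintro x ⟨hx, hxV⟩
    rcases eq_or_ne (V x) 0 with h0 | h0
    · exact Or.inl h0
    right
    obtain ⟨k, hk⟩ := exists_tw h0 hxV.ne_top
    obtain ⟨d, hd'⟩ := exists_level hd hgi (V := V) hk hxV
    exact mem_iUnion.2 ⟨(k - d, d), ⟨hx, by rw [sub_add_cancel]; exact hk⟩, hd'⟩
  have h1 : ∫⁻ x in {x | V x = 0}, U x * V x = 0 := by
    have hz : MeasurableSet {x | V x = 0} := H.mV (measurableSet_singleton 0)
    have := setLIntegral_mono' (μ := volume) (f := fun x => U x * V x) (g := fun _ => 0) hz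
      fun x hx => by rw [show V x = 0 from hx, mul_zero]
    simpa using this
  have h2 : ∀ q, ∫⁻ x in T q, U x * V x ≤ 2 * (tw q.1 * tw q.2 * dn U (T q)) := by
    intro q
    calc ∫⁻ x in T q, U x * V x ≤ ∫⁻ x in T q, tw (q.1 + q.2 + 1) * U x :=
          setLIntegral_mono' (hT q) fun x hx => by
            rw [mul_comm]
            exact mul_le_mul_left hx.1.2.2 _
      _ = tw (q.1 + q.2 + 1) * dn U (T q) := by
          rw [lintegral_const_mul _ H.mU, dn_apply U (hT q)]
      _ = _ := by rw [tw_succ, tw_add]; ring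
  have h3 : ∀ d, ∑' m, 2 * (tw m * tw d * dn U (tset L V g c N x₀ K d₁ m d)) ≤
      ENNReal.ofReal ((1 / 2) ^ (d - d₁).natAbs) * (2 * 3 ^ n * e₀ * s₂ * (b * G)) := by
    intro d
    calc _ ≤ ∑' m, 2 * ∑ j ∈ Finset.range (N + 1), ∑' l : ℤ, 3 ^ n *
            ENNReal.ofReal (2 ^ d₁ * kd n p C ε D * (1 / 2) ^ (d - d₁).natAbs *
              qr p ε ^ (d - l).natAbs) *
            ∫⁻ y in stl L V g x₀ m l j, ‖g y‖ₑ * nu L U j y :=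
          ENNReal.tsum_le_tsum fun m => mul_le_mul_right (H.dn_tset_le hK hg hc hs d₁ m d) _
      _ = ∑' l : ℤ, 2 * (3 ^ n * ENNReal.ofReal (2 ^ d₁ * kd n p C ε D * (1 / 2) ^ (d - d₁).natAbs *
              qr p ε ^ (d - l).natAbs)) * ∑' m, ∑ j ∈ Finset.range (N + 1),
            ∫⁻ y in stl L V g x₀ m l j, ‖g y‖ₑ * nu L U j y := by
          simp only [← Summable.tsum_finsetSum fun _ _ => ENNReal.summable]
          simp only [← ENNReal.tsum_mul_left]
          rw [ENNReal.tsum_comm]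
          simp only [Finset.mul_sum, mul_assoc]
      _ ≤ ∑' l : ℤ, 2 * (3 ^ n * (e₀ * ENNReal.ofReal ((1 / 2) ^ (d - d₁).natAbs) *
            ENNReal.ofReal (qr p ε ^ (d - l).natAbs))) * (b * G) := by
          refine ENNReal.tsum_le_tsum fun l => ?_
          rw [ENNReal.ofReal_mul' (pow_nonneg (qr_pos p ε).le _), ENNReal.ofReal_mul' (by positivity)]
          exact mul_le_mul_right (H.packing hg hgi hM1 hM l N) _
      _ = ∑' l : ℤ, (ENNReal.ofReal ((1 / 2) ^ (d - d₁).natAbs) * (2 * 3 ^ n * e₀ * (b * G))) *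
            ENNReal.ofReal (qr p ε ^ (d - l).natAbs) :=
          tsum_congr fun l => by ring
      _ = _ := by
          rw [ENNReal.tsum_mul_left, hs₂,
            ← (Equiv.subLeft d).tsum_eq fun e : ℤ => ENNReal.ofReal (qr p ε ^ e.natAbs)]
          simp only [Equiv.subLeft_apply]
          ring
  calc _ ≤ ∫⁻ x in {x | V x = 0} ∪ ⋃ q, T q, U x * V x := lintegral_mono_set hsub
    _ ≤ (∫⁻ x in {x | V x = 0}, U x * V x) + ∫⁻ x in ⋃ q, T q, U x * V x := lintegral_union_le _ _ _
    _ = ∫⁻ x in ⋃ q, T q, U x * V x := by rw [h1, zero_add]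
    _ ≤ ∑' q, ∫⁻ x in T q, U x * V x := lintegral_iUnion_le _ _
    _ ≤ ∑' q : ℤ × ℤ, 2 * (tw q.1 * tw q.2 * dn U (tset L V g c N x₀ K d₁ q.1 q.2)) :=
        ENNReal.tsum_le_tsum h2
    _ = ∑' d, ∑' m, 2 * (tw m * tw d * dn U (tset L V g c N x₀ K d₁ m d)) := by
        rw [ENNReal.tsum_prod (f := fun m d => 2 * (tw m * tw d * dn U (tset L V g c N x₀ K d₁ m d))),
          ENNReal.tsum_comm]
    _ ≤ ∑' d : ℤ, ENNReal.ofReal ((1 / 2) ^ (d - d₁).natAbs) * (2 * 3 ^ n * e₀ * s₂ * (b * G)) :=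
        ENNReal.tsum_le_tsum h3
    _ = _ := by
        rw [ENNReal.tsum_mul_right, hs₁,
          ← (Equiv.subRight d₁).tsum_eq fun e : ℤ => ENNReal.ofReal ((1 / 2 : ℝ) ^ e.natAbs)]
        simp only [Equiv.subRight_apply]
        ring

end

section

variable {n : ℕ} {L : ℝ} {p C ε D : ℝ} {x₀ : Rn n} {U V : Rn n → ℝ≥0∞}

lemma mn_const_mul (j : ℕ) (a : ℝ) (g : Rn n → ℝ) (x : Rn n) :
    mn L j (fun y => a * g y) x = ‖a‖ₑ * mn L j g x := by
  simp only [mn, enorm_mul]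
  rw [lintegral_const_mul' _ _ enorm_ne_top]
  ring

/-- The mixed weak type estimate for small scales on one cell. -/
lemma exists_local_mixed (hn : 0 < n) {ϱ : ℝ} (hϱ : 2 < ϱ) {p C ε D : ℝ} (hp : 1 ≤ p)
    (hε : 0 < ε) :
    ∃ B : ℝ≥0∞, B ≠ ∞ ∧ ∀ (L : ℝ) (x₀ : Rn n) (U V : Rn n → ℝ≥0∞), Ctx p C ε D L x₀ U V →
      ∀ g : Rn n → ℝ, Measurable g → Integrable g →
        ∫⁻ x in {x | x ∈ cell L 0 x₀ ∧ V x < vr ϱ (Ioc 0 L) (av g x)}, U x * V x ≤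
        B * ∫⁻ y in nb 1 L 0 x₀, ‖g y‖ₑ * U y := by
  obtain ⟨C₀, hC₀, hsp⟩ := exists_sparse hn hϱ
  obtain ⟨B, hB, hmix⟩ := exists_sparse_mixed n (C := C) (D := D) hp hε
  refine ⟨B * ENNReal.ofReal C₀, ENNReal.mul_ne_top hB ENNReal.ofReal_ne_top, ?_⟩
  intro L x₀ U V H g hg hgi
  have hL := H.hL
  have hE : ‖C₀‖ₑ = ENNReal.ofReal C₀ := Real.enorm_of_nonneg hC₀.le
  set G := ∫⁻ y in nb 1 L 0 x₀, ‖g y‖ₑ * U y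
  let S : ℕ → Set (Rn n) := fun N =>
    {x | x ∈ cell L 0 x₀ ∧ V x < vr ϱ (Icc (side L (N + 1)) (side L 0)) (av g x)}
  have hS : Monotone S := fun N N' h x hx =>
    ⟨hx.1, hx.2.trans_le (vr_mono ϱ (Icc_subset_Icc_left (side_anti hL (by omega))) _)⟩
  have hsub : {x | x ∈ cell L 0 x₀ ∧ V x < vr ϱ (Ioc 0 L) (av g x)} ⊆ ⋃ N, S N := by
    rintro x ⟨hx, hV⟩
    obtain ⟨N, hN⟩ := vr_Ioc_lt hL _ hV
    refine mem_iUnion.2 ⟨N, hx, hN.trans_le (vr_mono ϱ (Icc_subset_Icc ?_ side_zero.ge) _)⟩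
    exact side_anti hL (Nat.le_succ N)
  have hSN : ∀ N, dn (fun x => U x * V x) (S N) ≤ B * ENNReal.ofReal C₀ * G := by
    intro N
    obtain ⟨c, hc, hs, hv⟩ := hsp L hL N g hgi hg
    rw [dn, withDensity_apply']
    refine (lintegral_mono_set ?_).trans ((hmix L x₀ U V H N (fun y => C₀ * g y) (hg.const_mul _)
      (hgi.const_mul _) c hc hs).trans (le_of_eq ?_))
    · rintro x ⟨hx, hV⟩
      refine ⟨hx, hV.trans_le ((hv x).trans (le_of_eq ?_))⟩
      rw [Finset.mul_sum]
      refine Finset.sum_congr rfl fun k _ => ?_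
      by_cases hk : x ∈ c k
      · rw [indicator_of_mem hk, indicator_of_mem hk, mn_const_mul, hE]
      · rw [indicator_of_notMem hk, indicator_of_notMem hk, mul_zero]
    · simp only [enorm_mul, mul_assoc]
      rw [lintegral_const_mul' _ _ enorm_ne_top, hE]
  calc _ = dn (fun x => U x * V x) {x | x ∈ cell L 0 x₀ ∧ V x < vr ϱ (Ioc 0 L) (av g x)} := by
        rw [dn, withDensity_apply']
    _ ≤ dn (fun x => U x * V x) (⋃ N, S N) := measure_mono hsub
    _ ≤ _ := by
        rw [hS.measure_iUnion]
        exact iSup_le hSN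

end

section

variable {n : ℕ} {L : ℝ} {p C ε D : ℝ} {x₀ : Rn n} {U V : Rn n → ℝ≥0∞} {ρ : Rn n → ℝ}

/-- Local Muckenhoupt type conditions on balls `B(x, r)`, `r ≤ ρ x`. -/
structure Loc (ρ : Rn n → ℝ) (p C : ℝ) (U V : Rn n → ℝ≥0∞) : Prop where
  mU : Measurable U
  mV : Measurable V
  finU : ∀ x r, dn U (Metric.ball x r) ≠ ∞
  finV : ∀ x r, dn V (Metric.ball x r) ≠ ∞
  posV : ∀ᵐ x, V x ≠ 0
  aOne : ∀ x r, 0 < r → r ≤ ρ x → ∀ᵐ y, y ∈ Metric.ball x r →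
    dn U (Metric.ball x r) ≤ ENNReal.ofReal C * volume (Metric.ball x r) * U y
  dbl : ∀ x r, 0 < r → r ≤ ρ x → ∀ E ⊆ Metric.ball x r, MeasurableSet E →
    volume E ^ p * dn V (Metric.ball x r) ≤ ENNReal.ofReal C * dn V E * volume (Metric.ball x r) ^ p

lemma nb_subset_ball (hL : 0 < L) (j : ℕ) (x : Rn n) :
    nb 1 L j x ⊆ Metric.ball x ((2 * n + 1) * side L j) := by
  intro y hy
  have h1 := norm_sub_le_of_mem_nb hL hy
  have h2 := side_pos hL j
  rw [Metric.mem_ball, dist_eq_norm]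
  push_cast at h1
  linarith

lemma ball_subset_nb (hL : 0 < L) (j : ℕ) (x : Rn n) :
    Metric.ball x ((2 * n + 1) * side L j) ⊆ nb (2 * n + 1) L j x := by
  intro y hy
  rw [Metric.mem_ball, dist_eq_norm] at hy
  exact mem_nb_of_norm_le hL (by push_cast; exact hy.le)

lemma volume_ball_le (hL : 0 < L) (j : ℕ) (x : Rn n) :
    volume (Metric.ball x ((2 * n + 1) * side L j)) ≤
      ENNReal.ofReal ((4 * n + 3 : ℝ) ^ n) * volume (cell L j x) := by
  refine (measure_mono (ball_subset_nb hL j x)).trans (le_of_eq ?_)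
  rw [volume_nb_cell hL]
  congr 1
  rw [ENNReal.ofReal_pow (by positivity), ← ENNReal.ofReal_natCast]
  congr 2
  push_cast
  ring

lemma Dbl.of_one {C : ℝ} (hp : 1 ≤ p) {w : Measure (Rn n)} {j : ℕ} {x : Rn n}
    (h : Dbl 1 C w L j x) : Dbl p C w L j x := by
  intro E hE hEm
  have h1 := h E hE hEm
  simp only [ENNReal.rpow_one] at h1
  have e : ∀ a : ℝ≥0∞, a ^ p = a ^ (p - 1) * a := fun a => by
    conv_rhs => rw [← ENNReal.rpow_one a, ← ENNReal.rpow_mul, one_mul,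
      ← ENNReal.rpow_add_of_nonneg _ _ (by linarith) zero_le_one]
    congr 1
    ring
  rw [e, e]
  calc _ = volume E ^ (p - 1) * (volume E * w (nb 1 L j x)) := by ring
    _ ≤ volume (nb 1 L j x) ^ (p - 1) * (ENNReal.ofReal C * w E * volume (nb 1 L j x)) :=
        mul_le_mul' (ENNReal.rpow_le_rpow (measure_mono hE) (by linarith)) h1
    _ = _ := by ring

lemma exists_ctx (n : ℕ) {p C : ℝ} (hp : 1 ≤ p) (hC : 1 ≤ C) :
    ∃ C' ε D : ℝ, 0 < ε ∧ ∀ (ρ : Rn n → ℝ) (U V : Rn n → ℝ≥0∞), Loc ρ p C U V →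
      ∀ (L : ℝ) (x₀ : Rn n), 0 < L → (∀ y ∈ nb 2 L 0 x₀, (2 * n + 1) * L ≤ ρ y) →
        Ctx p C' ε D L x₀ U V := by
  set κ : ℝ := (4 * n + 3 : ℝ) ^ n with hκ
  have hκ1 : 1 ≤ κ := one_le_pow₀ (by have : (0 : ℝ) ≤ n := n.cast_nonneg; linarith)
  have hκp : κ ≤ κ ^ p := by
    conv_lhs => rw [← Real.rpow_one κ]
    exact Real.rpow_le_rpow_of_exponent_le hκ1 hp
  have hC' : 1 ≤ C * κ ^ p := one_le_mul_of_one_le_of_one_le hC (hκ1.trans hκp)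
  obtain ⟨ε, D, hε, hD, hinf⟩ := exists_ainf n (p := p) (by linarith) hC'
  refine ⟨C * κ ^ p, ε, D, hε, fun ρ U V H L x₀ hL hρ => ?_⟩
  have hr : ∀ j, ∀ x ∈ nb 2 L 0 x₀, 0 < (2 * n + 1) * side L j ∧ (2 * n + 1) * side L j ≤ ρ x := by
    intro j x hx
    refine ⟨mul_pos (by positivity) (side_pos hL j), le_trans ?_ (hρ x hx)⟩
    refine mul_le_mul_of_nonneg_left ?_ (by positivity)
    exact (side_anti hL (Nat.zero_le j)).trans side_zero.le
  have hCκ : ENNReal.ofReal C * ENNReal.ofReal κ ≤ ENNReal.ofReal (C * κ ^ p) := by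
    rw [← ENNReal.ofReal_mul (by linarith)]
    exact ENNReal.ofReal_le_ofReal (mul_le_mul_of_nonneg_left hκp (by linarith))
  have hfin : ∀ W : Rn n → ℝ≥0∞, (∀ x r, dn W (Metric.ball x r) ≠ ∞) → ∀ j x,
      dn W (nb 1 L j x) ≠ ∞ := fun W hW j x =>
    ((measure_mono (nb_subset_ball hL j x)).trans_lt (hW _ _).lt_top).ne
  have haOne : ∀ j, ∀ x ∈ nb 2 L 0 x₀, ∀ᵐ y, y ∈ nb 1 L j x →
      dn U (nb 1 L j x) ≤ ENNReal.ofReal (C * κ ^ p) * volume (cell L j x) * U y := by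
    intro j x hx
    filter_upwards [H.aOne x _ (hr j x hx).1 (hr j x hx).2] with y hy hyn
    refine (measure_mono (nb_subset_ball hL j x)).trans ((hy (nb_subset_ball hL j x hyn)).trans ?_)
    refine mul_le_mul_left ?_ _
    calc _ ≤ ENNReal.ofReal C * (ENNReal.ofReal κ * volume (cell L j x)) :=
          mul_le_mul_right (volume_ball_le hL j x) _
      _ = ENNReal.ofReal C * ENNReal.ofReal κ * volume (cell L j x) := by ring
      _ ≤ _ := mul_le_mul_left hCκ _
  have hdblU : ∀ j, ∀ x ∈ nb 2 L 0 x₀, Dbl p (C * κ ^ p) (dn U) L j x := by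
    intro j x hx
    refine Dbl.of_one hp fun E hE hEm => ?_
    simp only [ENNReal.rpow_one]
    have h1 : ∫⁻ _ in E, dn U (nb 1 L j x) ≤
        ∫⁻ y in E, ENNReal.ofReal (C * κ ^ p) * volume (cell L j x) * U y := by
      refine setLIntegral_mono_ae (H.mU.const_mul _).aemeasurable ?_
      filter_upwards [haOne j x hx] with y hy hyE
      exact hy (hE hyE)
    rw [setLIntegral_const, lintegral_const_mul _ H.mU, ← dn_apply U hEm] at h1
    calc _ = dn U (nb 1 L j x) * volume E := mul_comm _ _
      _ ≤ _ := h1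
      _ = ENNReal.ofReal (C * κ ^ p) * dn U E * volume (cell L j x) := by ring
      _ ≤ _ := mul_le_mul_right (measure_mono (cell_subset_nb 1 j x)) _
  have hdblV : ∀ j, ∀ x ∈ nb 2 L 0 x₀, Dbl p (C * κ ^ p) (dn V) L j x := by
    intro j x hx E hE hEm
    have h1 := H.dbl x _ (hr j x hx).1 (hr j x hx).2 E (hE.trans (nb_subset_ball hL j x)) hEm
    have h2 : volume (Metric.ball x ((2 * n + 1) * side L j)) ^ p ≤
        ENNReal.ofReal (κ ^ p) * volume (nb 1 L j x) ^ p := by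
      rw [← ENNReal.ofReal_rpow_of_nonneg (by linarith) (by linarith),
        ← ENNReal.mul_rpow_of_nonneg _ _ (by linarith)]
      exact ENNReal.rpow_le_rpow ((volume_ball_le hL j x).trans
        (mul_le_mul_right (measure_mono (cell_subset_nb 1 j x)) _)) (by linarith)
    calc _ ≤ volume E ^ p * dn V (Metric.ball x ((2 * n + 1) * side L j)) :=
          mul_le_mul_right (measure_mono (nb_subset_ball hL j x)) _
      _ ≤ _ := h1
      _ ≤ ENNReal.ofReal C * dn V E * (ENNReal.ofReal (κ ^ p) * volume (nb 1 L j x) ^ p) :=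
          mul_le_mul_right h2 _
      _ = _ := by rw [ENNReal.ofReal_mul (by linarith)]; ring
  have hsub : ∀ j, ∀ x ∈ nb 1 L 0 x₀, nb 1 L j x ⊆ nb 2 L 0 x₀ := fun j x hx y hy =>
    mem_nb_trans hx (nb_subset 1 (Nat.zero_le j) x hy)
  exact
    { hL := hL, hp := hp, hC := hC', hε := hε, hD := hD, mU := H.mU, mV := H.mV
      finU := fun j x _ => hfin U H.finU j x
      finV := fun j x _ => hfin V H.finV j x
      posV := fun j x _ h0 => by
        rw [dn_apply _ (measurableSet_nb 1 j x), setLIntegral_eq_zero_iff (measurableSet_nb 1 j x)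
          H.mV] at h0
        have h1 : volume (nb 1 L j x) = 0 := by
          refine measure_mono_null (fun y hy => ?_) (measure_eq_zero_iff_ae_notMem.2
            (show ∀ᵐ y, y ∉ nb 1 L j x from ?_))
          · exact hy
          · filter_upwards [h0, H.posV] with y hy hy' hyn using hy' (hy hyn)
        exact (volume_cell_pos hL j x).ne' (measure_mono_null (cell_subset_nb 1 j x) h1)
      aOne := haOne
      dbl := hdblV
      infU := fun j x hx => hinf L hL (dn U) (nb 2 L 0 x₀) (lv_nb 2 0 x₀)
        (fun j x hx => ⟨hfin U H.finU j x, hdblU j x hx⟩) j x (hsub j x hx)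
      infV := fun j x hx => hinf L hL (dn V) (nb 2 L 0 x₀) (lv_nb 2 0 x₀)
        (fun j x hx => ⟨hfin V H.finV j x, hdblV j x hx⟩) j x (hsub j x hx) }

/-- Comparability of the values of `ρ` at nearby points. -/
lemma exists_comparable (hρ : IsCriticalRadius ρ) :
    (∀ x, 0 < ρ x) ∧ ∃ κ : ℝ, 1 ≤ κ ∧ ∀ x y, ‖x - y‖ ≤ 3 * ρ x → ρ x ≤ κ * ρ y ∧ ρ y ≤ κ * ρ x := by
  obtain ⟨C₀, N₀, hC, hN, hpos, h⟩ := hρ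
  have h4 : 1 ≤ (4 : ℝ) ^ N₀ := Real.one_le_rpow (by norm_num) hN.le
  refine ⟨hpos, max 1 (max (C₀ * 4 ^ N₀) (C₀ * 4)), le_max_left _ _, fun x y hxy => ?_⟩
  obtain ⟨h1, h2⟩ := h x y
  have hx := hpos x
  have hy := hpos y
  have hb1 : 1 ≤ 1 + ‖x - y‖ / ρ x := by have := div_nonneg (norm_nonneg (x - y)) hx.le; linarith
  have hb4 : 1 + ‖x - y‖ / ρ x ≤ 4 := by
    have : ‖x - y‖ / ρ x ≤ 3 := (div_le_iff₀ hx).2 hxy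
    linarith
  constructor
  · have h3 : (4 : ℝ) ^ (-N₀) ≤ (1 + ‖x - y‖ / ρ x) ^ (-N₀) :=
      Real.rpow_le_rpow_of_nonpos (by linarith) hb4 (by linarith)
    rw [Real.rpow_neg (by norm_num)] at h3
    have h5 : C₀⁻¹ * ρ x * (4 ^ N₀)⁻¹ ≤ ρ y :=
      (mul_le_mul_of_nonneg_left h3 (by positivity)).trans h1
    have h6 : ρ x ≤ C₀ * 4 ^ N₀ * ρ y := by
      calc ρ x = C₀ * 4 ^ N₀ * (C₀⁻¹ * ρ x * (4 ^ N₀)⁻¹) := by field_simp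
        _ ≤ _ := mul_le_mul_of_nonneg_left h5 (by positivity)
    exact h6.trans (mul_le_mul_of_nonneg_right ((le_max_left _ _).trans (le_max_right _ _)) hy.le)
  · have h3 : (1 + ‖x - y‖ / ρ x) ^ (N₀ / (N₀ + 1)) ≤ 4 := by
      calc _ ≤ (1 + ‖x - y‖ / ρ x) ^ (1 : ℝ) :=
            Real.rpow_le_rpow_of_exponent_le hb1 ((div_le_one (by linarith)).2 (by linarith))
        _ ≤ 4 := by rwa [Real.rpow_one]
    calc ρ y ≤ C₀ * ρ x * 4 := h2.trans (mul_le_mul_of_nonneg_left h3 (by positivity))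
      _ = C₀ * 4 * ρ x := by ring
      _ ≤ _ := mul_le_mul_of_nonneg_right ((le_max_right _ _).trans (le_max_right _ _)) hx.le

lemma exists_overlap {κ δ : ℝ} (hδ : 0 < δ)
    (hpos : ∀ x, 0 < ρ x) (hcomp : ∀ x y, ‖x - y‖ ≤ 3 * ρ x → ρ x ≤ κ * ρ y ∧ ρ y ≤ κ * ρ x) :
    ∃ M : ℝ≥0∞, M ≠ ∞ ∧ ∀ A : ℤ → (Fin n → ℤ) → Set (Rn n),
      (∀ i z, A i z = ∅ ∨ ∃ x₀, 2 ^ i < ρ x₀ ∧ ρ x₀ ≤ 2 ^ (i + 1) ∧ idx (δ * 2 ^ i) 0 x₀ = z ∧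
        A i z = Metric.ball x₀ (3 * 2 ^ i)) →
      ∀ F : Rn n → ℝ≥0∞, Measurable F → ∑' i, ∑' z, ∫⁻ w in A i z, F w ≤ M * ∫⁻ w, F w := by
  classical
  obtain ⟨J, hJ⟩ := pow_unbounded_of_one_lt κ (show (1 : ℝ) < 2 by norm_num)
  obtain ⟨m, hm⟩ := exists_nat_ge (3 / δ)
  refine ⟨(2 * J + 2 : ℕ) * ((2 * m + 1) ^ n : ℕ), ENNReal.mul_ne_top (ENNReal.natCast_ne_top _)
    (ENNReal.natCast_ne_top _), fun A hA F hF => ?_⟩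
  have hmeas : ∀ i z, MeasurableSet (A i z) := by
    intro i z
    rcases hA i z with h | ⟨x₀, -, -, -, h⟩ <;> rw [h]
    · exact MeasurableSet.empty
    · exact measurableSet_ball
  have h1 : ∀ i w, ∑' z, (A i z).indicator (1 : Rn n → ℝ≥0∞) w ≤ ((2 * m + 1) ^ n : ℕ) := by
    intro i w
    have hL : 0 < δ * (2 : ℝ) ^ i := by positivity
    set T := Fintype.piFinset fun k =>
      Finset.Icc (idx (δ * 2 ^ i) 0 w k - m) (idx (δ * 2 ^ i) 0 w k + m) with hT
    have hz : ∀ z ∉ T, (A i z).indicator (1 : Rn n → ℝ≥0∞) w = 0 := by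
      intro z hz
      refine indicator_of_notMem (fun hw => hz ?_) _
      rcases hA i z with h | ⟨x₀, -, -, hx, h⟩
      · rw [h] at hw; exact hw.elim
      rw [h, Metric.mem_ball, dist_eq_norm] at hw
      have hx' : x₀ ∈ nb m (δ * 2 ^ i) 0 w := mem_nb_of_norm_le hL (by
        rw [norm_sub_rev, side_zero]
        calc ‖w - x₀‖ ≤ 3 * 2 ^ i := hw.le
          _ = 3 / δ * (δ * 2 ^ i) := by field_simp
          _ ≤ _ := mul_le_mul_of_nonneg_right hm hL.le)
      rw [hT, Fintype.mem_piFinset]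
      intro k
      have h2 := hx' k
      rw [abs_le] at h2
      rw [← hx, Finset.mem_Icc]
      constructor <;> linarith [h2.1, h2.2]
    rw [tsum_eq_sum hz]
    have h1 : ∑ z ∈ T, (A i z).indicator (1 : Rn n → ℝ≥0∞) w ≤ T.card • 1 :=
      Finset.sum_le_card_nsmul _ _ _ fun z _ => indicator_le_self' (fun _ _ => zero_le) _
    have hcard : T.card = (2 * m + 1) ^ n := by
      have h3 : ∀ a : ℤ, (a + m + 1 - (a - m)).toNat = 2 * m + 1 := fun a => by omega
      rw [hT, Fintype.card_piFinset]
      simp only [Int.card_Icc, h3, Finset.prod_const, Finset.card_univ, Fintype.card_fin]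
    rwa [hcard, nsmul_eq_mul, mul_one] at h1
  have h2 : ∀ w, ∑' i, ∑' z, (A i z).indicator (1 : Rn n → ℝ≥0∞) w ≤
      (2 * J + 2 : ℕ) * ((2 * m + 1) ^ n : ℕ) := by
    intro w
    obtain ⟨i₀, hi₀, hi₀'⟩ := exists_mem_Ico_zpow (hpos w) (show (1 : ℝ) < 2 by norm_num)
    have h20 : ∀ i : ℤ, (0 : ℝ) < 2 ^ i := fun i => by positivity
    have hJz : κ < (2 : ℝ) ^ (J : ℤ) := by rwa [zpow_natCast]
    have hz : ∀ i ∉ Finset.Icc (i₀ - J - 1) (i₀ + J),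
        ∑' z, (A i z).indicator (1 : Rn n → ℝ≥0∞) w = 0 := by
      intro i hi
      refine ENNReal.tsum_eq_zero.2 fun z => indicator_of_notMem (fun hw => hi ?_) _
      rcases hA i z with h | ⟨x₀, hx1, hx2, -, h⟩
      · rw [h] at hw; exact hw.elim
      rw [h, Metric.mem_ball, dist_comm, dist_eq_norm] at hw
      obtain ⟨h3, h4⟩ := hcomp x₀ w (by linarith)
      have hw0 := hpos w
      have h5 : (2 : ℝ) ^ i < 2 ^ ((J : ℤ) + (i₀ + 1)) := by
        rw [zpow_add₀ (by norm_num)]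
        calc (2 : ℝ) ^ i < κ * ρ w := hx1.trans_le h3
          _ ≤ _ := mul_le_mul hJz.le hi₀'.le hw0.le (h20 _).le
      have h6 : (2 : ℝ) ^ i₀ < 2 ^ ((J : ℤ) + (i + 1)) := by
        rw [zpow_add₀ (by norm_num)]
        calc (2 : ℝ) ^ i₀ ≤ κ * ρ x₀ := hi₀.trans h4
          _ < 2 ^ (J : ℤ) * ρ x₀ := mul_lt_mul_of_pos_right hJz (hpos x₀)
          _ ≤ _ := mul_le_mul_of_nonneg_left hx2 (h20 _).le
      rw [zpow_lt_zpow_iff_right₀ (by norm_num)] at h5 h6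
      rw [Finset.mem_Icc]
      omega
    rw [tsum_eq_sum hz]
    refine (Finset.sum_le_card_nsmul _ _ _ fun i _ => h1 i w).trans (le_of_eq ?_)
    rw [nsmul_eq_mul, Int.card_Icc]
    congr 2
    omega
  have h3 : ∀ i z, ∫⁻ w in A i z, F w = ∫⁻ w, (A i z).indicator 1 w * F w := by
    intro i z
    rw [← lintegral_indicator (hmeas i z)]
    refine lintegral_congr fun w => ?_
    by_cases hw : w ∈ A i z
    · rw [indicator_of_mem hw, indicator_of_mem hw, Pi.one_apply, one_mul]
    · rw [indicator_of_notMem hw, indicator_of_notMem hw, zero_mul]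
  have hm1 : ∀ i z, Measurable fun w => (A i z).indicator (1 : Rn n → ℝ≥0∞) w * F w := fun i z =>
    (measurable_one.indicator (hmeas i z)).mul hF
  simp only [h3]
  calc _ = ∫⁻ w, ∑' i, ∑' z, (A i z).indicator 1 w * F w := by
        rw [lintegral_tsum fun i => (Measurable.tsum fun z => hm1 i z).aemeasurable]
        exact tsum_congr fun i => (lintegral_tsum fun z => (hm1 i z).aemeasurable).symm
    _ ≤ ∫⁻ w, (2 * J + 2 : ℕ) * ((2 * m + 1) ^ n : ℕ) * F w := by
        refine lintegral_mono fun w => ?_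
        simp only [ENNReal.tsum_mul_right]
        exact mul_le_mul_left (h2 w) _
    _ = _ := by rw [lintegral_const_mul _ hF]

end

section

variable {n : ℕ} {L : ℝ} {p C : ℝ} {x₀ : Rn n} {U V : Rn n → ℝ≥0∞} {ρ : Rn n → ℝ}

lemma lt_vr_smul {ϱ : ℝ} (hϱ : 0 < ϱ) (S : Set ℝ) (g : Rn n → ℝ) (x : Rn n) {a l : ℝ}
    (ha : 0 < a) (hl : 0 < l) {v : ℝ≥0∞}
    (h : ENNReal.ofReal l * v < ENNReal.ofReal a * vr ϱ S (av g x)) :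
    v < vr ϱ S (av (fun y => a / l * g y) x) := by
  have h1 : vr ϱ S (av g x) ≤
      ENNReal.ofReal (l / a) * vr ϱ S (av (fun y => a / l * g y) x) := by
    have h2 := vr_const_mul hϱ S (l / a) (av (fun y => a / l * g y) x)
    have h3 : (fun r => l / a * av (fun y => a / l * g y) x r) = av g x := by
      funext r
      rw [av_const_mul]
      field_simp
    rwa [h3, Real.enorm_of_nonneg (by positivity)] at h2
  have h4 := h.trans_le (mul_le_mul_right h1 _)
  rw [← mul_assoc, ← ENNReal.ofReal_mul ha.le, mul_div_cancel₀ _ ha.ne'] at h4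
  exact (ENNReal.mul_lt_mul_iff_right (by simpa using hl) ENNReal.ofReal_ne_top).1 h4

lemma lt_or_le_of_lt_add {a b v h : ℝ≥0∞} (H : v < h * (a + b)) :
    v < 2 * h * a ∨ v ≤ 2 * h * b := by
  by_contra! hc
  refine absurd H (not_lt.2 ?_)
  have h2 : 2 * (h * (a + b)) ≤ 2 * v := by
    calc 2 * (h * (a + b)) = 2 * h * a + 2 * h * b := by ring
      _ ≤ v + v := add_le_add hc.1 hc.2.le
      _ = 2 * v := (two_mul v).symm
  exact (ENNReal.mul_le_mul_iff_right two_ne_zero ENNReal.ofNat_ne_top).1 h2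

lemma weak_of_pointwise (hU : Measurable U) (hV : Measurable V) {Q : Set (Rn n)}
    (hQ : MeasurableSet Q) (hfin : dn U Q ≠ ∞) (l K : ℝ≥0∞) :
    l * ∫⁻ x in {x | x ∈ Q ∧ l * V x * dn U Q ≤ K}, U x * V x ≤ K := by
  have hd : dn U Q = ∫⁻ x in Q, U x := by rw [dn, withDensity_apply']
  set W := {x | x ∈ Q ∧ l * V x * dn U Q ≤ K}
  have hW : W ⊆ Q := fun x hx => hx.1
  have hUV : Measurable fun x => U x * V x := hU.mul hV
  by_cases h0 : dn U Q = 0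
  · have h1 : U =ᵐ[volume.restrict Q] 0 := (lintegral_eq_zero_iff hU).1 (hd ▸ h0)
    have h2 : ∫⁻ x in W, U x * V x = 0 := by
      refine le_antisymm ((lintegral_mono_set hW).trans (le_of_eq ?_)) zero_le
      refine (lintegral_eq_zero_iff hUV).2 ?_
      filter_upwards [h1] with x hx
      simp [hx]
    simp [h2]
  · refine (ENNReal.mul_le_mul_iff_right h0 hfin).1 ?_
    calc dn U Q * (l * ∫⁻ x in W, U x * V x)
        = ∫⁻ x in W, dn U Q * l * (U x * V x) := by
          rw [lintegral_const_mul _ hUV]; ring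
      _ ≤ ∫⁻ x in W, U x * K := by
          refine setLIntegral_mono' ?_ fun x hx => ?_
          · exact hQ.inter (measurableSet_le ((hV.const_mul _).mul_const _) measurable_const)
          · calc dn U Q * l * (U x * V x) = U x * (l * V x * dn U Q) := by ring
              _ ≤ _ := mul_le_mul_right hx.2 _
      _ = (∫⁻ x in W, U x) * K := lintegral_mul_const _ hU
      _ ≤ (∫⁻ x in Q, U x) * K := mul_le_mul_left (lintegral_mono_set hW) _
      _ = dn U Q * K := by rw [hd]

lemma dn_mul_lintegral_le (H : Loc ρ p C U V) {x : Rn n} (hx : 0 < ρ x) {Q : Set (Rn n)}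
    (hQ : Q ⊆ Metric.ball x (ρ x)) {g : Rn n → ℝ} (hg : Measurable g) :
    dn U Q * ∫⁻ y in Metric.ball x (ρ x), ‖g y‖ₑ ≤
      ENNReal.ofReal C * volume (Metric.ball x (ρ x)) *
        ∫⁻ y in Metric.ball x (ρ x), ‖g y‖ₑ * U y := by
  have hm : Measurable fun y => ‖g y‖ₑ * U y := hg.enorm.mul H.mU
  rw [← lintegral_const_mul _ hg.enorm, ← lintegral_const_mul _ hm]
  refine lintegral_mono_ae ?_
  rw [ae_restrict_iff' measurableSet_ball]
  filter_upwards [H.aOne x (ρ x) hx le_rfl] with y hy hyb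
  calc dn U Q * ‖g y‖ₑ ≤ dn U (Metric.ball x (ρ x)) * ‖g y‖ₑ :=
        mul_le_mul_left (measure_mono hQ) _
    _ ≤ (ENNReal.ofReal C * volume (Metric.ball x (ρ x)) * U y) * ‖g y‖ₑ :=
        mul_le_mul_left (hy hyb) _
    _ = _ := by ring

lemma vr_Ici_av_indicator_le {ϱ : ℝ} (hϱ : 1 ≤ ϱ) (hn : 0 < n) {g : Rn n → ℝ}
    (hg : Integrable g) (x : Rn n) (hL : 0 < L) {S : Set (Rn n)} (hS : MeasurableSet S) :
    vr ϱ (Ici L) (av (S.indicator g) x) ≤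
      ENNReal.ofReal (kc n * (L ^ n)⁻¹) * ∫⁻ y in S, ‖g y‖ₑ := by
  refine (vr_le_vr_one hϱ _ _).trans ((vr_av_le hn (hg.indicator hS) x hL).trans ?_)
  rw [← lintegral_indicator hS, ← lintegral_const_mul' _ _ ENNReal.ofReal_ne_top]
  refine lintegral_mono fun y => ?_
  rw [enorm_indicator_eq_indicator_enorm]
  refine mul_le_mul_left (ENNReal.ofReal_le_ofReal ?_) _
  have := kc_pos (n := n)
  gcongr
  exact le_max_left _ _

lemma varHeat_indicator_le {ϱ : ℝ} (hϱ : 1 < ϱ) {g : Rn n → ℝ} (hg : Integrable g) (x : Rn n)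
    (hL : 0 < L) {R : ℝ} (hR : L ≤ R) :
    varHeat n ϱ ((Metric.ball x R).indicator g) x ≤ hmass n * (vr ϱ (Ioc 0 L) (av g x) +
      vr ϱ (Ici L) (av ((Metric.ball x R).indicator g) x)) := by
  refine (varHeat_le hϱ (hg.indicator measurableSet_ball) x).trans (mul_le_mul_right ?_ _)
  refine (vr_split hϱ.le (mem_Ioi.2 hL) _).trans (add_le_add ?_ (vr_mono ϱ inter_subset_right _))
  rw [Ioi_inter_Iic]
  refine le_of_eq (vr_congr ϱ fun r hr => ?_)
  refine av_congr hr.1 fun y hy => indicator_of_mem ?_ _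
  rw [Metric.mem_ball, dist_eq_norm]
  exact hy.trans_le (hr.2.trans hR)

end

section

variable {n : ℕ} {p C : ℝ} {U V : Rn n → ℝ≥0∞} {ρ : Rn n → ℝ}

lemma volume_ball_le_of_subset {L : ℝ} (hL : 0 < L) {m : ℕ} {x x₀ : Rn n} {r R : ℝ}
    (h : Metric.ball x r ⊆ Metric.ball x₀ R) (hR : R ≤ m * L) :
    volume (Metric.ball x r) ≤ ENNReal.ofReal (((2 * m + 1) * L) ^ n) := by
  have := volume_nb hL m 0 x₀
  rw [side_zero] at this
  rw [← this]
  refine measure_mono (h.trans fun y hy => mem_nb_of_norm_le hL ?_)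
  rw [Metric.mem_ball, dist_eq_norm] at hy
  rw [side_zero]
  exact hy.le.trans hR

/-- The mixed weak type estimate on one cell for the variation of the localized function. -/
lemma exists_cell_est (hn : 0 < n) {ϱ : ℝ} (hϱ : 2 < ϱ) {κ : ℝ} (hp : 1 ≤ p) (hC : 1 ≤ C)
    (hκ : 1 ≤ κ) :
    ∃ δ : ℝ, 0 < δ ∧ ∃ B : ℝ≥0∞, B ≠ ∞ ∧ ∀ (ρ : Rn n → ℝ) (U V : Rn n → ℝ≥0∞),
      (∀ x, 0 < ρ x) → (∀ x y, ‖x - y‖ ≤ 3 * ρ x → ρ x ≤ κ * ρ y ∧ ρ y ≤ κ * ρ x) →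
      Loc ρ p C U V → ∀ (i : ℤ) (x₀ : Rn n), 2 ^ i < ρ x₀ →
      ∀ g : Rn n → ℝ, Measurable g → Integrable g → ∀ l : ℝ, 0 < l →
        ENNReal.ofReal l * ∫⁻ x in {x | x ∈ cell (δ * 2 ^ i) 0 x₀ ∧ 2 ^ i < ρ x ∧
          ρ x ≤ 2 ^ (i + 1) ∧ ENNReal.ofReal l * V x <
            varHeat n ϱ ((Metric.ball x (ρ x)).indicator g) x}, U x * V x ≤
        B * ∫⁻ y in Metric.ball x₀ (3 * 2 ^ i), ‖g y‖ₑ * U y := by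
  have hκ0 : 0 < κ := by linarith
  have hn1 : (1 : ℝ) ≤ n := by exact_mod_cast hn
  obtain ⟨C', ε, D, hε, hctx⟩ := exists_ctx n hp hC
  obtain ⟨B, hB, hloc⟩ := exists_local_mixed hn hϱ (C := C') (D := D) hp hε
  set h := (hmass n).toReal + 1 with hh
  have hh0 : 0 < h := by positivity
  have hhm : hmass n ≤ ENNReal.ofReal h := by
    rw [hh]
    conv_lhs => rw [← ENNReal.ofReal_toReal (hmass_ne_top (n := n))]
    exact ENNReal.ofReal_le_ofReal (by linarith)
  set δ := ((3 * n + 1) * κ)⁻¹ with hδ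
  have hδ0 : 0 < δ := by positivity
  obtain ⟨m, hm⟩ := exists_nat_ge (3 / δ)
  have hkc := kc_pos (n := n)
  set K : ℝ := 2 * h * (kc n * (C * (2 * m + 1) ^ n)) with hK
  refine ⟨δ, hδ0, B * ENNReal.ofReal (2 * h) + ENNReal.ofReal K,
    ENNReal.add_ne_top.2 ⟨ENNReal.mul_ne_top hB ENNReal.ofReal_ne_top, ENNReal.ofReal_ne_top⟩, ?_⟩
  intro ρ U V hpos hcomp H i x₀ hx₀ g hg hgi l hl
  set s : ℝ := 2 ^ i with hs
  have hs0 : 0 < s := by positivity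
  have hs2 : (2 : ℝ) ^ (i + 1) = 2 * s := by rw [zpow_add_one₀ two_ne_zero, mul_comm]
  rw [hs2]
  set L := δ * s with hLd
  have hL : 0 < L := by positivity
  have hLs : (3 * n + 1) * κ * L = s := by
    rw [hLd, hδ]; field_simp
  have hLκ : (3 * n + 1) * L ≤ s := by
    rw [← hLs]
    have : (3 * n + 1) * L * 1 ≤ (3 * n + 1) * L * κ := by gcongr
    linarith
  have hnL : 0 ≤ n * L := by positivity
  have hm3 : 3 * s ≤ m * L := by
    have : 3 / δ * L ≤ m * L := by gcongr
    refine le_trans (le_of_eq ?_) this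
    rw [hLd]; field_simp
  have hCtx : Ctx p C' ε D L x₀ U V := by
    refine hctx ρ U V H L x₀ hL fun y hy => ?_
    have h1 := norm_sub_le_of_mem_nb hL hy
    rw [side_zero] at h1
    push_cast at h1
    have h2 := (hcomp x₀ y (by rw [norm_sub_rev]; linarith)).1
    refine le_of_mul_le_mul_left (a := κ) ?_ hκ0
    have : κ * ((2 * n + 1) * L) ≤ κ * ((3 * n + 1) * L) := by gcongr; linarith
    linarith
  set Q := cell L 0 x₀
  have hQm : MeasurableSet Q := measurableSet_cell 0 x₀
  set b := Metric.ball x₀ (3 * s)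
  set G := ∫⁻ y in b, ‖g y‖ₑ * U y
  have hnb : nb 1 L 0 x₀ ⊆ b := fun y hy => by
    have h1 := norm_sub_le_of_mem_nb hL hy
    rw [side_zero] at h1
    push_cast at h1
    rw [Metric.mem_ball, dist_eq_norm]
    linarith
  have hQb : Q ⊆ b := (cell_subset_nb 1 0 x₀).trans hnb
  have hQfin : dn U Q ≠ ∞ := ((measure_mono hQb).trans_lt (H.finU x₀ (3 * s)).lt_top).ne
  set T := {x | x ∈ Q ∧ s < ρ x ∧ ρ x ≤ 2 * s ∧ ENNReal.ofReal l * V x <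
    varHeat n ϱ ((Metric.ball x (ρ x)).indicator g) x}
  have hT : T ⊆ {x | x ∈ Q ∧ V x < vr ϱ (Ioc 0 L) (av (fun y => 2 * h / l * g y) x)} ∪
      {x | x ∈ Q ∧ ENNReal.ofReal l * V x * dn U Q ≤ ENNReal.ofReal K * G} := by
    rintro x ⟨hxQ, hx1, hx2, hx3⟩
    have hLx : L ≤ ρ x := by linarith
    have h1 := hx3.trans_le ((varHeat_indicator_le (by linarith) hgi x hL hLx).trans
      (mul_le_mul_left hhm _))
    have e2 : (2 : ℝ≥0∞) * ENNReal.ofReal h = ENNReal.ofReal (2 * h) := by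
      rw [ENNReal.ofReal_mul zero_le_two, ENNReal.ofReal_ofNat]
    rcases lt_or_le_of_lt_add h1 with h2 | h2
    · rw [e2] at h2
      exact Or.inl ⟨hxQ, lt_vr_smul (by linarith) _ g x (by positivity) hl h2⟩
    · refine Or.inr ⟨hxQ, ?_⟩
      rw [e2] at h2
      have hd : ‖x - x₀‖ ≤ n * L := by
        have := norm_sub_le_of_mem_cell hL hxQ
        rwa [side_zero] at this
      have hBx : Metric.ball x (ρ x) ⊆ b := by
        refine Metric.ball_subset_ball' ?_
        rw [dist_eq_norm]
        linarith
      have hQx : Q ⊆ Metric.ball x (ρ x) := fun y hy => by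
        have h3 : y ∈ cell L 0 x := by rwa [cell_eq hxQ]
        have h4 := norm_sub_le_of_mem_cell hL h3
        rw [side_zero] at h4
        rw [Metric.mem_ball, dist_eq_norm]
        linarith
      have hb := vr_Ici_av_indicator_le (by linarith : 1 ≤ ϱ) hn hgi x hL
        (measurableSet_ball (x := x) (ε := ρ x))
      have hdn := dn_mul_lintegral_le H (hpos x) hQx hg
      have hvol := volume_ball_le_of_subset hL hBx hm3
      have hK' : ENNReal.ofReal K = ENNReal.ofReal (2 * h) *
          (ENNReal.ofReal (kc n * (L ^ n)⁻¹) * (ENNReal.ofReal C *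
            ENNReal.ofReal (((2 * m + 1) * L) ^ n))) := by
        rw [← ENNReal.ofReal_mul (by linarith), ← ENNReal.ofReal_mul (by positivity),
          ← ENNReal.ofReal_mul (by positivity), hK]
        congr 2
        rw [mul_pow (2 * (m : ℝ) + 1) L n]
        field_simp
      calc ENNReal.ofReal l * V x * dn U Q
          ≤ ENNReal.ofReal (2 * h) * (ENNReal.ofReal (kc n * (L ^ n)⁻¹) *
            ∫⁻ y in Metric.ball x (ρ x), ‖g y‖ₑ) * dn U Q :=
            mul_le_mul_left (h2.trans (mul_le_mul_right hb _)) _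
        _ = ENNReal.ofReal (2 * h) * (ENNReal.ofReal (kc n * (L ^ n)⁻¹) *
            (dn U Q * ∫⁻ y in Metric.ball x (ρ x), ‖g y‖ₑ)) := by ring
        _ ≤ ENNReal.ofReal (2 * h) * (ENNReal.ofReal (kc n * (L ^ n)⁻¹) *
            (ENNReal.ofReal C * ENNReal.ofReal (((2 * m + 1) * L) ^ n) * G)) := by
            refine mul_le_mul_right (mul_le_mul_right (hdn.trans ?_) _) _
            exact mul_le_mul' (mul_le_mul_right hvol _) (lintegral_mono_set hBx)
        _ = ENNReal.ofReal K * G := by rw [hK']; ring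
  have h1 := hloc L x₀ U V hCtx (fun y => 2 * h / l * g y) (hg.const_mul _) (hgi.const_mul _)
  have h2 := weak_of_pointwise H.mU H.mV hQm hQfin (ENNReal.ofReal l) (ENNReal.ofReal K * G)
  have h3 : ∫⁻ y in nb 1 L 0 x₀, ‖2 * h / l * g y‖ₑ * U y ≤ ENNReal.ofReal (2 * h / l) * G := by
    rw [← lintegral_const_mul' _ _ ENNReal.ofReal_ne_top]
    refine (lintegral_mono_set hnb).trans (lintegral_mono fun y => ?_)
    rw [enorm_mul, Real.enorm_of_nonneg (by positivity), mul_assoc]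
  have e3 : ENNReal.ofReal l * ENNReal.ofReal (2 * h / l) = ENNReal.ofReal (2 * h) := by
    rw [← ENNReal.ofReal_mul hl.le, mul_div_cancel₀ _ hl.ne']
  calc ENNReal.ofReal l * ∫⁻ x in T, U x * V x
      ≤ ENNReal.ofReal l * ((B * (ENNReal.ofReal (2 * h / l) * G)) +
        ∫⁻ x in {x | x ∈ Q ∧ ENNReal.ofReal l * V x * dn U Q ≤ ENNReal.ofReal K * G},
          U x * V x) := by
        refine mul_le_mul_right ((lintegral_mono_set hT).trans
          ((lintegral_union_le _ _ _).trans (add_le_add ?_ le_rfl))) _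
        exact h1.trans (mul_le_mul_right h3 _)
    _ = B * (ENNReal.ofReal l * ENNReal.ofReal (2 * h / l)) * G + ENNReal.ofReal l *
        ∫⁻ x in {x | x ∈ Q ∧ ENNReal.ofReal l * V x * dn U Q ≤ ENNReal.ofReal K * G},
          U x * V x := by ring
    _ ≤ B * ENNReal.ofReal (2 * h) * G + ENNReal.ofReal K * G := by
        rw [e3]
        exact add_le_add le_rfl h2
    _ = _ := by ring

end

section

variable {n : ℕ} {p C : ℝ} {U V : Rn n → ℝ≥0∞} {ρ : Rn n → ℝ} {w : Rn n → ℝ}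

lemma dn_eq_wMeas (h : ∀ᵐ x, V x = ENNReal.ofReal (w x)) (S : Set (Rn n)) :
    dn V S = wMeas w S := by
  rw [dn, withDensity_apply', wMeas]
  exact lintegral_congr_ae (ae_restrict_of_ae h)

lemma exists_density (hw : IsWeight w) :
    ∃ V : Rn n → ℝ≥0∞, Measurable V ∧ (∀ᵐ x, V x = ENNReal.ofReal (w x)) ∧
      (∀ x r, dn V (Metric.ball x r) ≠ ∞) ∧ ∀ᵐ x, V x ≠ 0 := by
  have hm := hw.1.aestronglyMeasurable.aemeasurable
  have he : ∀ᵐ x, ENNReal.ofReal (hm.mk w x) = ENNReal.ofReal (w x) := by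
    filter_upwards [hm.ae_eq_mk] with x hx
    rw [hx]
  refine ⟨fun x => ENNReal.ofReal (hm.mk w x), hm.measurable_mk.ennreal_ofReal, he, ?_, ?_⟩
  · intro x r
    rw [dn_eq_wMeas he, wMeas]
    have h1 : IntegrableOn w (Metric.ball x r) :=
      (hw.1.integrableOn_isCompact (isCompact_closedBall x r)).mono_set
        Metric.ball_subset_closedBall
    exact (lintegral_ofReal_le_lintegral_enorm _).trans_lt h1.2 |>.ne
  · filter_upwards [he, hw.2] with x hx h0
    rw [hx]
    simpa using h0

lemma IsA1loc.ae_le (h : IsA1loc ρ w) (hV : ∀ᵐ x, V x = ENNReal.ofReal (w x)) :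
    ∃ C : ℝ, ∀ x r, 0 < r → r ≤ ρ x → ∀ᵐ y, y ∈ Metric.ball x r →
      dn V (Metric.ball x r) ≤ ENNReal.ofReal C * volume (Metric.ball x r) * V y := by
  obtain ⟨C, -, hC⟩ := h
  refine ⟨C, fun x r hr hrx => ?_⟩
  rw [← ae_restrict_iff' measurableSet_ball]
  filter_upwards [ae_restrict_of_ae hV,
    ae_essInf_le (μ := volume.restrict (Metric.ball x r))
      (f := fun y => ENNReal.ofReal (w y))] with y hy h1
  rw [dn_eq_wMeas hV, hy]
  exact (hC x r hr hrx).trans (mul_le_mul_right h1 _)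

lemma volume_rpow_le {q : ℝ} (hq : 1 < q) (hw : AEMeasurable w) (hpos : ∀ᵐ x, 0 < w x)
    (E : Set (Rn n)) :
    volume E ^ q ≤ wMeas w E *
      (∫⁻ y in E, ENNReal.ofReal (w y ^ (1 - q / (q - 1)))) ^ (q - 1) := by
  have hq0 : 0 < q := by linarith
  have hq1 : 0 < q - 1 := by linarith
  have hc := Real.HolderConjugate.conjExponent hq
  have hm : AEMeasurable w (volume.restrict E) := hw.restrict
  have h := ENNReal.lintegral_mul_le_Lp_mul_Lq (volume.restrict E) hc
    (f := fun x => ENNReal.ofReal (w x ^ (1 / q))) (g := fun x => ENNReal.ofReal (w x ^ (-(1 / q))))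
    (hm.pow_const _).ennreal_ofReal (hm.pow_const _).ennreal_ofReal
  have e1 : ∫⁻ x in E, ((fun x => ENNReal.ofReal (w x ^ (1 / q))) *
      fun x => ENNReal.ofReal (w x ^ (-(1 / q)))) x = volume E := by
    rw [← setLIntegral_one]
    refine lintegral_congr_ae ?_
    filter_upwards [ae_restrict_of_ae hpos] with x hx
    rw [Pi.mul_apply, ← ENNReal.ofReal_mul (by positivity), ← Real.rpow_add hx]
    simp
  have e2 : ∫⁻ x in E, ENNReal.ofReal (w x ^ (1 / q)) ^ q = wMeas w E := by
    rw [wMeas]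
    refine lintegral_congr_ae ?_
    filter_upwards [ae_restrict_of_ae hpos] with x hx
    rw [ENNReal.ofReal_rpow_of_pos (by positivity), ← Real.rpow_mul hx.le,
      one_div_mul_cancel hq0.ne', Real.rpow_one]
  have e3 : ∫⁻ x in E, ENNReal.ofReal (w x ^ (-(1 / q))) ^ q.conjExponent =
      ∫⁻ y in E, ENNReal.ofReal (w y ^ (1 - q / (q - 1))) := by
    refine lintegral_congr_ae ?_
    filter_upwards [ae_restrict_of_ae hpos] with x hx
    rw [ENNReal.ofReal_rpow_of_pos (by positivity), ← Real.rpow_mul hx.le, Real.conjExponent]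
    congr 2
    field_simp
    ring
  rw [e1, e2, e3] at h
  refine (ENNReal.rpow_le_rpow h hq0.le).trans (le_of_eq ?_)
  rw [ENNReal.mul_rpow_of_nonneg _ _ hq0.le, ← ENNReal.rpow_mul, ← ENNReal.rpow_mul,
    one_div_mul_cancel hq0.ne', ENNReal.rpow_one, Real.conjExponent]
  congr 2
  field_simp

lemma IsAinfLoc.exists_doubling (h : IsAinfLoc ρ w) (hw : IsWeight w)
    (hV : ∀ᵐ x, V x = ENNReal.ofReal (w x)) :
    ∃ p C : ℝ, 1 ≤ p ∧ ∀ x r, 0 < r → r ≤ ρ x → ∀ E ⊆ Metric.ball x r, MeasurableSet E →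
      volume E ^ p * dn V (Metric.ball x r) ≤
        ENNReal.ofReal C * dn V E * volume (Metric.ball x r) ^ p := by
  rcases h with h | ⟨q, hq, C, -, hC⟩
  · obtain ⟨C, hC⟩ := IsA1loc.ae_le h hV
    refine ⟨1, C, le_rfl, fun x r hr hrx E hE hEm => ?_⟩
    have hm := hw.1.aestronglyMeasurable.aemeasurable.ennreal_ofReal
    have hm' : AEMeasurable V := hm.congr (Filter.EventuallyEq.symm hV)
    rw [ENNReal.rpow_one, ENNReal.rpow_one]
    have e : dn V E = ∫⁻ y in E, V y := by rw [dn, withDensity_apply']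
    calc volume E * dn V (Metric.ball x r) = ∫⁻ y in E, dn V (Metric.ball x r) := by
          rw [setLIntegral_const, mul_comm]
      _ ≤ ∫⁻ y in E, ENNReal.ofReal C * volume (Metric.ball x r) * V y := by
          refine lintegral_mono_ae ?_
          rw [ae_restrict_iff' hEm]
          filter_upwards [hC x r hr hrx] with y hy hyE using hy (hE hyE)
      _ = ENNReal.ofReal C * volume (Metric.ball x r) * dn V E := by
          rw [lintegral_const_mul'' _ hm'.restrict, e]
      _ = _ := by ring
  · refine ⟨q, C, hq.le, fun x r hr hrx E hE _ => ?_⟩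
    rw [dn_eq_wMeas hV, dn_eq_wMeas hV]
    calc _ ≤ (wMeas w E * (∫⁻ y in E, ENNReal.ofReal (w y ^ (1 - q / (q - 1)))) ^ (q - 1)) *
          wMeas w (Metric.ball x r) :=
          mul_le_mul_left (volume_rpow_le hq hw.1.aestronglyMeasurable.aemeasurable hw.2 E) _
      _ ≤ (wMeas w E * (∫⁻ y in Metric.ball x r,
            ENNReal.ofReal (w y ^ (1 - q / (q - 1)))) ^ (q - 1)) * wMeas w (Metric.ball x r) := by
          refine mul_le_mul_left (mul_le_mul_right
            (ENNReal.rpow_le_rpow (lintegral_mono_set hE) (by linarith)) _) _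
      _ = wMeas w E * (wMeas w (Metric.ball x r) * (∫⁻ y in Metric.ball x r,
            ENNReal.ofReal (w y ^ (1 - q / (q - 1)))) ^ (q - 1)) := by ring
      _ ≤ wMeas w E * (ENNReal.ofReal C * volume (Metric.ball x r) ^ q) :=
          mul_le_mul_right (hC x r hr hrx) _
      _ = _ := by ring

lemma exists_loc {μ ν : Rn n → ℝ} (hμw : IsWeight μ) (hνw : IsWeight ν) (hμ : IsA1loc ρ μ)
    (hν : IsAinfLoc ρ ν) :
    ∃ p C : ℝ, 1 ≤ p ∧ 1 ≤ C ∧ ∃ U V : Rn n → ℝ≥0∞, Loc ρ p C U V ∧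
      (∀ᵐ x, U x = ENNReal.ofReal (μ x)) ∧ ∀ᵐ x, V x = ENNReal.ofReal (ν x) := by
  obtain ⟨U, mU, hU, finU, -⟩ := exists_density hμw
  obtain ⟨V, mV, hV, finV, posV⟩ := exists_density hνw
  obtain ⟨C₁, h1⟩ := IsA1loc.ae_le hμ hU
  obtain ⟨p, C₂, hp, h2⟩ := IsAinfLoc.exists_doubling hν hνw hV
  refine ⟨p, max 1 (max C₁ C₂), hp, le_max_left _ _, U, V,
    ⟨mU, mV, finU, finV, posV, ?_, ?_⟩, hU, hV⟩
  · intro x r hr hrx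
    filter_upwards [h1 x r hr hrx] with y hy hyb
    refine (hy hyb).trans (mul_le_mul_left (mul_le_mul_left (ENNReal.ofReal_le_ofReal ?_) _) _)
    exact (le_max_left _ _).trans (le_max_right _ _)
  · intro x r hr hrx E hE hEm
    refine (h2 x r hr hrx E hE hEm).trans
      (mul_le_mul_left (mul_le_mul_left (ENNReal.ofReal_le_ofReal ?_) _) _)
    exact (le_max_right _ _).trans (le_max_right _ _)

end

section

variable {n : ℕ} {p C : ℝ} {U V : Rn n → ℝ≥0∞} {ρ : Rn n → ℝ}

lemma exists_global_mixed (hn : 0 < n) {ϱ : ℝ} (hϱ : 2 < ϱ) (hρ : IsCriticalRadius ρ) (hp : 1 ≤ p)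
    (hC : 1 ≤ C) (H : Loc ρ p C U V) :
    ∃ B : ℝ≥0∞, B ≠ ∞ ∧ ∀ g : Rn n → ℝ, Measurable g → Integrable g → ∀ l : ℝ, 0 < l →
      ENNReal.ofReal l * ∫⁻ x in {x | ENNReal.ofReal l * V x <
          varHeat n ϱ ((Metric.ball x (ρ x)).indicator g) x}, U x * V x ≤
        B * ∫⁻ y, ‖g y‖ₑ * U y := by
  obtain ⟨hpos, κ, hκ, hcomp⟩ := exists_comparable hρ
  obtain ⟨δ, hδ, B, hB, hcell⟩ := exists_cell_est hn hϱ (C := C) hp hC hκ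
  obtain ⟨M, hM, hover⟩ := exists_overlap (n := n) hδ hpos hcomp
  refine ⟨B * M, ENNReal.mul_ne_top hB hM, fun g hg hgi l hl => ?_⟩
  let S : ℤ → (Fin n → ℤ) → Set (Rn n) := fun i z => {x | x ∈ fib (δ * 2 ^ i) 0 z ∧ 2 ^ i < ρ x ∧
    ρ x ≤ 2 ^ (i + 1) ∧ ENNReal.ofReal l * V x <
      varHeat n ϱ ((Metric.ball x (ρ x)).indicator g) x}
  have hA : ∀ i z, ∃ A : Set (Rn n), (A = ∅ ∨ ∃ x₀, 2 ^ i < ρ x₀ ∧ ρ x₀ ≤ 2 ^ (i + 1) ∧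
      idx (δ * 2 ^ i) 0 x₀ = z ∧ A = Metric.ball x₀ (3 * 2 ^ i)) ∧
      ENNReal.ofReal l * ∫⁻ x in S i z, U x * V x ≤ B * ∫⁻ y in A, ‖g y‖ₑ * U y := by
    intro i z
    rcases (S i z).eq_empty_or_nonempty with he | ⟨x₀, hz, h1, h2, -⟩
    · exact ⟨∅, Or.inl rfl, by simp [he]⟩
    · refine ⟨Metric.ball x₀ (3 * 2 ^ i), Or.inr ⟨x₀, h1, h2, hz, rfl⟩, ?_⟩
      have h3 := hcell ρ U V hpos hcomp H i x₀ h1 g hg hgi l hl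
      rwa [← fib_idx, show idx (δ * 2 ^ i) 0 x₀ = z from hz] at h3
  choose A hA1 hA2 using hA
  have hsub : {x | ENNReal.ofReal l * V x <
      varHeat n ϱ ((Metric.ball x (ρ x)).indicator g) x} ⊆ ⋃ i, ⋃ z, S i z := by
    intro x hx
    obtain ⟨i, hi⟩ := exists_mem_Ioc_zpow (hpos x) (one_lt_two (α := ℝ))
    exact mem_iUnion.2 ⟨i, mem_iUnion.2 ⟨idx (δ * 2 ^ i) 0 x, rfl, hi.1, hi.2, hx⟩⟩
  calc _ ≤ ENNReal.ofReal l * ∑' i, ∑' z, ∫⁻ x in S i z, U x * V x := by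
        refine mul_le_mul_right ((lintegral_mono_set hsub).trans
          ((lintegral_iUnion_le _ _).trans ?_)) _
        exact ENNReal.tsum_le_tsum fun i => lintegral_iUnion_le _ _
    _ = ∑' i, ∑' z, ENNReal.ofReal l * ∫⁻ x in S i z, U x * V x := by
        simp_rw [ENNReal.tsum_mul_left]
    _ ≤ ∑' i, ∑' z, B * ∫⁻ y in A i z, ‖g y‖ₑ * U y :=
        ENNReal.tsum_le_tsum fun i => ENNReal.tsum_le_tsum fun z => hA2 i z
    _ = B * ∑' i, ∑' z, ∫⁻ y in A i z, ‖g y‖ₑ * U y := by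
        simp_rw [ENNReal.tsum_mul_left]
    _ ≤ B * (M * ∫⁻ y, ‖g y‖ₑ * U y) :=
        mul_le_mul_right (hover A hA1 _ (hg.enorm.mul H.mU)) _
    _ = _ := by ring

lemma varHeat_congr_ae (ϱ : ℝ) {g h : Rn n → ℝ} (e : g =ᵐ[volume] h) (x : Rn n) :
    varHeat n ϱ g x = varHeat n ϱ h x := by
  have : ∀ t, heatSg n t g x = heatSg n t h x := fun t => by
    refine integral_congr_ae ?_
    filter_upwards [e] with y hy
    rw [hy]
  simp only [varHeat, this]

lemma integrable_mul_of_hasCompactSupport {f w : Rn n → ℝ} (hf : Measurable f) {M : ℝ}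
    (hM : ∀ x, |f x| ≤ M) (hc : HasCompactSupport f) (hw : LocallyIntegrable w) :
    Integrable fun x => f x * w x := by
  have h1 : IntegrableOn w (tsupport f) := hw.integrableOn_isCompact hc
  have h2 : IntegrableOn (fun x => f x * w x) (tsupport f) :=
    Integrable.bdd_mul h1 hf.aestronglyMeasurable (Filter.Eventually.of_forall hM)
  rw [← integrableOn_iff_integrable_of_support_subset (s := tsupport f)]
  · exact h2
  · exact (Function.support_mul_subset_left _ _).trans (subset_tsupport f)

end

end MixedHeat

/-- Mixed weak type inequality for the localized variation of the classical
heat semigroup, with `μ ∈ A₁^{ρ,loc}` and `ν ∈ A_∞^{ρ,loc}`. -/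
theorem statement9 (n : ℕ) (hn : 3 ≤ n) (ϱ : ℝ) (hϱ : 2 < ϱ)
    (ρ : Rn n → ℝ) (hρ : IsCriticalRadius ρ)
    (μ ν : Rn n → ℝ) (hμw : IsWeight μ) (hνw : IsWeight ν)
    (hμ : IsA1loc ρ μ) (hν : IsAinfLoc ρ ν) :
    ∃ C : ℝ, 0 < C ∧
      ∀ f : Rn n → ℝ, Measurable f → (∃ M : ℝ, ∀ x, |f x| ≤ M) → HasCompactSupport f →
      ∀ l : ℝ, 0 < l →
        ENNReal.ofReal l *
          wMeas (fun x => μ x * ν x)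
            {x | ENNReal.ofReal (l * ν x) <
              varHeat n ϱ
                (fun y => f y * (Metric.ball x (ρ x)).indicator (fun _ => (1 : ℝ)) y * ν y) x} ≤
          ENNReal.ofReal C * ∫⁻ x, ENNReal.ofReal (|f x| * μ x * ν x) := by
  obtain ⟨p, C₀, hp, hC₀, U, V, H, hU, hV⟩ := MixedHeat.exists_loc hμw hνw hμ hν
  obtain ⟨B, hB, hmix⟩ := MixedHeat.exists_global_mixed (by omega) hϱ hρ hp hC₀ H
  refine ⟨B.toReal + 1, by positivity, fun f hf ⟨M, hM⟩ hc l hl => ?_⟩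
  have hνm := hνw.1.aestronglyMeasurable.aemeasurable
  set k := hνm.mk ν
  have hk : ν =ᵐ[volume] k := hνm.ae_eq_mk
  have hgi : Integrable fun x => f x * k x := by
    refine (MixedHeat.integrable_mul_of_hasCompactSupport hf hM hc hνw.1).congr ?_
    filter_upwards [hk] with x hx
    rw [hx]
  have h := hmix (fun x => f x * k x) (hf.mul hνm.measurable_mk) hgi l hl
  have hvar : ∀ x, varHeat n ϱ
      (fun y => f y * (Metric.ball x (ρ x)).indicator (fun _ => (1 : ℝ)) y * ν y) x =
      varHeat n ϱ ((Metric.ball x (ρ x)).indicator fun y => f y * k y) x := fun x => by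
    refine MixedHeat.varHeat_congr_ae ϱ ?_ x
    filter_upwards [hk] with y hy
    by_cases hyb : y ∈ Metric.ball x (ρ x) <;> simp [hyb, hy]
  have hset : ({x | ENNReal.ofReal (l * ν x) < varHeat n ϱ
      (fun y => f y * (Metric.ball x (ρ x)).indicator (fun _ => (1 : ℝ)) y * ν y) x} :
      Set (Rn n)) =ᵐ[volume] {x | ENNReal.ofReal l * V x <
      varHeat n ϱ ((Metric.ball x (ρ x)).indicator fun y => f y * k y) x} := by
    rw [Filter.eventuallyEq_set]
    filter_upwards [hV] with x hx
    simp only [hvar, hx, ENNReal.ofReal_mul hl.le]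
  have hl1 : wMeas (fun x => μ x * ν x) {x | ENNReal.ofReal (l * ν x) < varHeat n ϱ
      (fun y => f y * (Metric.ball x (ρ x)).indicator (fun _ => (1 : ℝ)) y * ν y) x} =
      ∫⁻ x in {x | ENNReal.ofReal l * V x <
        varHeat n ϱ ((Metric.ball x (ρ x)).indicator fun y => f y * k y) x}, U x * V x := by
    rw [wMeas, Measure.restrict_congr_set hset]
    refine lintegral_congr_ae (ae_restrict_of_ae ?_)
    filter_upwards [hU, hV, hμw.2] with x h1 h2 h3
    rw [h1, h2, ENNReal.ofReal_mul h3.le]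
  have hr1 : ∫⁻ y, ‖f y * k y‖ₑ * U y = ∫⁻ x, ENNReal.ofReal (|f x| * μ x * ν x) := by
    refine lintegral_congr_ae ?_
    filter_upwards [hU, hk, hμw.2, hνw.2] with x h1 h2 h3 h4
    rw [h1, ← h2, enorm_mul, Real.enorm_of_nonneg h4.le, Real.enorm_eq_ofReal_abs,
      ← ENNReal.ofReal_mul (abs_nonneg _), ← ENNReal.ofReal_mul (by positivity)]
    congr 1
    ring
  rw [hl1, ← hr1]
  refine h.trans (mul_le_mul_left ?_ _)
  conv_lhs => rw [← ENNReal.ofReal_toReal hB]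
  exact ENNReal.ofReal_le_ofReal (by linarith)
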